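/- Assume W_{1,k},…,W_{K,k} are nonconstant and multiplicatively independent. For every λ > 0 there exist δ_0 = δ_0(λ) > 0 and constants A, Q* > 0 such that for all x ≥ 3, every modulus q ≤ (log x)^{K_0} lying in Q(k; f_1,…,f_K) whose radical Q := ∏_{ℓ prime, ℓ ∣ q} ℓ satisfies Q > Q*, every divisor Q_0 of q with Q_0 ≤ λ, and every tuple (χ_1,…,χ_K) of Dirichlet characters modulo Q_0 that are not all principal: |∑_{n ≤ x, gcd(f(n),q)=1} χ_1(f_1(n)) ⋯ χ_K(f_K(n))| ≤ A · x^{1/k} / (log x)^{1−(1−δ_0)α_k(Q)}. -/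

import Mathlib

open Polynomial
open scoped Classical

noncomputable section

/-- `f : ℕ → ℤ` is a multiplicative arithmetic function. -/
def IsMultFn (f : ℕ → ℤ) : Prop :=
  f 1 = 1 ∧ ∀ m n : ℕ, Nat.Coprime m n → f (m * n) = f m * f n

/-- The polynomials `F i` are multiplicatively independent over `ℤ`:
no nonzero integer tuple `c` makes `∏ i, (F i) ^ (c i)` identically constant in `ℚ(T)`. -/
def MultIndep {m : ℕ} (F : Fin m → Polynomial ℤ) : Prop :=
  ¬ ∃ c : Fin m → ℤ, c ≠ 0 ∧ ∃ r : ℚ,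
      (∏ i, (algebraMap (Polynomial ℚ) (RatFunc ℚ) ((F i).map (Int.castRingHom ℚ))) ^ (c i))
        = algebraMap ℚ (RatFunc ℚ) r

/-- `β` is the last invariant factor of the exponent matrix of the family `F`
(for some factorization of the `F i` into pairwise non-associated primitive irreducibles,
via a Smith normal form of the exponent matrix). -/
def IsLastInvFactor {m : ℕ} (F : Fin m → Polynomial ℤ) (β : ℤ) : Prop :=
  ∃ (M : ℕ) (G : Fin M → Polynomial ℤ) (c : Fin m → ℤ) (μ : Fin M → Fin m → ℕ),
    (∀ j, Irreducible (G j)) ∧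
    (∀ j, (G j).IsPrimitive) ∧
    (∀ j j', j ≠ j' → ¬ Associated (G j) (G j')) ∧
    (∀ i, F i = Polynomial.C (c i) * ∏ j, G j ^ μ j i) ∧
    (∀ j, ∃ i, 0 < μ j i) ∧
    ∃ (P : Matrix (Fin M) (Fin M) ℤ) (Q : Matrix (Fin m) (Fin m) ℤ),
      IsUnit P.det ∧ IsUnit Q.det ∧
      (∀ (s : Fin M) (t : Fin m), (s : ℕ) ≠ (t : ℕ) →
        (P * (Matrix.of fun u v => (μ u v : ℤ)) * Q) s t = 0) ∧
      (∀ (s s' : Fin M) (t t' : Fin m), (s : ℕ) = (t : ℕ) → (s' : ℕ) = (t' : ℕ) →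
        (s : ℕ) + 1 = (s' : ℕ) →
        (P * (Matrix.of fun u v => (μ u v : ℤ)) * Q) s t ∣
          (P * (Matrix.of fun u v => (μ u v : ℤ)) * Q) s' t') ∧
      (∀ (s : Fin M) (t : Fin m), (s : ℕ) = (t : ℕ) → (s : ℕ) + 1 = min M m →
        β = (P * (Matrix.of fun u v => (μ u v : ℤ)) * Q) s t)

/-- Invariant Factor Hypothesis `IFH(F; B₀)` for the modulus `q`. -/
def IFH {m : ℕ} (F : Fin m → Polynomial ℤ) (B₀ : ℝ) (q : ℕ) : Prop :=
  ∀ β : ℤ, IsLastInvFactor F β →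
    ∀ ℓ : ℕ, ℓ.Prime → ℓ ∣ q → B₀ < (ℓ : ℝ) → Int.gcd ((ℓ : ℤ) - 1) β = 1

/-- `alphaRatio q P`: the proportion of units `u` mod `q` with `P(u)` a unit mod `q`. -/
def alphaRatio (q : ℕ) (P : Polynomial ℤ) : ℝ :=
  (Nat.card {u : (ZMod q)ˣ // IsUnit (Polynomial.aeval ((u : ZMod q)) P)} : ℝ)
    / (Nat.totient q : ℝ)

/-- `q` is `k`-admissible with respect to the family of products `Wprod v`. -/
def KAdmissible (Wprod : ℕ → Polynomial ℤ) (k q : ℕ) : Prop :=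
  (∃ u : (ZMod q)ˣ, IsUnit (Polynomial.aeval ((u : ZMod q)) (Wprod k))) ∧
  ∀ v, 1 ≤ v → v < k → ¬ ∃ u : (ZMod q)ˣ, IsUnit (Polynomial.aeval ((u : ZMod q)) (Wprod v))

/-- Narkiewicz's set `Q(k; f_1, …, f_K)`. -/
def NarkSet {K : ℕ} (k : ℕ) (f : Fin K → ℕ → ℤ) (W : Fin K → ℕ → Polynomial ℤ) : Set ℕ :=
  {q | KAdmissible (fun v => ∏ i, W i v) k q ∧
    ∀ χ : Fin K → DirichletCharacter ℂ q, χ ≠ (fun _ => 1) →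
      (∀ u : (ZMod q)ˣ, IsUnit (Polynomial.aeval ((u : ZMod q)) (∏ i, W i k)) →
          (∏ i, (χ i) (Polynomial.aeval ((u : ZMod q)) (W i k))) = 1) →
      ∃ p : ℕ, p.Prime ∧
        (∑' j : ℕ, (∏ i, (χ i) ((f i (p ^ j) : ZMod q))) *
            ((((p : ℝ) ^ (-(j : ℝ) / (k : ℝ))) : ℝ) : ℂ)) = 0}

/-- `Pj j n`: the `j`-th largest prime factor of `n` counted with multiplicity,
equal to `1` if `Ω(n) < j`. -/
def Pj (j n : ℕ) : ℕ := (n.primeFactorsList.reverse).getD (j - 1) 1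

/-- `nPart k n` is `n_k`, the largest positive integer whose `k`-th power is a
unitary divisor of `n`. -/
def nPart (k n : ℕ) : ℕ :=
  ∏ p ∈ n.primeFactors, if k ∣ n.factorization p then p ^ (n.factorization p / k) else 1

/-- A polynomial is squarefull in `ℤ[T]` iff every complex root has multiplicity at least 2. -/
def SquarefullPoly (F : Polynomial ℤ) : Prop :=
  ∀ z : ℂ, (F.map (Int.castRingHom ℂ)).IsRoot z →
    2 ≤ (F.map (Int.castRingHom ℂ)).rootMultiplicity z

/-- `n` is convenient (with respect to exponent `k`, threshold `y` and length `J`). -/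
def Convenient (k : ℕ) (y : ℝ) (J : ℕ) (n : ℕ) : Prop :=
  ∃ (m : ℕ) (P : Fin J → ℕ), 0 < m ∧ (∀ t, (P t).Prime) ∧
    (∀ s t : Fin J, s < t → P t < P s) ∧
    (∀ t, y < (P t : ℝ) ∧ Pj 1 m < P t) ∧
    n = m * (∏ t, P t) ^ k

/-- The solution count `Ṽ_{N,K}(q; (w_i))`. -/
def VNK {K N : ℕ} (F : Fin K → Fin N → Polynomial ℤ) (q : ℕ) (w : Fin K → ZMod q) : ℕ :=
  Nat.card {v : Fin N → (ZMod q)ˣ //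
    ∀ i, (∏ j, Polynomial.aeval ((v j : ZMod q)) (F i j)) = w i}

/-- `α*_N(q) = ∏_j α̃_j(q)`. -/
def alphaStarN {K N : ℕ} (F : Fin K → Fin N → Polynomial ℤ) (q : ℕ) : ℝ :=
  ∏ j, alphaRatio q (∏ i, F i j)

/-- `n` is `r`-full: every prime dividing `n` divides it to the `r`-th power. -/
def IsRFull (r n : ℕ) : Prop := ∀ p : ℕ, p.Prime → p ∣ n → p ^ r ∣ n

/-- The `k`-free part of `n`. -/
def kfreePart (k n : ℕ) : ℕ :=
  ∏ p ∈ n.primeFactors, if n.factorization p < k then p ^ n.factorization p else 1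

namespace CharSum

open Filter Finset FourierTransform MeasureTheory Real Topology
open ArithmeticFunction hiding log id
open Complex (I norm_real re_le_norm ofReal_re sub_re ofReal_zero ofReal_one ofReal_mul ofReal_sub
  natCast_log ofReal_im ofReal_div ofReal_cpow ofReal_tsum ofReal_pow ofReal_natCast abs_re_le_norm
  abs_im_le_norm reCLM ofRealCLM continuous_re re_sum re_tsum)
open Complex renaming exp → cexp
open Convex (norm_image_sub_le_of_norm_hasDerivWithin_le)
open DirichletCharacter (norm_le_one LFunction_eq_LSeries LFunctionTrivChar LFunctionTrivChar₁)
open Function (Periodic)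
open LSeries (logMul abscissaOfAbsConv term_of_ne_zero norm_term_eq)
open MulChar (one_apply sum_eq_zero_of_ne_one)
open Nat (Coprime totient_pos prime_of_mem_primeFactors mem_primeFactors le_floor_iff
  prod_primeFactors_dvd)

/-- The function `u ↦ (log u) ^ a * u ^ (-s)` on the positive reals. -/
def logCpow (a : ℕ) (s : ℂ) (u : ℝ) : ℂ := (log u : ℂ) ^ a * (u : ℂ) ^ (-s)

/-- The antiderivative of `logCpow a s` that vanishes at infinity. -/
def logCpowPrim (s : ℂ) : ℕ → ℝ → ℂ
  | 0, u => -(u : ℂ) ^ (1 - s) / (s - 1)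
  | a + 1, u => -(u : ℂ) ^ (1 - s) / (s - 1) * (log u : ℂ) ^ (a + 1)
      + ((a + 1 : ℕ) : ℂ) / (s - 1) * logCpowPrim s a u

lemma hasDerivAt_ofReal_cpow' (r : ℂ) {u : ℝ} (hu : 0 < u) :
    HasDerivAt (fun u : ℝ => (u : ℂ) ^ r) (r * (u : ℂ) ^ (r - 1)) u := by
  have h := (hasDerivAt_id (u : ℂ)).cpow_const (c := r) (Or.inl (by simpa using hu))
  simpa using h.comp_ofReal

lemma hasDerivAt_ofReal_log_pow (a : ℕ) {u : ℝ} (hu : 0 < u) :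
    HasDerivAt (fun u : ℝ => (log u : ℂ) ^ a)
      ((a : ℂ) * (log u : ℂ) ^ (a - 1) * (u : ℂ)⁻¹) u := by
  have h := (hasDerivAt_log hu.ne').ofReal_comp.fun_pow a
  simpa using h

lemma hasDerivAt_logCpow (a : ℕ) (s : ℂ) {u : ℝ} (hu : 0 < u) :
    HasDerivAt (logCpow a s)
      (((a : ℂ) * (log u : ℂ) ^ (a - 1) - s * (log u : ℂ) ^ a) * (u : ℂ) ^ (-s - 1)) u := by
  have hu' : (u : ℂ) ≠ 0 := mod_cast hu.ne'
  have h := (hasDerivAt_ofReal_log_pow a hu).mul (hasDerivAt_ofReal_cpow' (-s) hu)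
  refine h.congr_deriv ?_
  rw [Complex.cpow_sub _ _ hu', Complex.cpow_one]
  field_simp
  ring

lemma hasDerivAt_logCpowPrim (a : ℕ) {s : ℂ} (hs : s ≠ 1) {u : ℝ} (hu : 0 < u) :
    HasDerivAt (logCpowPrim s a) (logCpow a s u) u := by
  have hs' : s - 1 ≠ 0 := sub_ne_zero.2 hs
  have hu' : (u : ℂ) ≠ 0 := mod_cast hu.ne'
  have h0 : HasDerivAt (fun u : ℝ => -(u : ℂ) ^ (1 - s) / (s - 1)) ((u : ℂ) ^ (-s)) u := by
    have := ((hasDerivAt_ofReal_cpow' (1 - s) hu).neg).div_const (s - 1)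
    refine this.congr_deriv ?_
    rw [show (1 - s - 1 : ℂ) = -s by ring]
    field_simp
    ring
  induction a with
  | zero => simpa [logCpowPrim, logCpow] using h0
  | succ a ih =>
    have h1 := (h0.mul (hasDerivAt_ofReal_log_pow (a + 1) hu)).add
      (ih.const_mul (((a + 1 : ℕ) : ℂ) / (s - 1)))
    refine h1.congr_deriv ?_
    simp only [logCpow, Nat.add_sub_cancel]
    rw [Complex.cpow_sub _ _ hu', Complex.cpow_one, Complex.cpow_neg]
    have : (u : ℂ) ^ s ≠ 0 := by simp [Complex.cpow_eq_zero_iff, hu']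
    field_simp
    ring

lemma logCpowPrim_one (a : ℕ) (s : ℂ) :
    logCpowPrim s a 1 = -((a.factorial : ℂ) / (s - 1) ^ (a + 1)) := by
  induction a with
  | zero => simp [logCpowPrim, neg_div]
  | succ a ih =>
    simp only [logCpowPrim, ih, log_one]
    push_cast [Nat.factorial_succ]
    simp
    rw [pow_succ (s - 1) (a + 1), div_mul_div_comm]
    ring

lemma log_pow_le {a : ℕ} (ha : a ≤ 2) {u : ℝ} (hu : 1 ≤ u) :
    log u ^ a ≤ 16 * u ^ (1 / 2 : ℝ) := by
  have h0 : 0 ≤ log u := log_nonneg hu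
  have h1 : log u ≤ 4 * u ^ (1 / 4 : ℝ) := by
    have := log_le_rpow_div (x := u) (ε := 1 / 4) (by linarith) (by norm_num)
    linarith
  have h4 : 1 ≤ u ^ (1 / 4 : ℝ) := one_le_rpow hu (by norm_num)
  have h2 : u ^ (1 / 2 : ℝ) = (u ^ (1 / 4 : ℝ)) ^ 2 := by
    rw [← rpow_natCast, ← rpow_mul (by linarith)]; norm_num
  rw [h2]
  interval_cases a
  · nlinarith
  · nlinarith
  · nlinarith

lemma norm_logCpow {a : ℕ} {s : ℂ} {u : ℝ} (hu : 1 ≤ u) :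
    ‖logCpow a s u‖ = log u ^ a * u ^ (-s.re) := by
  rw [logCpow, norm_mul, norm_pow, Complex.norm_cpow_eq_rpow_re_of_pos (by linarith),
    norm_real, norm_of_nonneg (log_nonneg hu), Complex.neg_re]

lemma norm_logCpow_le {a : ℕ} (ha : a ≤ 2) {s : ℂ} (hs : 1 ≤ s.re) {u : ℝ} (hu : 1 ≤ u) :
    ‖logCpow a s u‖ ≤ 16 * u ^ (-(1 / 2) : ℝ) := by
  rw [norm_logCpow hu]
  calc _ ≤ (16 * u ^ (1 / 2 : ℝ)) * u ^ (-1 : ℝ) := by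
        gcongr
        · exact log_pow_le ha hu
    _ = _ := by rw [mul_assoc, ← rpow_add (by linarith)]; norm_num

lemma norm_deriv_logCpow_le {a : ℕ} (ha : a ≤ 2) {s : ℂ} (hs : 1 ≤ s.re) {u : ℝ} (hu : 1 ≤ u) :
    ‖((a : ℂ) * (log u : ℂ) ^ (a - 1) - s * (log u : ℂ) ^ a) * (u : ℂ) ^ (-s - 1)‖ ≤
      16 * (2 + ‖s‖) * u ^ (-(3 / 2) : ℝ) := by
  have h0 : 0 ≤ log u := log_nonneg hu
  rw [norm_mul, Complex.norm_cpow_eq_rpow_re_of_pos (by linarith)]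
  have h1 : ‖(a : ℂ) * (log u : ℂ) ^ (a - 1) - s * (log u : ℂ) ^ a‖ ≤
      16 * (2 + ‖s‖) * u ^ (1 / 2 : ℝ) := by
    refine (norm_sub_le _ _).trans ?_
    rw [norm_mul, norm_mul, norm_pow, norm_pow, norm_real, norm_of_nonneg h0,
      Complex.norm_natCast]
    have e1 := log_pow_le (a := a - 1) (by omega) hu
    have e2 := log_pow_le ha hu
    have e3 : (a : ℝ) ≤ 2 := mod_cast ha
    have e4 : (a : ℝ) * log u ^ (a - 1) ≤ 2 * (16 * u ^ (1 / 2 : ℝ)) := by gcongr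
    have e5 : ‖s‖ * log u ^ a ≤ ‖s‖ * (16 * u ^ (1 / 2 : ℝ)) := by gcongr
    linarith
  calc _ ≤ (16 * (2 + ‖s‖) * u ^ (1 / 2 : ℝ)) * u ^ (-2 : ℝ) := by
        gcongr
        · simp; linarith
    _ = _ := by rw [mul_assoc, ← rpow_add (by linarith)]; norm_num

lemma norm_logCpow_sub_le {a : ℕ} (ha : a ≤ 2) {s : ℂ} (hs : 1 ≤ s.re) {n u : ℝ} (hn : 1 ≤ n)
    (hnu : n ≤ u) (hu : u ≤ n + 1) :
    ‖logCpow a s u - logCpow a s n‖ ≤ 16 * (2 + ‖s‖) * n ^ (-(3 / 2) : ℝ) := by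
  have h := norm_image_sub_le_of_norm_hasDerivWithin_le (f := logCpow a s)
    (s := Set.Icc n (n + 1)) (C := 16 * (2 + ‖s‖) * n ^ (-(3 / 2) : ℝ)) (x := n) (y := u)
    (fun x hx => (hasDerivAt_logCpow a s (by linarith [hx.1])).hasDerivWithinAt)
    (fun x hx => (norm_deriv_logCpow_le ha hs (by linarith [hx.1])).trans (by
      have := hx.1
      gcongr 16 * (2 + ‖s‖) * ?_
      exact rpow_le_rpow_of_nonpos (by linarith) this (by norm_num)))
    (convex_Icc _ _) ⟨le_rfl, by linarith⟩ ⟨hnu, hu⟩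
  refine h.trans ?_
  have : ‖u - n‖ ≤ 1 := by rw [norm_of_nonneg] <;> linarith
  exact mul_le_of_le_one_right (by positivity) this

lemma norm_logCpow_sub_primDiff_le {a : ℕ} (ha : a ≤ 2) {s : ℂ} (hs : 1 ≤ s.re) (hs1 : s ≠ 1)
    {n : ℝ} (hn : 1 ≤ n) :
    ‖logCpow a s n - (logCpowPrim s a (n + 1) - logCpowPrim s a n)‖ ≤
      16 * (2 + ‖s‖) * n ^ (-(3 / 2) : ℝ) := by
  have h := norm_image_sub_le_of_norm_hasDerivWithin_le
    (f := fun u : ℝ => logCpowPrim s a u - (u : ℂ) * logCpow a s n)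
    (f' := fun u => logCpow a s u - logCpow a s n)
    (s := Set.Icc n (n + 1)) (C := 16 * (2 + ‖s‖) * n ^ (-(3 / 2) : ℝ)) (x := n) (y := n + 1)
    (fun x hx => by
      have h1 := (hasDerivAt_logCpowPrim a hs1 (u := x) (by linarith [hx.1]))
      have h2 := ((hasDerivAt_id (x : ℂ)).comp_ofReal).mul_const (logCpow a s n)
      have h3 := h1.sub h2
      exact (h3.congr_deriv (by simp)).hasDerivWithinAt)
    (fun x hx => norm_logCpow_sub_le ha hs hn hx.1 hx.2)
    (convex_Icc _ _) ⟨le_rfl, by linarith⟩ ⟨by linarith, le_rfl⟩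
  have e : ‖(n + 1 - n : ℝ)‖ = 1 := by simp
  rw [e, mul_one, ← norm_neg] at h
  refine le_trans (le_of_eq ?_) h
  congr 1
  push_cast
  ring

lemma sum_rpow_neg_three_half_le {N M : ℕ} (hN : 1 ≤ N) :
    ∑ n ∈ Ico N M, (n : ℝ) ^ (-(3 / 2) : ℝ) ≤ 6 * (N : ℝ) ^ (-(1 / 2) : ℝ) := by
  rcases le_or_gt M N with h | h
  · rw [Ico_eq_empty (by omega)]; simp; positivity
  have key : ∀ n : ℕ, 1 ≤ n → (n : ℝ) ^ (-(3 / 2) : ℝ) ≤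
      6 * (n : ℝ) ^ (-(1 / 2) : ℝ) - 6 * ((n + 1 : ℕ) : ℝ) ^ (-(1 / 2) : ℝ) := by
    intro n hn
    have hn' : (1 : ℝ) ≤ n := mod_cast hn
    have e1 : (n : ℝ) ^ (-(1 / 2) : ℝ) = (sqrt n)⁻¹ := by
      rw [rpow_neg (by linarith), sqrt_eq_rpow]
    have e2 : ((n + 1 : ℕ) : ℝ) ^ (-(1 / 2) : ℝ) = (sqrt (n + 1))⁻¹ := by
      rw [rpow_neg (by positivity), sqrt_eq_rpow]; push_cast; rfl
    have e3 : (n : ℝ) ^ (-(3 / 2) : ℝ) = (sqrt n)⁻¹ * (n : ℝ)⁻¹ := by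
      rw [← e1, ← rpow_neg_one, ← rpow_add (by linarith)]; norm_num
    rw [e1, e2, e3]
    set r := sqrt n with hr
    set t := sqrt (n + 1) with ht
    have hr1 : 1 ≤ r := by rw [hr]; exact one_le_sqrt.2 hn'
    have hrr : r ^ 2 = n := sq_sqrt (by linarith)
    have htt : t ^ 2 = n + 1 := sq_sqrt (by linarith)
    have hrt : r ≤ t := sqrt_le_sqrt (by linarith)
    have ht2 : t ≤ 2 * r := by nlinarith
    rw [← hrr]
    have ht0 : 0 < t := by linarith
    have hr0 : 0 < r := by linarith
    have : 6 * r⁻¹ - 6 * t⁻¹ = 6 * (t - r) / (r * t) := by field_simp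
    rw [this]
    have h3 : (t - r) * (t + r) = 1 := by nlinarith
    have h4 : t - r = 1 / (t + r) := by field_simp; linarith
    rw [h4, ← mul_inv, mul_one_div, div_div, inv_eq_one_div,
      div_le_div_iff₀ (by positivity) (by positivity)]
    nlinarith [mul_nonneg hr0.le (mul_nonneg (sub_nonneg.2 ht2) (by linarith : 0 ≤ t + 3 * r))]
  calc _ ≤ ∑ n ∈ Ico N M, (6 * (n : ℝ) ^ (-(1 / 2) : ℝ) - 6 * ((n + 1 : ℕ) : ℝ) ^ (-(1 / 2) : ℝ)) :=
        sum_le_sum fun n hn => key n (by have := mem_Ico.1 hn; omega)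
    _ = 6 * (N : ℝ) ^ (-(1 / 2) : ℝ) - 6 * (M : ℝ) ^ (-(1 / 2) : ℝ) := by
        have := sum_Ico_sub (fun n : ℕ => -(6 * (n : ℝ) ^ (-(1 / 2) : ℝ))) h.le
        rw [(sum_congr rfl fun n _ => by ring :
          ∑ n ∈ Ico N M, (6 * (n : ℝ) ^ (-(1 / 2) : ℝ) - 6 * ((n + 1 : ℕ) : ℝ) ^ (-(1 / 2) : ℝ)) =
            _).trans this]
        ring
    _ ≤ _ := by
        have : 0 ≤ (M : ℝ) ^ (-(1 / 2) : ℝ) := by positivity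
        linarith

lemma sum_Ico_mul_eq (c : ℕ → ℂ) (φ : ℕ → ℂ) {N M : ℕ} (h : N ≤ M) :
    ∑ n ∈ Ico N M, c n * φ n = (∑ i ∈ range M, c i) * φ M
      - (∑ i ∈ range N, c i) * φ N
      - ∑ n ∈ Ico N M, (∑ i ∈ range (n + 1), c i) * (φ (n + 1) - φ n) := by
  induction M, h using Nat.le_induction with
  | base => simp
  | succ M hM ih =>
    rw [sum_Ico_succ_top hM, sum_Ico_succ_top hM, ih, sum_range_succ]
    ring

/-- The logarithm of the analytic conductor at `s` for the modulus `m`. -/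
def logCond (m : ℕ) (s : ℂ) : ℝ := log (m * (|s.im| + 3))

lemma one_le_logCond {m : ℕ} (hm : 1 ≤ m) (s : ℂ) : 1 ≤ logCond m s := by
  have hm' : (1 : ℝ) ≤ m := mod_cast hm
  rw [logCond, le_log_iff_exp_le (by positivity)]
  have h1 := exp_one_lt_three
  nlinarith [abs_nonneg s.im]

lemma logCond_mono {m m' : ℕ} (hm : 1 ≤ m) (h : m ≤ m') {s s' : ℂ} (hs : |s.im| ≤ |s'.im|) :
    logCond m s ≤ logCond m' s' := by
  have hm' : (1 : ℝ) ≤ m := mod_cast hm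
  have h' : (m : ℝ) ≤ m' := mod_cast h
  unfold logCond
  apply log_le_log (by positivity)
  gcongr

lemma logMul_iterate (c : ℕ → ℂ) (a n : ℕ) :
    logMul^[a] c n = (log n : ℂ) ^ a * c n := by
  induction a generalizing c with
  | zero => simp
  | succ a ih =>
    rw [Function.iterate_succ_apply, ih, logMul, natCast_log]
    ring

lemma term_logMul_iterate (c : ℕ → ℂ) (a : ℕ) (s : ℂ) {n : ℕ} (hn : n ≠ 0) :
    LSeries.term (logMul^[a] c) s n = c n * logCpow a s n := by
  rw [term_of_ne_zero hn, logMul_iterate, logCpow, ofReal_natCast, Complex.cpow_neg]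
  ring

lemma abscissa_le_one_of_bounded {c : ℕ → ℂ} {C : ℝ} (hc : ∀ n, ‖c n‖ ≤ C) :
    abscissaOfAbsConv c ≤ 1 :=
  LSeries.abscissaOfAbsConv_le_of_le_const ⟨C, fun n _ => hc n⟩

lemma summable_logMul_iterate {c : ℕ → ℂ} (hc : abscissaOfAbsConv c ≤ 1) (a : ℕ)
    {s : ℂ} (hs : 1 < s.re) : LSeriesSummable (logMul^[a] c) s := by
  apply LSeriesSummable_of_abscissaOfAbsConv_lt_re
  rw [LSeries.absicssaOfAbsConv_logPowMul]
  exact hc.trans_lt (mod_cast hs)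

lemma norm_sum_Ico_mul_logCpow_le {c : ℕ → ℂ} {M₀ : ℝ}
    (hc : ∀ N, ‖∑ i ∈ range N, c i‖ ≤ M₀) {a : ℕ} (ha : a ≤ 2) {s : ℂ} (hs : 1 ≤ s.re)
    {N M : ℕ} (hN : 1 ≤ N) (hNM : N ≤ M) :
    ‖∑ n ∈ Ico N M, c n * logCpow a s n‖ ≤
      96 * M₀ * (3 + ‖s‖) * (N : ℝ) ^ (-(1 / 2) : ℝ) := by
  have hN' : (1 : ℝ) ≤ N := mod_cast hN
  have hNM' : (N : ℝ) ≤ M := mod_cast hNM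
  have hM0 : 0 ≤ M₀ := (norm_nonneg _).trans (hc 0)
  rw [sum_Ico_mul_eq c (fun n => logCpow a s n) hNM]
  have e1 : ‖(∑ i ∈ range M, c i) * logCpow a s M‖ ≤ M₀ * (16 * (N : ℝ) ^ (-(1 / 2) : ℝ)) := by
    rw [norm_mul]
    gcongr
    · exact hc M
    · refine (norm_logCpow_le ha hs (by linarith)).trans ?_
      gcongr 16 * ?_
      exact rpow_le_rpow_of_nonpos (by linarith) hNM' (by norm_num)
  have e2 : ‖(∑ i ∈ range N, c i) * logCpow a s N‖ ≤ M₀ * (16 * (N : ℝ) ^ (-(1 / 2) : ℝ)) := by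
    rw [norm_mul]
    gcongr
    · exact hc N
    · exact norm_logCpow_le ha hs hN'
  have e3 : ‖∑ n ∈ Ico N M, (∑ i ∈ range (n + 1), c i) *
      (logCpow a s (n + 1 : ℕ) - logCpow a s n)‖ ≤
      M₀ * (16 * (2 + ‖s‖)) * (6 * (N : ℝ) ^ (-(1 / 2) : ℝ)) := by
    refine (norm_sum_le _ _).trans ?_
    refine le_trans ?_ (mul_le_mul_of_nonneg_left (sum_rpow_neg_three_half_le (M := M) hN)
      (by positivity))
    rw [mul_sum]
    refine sum_le_sum fun n hn => ?_
    have hn1 : (1 : ℝ) ≤ n := by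
      have := mem_Ico.1 hn
      exact_mod_cast (by omega : 1 ≤ n)
    rw [norm_mul, mul_assoc]
    gcongr
    · exact hc _
    · push_cast
      exact norm_logCpow_sub_le ha hs hn1 (by linarith) le_rfl
  refine (norm_sub_le _ _).trans ((add_le_add (norm_sub_le _ _) e3).trans ?_)
  have h0 : 0 ≤ (N : ℝ) ^ (-(1 / 2) : ℝ) := by positivity
  have : 0 ≤ M₀ * (N : ℝ) ^ (-(1 / 2) : ℝ) := by positivity
  nlinarith [norm_nonneg s]

lemma sum_Ico_norm_logCpow_le {a : ℕ} {s : ℂ} (hs : 1 ≤ s.re) {N : ℕ} (hN : 1 ≤ N) :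
    ∑ n ∈ Ico 1 N, ‖logCpow a s n‖ ≤ log N ^ a * (1 + log N) := by
  have hN' : (1 : ℝ) ≤ N := mod_cast hN
  have h1 : ∀ n ∈ Ico 1 N, ‖logCpow a s n‖ ≤ log N ^ a * (n : ℝ)⁻¹ := by
    intro n hn
    have hn' := mem_Ico.1 hn
    have hn1 : (1 : ℝ) ≤ n := mod_cast hn'.1
    have hn2 : (n : ℝ) ≤ N := mod_cast hn'.2.le
    rw [norm_logCpow hn1, ← rpow_neg_one]
    have : 0 ≤ log n := log_nonneg hn1
    gcongr
  refine (sum_le_sum h1).trans ?_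
  rw [← mul_sum]
  have h0 : 0 ≤ log N := log_nonneg hN'
  gcongr
  have h2 := harmonic_le_one_add_log N
  refine le_trans ?_ h2
  rw [harmonic_eq_sum_Icc]
  push_cast
  refine sum_le_sum_of_subset_of_nonneg ?_ fun _ _ _ => by positivity
  intro n hn
  have hn' := mem_Ico.1 hn
  exact mem_Icc.2 ⟨hn'.1, hn'.2.le⟩

/-- The cut-off at which the Dirichlet series is split. -/
def cutoff (m : ℕ) (s : ℂ) : ℕ := (m * (⌈|s.im|⌉₊ + 3)) ^ 2

lemma one_le_cutoff {m : ℕ} (hm : 1 ≤ m) (s : ℂ) : 1 ≤ cutoff m s :=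
  Nat.one_le_pow _ _ (Nat.mul_pos hm (by omega))

lemma log_cutoff_le {m : ℕ} (hm : 1 ≤ m) (s : ℂ) : log (cutoff m s) ≤ 4 * logCond m s := by
  have hm' : (1 : ℝ) ≤ m := mod_cast hm
  have h1 : (⌈|s.im|⌉₊ : ℝ) < |s.im| + 1 := Nat.ceil_lt_add_one (abs_nonneg _)
  have h2 : (cutoff m s : ℝ) ≤ (m * (|s.im| + 3)) ^ 4 := by
    simp only [cutoff]
    push_cast
    rw [show (4 : ℕ) = 2 * 2 from rfl, pow_mul]
    gcongr
    have := abs_nonneg s.im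
    rw [mul_pow]
    exact mul_le_mul (by nlinarith) (by nlinarith) (by positivity) (by positivity)
  calc log (cutoff m s) ≤ log ((m * (|s.im| + 3)) ^ 4) :=
        log_le_log (mod_cast one_le_cutoff hm s) h2
    _ = _ := by rw [log_pow]; simp [logCond]

lemma cutoff_rpow_mul_le {m : ℕ} (hm : 1 ≤ m) {s : ℂ} (hs : 0 ≤ s.re) (hs2 : s.re ≤ 2) :
    m * (3 + ‖s‖) * (cutoff m s : ℝ) ^ (-(1 / 2) : ℝ) ≤ 2 := by
  have hm' : (1 : ℝ) ≤ m := mod_cast hm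
  have e : (cutoff m s : ℝ) ^ (-(1 / 2) : ℝ) = ((m : ℝ) * (⌈|s.im|⌉₊ + 3))⁻¹ := by
    simp only [cutoff]
    push_cast
    rw [← rpow_natCast, ← rpow_mul (by positivity), ← rpow_neg_one]
    norm_num
  rw [e, ← div_eq_mul_inv, div_le_iff₀ (by positivity)]
  have h1 : |s.im| ≤ ⌈|s.im|⌉₊ := Nat.le_ceil _
  have h2 : ‖s‖ ≤ 2 + |s.im| := by
    refine (Complex.norm_le_abs_re_add_abs_im s).trans ?_
    rw [abs_of_nonneg hs]; linarith
  have := abs_nonneg s.im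
  nlinarith

lemma sum_Ico_norm_logCpow_cutoff_le {m : ℕ} (hm : 1 ≤ m) {a : ℕ} (ha : a ≤ 2) {s : ℂ}
    (hs : 1 ≤ s.re) :
    ∑ n ∈ Ico 1 (cutoff m s), ‖logCpow a s n‖ ≤ 80 * logCond m s ^ (a + 1) := by
  have h1 := one_le_logCond hm s
  refine (sum_Ico_norm_logCpow_le hs (one_le_cutoff hm s)).trans ?_
  have h0 : 0 ≤ log (cutoff m s) := log_nonneg (mod_cast one_le_cutoff hm s)
  calc _ ≤ (4 * logCond m s) ^ a * (1 + 4 * logCond m s) := by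
        gcongr <;> exact log_cutoff_le hm s
    _ ≤ (4 * logCond m s) ^ a * (5 * logCond m s) := by gcongr; linarith
    _ = (4 ^ a * 5) * logCond m s ^ (a + 1) := by ring
    _ ≤ _ := by
        gcongr
        interval_cases a <;> norm_num

lemma norm_LSeries_le_of_sum_range {f : ℕ → ℂ} {s : ℂ} (hf : LSeriesSummable f s) {C : ℝ} {N : ℕ}
    (h : ∀ M, N ≤ M → ‖∑ n ∈ range M, LSeries.term f s n‖ ≤ C) : ‖LSeries f s‖ ≤ C := by
  have h1 := (hf.hasSum.tendsto_sum_nat).norm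
  exact le_of_tendsto h1 (eventually_atTop.2 ⟨N, h⟩)

lemma norm_LSeries_le_of_bounded_sums {m : ℕ} (hm : 1 ≤ m) {c : ℕ → ℂ} (hc1 : ∀ n, ‖c n‖ ≤ 1)
    (hc : ∀ N, ‖∑ i ∈ range N, c i‖ ≤ m) {a : ℕ} (ha : a ≤ 2) {s : ℂ} (hs : 1 < s.re)
    (hs2 : s.re ≤ 2) :
    ‖LSeries (logMul^[a] c) s‖ ≤ 300 * logCond m s ^ (a + 1) := by
  have hB := one_le_logCond hm s
  refine norm_LSeries_le_of_sum_range (N := cutoff m s)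
    (summable_logMul_iterate (abscissa_le_one_of_bounded hc1) a hs) fun M hM => ?_
  have hN := one_le_cutoff hm s
  have e : ∑ n ∈ range M, LSeries.term (logMul^[a] c) s n =
      ∑ n ∈ Ico 1 (cutoff m s), c n * logCpow a s n +
        ∑ n ∈ Ico (cutoff m s) M, c n * logCpow a s n := by
    rw [sum_Ico_consecutive _ hN hM, range_eq_Ico,
      sum_eq_sum_Ico_succ_bot (by omega), LSeries.term_zero, zero_add]
    exact sum_congr rfl fun n hn =>
      term_logMul_iterate c a s (by have := mem_Ico.1 hn; omega)
  rw [e]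
  have e1 : ‖∑ n ∈ Ico 1 (cutoff m s), c n * logCpow a s n‖ ≤ 80 * logCond m s ^ (a + 1) := by
    refine ((norm_sum_le _ _).trans (sum_le_sum fun n _ => ?_)).trans
      (sum_Ico_norm_logCpow_cutoff_le hm ha hs.le)
    rw [norm_mul]
    exact mul_le_of_le_one_left (norm_nonneg _) (hc1 n)
  have e2 := norm_sum_Ico_mul_logCpow_le hc ha hs.le hN hM
  have e3 := cutoff_rpow_mul_le hm (s := s) (by linarith) hs2
  have e4 : 1 ≤ logCond m s ^ (a + 1) := one_le_pow₀ hB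
  refine (norm_add_le _ _).trans ?_
  nlinarith

lemma tendsto_logCpowPrim (a : ℕ) {s : ℂ} (hs : 1 < s.re) :
    Tendsto (logCpowPrim s a) atTop (nhds 0) := by
  have key : ∀ b : ℕ, Tendsto (fun u : ℝ => -(u : ℂ) ^ (1 - s) / (s - 1) * (log u : ℂ) ^ b)
      atTop (nhds 0) := by
    intro b
    rw [tendsto_zero_iff_norm_tendsto_zero]
    have h1 : Tendsto (fun u : ℝ => ‖(s - 1)⁻¹‖ * (log u ^ b / u ^ (s.re - 1))) atTop
        (nhds 0) := by
      have := (isLittleO_log_rpow_rpow_atTop (b : ℝ)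
        (show 0 < s.re - 1 by linarith)).tendsto_div_nhds_zero
      simpa using this.const_mul ‖(s - 1)⁻¹‖
    refine h1.congr' ?_
    filter_upwards [eventually_ge_atTop 1] with u hu
    rw [norm_mul, norm_div, norm_neg, Complex.norm_cpow_eq_rpow_re_of_pos (by linarith), norm_pow,
      norm_real, norm_of_nonneg (log_nonneg hu), norm_inv,
      show (1 - s).re = -(s.re - 1) by simp, rpow_neg (by linarith)]
    ring
  induction a with
  | zero => simpa [logCpowPrim] using key 0
  | succ a ih =>
    have := (key (a + 1)).add (ih.const_mul (((a + 1 : ℕ) : ℂ) / (s - 1)))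
    simpa [logCpowPrim] using this

lemma norm_zeta_sub_le {a : ℕ} (ha : a ≤ 2) {s : ℂ} (hs : 1 < s.re) (hs2 : s.re ≤ 2) :
    ‖LSeries (logMul^[a] 1) s - (a.factorial : ℂ) / (s - 1) ^ (a + 1)‖ ≤
      2000 * logCond 1 s ^ (a + 1) := by
  have hB := one_le_logCond le_rfl s
  have hs1 : s ≠ 1 := by rintro rfl; simp at hs
  have hsum : LSeriesSummable (logMul^[a] 1) s :=
    summable_logMul_iterate (abscissa_le_one_of_bounded (C := 1) fun n => by simp) a hs
  set d : ℕ → ℂ := fun n => logCpow a s n - (logCpowPrim s a (n + 1) - logCpowPrim s a n) with hd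
  have hlim : Tendsto (fun M : ℕ => ∑ n ∈ range M, LSeries.term (logMul^[a] 1) s n
      - (logCpowPrim s a M - logCpowPrim s a 1)) atTop
      (nhds (LSeries (logMul^[a] 1) s - (0 - logCpowPrim s a 1))) :=
    hsum.hasSum.tendsto_sum_nat.sub
      (((tendsto_logCpowPrim a hs).comp tendsto_natCast_atTop_atTop).sub_const _)
  rw [logCpowPrim_one, zero_sub, neg_neg] at hlim
  refine le_of_tendsto hlim.norm (eventually_atTop.2 ⟨cutoff 1 s, fun M hM => ?_⟩)
  have hN := one_le_cutoff le_rfl s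
  have e : ∑ n ∈ range M, LSeries.term (logMul^[a] 1) s n
      - (logCpowPrim s a M - -((a.factorial : ℂ) / (s - 1) ^ (a + 1))) =
      ∑ n ∈ Ico 1 (cutoff 1 s), d n + ∑ n ∈ Ico (cutoff 1 s) M, d n := by
    have h1 := sum_Ico_sub (fun n : ℕ => logCpowPrim s a n) (hN.trans hM)
    rw [sum_Ico_consecutive _ hN hM, range_eq_Ico,
      sum_eq_sum_Ico_succ_bot (by omega), LSeries.term_zero, zero_add, ← logCpowPrim_one]
    simp only [hd]
    rw [sum_sub_distrib]
    congr 1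
    · exact sum_congr rfl fun n hn => by
        rw [term_logMul_iterate 1 a s (by have := mem_Ico.1 hn; omega)]; simp
    · push_cast at h1
      exact h1.symm
  rw [e]
  have hd1 : ∀ n : ℕ, 1 ≤ n → ‖d n‖ ≤ 16 * (2 + ‖s‖) * (n : ℝ) ^ (-(3 / 2) : ℝ) := fun n hn =>
    norm_logCpow_sub_primDiff_le ha hs.le hs1 (mod_cast hn)
  have e2 : ‖∑ n ∈ Ico (cutoff 1 s) M, d n‖ ≤ 192 := by
    refine (norm_sum_le _ _).trans ?_
    refine (sum_le_sum fun n hn => hd1 n (by have := mem_Ico.1 hn; omega)).trans ?_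
    rw [← mul_sum]
    have h1 := sum_rpow_neg_three_half_le (M := M) hN
    have h2 := cutoff_rpow_mul_le le_rfl (s := s) (by linarith) hs2
    have h3 : 0 ≤ (cutoff 1 s : ℝ) ^ (-(1 / 2) : ℝ) := by positivity
    have h4 := mul_le_mul_of_nonneg_left h1 (by positivity : 0 ≤ 16 * (2 + ‖s‖))
    simp only [Nat.cast_one, one_mul] at h2
    nlinarith
  have e1 : ‖∑ n ∈ Ico 1 (cutoff 1 s), d n‖ ≤ 800 * logCond 1 s ^ (a + 1) := by
    have hbd : ∀ n ∈ Ico 1 (cutoff 1 s), ‖d n‖ ≤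
        2 * log (cutoff 1 s) ^ a * (n : ℝ)⁻¹ := by
      intro n hn
      have hn' := mem_Ico.1 hn
      have hn1 : (1 : ℝ) ≤ n := mod_cast hn'.1
      have hn2 : (n : ℝ) + 1 ≤ cutoff 1 s := mod_cast hn'.2
      have hphi : ∀ u : ℝ, u ∈ Set.Icc (n : ℝ) (n + 1) → ‖logCpow a s u‖ ≤
          log (cutoff 1 s) ^ a * (n : ℝ)⁻¹ := by
        intro u hu
        have hu1 : 1 ≤ u := hn1.trans hu.1
        rw [norm_logCpow hu1, ← rpow_neg_one]
        have h0 : 0 ≤ log u := log_nonneg hu1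
        have h3 : u ^ (-s.re) ≤ (n : ℝ) ^ (-1 : ℝ) := by
          calc u ^ (-s.re) ≤ u ^ (-1 : ℝ) := rpow_le_rpow_of_exponent_le hu1 (by linarith)
            _ ≤ _ := rpow_le_rpow_of_nonpos (by linarith) hu.1 (by norm_num)
        have h4 : log u ≤ log (cutoff 1 s) := log_le_log (by linarith) (hu.2.trans hn2)
        gcongr
      have h5 := norm_image_sub_le_of_norm_hasDerivWithin_le (f := logCpowPrim s a)
        (s := Set.Icc (n : ℝ) (n + 1)) (x := n) (y := n + 1)
        (fun x hx => (hasDerivAt_logCpowPrim a hs1 (by linarith [hx.1])).hasDerivWithinAt)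
        hphi (convex_Icc _ _) ⟨le_rfl, by linarith⟩ ⟨by linarith, le_rfl⟩
      have h6 : ‖((n : ℝ) + 1 - n : ℝ)‖ = 1 := by simp
      rw [h6, mul_one] at h5
      refine (norm_sub_le _ _).trans ?_
      have := hphi n ⟨le_rfl, by linarith⟩
      linarith
    refine ((norm_sum_le _ _).trans (sum_le_sum hbd)).trans ?_
    rw [← mul_sum]
    have h7 : ∑ n ∈ Ico 1 (cutoff 1 s), (n : ℝ)⁻¹ ≤ 1 + log (cutoff 1 s) := by
      have h := sum_Ico_norm_logCpow_le (a := 0) (s := 1) (by simp) hN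
      simp only [pow_zero, one_mul] at h
      refine le_trans (le_of_eq (sum_congr rfl fun n hn => ?_)) h
      have hn' := mem_Ico.1 hn
      rw [norm_logCpow (mod_cast hn'.1)]
      simp [rpow_neg_one]
    have h8 := log_cutoff_le le_rfl s
    have h0 : 0 ≤ log (cutoff 1 s) := log_nonneg (mod_cast hN)
    calc _ ≤ 2 * (4 * logCond 1 s) ^ a * (1 + 4 * logCond 1 s) := by
          gcongr
          exact h7.trans (by linarith)
      _ ≤ 2 * (4 * logCond 1 s) ^ a * (5 * logCond 1 s) := by gcongr; linarith
      _ = (2 * 4 ^ a * 5) * logCond 1 s ^ (a + 1) := by ring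
      _ ≤ _ := by
          gcongr
          interval_cases a <;> norm_num
  have e4 : 1 ≤ logCond 1 s ^ (a + 1) := one_le_pow₀ hB
  refine (norm_add_le _ _).trans ?_
  linarith

lemma sum_range_eq_sum_zmod {m : ℕ} [NeZero m] (f : ZMod m → ℂ) :
    ∑ i ∈ range m, f (i : ZMod m) = ∑ x : ZMod m, f x := by
  refine sum_nbij' (fun i => (i : ZMod m)) ZMod.val (by simp) ?_ ?_ ?_ (by simp)
  · intro x _
    exact mem_range.2 (ZMod.val_lt x)
  · intro i hi
    exact ZMod.val_cast_of_lt (mem_range.1 hi)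
  · intro x _
    exact ZMod.natCast_zmod_val x

lemma norm_sum_range_periodic_le {m : ℕ} [NeZero m] {f : ZMod m → ℂ} (h0 : ∑ x, f x = 0)
    (h1 : ∀ x, ‖f x‖ ≤ 1) (N : ℕ) : ‖∑ i ∈ range N, f (i : ZMod m)‖ ≤ m := by
  induction N using Nat.strong_induction_on with
  | _ N ih =>
    rcases le_or_gt N m with h | h
    · refine (norm_sum_le _ _).trans ((sum_le_sum fun i _ => h1 _).trans ?_)
      simpa using h
    · obtain ⟨M, rfl⟩ := Nat.exists_eq_add_of_lt h
      have e : ∑ i ∈ range (m + M + 1), f (i : ZMod m) =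
          ∑ i ∈ range (M + 1), f (i : ZMod m) := by
        rw [add_assoc, sum_range_add, sum_range_eq_sum_zmod, h0, zero_add]
        simp
      rw [e]
      exact ih (M + 1) (by have := NeZero.pos m; omega)

/-- The mean value of a Dirichlet character. -/
def charMean {m : ℕ} (χ : DirichletCharacter ℂ m) : ℝ := if χ = 1 then m.totient / m else 0

lemma charMean_nonneg {m : ℕ} (χ : DirichletCharacter ℂ m) : 0 ≤ charMean χ := by
  unfold charMean; split_ifs <;> positivity

lemma charMean_le_one {m : ℕ} (χ : DirichletCharacter ℂ m) : charMean χ ≤ 1 := by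
  unfold charMean
  split_ifs
  · exact div_le_one_of_le₀ (mod_cast Nat.totient_le m) (by positivity)
  · norm_num

lemma charMean_of_ne {m : ℕ} {χ : DirichletCharacter ℂ m} (h : χ ≠ 1) : charMean χ = 0 := if_neg h

lemma sum_char_sub_charMean {m : ℕ} [NeZero m] (χ : DirichletCharacter ℂ m) :
    ∑ x, (χ x - (charMean χ : ℂ)) = 0 := by
  rw [sum_sub_distrib, sum_const, card_univ, ZMod.card]
  have hm : (m : ℂ) ≠ 0 := mod_cast NeZero.ne m
  by_cases h : χ = 1
  · subst h
    rw [MulChar.sum_one_eq_card_units, ZMod.card_units_eq_totient, charMean, if_pos rfl]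
    push_cast
    simp
    field_simp
    ring
  · rw [sum_eq_zero_of_ne_one h, charMean_of_ne h]
    simp

lemma norm_char_sub_charMean_le {m : ℕ} [NeZero m] (χ : DirichletCharacter ℂ m) (x : ZMod m) :
    ‖χ x - (charMean χ : ℂ)‖ ≤ 1 := by
  by_cases h : χ = 1
  · subst h
    have h0 := charMean_nonneg (1 : DirichletCharacter ℂ m)
    have h1 := charMean_le_one (1 : DirichletCharacter ℂ m)
    by_cases hx : IsUnit x
    · rw [one_apply hx]
      rw [← ofReal_one, ← ofReal_sub, norm_real, norm_of_nonneg] <;> linarith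
    · rw [MulChar.map_nonunit _ hx, zero_sub, norm_neg, norm_real, norm_of_nonneg h0]
      exact h1
  · rw [charMean_of_ne h]
    simpa using norm_le_one χ x

/-- The series `∑ χ(n) (log n) ^ a n ^ (-s)`, which is `(-1) ^ a` times the `a`-th derivative of
the `L`-series of `χ`. -/
def charL {m : ℕ} (χ : DirichletCharacter ℂ m) (a : ℕ) (s : ℂ) : ℂ :=
  LSeries (logMul^[a] (fun n => χ n)) s

lemma abscissa_char_le {m : ℕ} (χ : DirichletCharacter ℂ m) :
    abscissaOfAbsConv (fun n => χ n) ≤ 1 :=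
  abscissa_le_one_of_bounded (C := 1) fun n => norm_le_one χ n

lemma charL_zero {m : ℕ} (χ : DirichletCharacter ℂ m) (s : ℂ) :
    charL χ 0 s = LSeries (fun n => χ n) s := rfl

lemma hasDerivAt_charL {m : ℕ} (χ : DirichletCharacter ℂ m) (a : ℕ) {s : ℂ} (hs : 1 < s.re) :
    HasDerivAt (charL χ a) (-charL χ (a + 1) s) s := by
  have h : abscissaOfAbsConv (logMul^[a] (fun n => χ n)) < s.re := by
    rw [LSeries.absicssaOfAbsConv_logPowMul]
    exact (abscissa_char_le χ).trans_lt (mod_cast hs)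
  have := LSeries_hasDerivAt h
  rwa [← Function.iterate_succ_apply' logMul a] at this

lemma norm_charL_sub_le {m : ℕ} (hm : 1 ≤ m) (χ : DirichletCharacter ℂ m) {a : ℕ} (ha : a ≤ 2)
    {s : ℂ} (hs : 1 < s.re) (hs2 : s.re ≤ 2) :
    ‖charL χ a s - charMean χ * ((a.factorial : ℂ) / (s - 1) ^ (a + 1))‖ ≤
      2300 * logCond m s ^ (a + 1) := by
  have : NeZero m := ⟨by omega⟩
  set c : ℕ → ℂ := fun n => χ n - (charMean χ : ℂ) with hc
  have hc1 : ∀ n, ‖c n‖ ≤ 1 := fun n => norm_char_sub_charMean_le χ n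
  have hcs : ∀ N, ‖∑ i ∈ range N, c i‖ ≤ m := fun N =>
    norm_sum_range_periodic_le (f := fun x => χ x - (charMean χ : ℂ)) (sum_char_sub_charMean χ)
      (norm_char_sub_charMean_le χ) N
  have h1 := norm_LSeries_le_of_bounded_sums hm hc1 hcs ha hs hs2
  have h2 := norm_zeta_sub_le ha hs hs2
  have e : logMul^[a] (fun n => χ n) =
      logMul^[a] c + (charMean χ : ℂ) • logMul^[a] (1 : ℕ → ℂ) := by
    funext n
    simp only [Pi.add_apply, Pi.smul_apply, logMul_iterate, smul_eq_mul, hc, Pi.one_apply]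
    ring
  have s1 := summable_logMul_iterate (abscissa_le_one_of_bounded hc1) a hs
  have s2 : LSeriesSummable (logMul^[a] 1) s :=
    summable_logMul_iterate (abscissa_le_one_of_bounded (C := 1) fun n => by simp) a hs
  have e2 : charL χ a s = LSeries (logMul^[a] c) s +
      charMean χ * LSeries (logMul^[a] 1) s := by
    rw [charL, e, LSeries_add s1 (s2.smul _), LSeries_smul]
  rw [e2, add_sub_assoc, ← mul_sub]
  refine (norm_add_le _ _).trans ?_
  rw [norm_mul, norm_real, norm_of_nonneg (charMean_nonneg χ)]
  have h3 : charMean χ * ‖LSeries (logMul^[a] 1) s - (a.factorial : ℂ) / (s - 1) ^ (a + 1)‖ ≤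
      1 * (2000 * logCond 1 s ^ (a + 1)) := by
    gcongr
    exact charMean_le_one χ
  have h4 : logCond 1 s ^ (a + 1) ≤ logCond m s ^ (a + 1) := by
    have := one_le_logCond le_rfl s
    gcongr
    exact logCond_mono le_rfl hm le_rfl
  linarith

lemma norm_charL_le_of_ne {m : ℕ} (hm : 1 ≤ m) {χ : DirichletCharacter ℂ m} (hχ : χ ≠ 1) {a : ℕ}
    (ha : a ≤ 2) {s : ℂ} (hs : 1 < s.re) (hs2 : s.re ≤ 2) :
    ‖charL χ a s‖ ≤ 2300 * logCond m s ^ (a + 1) := by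
  simpa [charMean_of_ne hχ] using norm_charL_sub_le hm χ ha hs hs2

lemma norm_charL_le {m : ℕ} (hm : 1 ≤ m) (χ : DirichletCharacter ℂ m) {a : ℕ}
    (ha : a ≤ 2) {s : ℂ} (hs : 1 < s.re) (hs2 : s.re ≤ 2) {κ : ℝ} (hκ : 1 ≤ κ)
    (h : χ = 1 → 1 ≤ κ * |s.im|) :
    ‖charL χ a s‖ ≤ 2302 * logCond m s ^ (a + 1) * κ ^ (a + 1) := by
  have hB := one_le_logCond hm s
  have h1 : 1 ≤ κ ^ (a + 1) := one_le_pow₀ hκ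
  have h2 : 1 ≤ logCond m s ^ (a + 1) := one_le_pow₀ hB
  by_cases hχ : χ = 1
  · have h3 := norm_charL_sub_le hm χ ha hs hs2
    have h4 : ‖(charMean χ : ℂ) * ((a.factorial : ℂ) / (s - 1) ^ (a + 1))‖ ≤ 2 * κ ^ (a + 1) := by
      rw [norm_mul, norm_div, norm_pow, norm_real, norm_of_nonneg (charMean_nonneg χ),
        Complex.norm_natCast]
      have h5 : (a.factorial : ℝ) ≤ 2 := by interval_cases a <;> norm_num [Nat.factorial]
      have h6 : 1 ≤ κ * ‖s - 1‖ := (h hχ).trans (by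
        gcongr
        simpa using abs_im_le_norm (s - 1))
      have h7 : 0 < ‖s - 1‖ := by
        by_contra h0
        have : ‖s - 1‖ = 0 := le_antisymm (not_lt.mp h0) (norm_nonneg _)
        rw [this] at h6; linarith
      have h8 : 1 ≤ κ ^ (a + 1) * ‖s - 1‖ ^ (a + 1) := by
        rw [← mul_pow]; exact one_le_pow₀ h6
      have h9 : (a.factorial : ℝ) / ‖s - 1‖ ^ (a + 1) ≤ 2 * κ ^ (a + 1) := by
        rw [div_le_iff₀ (by positivity)]
        nlinarith
      calc _ ≤ 1 * (2 * κ ^ (a + 1)) := by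
            gcongr
            exact charMean_le_one χ
        _ = _ := one_mul _
    calc ‖charL χ a s‖ ≤ ‖charL χ a s - charMean χ * ((a.factorial : ℂ) / (s - 1) ^ (a + 1))‖ +
          ‖(charMean χ : ℂ) * ((a.factorial : ℂ) / (s - 1) ^ (a + 1))‖ := by
            simpa using norm_add_le
              (charL χ a s - charMean χ * ((a.factorial : ℂ) / (s - 1) ^ (a + 1)))
              ((charMean χ : ℂ) * ((a.factorial : ℂ) / (s - 1) ^ (a + 1)))
      _ ≤ _ := by nlinarith
  · refine (norm_charL_le_of_ne hm hχ ha hs hs2).trans ?_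
    nlinarith

lemma norm_charL_zero_one_le {m : ℕ} {x : ℝ} (hx : 0 < x) (hx1 : x ≤ 1) :
    ‖LSeries (fun n => (1 : DirichletCharacter ℂ m) n) (1 + x)‖ ≤ 4001 / x := by
  have hs : 1 < (1 + x : ℂ).re := by simpa using hx
  have hs2 : (1 + x : ℂ).re ≤ 2 := by simp; linarith
  have h1 := norm_zeta_sub_le (a := 0) (by norm_num) hs hs2
  have hB : logCond 1 (1 + x) ≤ 2 := by
    simp only [logCond, Nat.cast_one, one_mul, Complex.add_im, Complex.one_im, ofReal_im,
      add_zero, abs_zero, zero_add]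
    have := log_le_sub_one_of_pos (show (0 : ℝ) < 3 by norm_num)
    linarith
  simp only [Function.iterate_zero, id_eq, Nat.factorial_zero, Nat.cast_one, zero_add, pow_one,
    add_sub_cancel_left] at h1
  have hz : LSeriesSummable (1 : ℕ → ℂ) (1 + x) := LSeriesSummable_one_iff.2 hs
  have h2 : ‖LSeries (fun n => (1 : DirichletCharacter ℂ m) n) (1 + x)‖ ≤
      ‖LSeries (1 : ℕ → ℂ) (1 + x)‖ := by
    have e : LSeries (1 : ℕ → ℂ) (1 + x) =
        ((∑' n, ‖LSeries.term (1 : ℕ → ℂ) (1 + x) n‖ : ℝ) : ℂ) := by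
      rw [LSeries, ofReal_tsum]
      congr 1
      funext n
      rcases eq_or_ne n 0 with rfl | hn
      · simp
      · rw [term_of_ne_zero hn, Pi.one_apply, norm_div, norm_one,
          Complex.norm_natCast_cpow_of_pos (pos_of_ne_zero hn)]
        rw [ofReal_div, ofReal_cpow (by positivity)]
        simp
    rw [e, norm_real, norm_of_nonneg (tsum_nonneg fun _ => norm_nonneg _)]
    have hle : ∀ n, ‖LSeries.term (fun n => (1 : DirichletCharacter ℂ m) n) (1 + x) n‖ ≤
        ‖LSeries.term (1 : ℕ → ℂ) (1 + x) n‖ := fun n =>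
      LSeries.norm_term_le _ (by simpa using norm_le_one (1 : DirichletCharacter ℂ m) n)
    exact tsum_of_norm_bounded hz.norm.hasSum hle
  refine h2.trans ?_
  have h3 : ‖(1 / x : ℂ)‖ = 1 / x := by
    rw [norm_div, norm_one, norm_real, norm_of_nonneg hx.le]
  have h4 : ‖LSeries (1 : ℕ → ℂ) (1 + x)‖ ≤
      ‖LSeries (1 : ℕ → ℂ) (1 + x) - 1 / x‖ + ‖(1 / x : ℂ)‖ := by
    simpa using norm_add_le (LSeries (1 : ℕ → ℂ) (1 + x) - 1 / x) (1 / x : ℂ)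
  have h5 : 1 ≤ 1 / x := by rw [le_div_iff₀ hx]; linarith
  have : 4001 / x = 4001 * (1 / x) := by ring
  rw [this]
  linarith

/-- The constant in the lower bound for `L`-series near the line `re s = 1`. -/
def cLow : ℝ := 4001 ^ 3 * 4604 * 4700 ^ 4

lemma one_le_cLow : 1 ≤ cLow := by norm_num [cLow]

lemma charL_zero_lower {m : ℕ} (hm : 1 ≤ m) (χ : DirichletCharacter ℂ m) {s : ℂ}
    (hs : 1 < s.re) (hs2 : s.re ≤ 2) {κ : ℝ} (hκ : 1 ≤ κ) (h1 : χ = 1 → 1 ≤ |s.im|)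
    (h2 : χ ^ 2 = 1 → 1 ≤ κ * |s.im|) :
    1 ≤ cLow * κ * logCond m s ^ 7 * ‖charL χ 0 s‖ := by
  have hB := one_le_logCond hm s
  set B := logCond m s with hBdef
  have hc := one_le_cLow
  set θ : ℝ := 1 / (cLow * κ * B ^ 9) with hθ
  have hden : 1 ≤ cLow * κ * B ^ 9 := by
    have : 1 ≤ B ^ 9 := one_le_pow₀ hB
    exact one_le_mul_of_one_le_of_one_le (one_le_mul_of_one_le_of_one_le hc hκ) this
  have hθ0 : 0 < θ := by positivity
  have hθ1 : θ ≤ 1 := by rw [hθ, div_le_one (by linarith)]; exact hden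
  -- the fourth-power bound to the right of `1 + θ`
  have far : ∀ x : ℝ, θ ≤ x → x ≤ 1 → 4700 * (θ * B ^ 2) ≤ ‖charL χ 0 (1 + x + I * s.im)‖ := by
    intro x hx hx1
    have hx0 : 0 < x := hθ0.trans_le hx
    have h341 := DirichletCharacter.norm_LSeries_product_ge_one χ hx0 s.im
    rw [norm_mul, norm_mul, norm_pow, norm_pow] at h341
    have b1 := norm_charL_zero_one_le (m := m) hx0 hx1
    have b3 : ‖charL (χ ^ 2) 0 (1 + x + 2 * I * s.im)‖ ≤ 4604 * B * κ := by
      have g := norm_charL_le hm (χ ^ 2) (a := 0) (s := 1 + x + 2 * I * s.im) (by norm_num)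
        (by simpa using hx0) (by simp; linarith) hκ (fun h => (h2 h).trans (by
          have e : (1 + (x : ℂ) + 2 * I * s.im).im = 2 * s.im := by simp
          rw [e, abs_mul]
          gcongr
          have := abs_nonneg s.im
          norm_num; linarith))
      refine g.trans ?_
      have hB2 : logCond m (1 + x + 2 * I * s.im) ≤ 2 * B := by
        have e : (1 + (x : ℂ) + 2 * I * s.im).im = 2 * s.im := by simp
        have hm' : (1 : ℝ) ≤ m := mod_cast hm
        have := abs_nonneg s.im
        rw [hBdef, logCond, logCond, e, abs_mul, ← Nat.cast_two (R := ℝ), ← log_pow]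
        apply log_le_log (by positivity)
        rw [Nat.cast_two, abs_two, mul_pow]
        exact mul_le_mul (by nlinarith) (by nlinarith) (by positivity) (by positivity)
      simp only [zero_add, pow_one]
      have : 0 ≤ κ := by linarith
      calc 2302 * logCond m (1 + x + 2 * I * s.im) * κ ≤ 2302 * (2 * B) * κ := by gcongr
        _ = _ := by ring
    set ℓ := ‖charL χ 0 (1 + x + I * s.im)‖ with hℓ
    have h4 : 1 ≤ (4001 / x) ^ 3 * ℓ ^ 4 * (4604 * B * κ) := by
      refine h341.le.trans ?_
      change _ * ‖charL χ 0 (1 + x + I * s.im)‖ ^ 4 * ‖charL (χ ^ 2) 0 (1 + x + 2 * I * s.im)‖ ≤ _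
      gcongr
    have h5 : (4001 / x) ^ 3 ≤ (4001 / θ) ^ 3 := by gcongr
    have h6 : 1 ≤ (4001 / θ) ^ 3 * ℓ ^ 4 * (4604 * B * κ) := h4.trans (by gcongr)
    have h7 : (4700 * (θ * B ^ 2)) ^ 4 ≤ ℓ ^ 4 := by
      have e1 : (4001 / θ) ^ 3 * ℓ ^ 4 * (4604 * B * κ) =
          (4001 ^ 3 * 4604 * B * κ / θ ^ 3) * ℓ ^ 4 := by
        field_simp
      rw [e1] at h6
      have e2 : (4001 ^ 3 * 4604 * B * κ / θ ^ 3) * (4700 * (θ * B ^ 2)) ^ 4 = 1 := by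
        have : θ * (cLow * κ * B ^ 9) = 1 := by rw [hθ]; field_simp
        have hh : (4001 ^ 3 * 4604 * B * κ / θ ^ 3) * (4700 * (θ * B ^ 2)) ^ 4 =
          θ * (cLow * κ * B ^ 9) := by
            rw [cLow]; field_simp
        rw [hh, this]
      have e3 : 0 < 4001 ^ 3 * 4604 * B * κ / θ ^ 3 := by positivity
      rw [← e2] at h6
      exact le_of_mul_le_mul_left h6 e3
    exact le_of_pow_le_pow_left₀ (by norm_num) (norm_nonneg _) h7
  have hfin : 2000 * (θ * B ^ 2) ≤ ‖charL χ 0 s‖ := by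
    have hpos : 0 ≤ θ * B ^ 2 := by positivity
    rcases le_or_gt (1 + θ) s.re with hcase | hcase
    · have := far (s.re - 1) (by linarith) (by linarith)
      have e : (1 + ((s.re - 1 : ℝ) : ℂ) + I * s.im) = s := by
        push_cast
        conv_rhs => rw [← Complex.re_add_im s]
        ring
      rw [e] at this
      linarith
    · have hfar := far θ le_rfl hθ1
      set s' : ℂ := 1 + (θ : ℂ) + I * s.im with hs'
      have him : s'.im = s.im := by simp [hs']
      have hre : s'.re = 1 + θ := by simp [hs']
      have hd := norm_image_sub_le_of_norm_hasDerivWithin_le (f := charL χ 0)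
        (f' := fun z => -charL χ 1 z)
        (s := {z : ℂ | z.im = s.im} ∩ {z : ℂ | s.re ≤ z.re} ∩ {z : ℂ | z.re ≤ 1 + θ})
        (C := 2302 * B ^ 2) (x := s) (y := s')
        (fun z hz =>
          (hasDerivAt_charL χ 0 (by have := hz.1.2; simp at this; linarith)).hasDerivWithinAt)
        (fun z hz => by
          have z1 : z.im = s.im := hz.1.1
          have z2 : s.re ≤ z.re := hz.1.2
          have z3 : z.re ≤ 1 + θ := hz.2
          have g := norm_charL_le hm χ (a := 1) (s := z) (by norm_num) (by linarith) (by linarith)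
            le_rfl (fun h => by rw [z1, one_mul]; exact h1 h)
          have eB : logCond m z = B := by rw [hBdef, logCond, logCond, z1]
          rw [norm_neg]
          simpa [eB] using g)
        (((convex_hyperplane (E := ℂ) (f := Complex.imLm) (Complex.imLm.isLinear) s.im).inter
          (convex_halfSpace_re_ge s.re)).inter (convex_halfSpace_re_le (1 + θ)))
        ⟨⟨rfl, le_refl s.re⟩, hcase.le⟩
        ⟨⟨him, by simp only [Set.mem_ofPred_eq, hre]; exact hcase.le⟩, hre.le⟩
      have hdist : ‖s' - s‖ ≤ θ := by
        have : s' - s = ((1 + θ - s.re : ℝ) : ℂ) := by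
          apply Complex.ext <;> simp [hre, him]
        rw [this, norm_real, norm_of_nonneg (by linarith)]
        linarith
      have h3 : ‖charL χ 0 s'‖ ≤ ‖charL χ 0 s‖ + ‖charL χ 0 s' - charL χ 0 s‖ := by
        simpa using norm_add_le (charL χ 0 s) (charL χ 0 s' - charL χ 0 s)
      have h4 : 2302 * B ^ 2 * ‖s' - s‖ ≤ 2302 * B ^ 2 * θ := by gcongr
      nlinarith
  have e : θ * B ^ 2 * (cLow * κ * B ^ 7) = 1 := by rw [hθ]; field_simp
  have hp : 0 ≤ cLow * κ * B ^ 7 := by positivity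
  have := mul_le_mul_of_nonneg_right hfin hp
  nlinarith

def charLam {m : ℕ} (χ : DirichletCharacter ℂ m) (a : ℕ) (s : ℂ) : ℂ :=
  LSeries (logMul^[a] (fun n => χ n * Λ n)) s

lemma abscissa_charLam_le {m : ℕ} (χ : DirichletCharacter ℂ m) :
    abscissaOfAbsConv (fun n => χ n * Λ n) ≤ 1 := by
  refine LSeries.abscissaOfAbsConv_le_of_forall_lt_LSeriesSummable fun y hy => ?_
  exact DirichletCharacter.LSeriesSummable_twist_vonMangoldt χ (by simpa using hy)

lemma charL_zero_ne_zero {m : ℕ} (χ : DirichletCharacter ℂ m) {s : ℂ} (hs : 1 < s.re) :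
    charL χ 0 s ≠ 0 :=
  DirichletCharacter.LSeries_ne_zero_of_one_lt_re χ hs

lemma charLam_zero {m : ℕ} (χ : DirichletCharacter ℂ m) {s : ℂ} (hs : 1 < s.re) :
    charLam χ 0 s = charL χ 1 s / charL χ 0 s := by
  have h := DirichletCharacter.LSeries_twist_vonMangoldt_eq χ hs
  have h2 := (hasDerivAt_charL χ 0 hs).deriv
  rw [← neg_eq_iff_eq_neg] at h2
  rw [← h2]
  exact h

lemma charLam_one {m : ℕ} (χ : DirichletCharacter ℂ m) {s : ℂ} (hs : 1 < s.re) :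
    charLam χ 1 s = charL χ 2 s / charL χ 0 s - (charL χ 1 s / charL χ 0 s) ^ 2 := by
  have h0 := charL_zero_ne_zero χ hs
  have h1 : HasDerivAt (charLam χ 0) (-charLam χ 1 s) s :=
    LSeries_hasDerivAt ((abscissa_charLam_le χ).trans_lt (mod_cast hs))
  have h2 := (hasDerivAt_charL χ 1 hs).div (hasDerivAt_charL χ 0 hs) h0
  have h3 : charLam χ 0 =ᶠ[nhds s] (charL χ 1 / charL χ 0) := by
    filter_upwards [(isOpen_lt continuous_const continuous_re).mem_nhds hs] with z hz
    exact charLam_zero χ hz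
  have h4 := h1.unique (h2.congr_of_eventuallyEq h3)
  rw [neg_eq_iff_eq_neg] at h4
  rw [h4]
  field_simp
  ring

lemma norm_charLam_le_of_bounds {m : ℕ} (χ : DirichletCharacter ℂ m) {s : ℂ} (hs : 1 < s.re)
    {D B : ℝ} (hD1 : 1 ≤ D) (hB : 0 ≤ B) (hD : 1 ≤ D * ‖charL χ 0 s‖)
    (h : ∀ a ≤ 2, ‖charL χ a s‖ ≤ B ^ (a + 1)) {a : ℕ} (ha : a ≤ 1) :
    ‖charLam χ a s‖ ≤ (2 * D * (B + 1) ^ 2) ^ (a + 1) := by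
  have h0 : 0 < ‖charL χ 0 s‖ := norm_pos_iff.2 (charL_zero_ne_zero χ hs)
  have hq : ∀ a ≤ 2, ‖charL χ a s / charL χ 0 s‖ ≤ D * B ^ (a + 1) := by
    intro a ha
    rw [norm_div, div_le_iff₀ h0]
    have := h a ha
    have h3 : 0 ≤ B ^ (a + 1) := by positivity
    nlinarith
  interval_cases a
  · rw [charLam_zero χ hs]
    refine (hq 1 (by norm_num)).trans ?_
    norm_num
    nlinarith [mul_nonneg (by linarith : 0 ≤ D) hB, sq_nonneg B]
  · rw [charLam_one χ hs]
    refine (norm_sub_le _ _).trans ?_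
    rw [norm_pow]
    have e1 := hq 2 le_rfl
    have e2 := hq 1 (by norm_num)
    have e3 : ‖charL χ 1 s / charL χ 0 s‖ ^ 2 ≤ (D * B ^ 2) ^ 2 := by gcongr
    norm_num only at e1 ⊢
    have e4 : B ^ 3 ≤ (B + 1) ^ 4 := by
      nlinarith [pow_nonneg hB 2, pow_nonneg hB 3, pow_nonneg hB 4]
    have e5 : B ^ 4 ≤ (B + 1) ^ 4 := by gcongr; linarith
    have e6 : D * B ^ 3 ≤ D ^ 2 * (B + 1) ^ 4 := by
      calc D * B ^ 3 ≤ D ^ 2 * B ^ 3 := by gcongr; nlinarith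
        _ ≤ _ := by gcongr
    have e7 : (D * B ^ 2) ^ 2 ≤ D ^ 2 * (B + 1) ^ 4 := by
      calc (D * B ^ 2) ^ 2 = D ^ 2 * B ^ 4 := by ring
        _ ≤ _ := by gcongr
    have e8 : 0 ≤ D ^ 2 * (B + 1) ^ 4 := by positivity
    have e9 : (2 * D * (B + 1) ^ 2) ^ 2 = 4 * (D ^ 2 * (B + 1) ^ 4) := by ring
    linarith

def cLam : ℝ := 2 * cLow * 2303 ^ 2

lemma one_le_cLam : 1 ≤ cLam := by norm_num [cLam, cLow]

lemma norm_charLam_le {m : ℕ} (hm : 1 ≤ m) (χ : DirichletCharacter ℂ m) {s : ℂ}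
    (hs : 1 < s.re) (hs2 : s.re ≤ 2) {κ : ℝ} (hκ : 1 ≤ κ) (h1 : χ = 1 → 1 ≤ |s.im|)
    (h2 : χ ^ 2 = 1 → 1 ≤ κ * |s.im|) {a : ℕ} (ha : a ≤ 1) :
    ‖charLam χ a s‖ ≤ (cLam * κ * logCond m s ^ 9) ^ (a + 1) := by
  have hB := one_le_logCond hm s
  have hc := one_le_cLow
  have hB7 : 1 ≤ logCond m s ^ 7 := one_le_pow₀ hB
  refine (norm_charLam_le_of_bounds χ hs (D := cLow * κ * logCond m s ^ 7) (B := 2302 * logCond m s)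
    ?_ (by positivity) (charL_zero_lower hm χ hs hs2 hκ h1 h2) ?_ ha).trans ?_
  · exact one_le_mul_of_one_le_of_one_le (one_le_mul_of_one_le_of_one_le hc hκ) hB7
  · intro b hb
    refine (norm_charL_le hm χ hb hs hs2 le_rfl (by simpa using h1)).trans ?_
    rw [one_pow, mul_one, mul_pow]
    gcongr
    exact le_self_pow₀ (by norm_num) (by omega)
  · refine pow_le_pow_left₀ (by positivity) ?_ _
    calc 2 * (cLow * κ * logCond m s ^ 7) * (2302 * logCond m s + 1) ^ 2
        ≤ 2 * (cLow * κ * logCond m s ^ 7) * (2303 * logCond m s) ^ 2 := by gcongr; linarith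
      _ = _ := by rw [cLam]; ring

lemma exists_zetaLam_bound : ∃ C : ℝ, 1 ≤ C ∧ ∀ s : ℂ, 1 < s.re → s.re ≤ 2 → |s.im| ≤ 1 → ∀ a ≤ 1,
    ‖charLam (1 : DirichletCharacter ℂ 1) a s - 1 / (s - 1) ^ (a + 1)‖ ≤ C := by
  set F := LFunctionTrivChar₁ 1 with hF
  have hFd : Differentiable ℂ F := DirichletCharacter.differentiable_LFunctionTrivChar₁ 1
  have hFan : AnalyticOnNhd ℂ F Set.univ := fun z _ => hFd.analyticAt z
  set φ : ℂ → ℂ := fun z => -deriv F z / F z with hφ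
  have hne : ∀ z : ℂ, 1 ≤ z.re → F z ≠ 0 := by
    intro z hz
    by_cases h : z = 1
    · rw [h]; exact DirichletCharacter.LFunctionTrivChar₁_apply_one_ne_zero 1
    · rw [hF, LFunctionTrivChar₁, Function.update_of_ne h]
      exact mul_ne_zero (sub_ne_zero.2 h)
        (DirichletCharacter.LFunction_ne_zero_of_one_le_re _ (Or.inr h) hz)
  have hφan : AnalyticOnNhd ℂ φ {z | 1 ≤ z.re} := fun z hz =>
    ((hFd.analyticAt z).deriv.neg).div (hFd.analyticAt z) (hne z hz)
  have hrel : ∀ z : ℂ, 1 < z.re →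
      charLam (1 : DirichletCharacter ℂ 1) 0 z - 1 / (z - 1) = φ z := by
    intro z hz
    have hz1 : z ≠ 1 := by rintro rfl; simp at hz
    have hz1' := sub_ne_zero.2 hz1
    have h0 := charL_zero_ne_zero (1 : DirichletCharacter ℂ 1) hz
    have hL : LFunctionTrivChar 1 z = charL (1 : DirichletCharacter ℂ 1) 0 z :=
      LFunction_eq_LSeries _ hz
    have hL' : deriv (LFunctionTrivChar 1) z =
        -charL (1 : DirichletCharacter ℂ 1) 1 z :=
      (DirichletCharacter.deriv_LFunction_eq_deriv_LSeries _ hz).trans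
        (hasDerivAt_charL _ 0 hz).deriv
    rw [charLam_zero _ hz]
    simp only [hφ]
    rw [hF, DirichletCharacter.deriv_LFunctionTrivChar₁_apply_of_ne_one 1 hz1,
      LFunctionTrivChar₁, Function.update_of_ne hz1, hL, hL']
    field_simp
    ring
  have hrel' : ∀ z : ℂ, 1 < z.re →
      charLam (1 : DirichletCharacter ℂ 1) 1 z - 1 / (z - 1) ^ 2 = -deriv φ z := by
    intro z hz
    have hz1 : z ≠ 1 := by rintro rfl; simp at hz
    have hz1' := sub_ne_zero.2 hz1
    have h1 : HasDerivAt (charLam (1 : DirichletCharacter ℂ 1) 0)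
        (-charLam (1 : DirichletCharacter ℂ 1) 1 z) z :=
      LSeries_hasDerivAt ((abscissa_charLam_le _).trans_lt (mod_cast hz))
    have h2 : HasDerivAt (fun z : ℂ => 1 / (z - 1)) (-1 / (z - 1) ^ 2) z := by
      simpa [one_div] using ((hasDerivAt_id z).sub_const 1).fun_inv hz1'
    have h3 : φ =ᶠ[nhds z] fun z => charLam (1 : DirichletCharacter ℂ 1) 0 z - 1 / (z - 1) := by
      filter_upwards [(isOpen_lt continuous_const continuous_re).mem_nhds hz] with w hw
      exact (hrel w hw).symm
    rw [((h1.sub h2).congr_of_eventuallyEq h3).deriv]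
    ring
  have hcpt : IsCompact (Set.Icc (1 : ℝ) 2 ×ℂ Set.Icc (-1 : ℝ) 1) :=
    isCompact_Icc.reProdIm isCompact_Icc
  have hsub : (Set.Icc (1 : ℝ) 2 ×ℂ Set.Icc (-1 : ℝ) 1) ⊆ {z : ℂ | 1 ≤ z.re} := fun z hz =>
    (Complex.mem_reProdIm.1 hz).1.1
  obtain ⟨C₀, hC₀⟩ := hcpt.exists_bound_of_continuousOn (hφan.continuousOn.mono hsub)
  obtain ⟨C₁, hC₁⟩ := hcpt.exists_bound_of_continuousOn (hφan.deriv.continuousOn.mono hsub)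
  refine ⟨max 1 (max C₀ C₁), le_max_left _ _, fun s hs hs2 ht a ha => ?_⟩
  have hmem : s ∈ (Set.Icc (1 : ℝ) 2 ×ℂ Set.Icc (-1 : ℝ) 1) :=
    Complex.mem_reProdIm.2 ⟨⟨hs.le, hs2⟩, abs_le.mp ht⟩
  interval_cases a
  · rw [zero_add, pow_one, hrel s hs]
    exact (hC₀ s hmem).trans ((le_max_left _ _).trans (le_max_right _ _))
  · rw [hrel' s hs, norm_neg]
    exact (hC₁ s hmem).trans ((le_max_right _ _).trans (le_max_right _ _))

lemma summable_nonprime_vonMangoldt :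
    Summable fun n : ℕ => if n.Prime then 0 else Λ n * (1 + log n) / n := by
  set F : ℕ → ℝ := fun n => if n.Prime then 0 else Λ n * (1 + log n) / n with hF
  have key : Summable (fun pk : Nat.Primes × ℕ => F ((pk.1 : ℕ) ^ (pk.2 + 1))) := by
    have hdom : Summable (fun pk : Nat.Primes × ℕ =>
        72 * ((pk.1 : ℝ) ^ (-(5 / 4) : ℝ) * ((1 / 2 : ℝ) ^ (1 / 4 : ℝ)) ^ pk.2)) := by
      refine Summable.mul_left _ ?_
      refine Summable.mul_of_nonneg (Nat.Primes.summable_rpow.2 (by norm_num)) ?_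
        (fun p => by positivity) (fun k => by positivity)
      exact summable_geometric_of_lt_one (by positivity)
        (rpow_lt_one (by norm_num) (by norm_num) (by norm_num))
    refine hdom.of_nonneg_of_le (fun pk => ?_) fun ⟨p, j⟩ => ?_
    · simp only [hF]
      split_ifs
      · exact le_rfl
      · have : 0 ≤ log ((pk.1 : ℕ) ^ (pk.2 + 1) : ℕ) := log_natCast_nonneg _
        positivity [vonMangoldt_nonneg (n := (pk.1 : ℕ) ^ (pk.2 + 1))]
    · have hp1 : (2 : ℝ) ≤ p := mod_cast p.prop.two_le
      have hp0 : (0 : ℝ) < p := by linarith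
      simp only [hF]
      rcases Nat.eq_zero_or_pos j with rfl | hj
      · simp only [zero_add, pow_one, p.prop, if_true]
        positivity
      have hnp : ¬ ((p : ℕ) ^ (j + 1)).Prime := Nat.Prime.not_prime_pow (by omega)
      rw [if_neg hnp, vonMangoldt_apply_pow (by omega), vonMangoldt_apply_prime p.prop]
      push_cast
      set u : ℝ := (p : ℝ) ^ (j + 1) with hu
      have hu1 : 1 ≤ u := one_le_pow₀ (by linarith)
      have hup : (p : ℝ) ≤ u := le_self_pow₀ (by linarith) (by omega)
      have hu0 : 0 < u := by linarith
      have l1 : log u ≤ 8 * u ^ (1 / 8 : ℝ) := by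
        have := log_le_rpow_div hu0.le (show (0 : ℝ) < 1 / 8 by norm_num)
        linarith
      have l2 : log p ≤ log u := log_le_log hp0 hup
      have l3 : 1 ≤ u ^ (1 / 8 : ℝ) := one_le_rpow hu1 (by norm_num)
      have l4 : log p * (1 + log u) ≤ 72 * u ^ (1 / 4 : ℝ) := by
        have e : u ^ (1 / 4 : ℝ) = u ^ (1 / 8 : ℝ) * u ^ (1 / 8 : ℝ) := by
          rw [← rpow_add hu0]; norm_num
        rw [e]
        calc _ ≤ (8 * u ^ (1 / 8 : ℝ)) * (9 * u ^ (1 / 8 : ℝ)) := by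
              have l5 : 0 ≤ log u := log_nonneg hu1
              have l6 : 1 + log u ≤ 9 * u ^ (1 / 8 : ℝ) := by linarith
              gcongr
              exact l2.trans l1
          _ = _ := by ring
      have e1 : u ^ (1 / 4 : ℝ) / u = (p : ℝ) ^ (-(3 / 4) * (j + 1) : ℝ) := by
        rw [div_eq_mul_inv, ← rpow_neg_one, ← rpow_add hu0, hu, ← rpow_natCast,
          ← rpow_mul hp0.le]
        congr 1
        push_cast
        ring
      have hj1 : (1 : ℝ) ≤ j := mod_cast hj
      calc _ ≤ 72 * u ^ (1 / 4 : ℝ) / u := by gcongr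
        _ = 72 * (p : ℝ) ^ (-(3 / 4) * (j + 1) : ℝ) := by rw [mul_div_assoc, e1]
        _ ≤ 72 * (p : ℝ) ^ (-(5 / 4) + -(1 / 4) * j : ℝ) := by
            gcongr
            · linarith
            · linarith
        _ ≤ _ := by
            have e2 : ((1 / 2 : ℝ) ^ (1 / 4 : ℝ)) ^ j = 2 ^ (-(1 / 4) * j : ℝ) := by
              rw [← rpow_natCast ((1 / 2 : ℝ) ^ (1 / 4 : ℝ)), ← rpow_mul (by norm_num),
                one_div, inv_rpow (by norm_num), ← rpow_neg (by norm_num), neg_mul]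
            rw [rpow_add hp0, e2]
            have e3 := rpow_le_rpow_of_nonpos (by norm_num) hp1
              (show (-(1 / 4) * j : ℝ) ≤ 0 by linarith)
            gcongr
  have e := Nat.Primes.prodNatEquiv.summable_iff (f := fun n : {n : ℕ // IsPrimePow n} => F n)
  have h2 : Summable (fun n : {n : ℕ // IsPrimePow n} => F n) := e.mp key
  refine (Function.Injective.summable_iff (f := F) Subtype.val_injective fun n hn => ?_).mp h2
  simp only [hF]
  have : Λ n = 0 := by
    by_contra h
    exact hn ⟨⟨n, vonMangoldt_ne_zero_iff.1 h⟩, rfl⟩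
  simp [this]

def nonprimeMass : ℝ :=
  ∑' n : ℕ, if n.Prime then 0 else Λ n * (1 + log n) / n

lemma nonprimeMass_nonneg : 0 ≤ nonprimeMass := by
  refine tsum_nonneg fun n => ?_
  split_ifs
  · exact le_rfl
  · have := log_natCast_nonneg n
    positivity [vonMangoldt_nonneg (n := n)]

lemma abscissa_le_one_of_vonMangoldt {c : ℕ → ℂ} {M : ℝ}
    (hc : ∀ n, ‖c n‖ ≤ M * Λ n) :
    abscissaOfAbsConv c ≤ 1 := by
  refine LSeries.abscissaOfAbsConv_le_of_forall_lt_LSeriesSummable fun y hy => ?_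
  have h := (LSeriesSummable_vonMangoldt (s := y) (by simpa using hy)).norm.mul_left M
  refine Summable.of_norm_bounded h fun n => ?_
  rcases eq_or_ne n 0 with rfl | hn
  · simp
  rw [norm_term_eq, norm_term_eq, if_neg hn, if_neg hn, mul_div_assoc']
  gcongr
  have := hc n
  rwa [norm_real, norm_of_nonneg vonMangoldt_nonneg]

lemma norm_LSeries_le_of_sparse {c : ℕ → ℂ} {M : ℝ} (hM : 0 ≤ M)
    (hc : ∀ n, ‖c n‖ ≤ M * Λ n) (T : Finset ℕ)
    (hT : ∀ p : ℕ, p.Prime → p ∉ T → c p = 0) {a : ℕ} (ha : a ≤ 1) {s : ℂ} (hs : 1 < s.re) :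
    ‖LSeries (logMul^[a] c) s‖ ≤ M * (nonprimeMass + 16 * T.card) := by
  set g : ℕ → ℝ := fun n => if n ∈ T then (16 : ℝ) else 0 with hg
  have hgsum : HasSum g (16 * T.card) := by
    have : (16 * T.card : ℝ) = ∑ n ∈ T, g n := by
      rw [sum_congr rfl (g := fun _ => (16 : ℝ)) fun n hn => by simp [hg, hn]]
      simp [mul_comm]
    rw [this]
    exact hasSum_sum_of_ne_finset_zero fun n hn => by simp [hg, hn]
  have htot := (summable_nonprime_vonMangoldt.hasSum.add hgsum).mul_left M
  refine tsum_of_norm_bounded htot fun n => ?_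
  rcases eq_or_ne n 0 with rfl | hn
  · rw [LSeries.term_zero, norm_zero]
    have : 0 ≤ g 0 := by simp only [hg]; split_ifs <;> norm_num
    simp only [Nat.not_prime_zero, if_false, Nat.cast_zero, div_zero, zero_add]
    positivity
  have hn1 : (1 : ℝ) ≤ n := mod_cast Nat.one_le_iff_ne_zero.2 hn
  have hn0 : (0 : ℝ) < n := by linarith
  have hlog : 0 ≤ log n := log_natCast_nonneg n
  have hΛ := vonMangoldt_nonneg (n := n)
  have hterm : ‖LSeries.term (logMul^[a] c) s n‖ ≤ log n ^ a * ‖c n‖ / n := by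
    rw [norm_term_eq, if_neg hn, logMul_iterate, norm_mul, norm_pow, norm_real,
      norm_of_nonneg hlog]
    gcongr
    exact self_le_rpow_of_one_le hn1 hs.le
  refine hterm.trans ?_
  by_cases hp : n.Prime
  · simp only [hp, if_true, zero_add, hg]
    by_cases hnT : n ∈ T
    · rw [if_pos hnT]
      have h1 := hc n
      rw [vonMangoldt_apply_prime hp] at h1
      have h2 : log n ^ (a + 1) ≤ 16 * n := by
        refine (log_pow_le (by omega) hn1).trans ?_
        gcongr
        exact rpow_le_self_of_one_le hn1 (by norm_num)
      rw [div_le_iff₀ hn0]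
      calc log n ^ a * ‖c n‖ ≤ log n ^ a * (M * log n) := by gcongr
        _ = M * log n ^ (a + 1) := by ring
        _ ≤ M * (16 * n) := by gcongr
        _ = _ := by ring
    · simp [hnT, hT n hp hnT]
  · have h0 : 0 ≤ g n := by simp only [hg]; split_ifs <;> norm_num
    simp only [hp, if_false]
    have h3 : log n ^ a ≤ 1 + log n := by
      interval_cases a
      · simp [hlog]
      · simp
    calc _ ≤ (1 + log n) * (M * Λ n) / n := by
          gcongr
          exact hc n
      _ = M * (Λ n * (1 + log n) / n) := by ring
      _ ≤ _ := by
          gcongr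
          linarith

lemma card_primeFactors_le_log {m : ℕ} (hm : m ≠ 0) : (m.primeFactors.card : ℝ) ≤ 2 * log m := by
  have h1 : 2 ^ m.primeFactors.card ≤ m := by
    calc 2 ^ m.primeFactors.card = ∏ p ∈ m.primeFactors, 2 := by simp
      _ ≤ ∏ p ∈ m.primeFactors, p :=
        prod_le_prod' fun p hp => (prime_of_mem_primeFactors hp).two_le
      _ ≤ m := Nat.le_of_dvd (pos_of_ne_zero hm) (prod_primeFactors_dvd m)
  have h2 : (m.primeFactors.card : ℝ) * log 2 ≤ log m := by
    rw [← log_pow]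
    exact log_le_log (by positivity) (mod_cast h1)
  have := log_two_gt_d9
  have h3 : (0 : ℝ) ≤ m.primeFactors.card := by positivity
  nlinarith

lemma exists_charLam_one_bound : ∃ C : ℝ, 1 ≤ C ∧ ∀ m : ℕ, 1 ≤ m → ∀ s : ℂ, 1 < s.re → s.re ≤ 2 →
    |s.im| ≤ 1 → ∀ a ≤ 1,
    ‖charLam (1 : DirichletCharacter ℂ m) a s - 1 / (s - 1) ^ (a + 1)‖ ≤ C * logCond m s := by
  obtain ⟨C, hC1, hC⟩ := exists_zetaLam_bound
  have hN := nonprimeMass_nonneg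
  refine ⟨C + nonprimeMass + 32, by linarith, fun m hm s hs hs2 ht a ha => ?_⟩
  have hB := one_le_logCond hm s
  have hm0 : (1 : ℝ) ≤ m := mod_cast hm
  set c : ℕ → ℂ := fun n => (1 : DirichletCharacter ℂ m) n * Λ n -
    (1 : DirichletCharacter ℂ 1) n * Λ n with hc
  have hdiff : charLam (1 : DirichletCharacter ℂ m) a s - charLam (1 : DirichletCharacter ℂ 1) a s =
      LSeries (logMul^[a] c) s := by
    unfold charLam
    rw [← LSeries_sub (summable_logMul_iterate (abscissa_charLam_le _) a hs)
      (summable_logMul_iterate (abscissa_charLam_le _) a hs)]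
    congr 1
    ext n
    simp only [Pi.sub_apply, logMul_iterate, hc]
    ring
  have hone : ∀ n : ℕ, (1 : DirichletCharacter ℂ 1) n = 1 := fun n =>
    one_apply (isUnit_of_subsingleton _)
  have hbd : ‖LSeries (logMul^[a] c) s‖ ≤ 1 * (nonprimeMass + 16 * m.primeFactors.card) := by
    refine norm_LSeries_le_of_sparse zero_le_one (fun n => ?_) _ (fun p hp hpm => ?_) ha hs
    · simp only [hc, hone]
      rw [← sub_mul, norm_mul, norm_real,
        norm_of_nonneg vonMangoldt_nonneg]
      gcongr
      by_cases h : IsUnit (n : ZMod m)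
      · simp [one_apply h]
      · simp [MulChar.map_nonunit _ h]
    · have : IsUnit (p : ZMod m) := by
        rw [ZMod.isUnit_iff_coprime, Nat.Prime.coprime_iff_not_dvd hp]
        exact fun h => hpm (mem_primeFactors.2 ⟨hp, h, by omega⟩)
      simp only [hc, hone, one_apply this, sub_self]
  have hlog : log m ≤ logCond m s := by
    unfold logCond
    apply log_le_log (by linarith)
    nlinarith [abs_nonneg s.im]
  have hcard := card_primeFactors_le_log (m := m) (by omega)
  calc _ = ‖(charLam (1 : DirichletCharacter ℂ 1) a s - 1 / (s - 1) ^ (a + 1)) +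
        LSeries (logMul^[a] c) s‖ := by rw [← hdiff]; congr 1; ring
    _ ≤ C + 1 * (nonprimeMass + 16 * m.primeFactors.card) :=
        (norm_add_le _ _).trans (add_le_add (hC s hs hs2 ht a ha) hbd)
    _ ≤ _ := by nlinarith

lemma exists_charLam_trivial_bound : ∃ C : ℝ, 1 ≤ C ∧ ∀ (c : ℕ → ℂ) (M : ℝ), 0 ≤ M →
    (∀ n, ‖c n‖ ≤ M * Λ n) → ∀ s : ℂ, 1 < s.re → s.re ≤ 2 → ∀ a ≤ 1,
    ‖LSeries (logMul^[a] c) s‖ ≤ M * (C / (s.re - 1) ^ (a + 1)) := by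
  obtain ⟨C, hC1, hC⟩ := exists_zetaLam_bound
  refine ⟨C + 1, by linarith, fun c M hM hc s hs hs2 a ha => ?_⟩
  have h1 := hC s.re (by simpa using hs) (by simpa using hs2) (by simp) a ha
  have hx : 0 < s.re - 1 := by linarith
  have hone : ∀ n : ℕ, (1 : DirichletCharacter ℂ 1) n = 1 := fun n =>
    one_apply (isUnit_of_subsingleton _)
  have hsum : Summable fun n => ‖LSeries.term (logMul^[a] fun n => (1 : DirichletCharacter ℂ 1) n *
      (Λ n : ℂ)) s n‖ :=
    (summable_logMul_iterate (abscissa_charLam_le _) a hs).norm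
  have hreal : ((∑' n, ‖LSeries.term (logMul^[a] fun n => (1 : DirichletCharacter ℂ 1) n *
      (Λ n : ℂ)) s n‖ : ℝ) : ℂ) =
      charLam (1 : DirichletCharacter ℂ 1) a s.re := by
    rw [charLam, LSeries, ofReal_tsum]
    congr 1
    ext n
    rcases eq_or_ne n 0 with rfl | hn
    · simp
    rw [norm_term_eq, if_neg hn, term_of_ne_zero hn, logMul_iterate, hone, one_mul,
      norm_mul, norm_pow, norm_real, norm_real,
      norm_of_nonneg vonMangoldt_nonneg,
      norm_of_nonneg (log_natCast_nonneg n), ofReal_div,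
      ofReal_cpow (Nat.cast_nonneg n)]
    push_cast
    ring
  have h2 : ∑' n, ‖LSeries.term (logMul^[a] fun n => (1 : DirichletCharacter ℂ 1) n *
      (Λ n : ℂ)) s n‖ ≤ C + 1 / (s.re - 1) ^ (a + 1) := by
    have h3 : ‖charLam (1 : DirichletCharacter ℂ 1) a s.re‖ ≤
        C + ‖1 / ((s.re : ℂ) - 1) ^ (a + 1)‖ := by
      have := norm_sub_norm_le (charLam (1 : DirichletCharacter ℂ 1) a s.re)
        (1 / ((s.re : ℂ) - 1) ^ (a + 1))
      linarith
    rw [← hreal, norm_real] at h3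
    refine (le_abs_self _).trans (h3.trans_eq ?_)
    rw [norm_div, norm_one, norm_pow, ← ofReal_one, ← ofReal_sub, norm_real,
      norm_of_nonneg hx.le]
  refine (tsum_of_norm_bounded (hsum.hasSum.mul_left M) fun n => ?_).trans ?_
  · rcases eq_or_ne n 0 with rfl | hn
    · simp
    rw [norm_term_eq, norm_term_eq, if_neg hn, if_neg hn, logMul_iterate,
      logMul_iterate, norm_mul, norm_mul, hone, one_mul, norm_real (Λ n),
      norm_of_nonneg vonMangoldt_nonneg, ← mul_div_assoc, mul_left_comm]
    gcongr
    exact hc n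
  · gcongr
    refine h2.trans ?_
    have h4 : 1 ≤ 1 / (s.re - 1) ^ (a + 1) := by
      rw [le_div_iff₀ (by positivity), one_mul]
      exact pow_le_one₀ hx.le (by linarith)
    rw [add_div, div_eq_mul_one_div C]
    nlinarith

lemma abs_sum_mul_antitone_le {c b : ℕ → ℝ} {M : ℝ} (hb : Antitone b) (hb0 : ∀ n, 0 ≤ b n)
    (hc : ∀ n, |∑ i ∈ range n, c i| ≤ M) (n : ℕ) :
    |∑ i ∈ range n, c i * b i| ≤ M * b 0 := by
  have key : ∀ n, |∑ i ∈ range n, c i * b i - (∑ i ∈ range n, c i) * b n| ≤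
      M * (b 0 - b n) := by
    intro n
    induction n with
    | zero => simp
    | succ n ih =>
      have e : ∑ i ∈ range (n + 1), c i * b i - (∑ i ∈ range (n + 1), c i) * b (n + 1) =
          (∑ i ∈ range n, c i * b i - (∑ i ∈ range n, c i) * b n) +
            (∑ i ∈ range (n + 1), c i) * (b n - b (n + 1)) := by
        rw [sum_range_succ, sum_range_succ]; ring
      rw [e]
      refine (abs_add_le _ _).trans ?_
      rw [abs_mul, abs_of_nonneg (sub_nonneg.2 (hb n.le_succ))]
      have := mul_le_mul_of_nonneg_right (hc (n + 1)) (sub_nonneg.2 (hb n.le_succ))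
      linarith
  have h1 := key n
  have h2 := mul_le_mul_of_nonneg_right (hc n) (hb0 n)
  have h3 : |(∑ i ∈ range n, c i) * b n| ≤ M * b n := by
    rwa [abs_mul, abs_of_nonneg (hb0 n)]
  calc |∑ i ∈ range n, c i * b i|
      = |(∑ i ∈ range n, c i * b i - (∑ i ∈ range n, c i) * b n) +
          (∑ i ∈ range n, c i) * b n| := by congr 1; ring
    _ ≤ M * (b 0 - b n) + M * b n := (abs_add_le _ _).trans (add_le_add h1 h3)
    _ = _ := by ring

lemma mul_pow_le_geom {y : ℝ} (hy : 0 ≤ y) (n : ℕ) :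
    n * y ^ n ≤ y * ∑ i ∈ range n, (y ^ 2) ^ i := by
  induction n using Nat.twoStepInduction with
  | zero => simp
  | one => simp
  | more n ih _ =>
    rw [sum_range_succ, sum_range_succ', sum_congr rfl fun i _ => pow_succ (y ^ 2) i,
      ← sum_mul]
    push_cast
    have h2 : 0 ≤ y * (y ^ (n + 1) - 1) ^ 2 := by positivity
    have h3 := mul_le_mul_of_nonneg_right ih (sq_nonneg y)
    have e : (y ^ 2) ^ (n + 1) = (y ^ (n + 1)) ^ 2 := by ring
    have e2 : y ^ (n + 2) = y ^ (n + 1) * y := by ring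
    have e3 : y ^ (n + 2) = y ^ n * y ^ 2 := by ring
    rw [e]
    have e4 : (n + 2 : ℝ) * y ^ (n + 2) = n * y ^ n * y ^ 2 + 2 * (y ^ (n + 1) * y) := by
      rw [← e2]; rw [e3]; ring
    rw [e4]
    nlinarith

def lambertWeight (y : ℝ) (n : ℕ) : ℝ :=
  1 / (n + 1) - (y ^ 2) ^ (n + 1) / ∑ i ∈ range (n + 1), (y ^ 2) ^ i

lemma geom_pos {y : ℝ} (hy : 0 < y) (n : ℕ) : 0 < ∑ i ∈ range (n + 1), (y ^ 2) ^ i :=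
  sum_pos (fun i _ => by positivity) ⟨0, by simp⟩

lemma antitone_lambertWeight {y : ℝ} (hy : 0 < y) (hy1 : y ≤ 1) : Antitone (lambertWeight y) := by
  refine antitone_nat_of_succ_le fun n => ?_
  have g1 := geom_pos hy n
  have g2 := geom_pos hy (n + 1)
  have a1 := mul_pow_le_geom hy.le (n + 1)
  have a2 := mul_pow_le_geom hy.le (n + 1 + 1)
  have e : ∑ i ∈ range (n + 1 + 1), (y ^ 2) ^ i =
      y ^ 2 * ∑ i ∈ range (n + 1), (y ^ 2) ^ i + 1 := by
    rw [sum_range_succ', mul_sum]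
    simp only [pow_succ, pow_zero]
    congr 1
    exact sum_congr rfl fun i _ => by ring
  unfold lambertWeight
  push_cast at a1 a2 ⊢
  set G := ∑ i ∈ range (n + 1), (y ^ 2) ^ i
  set G' := ∑ i ∈ range (n + 1 + 1), (y ^ 2) ^ i
  have hn : (0 : ℝ) < n + 1 := by positivity
  have hn2 : (0 : ℝ) < n + 1 + 1 := by positivity
  have e1 : (y ^ 2) ^ (n + 1) / G - (y ^ 2) ^ (n + 1 + 1) / G' = (y ^ 2) ^ (n + 1) / (G * G') := by
    rw [div_sub_div _ _ g1.ne' g2.ne']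
    congr 1
    rw [e]; ring
  have e2 : 1 / ((n : ℝ) + 1) - 1 / (n + 1 + 1) = 1 / ((n + 1) * (n + 1 + 1)) := by
    field_simp; ring
  have key : (y ^ 2) ^ (n + 1) / (G * G') ≤ 1 / (((n : ℝ) + 1) * (n + 1 + 1)) := by
    rw [div_le_div_iff₀ (by positivity) (by positivity)]
    have m1 := mul_le_mul a1 a2 (by positivity) (by positivity)
    have e3 : ((n : ℝ) + 1) * y ^ (n + 1) * ((n + 1 + 1) * y ^ (n + 1 + 1)) =
        y * ((y ^ 2) ^ (n + 1) * ((n + 1) * (n + 1 + 1))) := by ring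
    rw [e3] at m1
    have m2 : (y ^ 2) ^ (n + 1) * ((n + 1) * (n + 1 + 1)) ≤ y * (G * G') := by
      refine le_of_mul_le_mul_left (m1.trans_eq ?_) hy
      ring
    refine m2.trans ?_
    have : 0 ≤ G * G' := by positivity
    nlinarith
  linarith

lemma lambertWeight_zero (y : ℝ) : lambertWeight y 0 = 1 - y ^ 2 := by
  simp [lambertWeight]

lemma lambertWeight_nonneg {y : ℝ} (hy : 0 < y) (hy1 : y ≤ 1) (n : ℕ) : 0 ≤ lambertWeight y n := by
  have g1 := geom_pos hy n
  unfold lambertWeight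
  rw [sub_nonneg, div_le_div_iff₀ g1 (by positivity), one_mul]
  have : ∑ i ∈ range (n + 1), (y ^ 2) ^ (n + 1) ≤ ∑ i ∈ range (n + 1), (y ^ 2) ^ i := by
    refine sum_le_sum fun i hi => pow_le_pow_of_le_one (by positivity) ?_ ?_
    · exact pow_le_one₀ hy.le hy1
    · exact (mem_range.1 hi).le
  simp only [sum_const, card_range, nsmul_eq_mul] at this
  push_cast at this
  linarith

lemma sum_divisors_mul_pow_eq (c : ℕ → ℝ) (x : ℝ) (N : ℕ) :
    ∑ n ∈ Icc 1 N, (∑ d ∈ n.divisors, c d) * x ^ n =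
      ∑ d ∈ Icc 1 N, c d * ∑ e ∈ range (N / d), (x ^ d) ^ (e + 1) := by
  simp only [sum_mul, mul_sum]
  rw [sum_sigma', sum_sigma']
  refine sum_bij' (fun p _ => ⟨p.2, p.1 / p.2 - 1⟩) (fun p _ => ⟨p.1 * (p.2 + 1), p.1⟩)
    ?_ ?_ ?_ ?_ ?_
  · rintro ⟨n, d⟩ h
    simp only [mem_sigma, mem_Icc, Nat.mem_divisors, mem_range] at h ⊢
    obtain ⟨⟨h1, h2⟩, ⟨k, rfl⟩, h4⟩ := h
    obtain ⟨hd, hk⟩ := CanonicallyOrderedAdd.mul_pos.1 (pos_of_ne_zero h4)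
    rw [Nat.mul_div_cancel_left _ hd]
    refine ⟨⟨hd, (Nat.le_mul_of_pos_right d hk).trans h2⟩, ?_⟩
    have : k ≤ N / d := (Nat.le_div_iff_mul_le hd).mpr (by rwa [mul_comm])
    omega
  · rintro ⟨d, e⟩ h
    simp only [mem_sigma, mem_Icc, Nat.mem_divisors, mem_range] at h ⊢
    have h3 : e + 1 ≤ N / d := h.2
    rw [Nat.le_div_iff_mul_le h.1.1, mul_comm] at h3
    have h4 : 0 < d * (e + 1) := Nat.mul_pos h.1.1 e.succ_pos
    exact ⟨⟨h4, h3⟩, ⟨_, rfl⟩, h4.ne'⟩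
  · rintro ⟨n, d⟩ h
    simp only [mem_sigma, mem_Icc, Nat.mem_divisors] at h
    obtain ⟨⟨h1, h2⟩, ⟨k, rfl⟩, h4⟩ := h
    obtain ⟨hd, hk⟩ := CanonicallyOrderedAdd.mul_pos.1 (pos_of_ne_zero h4)
    simp only [Nat.mul_div_cancel_left _ hd, Nat.sub_add_cancel hk]
  · rintro ⟨d, e⟩ h
    simp only [mem_sigma, mem_Icc] at h
    simp only [Nat.mul_div_cancel_left _ h.1.1, Nat.add_sub_cancel]
  · rintro ⟨n, d⟩ h
    simp only [mem_sigma, mem_Icc, Nat.mem_divisors] at h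
    obtain ⟨⟨h1, h2⟩, ⟨k, rfl⟩, h4⟩ := h
    obtain ⟨hd, hk⟩ := CanonicallyOrderedAdd.mul_pos.1 (pos_of_ne_zero h4)
    simp only [Nat.mul_div_cancel_left _ hd, Nat.sub_add_cancel hk, pow_mul]

lemma sum_div_lower {c : ℕ → ℝ} {M : ℝ} (hc1 : ∀ n, |c n| ≤ 1)
    (hc : ∀ n, |∑ i ∈ range n, c (i + 1)| ≤ M)
    (hr : ∀ n, 0 ≤ ∑ d ∈ Nat.divisors n, c d)
    (hsq : ∀ j, 1 ≤ j → 1 ≤ ∑ d ∈ (j ^ 2).divisors, c d)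
    {y : ℝ} (hy : 0 < y) (hy1 : y < 1) (J N : ℕ) (hN : J ^ 2 ≤ N) :
    (1 - y ^ 2) * (J * (y ^ 2) ^ (J ^ 2) - M) - N * (y ^ 2) ^ N ≤
      ∑ i ∈ range N, c (i + 1) / (i + 1) := by
  set x := y ^ 2 with hx
  have hx0 : 0 < x := by positivity
  have hx1 : x < 1 := by rw [hx]; nlinarith
  have h1 := abs_sum_mul_antitone_le (antitone_lambertWeight hy hy1.le)
    (lambertWeight_nonneg hy hy1.le) hc N
  rw [lambertWeight_zero] at h1
  have e1 : ∑ i ∈ range N, c (i + 1) * lambertWeight y i =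
      ∑ i ∈ range N, c (i + 1) / (i + 1) -
        (1 - x) * ∑ d ∈ Icc 1 N, c d * (x ^ d / (1 - x ^ d)) := by
    have e2 : ∑ d ∈ Icc 1 N, c d * (x ^ d / (1 - x ^ d)) =
        ∑ i ∈ range N, c (i + 1) * (x ^ (i + 1) / (1 - x ^ (i + 1))) := by
      rw [range_eq_Ico, sum_Ico_add' (fun d => c d * (x ^ d / (1 - x ^ d))) 0 N 1]
      rfl
    rw [e2, mul_sum, ← sum_sub_distrib]
    refine sum_congr rfl fun i _ => ?_
    have hxi : x ^ (i + 1) < 1 := pow_lt_one₀ hx0.le hx1 (by omega)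
    unfold lambertWeight
    rw [← hx, geom_sum_eq hx1.ne, ← neg_sub 1 x, ← neg_sub 1 (x ^ (i + 1)), neg_div_neg_eq]
    have n1 : 1 - x ≠ 0 := by linarith
    have n2 : 1 - x ^ (i + 1) ≠ 0 := by linarith
    field_simp
  have low : (J : ℝ) * x ^ (J ^ 2) ≤ ∑ n ∈ Icc 1 N, (∑ d ∈ n.divisors, c d) * x ^ n := by
    have hinj : Set.InjOn (fun j : ℕ => j ^ 2) (Icc 1 J : Finset ℕ) := fun a _ b _ h =>
      Nat.pow_left_injective (n := 2) (by norm_num) h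
    calc (J : ℝ) * x ^ (J ^ 2) = ∑ j ∈ Icc 1 J, x ^ (J ^ 2) := by simp
      _ ≤ ∑ j ∈ Icc 1 J, (∑ d ∈ (j ^ 2).divisors, c d) * x ^ (j ^ 2) := by
        refine sum_le_sum fun j hj => ?_
        have hj' := mem_Icc.1 hj
        have h3 : x ^ (J ^ 2) ≤ x ^ (j ^ 2) :=
          pow_le_pow_of_le_one hx0.le hx1.le (Nat.pow_le_pow_left hj'.2 2)
        have h4 := hsq j hj'.1
        have : 0 < x ^ (j ^ 2) := by positivity
        nlinarith
      _ = ∑ n ∈ (Icc 1 J).image (fun j => j ^ 2), (∑ d ∈ n.divisors, c d) * x ^ n := by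
        rw [sum_image hinj]
      _ ≤ _ := by
        refine sum_le_sum_of_subset_of_nonneg ?_ fun n _ _ => mul_nonneg (hr n) (by positivity)
        intro n hn
        obtain ⟨j, hj, rfl⟩ := mem_image.1 hn
        have hj' := mem_Icc.1 hj
        exact mem_Icc.2 ⟨Nat.one_le_pow _ _ hj'.1, (Nat.pow_le_pow_left hj'.2 2).trans hN⟩
  rw [sum_divisors_mul_pow_eq] at low
  have hdiff : ∀ d ∈ Icc 1 N, (1 - x) * |c d * (x ^ d / (1 - x ^ d)) -
      c d * ∑ e ∈ range (N / d), (x ^ d) ^ (e + 1)| ≤ x ^ N := by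
    intro d hd
    have hd' := mem_Icc.1 hd
    have hxd : x ^ d < 1 := pow_lt_one₀ hx0.le hx1 (by omega)
    have hxd1 : x ^ d ≤ x := pow_le_of_le_one hx0.le hx1.le (by omega)
    have hxd0 : 0 < x ^ d := by positivity
    have g : ∑ e ∈ range (N / d), (x ^ d) ^ (e + 1) =
        x ^ d / (1 - x ^ d) - (x ^ d) ^ (N / d + 1) / (1 - x ^ d) := by
      have : ∑ e ∈ range (N / d), (x ^ d) ^ (e + 1) =
          (∑ e ∈ range (N / d), (x ^ d) ^ e) * x ^ d := by
        rw [sum_mul]; exact sum_congr rfl fun e _ => pow_succ _ _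
      rw [this, geom_sum_eq hxd.ne, ← sub_div, pow_succ, ← neg_sub 1 (x ^ d),
        ← neg_sub 1 ((x ^ d) ^ _), neg_div_neg_eq]
      ring
    have hnn : 0 ≤ (x ^ d) ^ (N / d + 1) / (1 - x ^ d) :=
      div_nonneg (by positivity) (by linarith)
    rw [g, ← mul_sub, sub_sub_cancel, abs_mul, abs_of_nonneg hnn]
    have hpow : (x ^ d) ^ (N / d + 1) ≤ x ^ N := by
      rw [← pow_mul]
      apply pow_le_pow_of_le_one hx0.le hx1.le
      exact (Nat.lt_mul_div_succ N (by omega)).le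
    have h5 : (1 - x) * ((x ^ d) ^ (N / d + 1) / (1 - x ^ d)) ≤ x ^ N := by
      rw [mul_div_assoc', div_le_iff₀ (by linarith)]
      have : 0 < x ^ N := by positivity
      nlinarith
    have h6 : 0 ≤ (1 - x) * ((x ^ d) ^ (N / d + 1) / (1 - x ^ d)) :=
      mul_nonneg (by linarith) hnn
    calc (1 - x) * (|c d| * ((x ^ d) ^ (N / d + 1) / (1 - x ^ d)))
        = |c d| * ((1 - x) * ((x ^ d) ^ (N / d + 1) / (1 - x ^ d))) := by ring
      _ ≤ 1 * ((1 - x) * ((x ^ d) ^ (N / d + 1) / (1 - x ^ d))) :=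
        mul_le_mul_of_nonneg_right (hc1 d) h6
      _ ≤ x ^ N := by rwa [one_mul]
  have hsum : (1 - x) * |∑ d ∈ Icc 1 N, c d * (x ^ d / (1 - x ^ d)) -
      ∑ d ∈ Icc 1 N, c d * ∑ e ∈ range (N / d), (x ^ d) ^ (e + 1)| ≤ N * x ^ N := by
    rw [← sum_sub_distrib]
    refine (mul_le_mul_of_nonneg_left (abs_sum_le_sum_abs _ _) (by linarith)).trans ?_
    rw [mul_sum]
    refine (sum_le_sum hdiff).trans ?_
    simp
  rw [e1] at h1
  have h1' := (abs_le.mp h1).1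
  have hs' := neg_abs_le (∑ d ∈ Icc 1 N, c d * (x ^ d / (1 - x ^ d)) -
      ∑ d ∈ Icc 1 N, c d * ∑ e ∈ range (N / d), (x ^ d) ^ (e + 1))
  have hs2 := mul_le_mul_of_nonneg_left hs' (show 0 ≤ 1 - x by linarith)
  have hl2 := mul_le_mul_of_nonneg_left low (show 0 ≤ 1 - x by linarith)
  nlinarith

lemma quadratic_apply {m : ℕ} {χ : DirichletCharacter ℂ m} (hχ : χ ^ 2 = 1) (x : ZMod m) :
    χ x = ((χ x).re : ℂ) ∧ ((χ x).re = 0 ∨ (χ x).re = 1 ∨ (χ x).re = -1) := by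
  rcases MulChar.isQuadratic_iff_sq_eq_one.2 hχ x with h | h | h <;> simp [h]

lemma zetaMul_eq_sum {m : ℕ} {χ : DirichletCharacter ℂ m} (hχ : χ ^ 2 = 1) (n : ℕ) :
    χ.zetaMul n = ((∑ d ∈ n.divisors, (χ (d : ZMod m)).re : ℝ) : ℂ) := by
  rw [DirichletCharacter.zetaMul, coe_zeta_mul_apply, Complex.ofReal_sum]
  refine sum_congr rfl fun d hd => ?_
  have : d ≠ 0 := (Nat.pos_of_mem_divisors hd).ne'
  rw [toArithmeticFunction, coe_mk, if_neg this]
  exact (quadratic_apply hχ _).1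

open scoped ComplexOrder in
lemma sum_divisors_quadratic_nonneg {m : ℕ} {χ : DirichletCharacter ℂ m} (hχ : χ ^ 2 = 1) (n : ℕ) :
    0 ≤ ∑ d ∈ n.divisors, (χ (d : ZMod m)).re := by
  have h := DirichletCharacter.zetaMul_nonneg hχ n
  rw [zetaMul_eq_sum hχ] at h
  exact_mod_cast h

lemma one_le_sum_divisors_quadratic_sq {m : ℕ} {χ : DirichletCharacter ℂ m} (hχ : χ ^ 2 = 1)
    (j : ℕ) (hj : 1 ≤ j) : 1 ≤ ∑ d ∈ (j ^ 2).divisors, (χ (d : ZMod m)).re := by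
  induction j using Nat.recOnPosPrimePosCoprime with
  | zero => omega
  | one => simp
  | prime_pow p n hp hn =>
    rw [← pow_mul, Nat.sum_divisors_prime_pow hp]
    have e : ∀ i, (χ ((p ^ i : ℕ) : ZMod m)).re = (χ (p : ZMod m)).re ^ i := by
      intro i
      rw [Nat.cast_pow, map_pow, (quadratic_apply hχ p).1, ← ofReal_pow, ofReal_re,
        ofReal_re]
    simp only [e]
    rcases (quadratic_apply hχ (p : ZMod m)).2 with h | h | h
    · rw [h, sum_range_succ', pow_zero]
      simp
    · rw [h]; simp
    · rw [h, neg_one_geom_sum, if_neg]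
      simp [Nat.even_add_one]
  | coprime a b ha hb hab iha ihb =>
    have h1 := iha (by omega)
    have h2 := ihb (by omega)
    have h3 := χ.isMultiplicative_zetaMul.map_mul_of_coprime
      (Nat.Coprime.pow 2 2 hab)
    rw [zetaMul_eq_sum hχ, zetaMul_eq_sum hχ, zetaMul_eq_sum hχ, ← ofReal_mul,
      Complex.ofReal_inj, ← mul_pow] at h3
    rw [h3]
    nlinarith

lemma norm_LFunction_one_sub_le {m : ℕ} [NeZero m] {χ : DirichletCharacter ℂ m} (hχ : χ ≠ 1)
    (N : ℕ) :
    ‖χ.LFunction 1 - ∑ i ∈ range N, χ ((i + 1 : ℕ) : ZMod m) / ((i + 1 : ℕ) : ℂ)‖ ≤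
      480 * m * ((N + 1 : ℕ) : ℝ) ^ (-(1 / 2) : ℝ) := by
  have hsum : ∀ M, ‖∑ i ∈ range M, (χ (i : ZMod m) : ℂ)‖ ≤ m :=
    norm_sum_range_periodic_le (sum_eq_zero_of_ne_one hχ)
      (norm_le_one χ)
  have hσ : ∀ s : ℂ, 1 < s.re → ‖s‖ ≤ 2 →
      ‖χ.LFunction s - ∑ n ∈ Ico 1 (N + 1), χ (n : ZMod m) * logCpow 0 s n‖ ≤
      480 * m * ((N + 1 : ℕ) : ℝ) ^ (-(1 / 2) : ℝ) := by
    intro s hs hs2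
    rw [LFunction_eq_LSeries χ hs]
    have hS : LSeriesSummable (fun n => χ n) s :=
      summable_logMul_iterate (abscissa_char_le χ) 0 hs
    refine le_of_tendsto ((hS.hasSum.tendsto_sum_nat.sub_const _).norm)
      (eventually_atTop.2 ⟨N + 1, fun M hM => ?_⟩)
    have e : ∑ n ∈ range M, LSeries.term (fun n => χ n) s n =
        ∑ n ∈ Ico 1 (N + 1), χ n * logCpow 0 s n +
        ∑ n ∈ Ico (N + 1) M, χ n * logCpow 0 s n := by
      rw [sum_Ico_consecutive _ (by omega) hM, range_eq_Ico,
        sum_eq_sum_Ico_succ_bot (by omega), LSeries.term_zero, zero_add]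
      exact sum_congr rfl fun n hn =>
        term_logMul_iterate (fun n => χ n) 0 s (by have := mem_Ico.1 hn; omega)
    rw [e, add_sub_cancel_left]
    refine (norm_sum_Ico_mul_logCpow_le hsum (by norm_num) hs.le (by omega) hM).trans ?_
    have : (0 : ℝ) ≤ m * ((N + 1 : ℕ) : ℝ) ^ (-(1 / 2) : ℝ) := by positivity
    nlinarith
  have hcont : ContinuousAt (fun s : ℂ => ‖χ.LFunction s -
      ∑ n ∈ Ico 1 (N + 1), χ (n : ZMod m) * logCpow 0 s n‖) 1 := by
    refine ((DirichletCharacter.differentiable_LFunction hχ).continuous.continuousAt.sub ?_).norm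
    refine tendsto_finsetSum _ fun n hn => ?_
    have hn0 : (n : ℂ) ≠ 0 := by
      have := mem_Ico.1 hn
      exact_mod_cast (by omega : n ≠ 0)
    have : ContinuousAt (fun s : ℂ => χ (n : ZMod m) * logCpow 0 s n) 1 := by
      unfold logCpow
      simp only [pow_zero, one_mul, ofReal_natCast]
      exact continuousAt_const.mul
        ((continuousAt_const_cpow hn0).comp (x := (1 : ℂ)) continuousAt_neg)
    exact this
  have hseq : Tendsto (fun j : ℕ => (1 + 1 / ((j : ℂ) + 1))) atTop (𝓝 1) := by
    have := (tendsto_one_div_add_atTop_nhds_zero_nat (𝕜 := ℂ)).const_add 1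
    simpa using this
  have hlim := (hcont.tendsto.comp hseq)
  have := le_of_tendsto hlim (.of_forall fun j => by
    have e : (1 + 1 / ((j : ℂ) + 1)) = ((1 + 1 / ((j : ℝ) + 1) : ℝ) : ℂ) := by push_cast; rfl
    have hp : 0 < 1 / ((j : ℝ) + 1) := by positivity
    have hp1 : 1 / ((j : ℝ) + 1) ≤ 1 := by
      rw [div_le_one (by positivity)]; linarith [(Nat.cast_nonneg j : (0 : ℝ) ≤ j)]
    refine hσ _ ?_ ?_ <;> beta_reduce
    · rw [e, ofReal_re]; linarith
    · rw [e, norm_real, norm_of_nonneg (by linarith)]; linarith)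
  refine le_trans (le_of_eq ?_) this
  rw [range_eq_Ico, sum_Ico_add' (fun n : ℕ => χ (n : ZMod m) / (n : ℂ)) 0 N 1, zero_add]
  congr 2
  refine sum_congr rfl fun n _ => ?_
  simp [logCpow, Complex.cpow_neg_one, div_eq_mul_inv]

lemma LFunction_one_lower {m : ℕ} [NeZero m] {χ : DirichletCharacter ℂ m} (hχ : χ ≠ 1)
    (hχ2 : χ ^ 2 = 1) : 1 / (32 * m) ≤ ‖χ.LFunction 1‖ := by
  have hm' : (1 : ℝ) ≤ m := mod_cast Nat.one_le_iff_ne_zero.2 (NeZero.ne m)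
  set c : ℕ → ℝ := fun n => (χ (n : ZMod m)).re with hc
  have hc1 : ∀ n, |c n| ≤ 1 := fun n =>
    (abs_re_le_norm _).trans (norm_le_one χ _)
  have hcs : ∀ n, |∑ i ∈ range n, c (i + 1)| ≤ m := by
    intro n
    have h := norm_sum_range_periodic_le (f := fun x => χ (x + 1))
      (((Equiv.addRight (1 : ZMod m)).bijective.sum_comp (fun x => χ x)).trans
        (sum_eq_zero_of_ne_one hχ))
      (fun x => norm_le_one χ _) n
    refine le_trans ?_ h
    refine le_trans (le_of_eq ?_) (abs_re_le_norm _)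
    rw [re_sum]
    simp [c]
  set J : ℕ := 4 * m
  set x : ℝ := 1 - 1 / (2 * (J : ℝ) ^ 2) with hx
  have hJ : (J : ℝ) = 4 * m := by simp [J]
  have hJ1 : (4 : ℝ) ≤ J := by rw [hJ]; linarith
  have hJi : 1 / (2 * (J : ℝ) ^ 2) ≤ 1 / 2 := by
    apply one_div_le_one_div_of_le <;> nlinarith
  have hJp : 0 < 1 / (2 * (J : ℝ) ^ 2) := by positivity
  have hx0 : 0 < x := by linarith
  have hx1 : x < 1 := by linarith
  have hxp : 1 / 2 ≤ x ^ (J ^ 2) := by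
    have h := one_add_mul_le_pow (a := -(1 / (2 * (J : ℝ) ^ 2))) (by linarith) (J ^ 2)
    have e : 1 + ((J ^ 2 : ℕ) : ℝ) * -(1 / (2 * (J : ℝ) ^ 2)) = 1 / 2 := by
      push_cast; field_simp; norm_num
    rw [e] at h
    simpa [hx, sub_eq_add_neg] using h
  have hmain : ∀ N, J ^ 2 ≤ N → 1 / (32 * (m : ℝ)) - N * x ^ N ≤
      (∑ i ∈ range N, χ ((i + 1 : ℕ) : ZMod m) / ((i + 1 : ℕ) : ℂ)).re := by
    intro N hN
    have h := sum_div_lower hc1 hcs (sum_divisors_quadratic_nonneg hχ2)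
      (one_le_sum_divisors_quadratic_sq hχ2) (y := √x) (sqrt_pos.2 hx0)
      (by rw [sqrt_lt' one_pos]; simpa using hx1) J N hN
    rw [sq_sqrt hx0.le] at h
    have e2 : (∑ i ∈ range N, χ ((i + 1 : ℕ) : ZMod m) / ((i + 1 : ℕ) : ℂ)).re =
        ∑ i ∈ range N, c (i + 1) / ((i : ℝ) + 1) := by
      rw [re_sum]
      refine sum_congr rfl fun i _ => ?_
      rw [Complex.div_natCast_re]
      push_cast; simp [c]
    rw [e2]
    refine le_trans ?_ h
    have h1x : 1 - x = 1 / (2 * (J : ℝ) ^ 2) := by rw [hx]; ring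
    have h3 : (m : ℝ) ≤ J * x ^ (J ^ 2) - m := by
      have : (J : ℝ) * (1 / 2) ≤ J * x ^ (J ^ 2) := by gcongr
      linarith
    have h4 : (1 - x) * m ≤ (1 - x) * (J * x ^ (J ^ 2) - m) :=
      mul_le_mul_of_nonneg_left h3 (by linarith)
    have h5 : (1 - x) * m = 1 / (32 * (m : ℝ)) := by
      rw [h1x, hJ]; field_simp; norm_num
    linarith
  have hlim1 : Tendsto (fun N : ℕ => (∑ i ∈ range N,
      χ ((i + 1 : ℕ) : ZMod m) / ((i + 1 : ℕ) : ℂ))) atTop (𝓝 (χ.LFunction 1)) := by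
    rw [tendsto_iff_norm_sub_tendsto_zero]
    refine squeeze_zero (g := fun N : ℕ => 480 * m * ((N + 1 : ℕ) : ℝ) ^ (-(1 / 2) : ℝ))
      (fun _ => norm_nonneg _)
      (fun N => by rw [norm_sub_rev]; exact norm_LFunction_one_sub_le hχ N) ?_
    have h0 : Tendsto (fun N : ℕ => ((N + 1 : ℕ) : ℝ) ^ (-(1 / 2) : ℝ)) atTop (𝓝 0) :=
      (tendsto_rpow_neg_atTop (by norm_num : (0 : ℝ) < 1 / 2)).comp
        (tendsto_natCast_atTop_atTop.comp (tendsto_add_atTop_nat 1))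
    simpa using h0.const_mul (480 * (m : ℝ))
  have hlim2 : Tendsto (fun N : ℕ => 1 / (32 * (m : ℝ)) - N * x ^ N) atTop (𝓝 (1 / (32 * m) - 0)) :=
    (tendsto_self_mul_const_pow_of_lt_one hx0.le hx1).const_sub _
  rw [sub_zero] at hlim2
  have hlim1' := (continuous_re.tendsto _).comp hlim1
  have := le_of_tendsto_of_tendsto hlim2 hlim1'
    (eventually_atTop.2 ⟨J ^ 2, fun N hN => hmain N hN⟩)
  exact this.trans (re_le_norm _)

lemma logCond_le_of_abs_im_le {m : ℕ} (hm : 1 ≤ m) {s : ℂ} (hs : |s.im| ≤ 1) :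
    logCond m s ≤ log (4 * m) := by
  have hm' : (1 : ℝ) ≤ m := mod_cast hm
  exact log_le_log (by positivity) (by nlinarith)

lemma one_le_log_four_mul {m : ℕ} (hm : 1 ≤ m) : 1 ≤ log (4 * m) := by
  have hm' : (1 : ℝ) ≤ m := mod_cast hm
  rw [le_log_iff_exp_le (by positivity)]
  have h1 := exp_one_lt_three
  linarith

lemma norm_charL_zero_sub_LFunction_one_le {m : ℕ} [NeZero m] {χ : DirichletCharacter ℂ m}
    (hχ : χ ≠ 1) {s : ℂ} (hs : 1 < s.re) (hs2 : s.re ≤ 2) (ht : |s.im| ≤ 1) :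
    ‖charL χ 0 s - χ.LFunction 1‖ ≤ 2300 * log (4 * m) ^ 2 * ‖s - 1‖ := by
  have hm : 1 ≤ m := Nat.one_le_iff_ne_zero.2 (NeZero.ne m)
  set D : Set ℂ := {z | 1 < z.re} ∩ {z | z.re ≤ 2} ∩ ({z | -1 ≤ z.im} ∩ {z | z.im ≤ 1}) with hD
  have hconv : Convex ℝ D :=
    ((convex_halfSpace_re_gt 1).inter (convex_halfSpace_re_le 2)).inter
      ((convex_halfSpace_im_ge (-1)).inter (convex_halfSpace_im_le 1))
  have hsD : s ∈ D := ⟨⟨hs, hs2⟩, abs_le.mp ht⟩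
  have key : ∀ z ∈ D, ‖charL χ 0 s - charL χ 0 z‖ ≤ 2300 * log (4 * m) ^ 2 * ‖s - z‖ := by
    intro z hz
    refine hconv.norm_image_sub_le_of_norm_hasDerivWithin_le (f' := fun z => -charL χ 1 z)
      (fun w hw => (hasDerivAt_charL χ 0 hw.1.1).hasDerivWithinAt) (fun w hw => ?_) hz hsD
    rw [norm_neg]
    have h0 := one_le_logCond hm w
    have h1 := logCond_le_of_abs_im_le hm (abs_le.2 hw.2)
    calc _ ≤ 2300 * logCond m w ^ (1 + 1) := norm_charL_le_of_ne hm hχ (by norm_num) hw.1.1 hw.1.2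
      _ ≤ _ := by gcongr
  have hseq : Tendsto (fun j : ℕ => (1 + 1 / ((j : ℂ) + 1))) atTop (𝓝 1) := by
    have := (tendsto_one_div_add_atTop_nhds_zero_nat (𝕜 := ℂ)).const_add 1
    simpa using this
  have hc := (DirichletCharacter.differentiable_LFunction hχ).continuous
  have h1 := ((hc.tendsto 1).comp hseq).const_sub (charL χ 0 s) |>.norm
  have h2 := (hseq.const_sub s).norm.const_mul (2300 * log (4 * m) ^ 2)
  refine le_of_tendsto_of_tendsto h1 h2 (.of_forall fun j => ?_)
  have e : (1 + 1 / ((j : ℂ) + 1)) = ((1 + 1 / ((j : ℝ) + 1) : ℝ) : ℂ) := by push_cast; rfl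
  have hp : 0 < 1 / ((j : ℝ) + 1) := by positivity
  have hp1 : 1 / ((j : ℝ) + 1) ≤ 1 := by
    rw [div_le_one (by positivity)]; linarith [(Nat.cast_nonneg j : (0 : ℝ) ≤ j)]
  have hz : (1 + 1 / ((j : ℂ) + 1)) ∈ D := by
    rw [e]
    refine ⟨⟨?_, ?_⟩, ?_, ?_⟩ <;> simp only [Set.mem_ofPred_eq, ofReal_re, ofReal_im] <;>
      linarith
  have := key _ hz
  rwa [charL_zero χ (1 + 1 / ((j : ℂ) + 1)), ← LFunction_eq_LSeries χ hz.1.1] at this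

lemma norm_sub_one_le_add {s : ℂ} (hs : 1 < s.re) : ‖s - 1‖ ≤ (s.re - 1) + |s.im| := by
  have := Complex.norm_le_abs_re_add_abs_im (s - 1)
  simp only [sub_re, Complex.one_re, Complex.sub_im, Complex.one_im, sub_zero] at this
  rwa [abs_of_pos (by linarith)] at this

lemma norm_char_mul_vonMangoldt_le {m : ℕ} (χ : DirichletCharacter ℂ m) (n : ℕ) :
    ‖χ (n : ZMod m) * Λ n‖ ≤
      1 * Λ n := by
  rw [norm_mul, norm_real, norm_of_nonneg vonMangoldt_nonneg]
  exact mul_le_mul_of_nonneg_right (norm_le_one χ _)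
    vonMangoldt_nonneg

lemma exists_charLam_quadratic_bound : ∃ C : ℝ, 1 ≤ C ∧ ∀ m : ℕ, 1 ≤ m →
    ∀ χ : DirichletCharacter ℂ m, χ ≠ 1 → χ ^ 2 = 1 → ∀ s : ℂ, 1 < s.re → s.re ≤ 2 → |s.im| ≤ 1 →
    ∀ a ≤ 1, ‖charLam χ a s‖ ≤ (C * (m : ℝ) ^ 12) ^ (a + 1) ∧
      ‖charLam χ a s‖ ≤ (C * log (4 * m) ^ 9 / ‖s - 1‖) ^ (a + 1) := by
  obtain ⟨C₀, hC₀, htriv⟩ := exists_charLam_trivial_bound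
  have hcL : 1 ≤ cLam := one_le_cLam
  set C : ℝ := 128 * 2301 ^ 2 * 16 + cLam * 300000 * 4 ^ 11 + C₀ * 300000 * 4 ^ 11 with hC
  refine ⟨C, by linarith, ?_⟩
  intro m hm χ hχ hχ2 s hs hs2 ht a ha
  have : NeZero m := ⟨by omega⟩
  have hm' : (1 : ℝ) ≤ m := mod_cast hm
  set b := log (4 * m) with hb
  have hb1 : 1 ≤ b := one_le_log_four_mul hm
  have hb4 : b ≤ 4 * m := (log_le_sub_one_of_pos (by positivity)).trans (by linarith)
  have hB1 := one_le_logCond hm s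
  have hBb : logCond m s ≤ b := logCond_le_of_abs_im_le hm ht
  have hsr : 0 < s.re - 1 := by linarith
  have hn := norm_sub_one_le_add hs
  have hnpos : 0 < ‖s - 1‖ := norm_pos_iff.2 (by
    intro h; rw [sub_eq_zero] at h; rw [h] at hs; simp at hs)
  have hT : ‖charLam χ a s‖ ≤ (C₀ / (s.re - 1)) ^ (a + 1) := by
    have h := htriv (fun n => χ n * Λ n) 1 zero_le_one
      (norm_char_mul_vonMangoldt_le χ) s hs hs2 a ha
    rw [one_mul] at h
    refine h.trans ?_
    rw [div_pow]
    gcongr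
    exact le_self_pow₀ hC₀ (by omega)
  have hK : ∀ κ : ℝ, 1 ≤ κ → 1 ≤ κ * |s.im| →
      ‖charLam χ a s‖ ≤ (cLam * κ * b ^ 9) ^ (a + 1) := by
    intro κ hκ h
    refine (norm_charLam_le hm χ hs hs2 hκ (fun h' => absurd h' hχ) (fun _ => h) ha).trans ?_
    refine pow_le_pow_left₀ (by positivity) ?_ _
    gcongr
  constructor
  · set ρ : ℝ := 1 / (150000 * m * b ^ 2) with hρ
    have hρ0 : 0 < ρ := by positivity
    have hρi : 2 / ρ = 300000 * m * b ^ 2 := by rw [hρ]; field_simp; norm_num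
    have hρb : 300000 * m * b ^ 2 ≤ 300000 * 4 ^ 11 * (m : ℝ) ^ 12 := by
      have h1 : b ^ 2 ≤ b ^ 11 := pow_le_pow_right₀ hb1 (by norm_num)
      have h2 : b ^ 11 ≤ (4 * m) ^ 11 := pow_le_pow_left₀ (by linarith) hb4 _
      calc 300000 * m * b ^ 2 ≤ 300000 * m * (4 * m) ^ 11 := by gcongr; exact h1.trans h2
        _ = _ := by ring
    rcases le_or_gt ‖s - 1‖ ρ with hcase | hcase
    · have h1 := LFunction_one_lower hχ hχ2
      have h2 := norm_charL_zero_sub_LFunction_one_le hχ hs hs2 ht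
      have h3 : 2300 * b ^ 2 * ‖s - 1‖ ≤ 2300 / (150000 * m) := by
        calc _ ≤ 2300 * b ^ 2 * ρ := by gcongr
          _ = _ := by rw [hρ]; field_simp
      have h4 : 1 / (64 * m) ≤ ‖charL χ 0 s‖ := by
        have h5 : ‖χ.LFunction 1‖ ≤ ‖charL χ 0 s‖ + ‖charL χ 0 s - χ.LFunction 1‖ := by
          have := norm_sub_le (charL χ 0 s) (charL χ 0 s - χ.LFunction 1)
          rwa [sub_sub_cancel] at this
        have h6 : 1 / (32 * (m : ℝ)) - 2300 / (150000 * m) ≥ 1 / (64 * m) := by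
          have : 1 / (32 * (m : ℝ)) - 2300 / (150000 * m) - 1 / (64 * m) =
            (1 / 32 - 2300 / 150000 - 1 / 64) / m := by field_simp
          have h7 : 0 ≤ (1 / 32 - 2300 / 150000 - 1 / 64) / (m : ℝ) := by positivity
          linarith
        linarith
      have h5 : 1 ≤ 64 * m * ‖charL χ 0 s‖ := by
        rwa [div_le_iff₀ (by positivity), mul_comm] at h4
      have h6 := norm_charLam_le_of_bounds χ hs (D := 64 * m) (B := 2300 * b) (by linarith)
        (by positivity) h5 (fun a ha => by
          refine (norm_charL_le_of_ne hm hχ ha hs hs2).trans ?_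
          rw [mul_pow]
          gcongr
          exact le_self_pow₀ (by norm_num) (by omega)) ha
      refine h6.trans (pow_le_pow_left₀ (by positivity) ?_ _)
      calc 2 * (64 * (m : ℝ)) * (2300 * b + 1) ^ 2 ≤ 2 * (64 * m) * (2301 * (4 * m)) ^ 2 := by
            gcongr; linarith
        _ = 128 * 2301 ^ 2 * 16 * (m : ℝ) ^ 3 := by ring
        _ ≤ C * (m : ℝ) ^ 12 := by
            gcongr
            · have : 0 ≤ cLam * 300000 * 4 ^ 11 + C₀ * 300000 * 4 ^ 11 := by positivity
              linarith
            · norm_num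
    · rcases le_or_gt (ρ / 2) |s.im| with h | h
      · refine (hK (2 / ρ) ?_ ?_).trans (pow_le_pow_left₀ (by positivity) ?_ _)
        · rw [hρi]; nlinarith [one_le_pow₀ (n := 2) hb1]
        · calc (1 : ℝ) = 2 / ρ * (ρ / 2) := by field_simp
            _ ≤ _ := by gcongr
        · rw [hρi]
          have h2 : b ^ 11 ≤ (4 * m) ^ 11 := pow_le_pow_left₀ (by linarith) hb4 _
          calc cLam * (300000 * m * b ^ 2) * b ^ 9 = cLam * 300000 * m * b ^ 11 := by ring
            _ ≤ cLam * 300000 * m * (4 * m) ^ 11 := by gcongr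
            _ = cLam * 300000 * 4 ^ 11 * (m : ℝ) ^ 12 := by ring
            _ ≤ C * (m : ℝ) ^ 12 := by
              gcongr
              have : 0 ≤ C₀ * 300000 * 4 ^ 11 := by positivity
              linarith
      · refine hT.trans (pow_le_pow_left₀ (by positivity) ?_ _)
        calc C₀ / (s.re - 1) ≤ C₀ / (ρ / 2) := by gcongr; linarith
          _ = C₀ * (2 / ρ) := by field_simp
          _ ≤ C₀ * (300000 * 4 ^ 11 * (m : ℝ) ^ 12) := by rw [hρi]; gcongr
          _ = C₀ * 300000 * 4 ^ 11 * (m : ℝ) ^ 12 := by ring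
          _ ≤ C * (m : ℝ) ^ 12 := by
            gcongr
            have : 0 ≤ cLam * 300000 * 4 ^ 11 := by positivity
            linarith
  · rcases le_or_gt (‖s - 1‖ / 2) |s.im| with h | h
    · refine (hK (2 / ‖s - 1‖) ?_ ?_).trans (pow_le_pow_left₀ (by positivity) ?_ _)
      · rw [le_div_iff₀ hnpos]; linarith
      · calc (1 : ℝ) = 2 / ‖s - 1‖ * (‖s - 1‖ / 2) := by field_simp
          _ ≤ _ := by gcongr
      · calc cLam * (2 / ‖s - 1‖) * b ^ 9 = cLam * 2 * b ^ 9 / ‖s - 1‖ := by ring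
          _ ≤ C * b ^ 9 / ‖s - 1‖ := by
            gcongr
            have : 0 ≤ C₀ * 300000 * 4 ^ 11 := by positivity
            linarith
    · refine hT.trans (pow_le_pow_left₀ (by positivity) ?_ _)
      calc C₀ / (s.re - 1) ≤ C₀ / (‖s - 1‖ / 2) := by gcongr; linarith
        _ = C₀ * 2 * 1 / ‖s - 1‖ := by field_simp
        _ ≤ C * b ^ 9 / ‖s - 1‖ := by
          gcongr
          · linarith
          · exact one_le_pow₀ hb1

/-- The Chinese remainder isomorphism on unit groups. -/
def unitsCRT {m n : ℕ} (h : Coprime m n) : (ZMod (m * n))ˣ ≃* (ZMod m)ˣ × (ZMod n)ˣ :=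
  (Units.mapEquiv (ZMod.chineseRemainder h).toMulEquiv).trans MulEquiv.prodUnits

lemma unitsCRT_fst {m n : ℕ} (h : Coprime m n) (u : (ZMod (m * n))ˣ) :
    ((unitsCRT h u).1 : ZMod m) = ZMod.castHom (dvd_mul_right m n) (ZMod m) (u : ZMod (m * n)) :=
  RingHom.congr_fun (Subsingleton.elim
    ((RingHom.fst _ _).comp (ZMod.chineseRemainder h).toRingHom) _) (u : ZMod (m * n))

lemma unitsCRT_snd {m n : ℕ} (h : Coprime m n) (u : (ZMod (m * n))ˣ) :
    ((unitsCRT h u).2 : ZMod n) = ZMod.castHom (dvd_mul_left n m) (ZMod n) (u : ZMod (m * n)) :=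
  RingHom.congr_fun (Subsingleton.elim
    ((RingHom.snd _ _).comp (ZMod.chineseRemainder h).toRingHom) _) (u : ZMod (m * n))

/-- The number of Dirichlet characters of order dividing two. -/
def quadCount (m : ℕ) : ℕ := Nat.card {χ : DirichletCharacter ℂ m // χ ^ 2 = 1}

lemma quadCount_eq (m : ℕ) [NeZero m] : quadCount m = Nat.card {u : (ZMod m)ˣ // u ^ 2 = 1} := by
  have e := (DirichletCharacter.mulEquiv_units ℂ m).some
  exact Nat.card_congr (e.toEquiv.subtypeEquiv fun χ => by
    change χ ^ 2 = 1 ↔ (e χ) ^ 2 = 1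
    rw [← map_pow, map_eq_one_iff e e.injective])

lemma quadCount_mul_le {m n : ℕ} [NeZero m] [NeZero n] (h : Coprime m n) :
    quadCount (m * n) ≤ quadCount m * quadCount n := by
  rw [quadCount_eq, quadCount_eq, quadCount_eq, ← Nat.card_prod]
  refine Nat.card_le_card_of_injective
    (fun u => (⟨(unitsCRT h u.1).1, ?_⟩, ⟨(unitsCRT h u.1).2, ?_⟩)) ?_
  · have := congrArg (fun z => (unitsCRT h z).1) u.2
    simpa using this
  · have := congrArg (fun z => (unitsCRT h z).2) u.2
    simpa using this
  · intro u v huv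
    simp only [Prod.mk.injEq, Subtype.mk.injEq] at huv
    exact Subtype.ext ((unitsCRT h).injective (Prod.ext huv.1 huv.2))

lemma quadCount_prime_le {p : ℕ} (hp : p.Prime) : quadCount p ≤ 2 := by
  have : Fact p.Prime := ⟨hp⟩
  rw [quadCount_eq]
  have hsub : Set.Subsingleton {u : (ZMod p)ˣ | u ^ 2 = 1 ∧ u ≠ 1} := by
    intro a ha b hb
    have h : ∀ u : (ZMod p)ˣ, u ^ 2 = 1 ∧ u ≠ 1 → (u : ZMod p) = -1 := by
      intro u hu
      have h2 : (u : ZMod p) * u = 1 := by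
        rw [← sq, ← Units.val_pow_eq_pow_val, hu.1, Units.val_one]
      rcases mul_self_eq_one_iff.1 h2 with h3 | h3
      · exact absurd (Units.ext h3) hu.2
      · exact h3
    exact Units.ext ((h a ha).trans (h b hb).symm)
  have e : {u : (ZMod p)ˣ | u ^ 2 = 1} ⊆ insert 1 {u | u ^ 2 = 1 ∧ u ≠ 1} := by
    intro u hu
    by_cases h : u = 1
    · exact Or.inl h
    · exact Or.inr ⟨hu, h⟩
  calc Nat.card {u : (ZMod p)ˣ // u ^ 2 = 1} = Set.ncard {u : (ZMod p)ˣ | u ^ 2 = 1} := rfl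
    _ ≤ Set.ncard (insert 1 {u : (ZMod p)ˣ | u ^ 2 = 1 ∧ u ≠ 1}) := Set.ncard_le_ncard e
    _ ≤ Set.ncard {u : (ZMod p)ˣ | u ^ 2 = 1 ∧ u ≠ 1} + 1 := Set.ncard_insert_le _ _
    _ ≤ 2 := by
      have := (Set.ncard_le_one_iff_subsingleton).mpr hsub
      omega

lemma quadCount_le (m : ℕ) [NeZero m] : quadCount m ≤ m := by
  rw [quadCount_eq]
  refine (Nat.card_le_card_of_injective Subtype.val Subtype.val_injective).trans ?_
  rw [Nat.card_eq_fintype_card, ZMod.card_units_eq_totient]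
  exact Nat.totient_le m

/-- The Dirichlet series of the von Mangoldt function restricted to a residue class, weighted by
the `a`-th power of the logarithm. -/
def residueLam {m : ℕ} (u : ZMod m) (a : ℕ) (s : ℂ) : ℂ :=
  LSeries (logMul^[a] fun n => if (n : ZMod m) = u then (Λ n : ℂ)
    else 0) s

lemma residueLam_eq_sum {m : ℕ} [NeZero m] (u : (ZMod m)ˣ) (a : ℕ) {s : ℂ} (hs : 1 < s.re) :
    residueLam (u : ZMod m) a s = (m.totient : ℂ)⁻¹ *
      ∑ χ : DirichletCharacter ℂ m, χ (u : ZMod m)⁻¹ * charLam χ a s := by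
  have hm : (m.totient : ℂ) ≠ 0 := by
    exact_mod_cast (totient_pos.2 (NeZero.pos m)).ne'
  have e : (logMul^[a] fun n : ℕ => if (n : ZMod m) = (u : ZMod m) then
      (Λ n : ℂ) else 0) =
      (m.totient : ℂ)⁻¹ • ∑ χ : DirichletCharacter ℂ m, (χ (u : ZMod m)⁻¹) •
        logMul^[a] (fun n => χ n * Λ n) := by
    funext n
    simp only [logMul_iterate, Pi.smul_apply, Finset.sum_apply, smul_eq_mul]
    have h := DirichletCharacter.sum_char_inv_mul_char_eq ℂ u.isUnit (n : ZMod m)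
    have e2 : ∑ χ : DirichletCharacter ℂ m, χ (u : ZMod m)⁻¹ * ((log n : ℂ) ^ a *
        (χ n * Λ n)) =
        (∑ χ : DirichletCharacter ℂ m, χ (u : ZMod m)⁻¹ * χ n) *
          ((log n : ℂ) ^ a * Λ n) := by
      rw [sum_mul]
      exact sum_congr rfl fun χ _ => by ring
    rw [e2, h]
    by_cases hn : (n : ZMod m) = u
    · rw [if_pos hn, if_pos hn.symm]
      field_simp
    · rw [if_neg hn, if_neg (Ne.symm hn)]
      simp
  have hsum : ∀ χ : DirichletCharacter ℂ m, LSeriesSummable (logMul^[a]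
      (fun n => χ n * Λ n)) s := fun χ =>
    summable_logMul_iterate (abscissa_charLam_le χ) a hs
  rw [residueLam, e, LSeries_smul, LSeries_sum (fun χ _ => (hsum χ).smul _)]
  simp only [LSeries_smul]
  rfl

lemma card_dirichletCharacter (m : ℕ) [NeZero m] :
    Fintype.card (DirichletCharacter ℂ m) = m.totient := by
  rw [← Nat.card_eq_fintype_card]
  exact DirichletCharacter.card_eq_totient_of_hasEnoughRootsOfUnity ℂ m

/-- An average over all characters is controlled by the bounds for nonquadratic characters and for
quadratic characters. -/
lemma norm_average_char_le {m : ℕ} [NeZero m] (c : ZMod m) (F : DirichletCharacter ℂ m → ℂ)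
    {X Y : ℝ}
    (h1 : ∀ χ, χ ^ 2 ≠ 1 → ‖F χ‖ ≤ X) (h2 : ∀ χ, χ ^ 2 = 1 → ‖F χ‖ ≤ X + Y) :
    ‖(m.totient : ℂ)⁻¹ * ∑ χ : DirichletCharacter ℂ m, χ c * F χ‖ ≤
      X + quadCount m / m.totient * Y := by
  have hφ : (0 : ℝ) < m.totient := mod_cast totient_pos.2 (NeZero.pos m)
  have h : ∀ χ : DirichletCharacter ℂ m, ‖χ c * F χ‖ ≤ X + if χ ^ 2 = 1 then Y else 0 := by
    intro χ
    rw [norm_mul]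
    refine (mul_le_of_le_one_left (norm_nonneg _) (norm_le_one χ _)).trans ?_
    split_ifs with hχ
    · exact h2 χ hχ
    · simpa using h1 χ hχ
  rw [norm_mul, norm_inv, Complex.norm_natCast]
  have h3 := (norm_sum_le univ fun χ : DirichletCharacter ℂ m => χ c * F χ).trans
    (sum_le_sum fun χ _ => h χ)
  rw [sum_add_distrib, sum_const, card_univ, card_dirichletCharacter,
    nsmul_eq_mul, ← sum_filter, sum_const, nsmul_eq_mul] at h3
  have h4 : (univ.filter fun χ : DirichletCharacter ℂ m => χ ^ 2 = 1).card = quadCount m := by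
    rw [quadCount, Nat.card_eq_fintype_card, Fintype.card_subtype]
  rw [h4] at h3
  calc _ ≤ (m.totient : ℝ)⁻¹ * (m.totient * X + quadCount m * Y) := by gcongr
    _ = _ := by field_simp

lemma one_div_mul_eq_average {m : ℕ} [NeZero m] (u : (ZMod m)ˣ) (z : ℂ) :
    1 / m.totient * z = (m.totient : ℂ)⁻¹ *
      ∑ χ : DirichletCharacter ℂ m, χ (u : ZMod m)⁻¹ * (if χ = 1 then z else 0) := by
  simp

lemma exists_residueLam_bound : ∃ C : ℝ, 1 ≤ C ∧ ∀ m : ℕ, 1 ≤ m → ∀ u : (ZMod m)ˣ, ∀ s : ℂ,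
    1 < s.re → s.re ≤ 2 → ∀ a ≤ 1,
    (1 ≤ |s.im| → ‖residueLam (u : ZMod m) a s‖ ≤ (C * logCond m s ^ 9) ^ (a + 1)) ∧
    (|s.im| ≤ 1 →
      ‖residueLam (u : ZMod m) a s - 1 / m.totient * (1 / (s - 1) ^ (a + 1))‖ ≤
        (C * log (4 * m) ^ 9) ^ (a + 1) + quadCount m / m.totient * (C * (m : ℝ) ^ 12) ^ (a + 1) ∧
      ‖residueLam (u : ZMod m) a s - 1 / m.totient * (1 / (s - 1) ^ (a + 1))‖ ≤
        (C * log (4 * m) ^ 9) ^ (a + 1) +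
          quadCount m / m.totient * (C * log (4 * m) ^ 9 / ‖s - 1‖) ^ (a + 1)) := by
  obtain ⟨C₁, hC₁, h1⟩ := exists_charLam_one_bound
  obtain ⟨C₂, hC₂, h2⟩ := exists_charLam_quadratic_bound
  have hc := one_le_cLam
  set C := cLam + C₁ + C₂ with hC
  refine ⟨C, by linarith, ?_⟩
  intro m hm u s hs hs2 a ha
  have : NeZero m := ⟨by omega⟩
  have hB := one_le_logCond hm s
  constructor
  · intro ht
    rw [residueLam_eq_sum u a hs]
    have := norm_average_char_le (u : ZMod m)⁻¹ (fun χ => charLam χ a s)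
      (X := (C * logCond m s ^ 9) ^ (a + 1)) (Y := 0)
    have hall (χ : DirichletCharacter ℂ m) :
        ‖charLam χ a s‖ ≤ (C * logCond m s ^ 9) ^ (a + 1) := by
      refine (norm_charLam_le hm χ hs hs2 le_rfl (fun _ => ht) (fun _ => by linarith) ha).trans ?_
      refine pow_le_pow_left₀ (by positivity) ?_ _
      gcongr
      linarith
    simpa using this (fun χ _ => hall χ) (fun χ _ => by simpa using hall χ)
  · intro ht
    have hb := one_le_log_four_mul hm
    set b := log (4 * m) with hbdef
    have hBb : logCond m s ≤ b := logCond_le_of_abs_im_le hm ht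
    have e : residueLam (u : ZMod m) a s - 1 / m.totient * (1 / (s - 1) ^ (a + 1)) =
        (m.totient : ℂ)⁻¹ * ∑ χ : DirichletCharacter ℂ m, χ (u : ZMod m)⁻¹ *
          (charLam χ a s - if χ = 1 then 1 / (s - 1) ^ (a + 1) else 0) := by
      rw [residueLam_eq_sum u a hs, one_div_mul_eq_average u, ← mul_sub, ← sum_sub_distrib]
      simp only [mul_sub]
    have hne : ∀ χ : DirichletCharacter ℂ m, χ ^ 2 ≠ 1 →
        ‖charLam χ a s - if χ = 1 then 1 / (s - 1) ^ (a + 1) else 0‖ ≤ (C * b ^ 9) ^ (a + 1) := by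
      intro χ hχ
      have h : χ ≠ 1 := by rintro rfl; simp at hχ
      rw [if_neg h, sub_zero]
      refine (norm_charLam_le hm χ hs hs2 le_rfl (fun h' => absurd h' h)
        (fun h' => absurd h' hχ) ha).trans ?_
      refine pow_le_pow_left₀ (by positivity) ?_ _
      rw [mul_one]
      gcongr
      linarith
    have hone : ‖charLam (1 : DirichletCharacter ℂ m) a s - 1 / (s - 1) ^ (a + 1)‖ ≤
        (C * b ^ 9) ^ (a + 1) := by
      refine (h1 m hm s hs hs2 ht a ha).trans ?_
      calc C₁ * logCond m s ≤ C * b ^ 9 := by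
            gcongr
            · linarith
            · exact hBb.trans (le_self_pow₀ hb (by norm_num))
        _ ≤ _ := by
          refine le_self_pow₀ ?_ (by omega)
          have : 1 ≤ b ^ 9 := one_le_pow₀ hb
          nlinarith
    have hq : ∀ Y : ℝ, 0 ≤ Y →
        (∀ χ : DirichletCharacter ℂ m, χ ≠ 1 → χ ^ 2 = 1 → ‖charLam χ a s‖ ≤ Y) →
        ∀ χ : DirichletCharacter ℂ m, χ ^ 2 = 1 →
        ‖charLam χ a s - if χ = 1 then 1 / (s - 1) ^ (a + 1) else 0‖ ≤
          (C * b ^ 9) ^ (a + 1) + Y := by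
      intro Y hY hY2 χ hχ
      by_cases h : χ = 1
      · rw [if_pos h, h]; linarith
      · have : 0 ≤ (C * b ^ 9) ^ (a + 1) := by positivity
        rw [if_neg h, sub_zero]; linarith [hY2 χ h hχ]
    rw [e]
    have hCC : C₂ ≤ C := by linarith
    constructor
    · refine norm_average_char_le _ _ hne (hq _ (by positivity) fun χ hχ hχ2 => ?_)
      refine (h2 m hm χ hχ hχ2 s hs hs2 ht a ha).1.trans (pow_le_pow_left₀ (by positivity) ?_ _)
      gcongr
    · refine norm_average_char_le _ _ hne (hq _ (by positivity) fun χ hχ hχ2 => ?_)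
      refine (h2 m hm χ hχ hχ2 s hs hs2 ht a ha).2.trans (pow_le_pow_left₀ (by positivity) ?_ _)
      gcongr

lemma integrable_ramp {σ : ℝ} (hσ : 0 < σ) :
    Integrable (fun v : ℝ => ((max v 0 * exp (-(σ * v)) : ℝ) : ℂ)) := by
  suffices hr : Integrable (fun v : ℝ => max v 0 * exp (-(σ * v))) from hr.ofReal
  have h : IntegrableOn (fun v : ℝ => v ^ (1 : ℝ) * exp (-σ * v ^ (1 : ℝ))) (Set.Ioi 0) :=
    integrableOn_rpow_mul_exp_neg_mul_rpow (by norm_num) one_pos hσ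
  rw [← integrable_indicator_iff measurableSet_Ioi] at h
  refine h.congr (.of_forall fun v => ?_)
  beta_reduce
  by_cases hv : 0 < v
  · rw [Set.indicator_of_mem (by simpa using hv), max_eq_left hv.le]
    simp
  · rw [Set.indicator_of_notMem (by simpa using hv), max_eq_right (not_lt.1 hv)]
    simp

lemma integral_Ioi_mul_exp_neg {r : ℂ} (hr : 0 < r.re) :
    ∫ t : ℝ in Set.Ioi 0, (t : ℂ) * cexp (-(r * t)) = 1 / r ^ 2 := by
  have hr0 : r ≠ 0 := fun h => by simp [h] at hr
  have hn (t : ℝ) : ‖cexp (-(r * t))‖ = exp (-(r.re * t)) := by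
    rw [Complex.norm_exp]; simp
  have hd : ∀ t ∈ Set.Ici (0 : ℝ), HasDerivAt
      (fun t : ℝ => -((t : ℂ) / r + 1 / r ^ 2) * cexp (-(r * t)))
      ((t : ℂ) * cexp (-(r * t))) t := by
    intro t _
    have h1 : HasDerivAt (fun t : ℝ => (t : ℂ)) 1 t := ofRealCLM.hasDerivAt
    have h2 := ((h1.div_const r).add_const (1 / r ^ 2)).neg.mul (h1.const_mul r).neg.cexp
    convert! h2 using 1
    simp only [Pi.neg_apply]
    field_simp
    ring
  have hi : IntegrableOn (fun t : ℝ => (t : ℂ) * cexp (-(r * t))) (Set.Ioi 0) := by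
    have h := (integrable_ramp hr).integrableOn (s := Set.Ioi 0)
    refine Integrable.mono h (by fun_prop)
      ((ae_restrict_iff' measurableSet_Ioi).2 (.of_forall fun t ht => ?_))
    rw [norm_real, norm_mul, norm_mul, hn, max_eq_left (le_of_lt ht), norm_real,
      norm_of_nonneg (exp_nonneg _)]
  have ht : Tendsto (fun t : ℝ => -((t : ℂ) / r + 1 / r ^ 2) * cexp (-(r * t)))
      atTop (nhds 0) := by
    rw [tendsto_zero_iff_norm_tendsto_zero]
    have e1 := (tendsto_pow_mul_exp_neg_atTop_nhds_zero 1).comp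
      (tendsto_id.const_mul_atTop hr)
    have e0 := (tendsto_pow_mul_exp_neg_atTop_nhds_zero 0).comp
      (tendsto_id.const_mul_atTop hr)
    have e := (e1.const_mul (1 / (r.re * ‖r‖))).add (e0.const_mul (1 / ‖r‖ ^ 2))
    simp only [mul_zero, add_zero] at e
    refine squeeze_zero' (.of_forall fun t => norm_nonneg _) ?_ e
    filter_upwards [eventually_ge_atTop 0] with t ht
    rw [norm_mul, norm_neg, hn]
    have : ‖(t : ℂ) / r + 1 / r ^ 2‖ ≤ t / ‖r‖ + 1 / ‖r‖ ^ 2 := by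
      refine (norm_add_le _ _).trans (le_of_eq ?_)
      simp [abs_of_nonneg ht]
    refine (mul_le_mul_of_nonneg_right this (exp_nonneg _)).trans (le_of_eq ?_)
    have : ‖r‖ ≠ 0 := norm_ne_zero_iff.2 hr0
    have hr' := hr.ne'
    simp only [Function.comp, id]
    field_simp
  rw [integral_Ioi_of_hasDerivAt_of_tendsto' hd hi ht]
  simp

lemma fourier_ramp {σ : ℝ} (hσ : 0 < σ) (ξ : ℝ) :
    𝓕 (fun v : ℝ => ((max v 0 * exp (-(σ * v)) : ℝ) : ℂ)) ξ
      = 1 / ((σ : ℂ) + (2 * π * ξ : ℝ) * I) ^ 2 := by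
  rw [fourier_real_eq_integral_exp_smul,
    ← integral_Ioi_mul_exp_neg (r := (σ : ℂ) + (2 * π * ξ : ℝ) * I) (by simpa using hσ),
    ← integral_indicator measurableSet_Ioi]
  congr 1
  ext v
  by_cases hv : 0 < v
  · rw [Set.indicator_of_mem (by simpa using hv), max_eq_left hv.le]
    push_cast
    rw [smul_eq_mul, mul_left_comm, ← Complex.exp_add]
    congr 2
    ring
  · rw [Set.indicator_of_notMem (by simpa using hv), max_eq_right (not_lt.1 hv)]
    simp

lemma norm_sq_add_mul_I (σ t : ℝ) : ‖(σ : ℂ) + t * I‖ ^ 2 = σ ^ 2 + t ^ 2 := by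
  rw [← Complex.normSq_eq_norm_sq, Complex.normSq_add_mul_I]

lemma integrable_inv_sq_add_sq {c : ℝ} (hc : 0 < c) :
    Integrable (fun t : ℝ => 1 / (c ^ 2 + t ^ 2)) := by
  have h := (integrable_inv_one_add_sq.comp_mul_left' (inv_ne_zero hc.ne')).const_mul (c⁻¹ ^ 2)
  refine h.congr (.of_forall fun t => ?_)
  simp only
  have : c ^ 2 + t ^ 2 ≠ 0 := by positivity
  field_simp

lemma integral_inv_sq_add_sq {c : ℝ} (hc : 0 < c) :
    ∫ t : ℝ, 1 / (c ^ 2 + t ^ 2) = π / c := by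
  have h := Measure.integral_comp_mul_left (fun t : ℝ => (1 + t ^ 2)⁻¹) c⁻¹
  rw [integral_univ_inv_one_add_sq, inv_inv, abs_of_pos hc, smul_eq_mul] at h
  have h2 : ∫ t : ℝ, 1 / (c ^ 2 + t ^ 2) = c⁻¹ ^ 2 * ∫ t : ℝ, (1 + (c⁻¹ * t) ^ 2)⁻¹ := by
    rw [← integral_const_mul]
    congr 1
    ext t
    have : c ^ 2 + t ^ 2 ≠ 0 := by positivity
    field_simp
  rw [h2, h]
  field_simp

lemma integrable_inv_sq_line {σ : ℝ} (hσ : 0 < σ) :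
    Integrable (fun t : ℝ => 1 / ((σ : ℂ) + t * I) ^ 2) := by
  refine (integrable_inv_sq_add_sq hσ).mono' ?_ (.of_forall fun t => ?_)
  · apply Measurable.aestronglyMeasurable
    fun_prop
  · rw [norm_div, norm_one, norm_pow, norm_sq_add_mul_I]

theorem integral_exp_div_sq {σ : ℝ} (hσ : 0 < σ) (v : ℝ) :
    ∫ t : ℝ, cexp (((σ : ℂ) + t * I) * v) / ((σ : ℂ) + t * I) ^ 2
      = 2 * π * (max v 0 : ℝ) := by
  set f : ℝ → ℂ := fun v : ℝ => ((max v 0 * exp (-(σ * v)) : ℝ) : ℂ) with hf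
  have hcont : Continuous f := by
    rw [hf]; fun_prop
  have hF : 𝓕 f = fun ξ : ℝ => 1 / ((σ : ℂ) + (2 * π * ξ : ℝ) * I) ^ 2 :=
    funext fun ξ => fourier_ramp hσ ξ
  have h2pi : (2 * π : ℝ) ≠ 0 := by positivity
  have hFi : Integrable (𝓕 f) := by
    rw [hF]
    exact (integrable_inv_sq_line hσ).comp_mul_left' h2pi
  have hinv := congrFun (hcont.fourierInv_fourier_eq (integrable_ramp hσ) hFi) v
  rw [fourierInv_eq', hF] at hinv
  have hsub := Measure.integral_comp_mul_left
    (fun t : ℝ => cexp ((t * v : ℝ) * I) * (1 / ((σ : ℂ) + t * I) ^ 2))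
    (2 * π)
  have hinv' : (2 * π : ℝ)⁻¹ •
      ∫ t : ℝ, cexp ((t * v : ℝ) * I) * (1 / ((σ : ℂ) + t * I) ^ 2)
        = f v := by
    rw [← hinv]
    rw [abs_of_pos (by positivity)] at hsub
    rw [← hsub]
    congr 1
    ext ξ
    simp only [smul_eq_mul, RCLike.inner_apply, conj_trivial]
    push_cast
    ring_nf
  have hI : ∫ t : ℝ, cexp (((σ : ℂ) + t * I) * v) / ((σ : ℂ) + t * I) ^ 2
      = cexp (σ * v) *
        ∫ t : ℝ, cexp ((t * v : ℝ) * I) * (1 / ((σ : ℂ) + t * I) ^ 2) := by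
    rw [← integral_const_mul]
    congr 1
    ext t
    rw [mul_one_div, ← mul_div_assoc, ← Complex.exp_add]
    congr 2
    push_cast
    ring
  rw [hI]
  rw [inv_smul_eq_iff₀ h2pi] at hinv'
  rw [hinv', hf, Complex.real_smul]
  push_cast
  have : cexp (σ * v) * cexp (-(σ * v)) = 1 := by
    rw [← Complex.exp_add]; simp
  linear_combination (2 * π * ((max v 0 : ℝ) : ℂ)) * this

/-- The kernel of the smoothed Perron formula. -/
def smoothKernel (h : ℝ) (s : ℂ) : ℂ := (1 - cexp (-(h * s))) / (h * s ^ 2)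

/-- The weight detected by `smoothKernel`: a ramp from `0` to `1` of length `h`. -/
def smoothStep (h v : ℝ) : ℝ := (max v 0 - max (v - h) 0) / h

lemma smoothStep_of_nonpos {h v : ℝ} (hh : 0 < h) (hv : v ≤ 0) : smoothStep h v = 0 := by
  rw [smoothStep, max_eq_right hv, max_eq_right (by linarith)]; simp

lemma smoothStep_of_le {h v : ℝ} (hh : 0 < h) (hv : h ≤ v) : smoothStep h v = 1 := by
  rw [smoothStep, max_eq_left (by linarith), max_eq_left (by linarith)]
  field_simp
  ring

lemma smoothStep_mem {h : ℝ} (hh : 0 < h) (v : ℝ) : 0 ≤ smoothStep h v ∧ smoothStep h v ≤ 1 := by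
  rw [smoothStep, div_le_one hh]
  refine ⟨div_nonneg ?_ hh.le, ?_⟩
  · have : max (v - h) 0 ≤ max v 0 := max_le_max (by linarith) le_rfl
    linarith
  · rcases max_cases v 0 with h1 | h1 <;> rcases max_cases (v - h) 0 with h2 | h2 <;> linarith

lemma norm_one_sub_exp_neg_le_two {u : ℂ} (hu : 0 ≤ u.re) : ‖1 - cexp (-u)‖ ≤ 2 := by
  refine (norm_sub_le _ _).trans ?_
  rw [norm_one, Complex.norm_exp, Complex.neg_re]
  have : exp (-u.re) ≤ 1 := exp_le_one_iff.2 (by linarith)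
  linarith

lemma norm_one_sub_exp_neg_le {u : ℂ} (hu : 0 ≤ u.re) : ‖1 - cexp (-u)‖ ≤ 2 * ‖u‖ := by
  rcases le_total ‖u‖ 1 with h | h
  · rw [norm_sub_rev]
    have := Complex.norm_exp_sub_one_le (x := -u) (by simpa using h)
    simpa using this
  · linarith [norm_one_sub_exp_neg_le_two hu]

lemma norm_smoothKernel {h : ℝ} (hh : 0 < h) (s : ℂ) :
    ‖smoothKernel h s‖ = ‖1 - cexp (-(h * s))‖ / (h * ‖s‖ ^ 2) := by
  rw [smoothKernel, norm_div, norm_mul, norm_pow, Complex.norm_of_nonneg hh.le]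

lemma norm_smoothKernel_le {h : ℝ} (hh : 0 < h) {s : ℂ} (hs : 0 < s.re) :
    ‖smoothKernel h s‖ ≤ 2 / ‖s‖ := by
  have hs0 : 0 < ‖s‖ := norm_pos_iff.2 fun h => by simp [h] at hs
  rw [norm_smoothKernel hh, div_le_div_iff₀ (by positivity) hs0]
  have := norm_one_sub_exp_neg_le (u := h * s) (by simp; positivity)
  rw [norm_mul, Complex.norm_of_nonneg hh.le] at this
  nlinarith

lemma norm_smoothKernel_le_sq {h : ℝ} (hh : 0 < h) {s : ℂ} (hs : 0 < s.re) :
    ‖smoothKernel h s‖ ≤ 2 / (h * ‖s‖ ^ 2) := by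
  rw [norm_smoothKernel hh]
  gcongr
  exact norm_one_sub_exp_neg_le_two (by simp; positivity)

lemma measurable_smoothKernel (h σ : ℝ) :
    Measurable fun t : ℝ => smoothKernel h ((σ : ℂ) + t * I) := by
  unfold smoothKernel; fun_prop

lemma integrable_smoothKernel {h σ : ℝ} (hh : 0 < h) (hσ : 0 < σ) :
    Integrable fun t : ℝ => smoothKernel h ((σ : ℂ) + t * I) := by
  refine ((integrable_inv_sq_add_sq hσ).const_mul (2 / h)).mono'
    (measurable_smoothKernel h σ).aestronglyMeasurable (.of_forall fun t => ?_)
  refine (norm_smoothKernel_le_sq hh (by simpa using hσ)).trans (le_of_eq ?_)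
  rw [norm_sq_add_mul_I]
  field_simp

lemma norm_exp_line (σ t v : ℝ) :
    ‖cexp (((σ : ℂ) + t * I) * v)‖ = exp (σ * v) := by
  rw [Complex.norm_exp]; simp

lemma integral_exp_mul_smoothKernel {h σ : ℝ} (hh : 0 < h) (hσ : 0 < σ) (v : ℝ) :
    ∫ t : ℝ, cexp (((σ : ℂ) + t * I) * v) *
      smoothKernel h ((σ : ℂ) + t * I) = 2 * π * (smoothStep h v : ℝ) := by
  have hker (v : ℝ) : Integrable fun t : ℝ =>
      cexp (((σ : ℂ) + t * I) * v) / ((σ : ℂ) + t * I) ^ 2 := by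
    refine ((integrable_inv_sq_line hσ).norm.const_mul (exp (σ * v))).mono' ?_
      (.of_forall fun t => ?_)
    · exact Measurable.aestronglyMeasurable (by fun_prop)
    · rw [norm_div, norm_exp_line, norm_div, norm_one, mul_one_div]
  have h1 := integral_exp_div_sq hσ v
  have h2 := integral_exp_div_sq hσ (v - h)
  have h3 := integral_sub (hker v) (hker (v - h))
  rw [h1, h2] at h3
  have hh' : (h : ℂ) ≠ 0 := mod_cast hh.ne'
  have h4 : ∫ t : ℝ, cexp (((σ : ℂ) + t * I) * v) *
      smoothKernel h ((σ : ℂ) + t * I) = (h : ℂ)⁻¹ * ∫ t : ℝ,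
      (cexp (((σ : ℂ) + t * I) * v) / ((σ : ℂ) + t * I) ^ 2 -
      cexp (((σ : ℂ) + t * I) * (v - h : ℝ)) / ((σ : ℂ) + t * I) ^ 2) := by
    rw [← integral_const_mul]
    congr 1
    ext t
    have hs : (σ : ℂ) + t * I ≠ 0 := by
      intro h0
      have := congrArg Complex.re h0
      simp at this
      exact hσ.ne' this
    have : cexp (((σ : ℂ) + t * I) * (v - h : ℝ)) =
        cexp (((σ : ℂ) + t * I) * v) *
          cexp (-(h * ((σ : ℂ) + t * I))) := by
      rw [← Complex.exp_add]
      congr 1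
      push_cast
      ring
    rw [this, smoothKernel]
    field_simp
  rw [h4, h3, smoothStep]
  push_cast
  field_simp

theorem integral_LSeries_mul_smoothKernel {a : ℕ → ℂ} {h σ : ℝ} (hh : 0 < h) (hσ : 0 < σ)
    (ha : LSeriesSummable a σ) (L : ℝ) :
    HasSum (fun n : ℕ => (if n = 0 then 0 else a n) * (2 * π * (smoothStep h (L - log n) : ℝ)))
      (∫ t : ℝ, LSeries a ((σ : ℂ) + t * I) *
        (cexp (((σ : ℂ) + t * I) * L) * smoothKernel h ((σ : ℂ) + t * I))) := by
  set F : ℕ → ℝ → ℂ := fun n t => LSeries.term a ((σ : ℂ) + t * I) n *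
    (cexp (((σ : ℂ) + t * I) * L) * smoothKernel h ((σ : ℂ) + t * I)) with hF
  have hFe (n : ℕ) (t : ℝ) : F n t = (if n = 0 then 0 else a n) *
      (cexp (((σ : ℂ) + t * I) * (L - log n : ℝ)) *
        smoothKernel h ((σ : ℂ) + t * I)) := by
    simp only [hF]
    rcases eq_or_ne n 0 with rfl | hn
    · simp
    · rw [term_of_ne_zero hn, if_neg hn, Complex.cpow_def_of_ne_zero (mod_cast hn),
        div_eq_mul_inv, ← Complex.exp_neg]
      have : cexp (((σ : ℂ) + t * I) * (L - log n : ℝ)) =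
          cexp (-(Complex.log n * ((σ : ℂ) + t * I))) *
          cexp (((σ : ℂ) + t * I) * L) := by
        rw [← Complex.exp_add]
        congr 1
        push_cast [natCast_log]
        ring
      rw [this]
      ring
  have hki := integrable_smoothKernel hh hσ
  have hei (v : ℝ) : Integrable fun t : ℝ => cexp (((σ : ℂ) + t * I) * v) *
      smoothKernel h ((σ : ℂ) + t * I) := by
    refine (hki.norm.const_mul (exp (σ * v))).mono' ?_ (.of_forall fun t => ?_)
    · exact ((by fun_prop : Measurable fun t : ℝ =>
        cexp (((σ : ℂ) + t * I) * v)).mul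
        (measurable_smoothKernel h σ)).aestronglyMeasurable
    · rw [norm_mul, norm_exp_line]
  have hFi (n : ℕ) : Integrable (F n) := by
    have := (hei (L - log n)).const_mul (if n = 0 then 0 else a n)
    exact this.congr (.of_forall fun t => (hFe n t).symm)
  have hFn (n : ℕ) (t : ℝ) : ‖F n t‖ = ‖LSeries.term a σ n‖ *
      (exp (σ * L) * ‖smoothKernel h ((σ : ℂ) + t * I)‖) := by
    simp only [hF]
    rw [norm_mul, norm_mul, norm_exp_line]
    congr 1
    rw [norm_term_eq, norm_term_eq]
    simp
  have hsum : Summable fun n => ∫ t, ‖F n t‖ := by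
    simp_rw [hFn, integral_const_mul]
    exact ha.norm.mul_right _
  have key := hasSum_integral_of_summable_integral_norm hFi hsum
  have e1 : (fun t => ∑' n, F n t) = fun t : ℝ => LSeries a ((σ : ℂ) + t * I) *
        (cexp (((σ : ℂ) + t * I) * L) *
          smoothKernel h ((σ : ℂ) + t * I)) := by
    ext t
    rw [LSeries, ← tsum_mul_right]
  rw [e1] at key
  convert! key using 1
  ext n
  simp_rw [hFe]
  rw [integral_const_mul, integral_exp_mul_smoothKernel hh hσ]

lemma norm_sum_sub_tsum_smoothStep_le {a : ℕ → ℂ} {B L h : ℝ} (hh : 0 < h)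
    (hB : 0 ≤ B) (ha : ∀ n ∈ Icc 1 ⌊exp L⌋₊, ‖a n‖ ≤ B) :
    ‖∑ n ∈ Icc 1 ⌊exp L⌋₊, a n -
      ∑' n : ℕ, (if n = 0 then 0 else a n) * (smoothStep h (L - log n) : ℝ)‖
      ≤ B * (exp L * h + 1) := by
  rw [tsum_eq_sum (s := Icc 1 ⌊exp L⌋₊), ← sum_sub_distrib]
  · have hterm : ∀ n ∈ Icc 1 ⌊exp L⌋₊,
        ‖a n - (if n = 0 then 0 else a n) * (smoothStep h (L - log n) : ℝ)‖ ≤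
          B * (if n ∈ Ioc ⌊exp L * (1 - h)⌋₊ ⌊exp L⌋₊ then 1 else 0) := by
      intro n hn
      have hn1 := mem_Icc.1 hn
      have hn0 : n ≠ 0 := by omega
      have hnp : (0 : ℝ) < n := by positivity
      rw [if_neg hn0]
      have e : a n - a n * (smoothStep h (L - log n) : ℝ) =
          a n * ((1 - smoothStep h (L - log n) : ℝ) : ℂ) := by push_cast; ring
      have hs := smoothStep_mem hh (L - log n)
      rw [e, norm_mul, Complex.norm_of_nonneg (by linarith)]
      refine mul_le_mul (ha n hn) ?_ (by linarith) hB
      split_ifs with hm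
      · linarith
      · have hle : n ≤ ⌊exp L * (1 - h)⌋₊ := by
          by_contra hcon
          exact hm (mem_Ioc.2 ⟨by omega, hn1.2⟩)
        have h1 : (n : ℝ) ≤ exp L * (1 - h) := by
          rcases le_total 0 (exp L * (1 - h)) with h0 | h0
          · exact (le_floor_iff h0).1 hle
          · rw [Nat.floor_of_nonpos h0] at hle
            omega
        have h2 : (n : ℝ) ≤ exp (L - h) := by
          rw [sub_eq_add_neg, exp_add]
          refine h1.trans (mul_le_mul_of_nonneg_left ?_ (exp_nonneg _))
          linarith [add_one_le_exp (-h)]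
        have h3 := log_le_log hnp h2
        rw [log_exp] at h3
        rw [smoothStep_of_le hh (by linarith)]
        simp
    refine (norm_sum_le_of_le _ hterm).trans ?_
    rw [← mul_sum]
    refine mul_le_mul_of_nonneg_left ?_ hB
    rw [sum_ite_mem, sum_const, nsmul_eq_mul, mul_one]
    have hc : (Icc 1 ⌊exp L⌋₊ ∩ Ioc ⌊exp L * (1 - h)⌋₊ ⌊exp L⌋₊).card ≤
        ⌊exp L⌋₊ - ⌊exp L * (1 - h)⌋₊ := by
      rw [← Nat.card_Ioc]
      exact card_le_card inter_subset_right
    have hle : ⌊exp L * (1 - h)⌋₊ ≤ ⌊exp L⌋₊ := by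
      apply Nat.floor_mono
      nlinarith [exp_pos L]
    have hc' : ((Icc 1 ⌊exp L⌋₊ ∩
        Ioc ⌊exp L * (1 - h)⌋₊ ⌊exp L⌋₊).card : ℝ) ≤
        (⌊exp L⌋₊ : ℝ) - ⌊exp L * (1 - h)⌋₊ := by
      rw [← Nat.cast_sub hle]
      exact_mod_cast hc
    have h1 := Nat.floor_le (exp_nonneg L)
    have h2 := Nat.lt_floor_add_one (exp L * (1 - h))
    nlinarith
  · intro n hn
    rcases eq_or_ne n 0 with rfl | hn0
    · simp
    · have : ⌊exp L⌋₊ < n := by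
        by_contra hcon
        exact hn (mem_Icc.2 ⟨by omega, by omega⟩)
      have h1 := Nat.lt_of_floor_lt this
      have h2 := log_le_log (exp_pos L) h1.le
      rw [log_exp] at h2
      rw [smoothStep_of_nonpos hh (by linarith)]
      simp

lemma sum_log_eq_log_factorial (N : ℕ) :
    ∑ n ∈ Icc 1 N, log n = log N.factorial := by
  induction N with
  | zero => simp
  | succ N ih =>
    rw [sum_Icc_succ_top (by omega), ih, Nat.factorial_succ, Nat.cast_mul,
      log_mul (by positivity) (by positivity), add_comm]

lemma sum_sub_log_le {L : ℝ} :
    ∑ n ∈ Icc 1 ⌊exp L⌋₊, (L - log n) ≤ exp L := by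
  set N := ⌊exp L⌋₊
  have h := pow_div_factorial_le_exp (exp L) (exp_nonneg L) N
  have h2 := log_le_log (by positivity) h
  rw [log_exp, log_div (by positivity) (by positivity), log_pow, log_exp] at h2
  refine le_trans (le_of_eq ?_) h2
  rw [sum_sub_distrib, sum_const, Nat.card_Icc, sum_log_eq_log_factorial]
  simp

lemma norm_sum_mul_sq_sub_log_sq_le {G : ℕ → ℂ} (hG : ∀ n, ‖G n‖ ≤ 1) {X L : ℝ} (hX : 0 ≤ X)
    (hL : L ≤ X) :
    ‖∑ n ∈ Icc 1 ⌊exp L⌋₊, G n * ((X : ℂ) ^ 2 - (log n : ℂ) ^ 2)‖ ≤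
      2 * X * (exp L * (X - L + 1)) := by
  have hterm : ∀ n ∈ Icc 1 ⌊exp L⌋₊,
      ‖G n * ((X : ℂ) ^ 2 - (log n : ℂ) ^ 2)‖ ≤ 2 * X * ((X - L) + (L - log n)) := by
    intro n hn
    have hn1 := mem_Icc.1 hn
    have hn1' : (1 : ℝ) ≤ n := mod_cast hn1.1
    have hl0 : 0 ≤ log n := log_nonneg hn1'
    have hl1 : log n ≤ L := by
      have := log_le_log (by linarith) ((le_floor_iff (exp_nonneg L)).1 hn1.2)
      rwa [log_exp] at this
    have e : (X : ℂ) ^ 2 - (log n : ℂ) ^ 2 = ((X ^ 2 - log n ^ 2 : ℝ) : ℂ) := by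
      push_cast; ring
    rw [norm_mul, e, Complex.norm_of_nonneg (by nlinarith)]
    calc ‖G n‖ * (X ^ 2 - log n ^ 2) ≤ 1 * (X ^ 2 - log n ^ 2) :=
          mul_le_mul_of_nonneg_right (hG n) (by nlinarith)
      _ ≤ _ := by nlinarith
  refine (norm_sum_le_of_le _ hterm).trans ?_
  rw [← mul_sum, sum_add_distrib, sum_const, Nat.card_Icc, nsmul_eq_mul]
  refine mul_le_mul_of_nonneg_left ?_ (by positivity)
  have h1 := sum_sub_log_le (L := L)
  have h2 := Nat.floor_le (exp_nonneg L)
  have h3 : ((⌊exp L⌋₊ + 1 - 1 : ℕ) : ℝ) * (X - L) ≤ exp L * (X - L) := by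
    rw [Nat.add_sub_cancel]
    exact mul_le_mul_of_nonneg_right h2 (by linarith)
  linarith

/-- The integrand of the smoothed Perron formula for `∑ G(n) log² n` at height `e^L`,
normalised by `e^{-L}`. -/
def perronInt (G : ℕ → ℂ) (X L : ℝ) : ℂ :=
  ∫ t : ℝ, LSeries (logMul^[2] G) (((1 + 1 / X : ℝ) : ℂ) + t * I) *
    (cexp (((1 / X : ℝ) + t * I) * L) *
      smoothKernel (X ^ 2)⁻¹ (((1 + 1 / X : ℝ) : ℂ) + t * I))

theorem norm_sum_sub_perronInt_le {G : ℕ → ℂ} (hG : ∀ n, ‖G n‖ ≤ 1) {X L : ℝ} (hX : 1 ≤ X)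
    (hXL : X / 2 ≤ L) (hL : L ≤ X) :
    ‖(X : ℂ) ^ 2 * ((∑ n ∈ Icc 1 ⌊exp L⌋₊, G n) * exp (-L)) -
      (2 * π)⁻¹ * perronInt G X L‖ ≤ 11 * X * (1 + (X - L)) := by
  have hX0 : 0 < X := by linarith
  set h : ℝ := (X ^ 2)⁻¹ with hh
  have hh0 : 0 < h := by positivity
  set a : ℕ → ℂ := logMul^[2] G with ha
  have hsum : LSeriesSummable a ((1 + 1 / X : ℝ) : ℂ) := by
    refine summable_logMul_iterate (abscissa_le_one_of_bounded (C := 1) hG) 2 ?_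
    simp
    positivity
  have hP := (integral_LSeries_mul_smoothKernel hh0 (by positivity : 0 < 1 + 1 / X) hsum L).tsum_eq
  have hpi : (2 * π : ℂ) ≠ 0 := mod_cast (by positivity : (2 * π : ℝ) ≠ 0)
  have hI : (2 * π)⁻¹ * perronInt G X L = exp (-L) *
      ∑' n : ℕ, (if n = 0 then 0 else a n) * (smoothStep h (L - log n) : ℝ) := by
    have e1 : perronInt G X L = exp (-L) * ∫ t : ℝ,
        LSeries a (((1 + 1 / X : ℝ) : ℂ) + t * I) *
        (cexp ((((1 + 1 / X : ℝ) : ℂ) + t * I) * L) *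
          smoothKernel h (((1 + 1 / X : ℝ) : ℂ) + t * I)) := by
      rw [perronInt, ← integral_const_mul]
      congr 1
      ext t
      have : cexp (((1 / X : ℝ) + t * I) * L) = exp (-L) *
          cexp ((((1 + 1 / X : ℝ) : ℂ) + t * I) * L) := by
        rw [Complex.ofReal_exp, ← Complex.exp_add]
        congr 1
        push_cast
        ring
      rw [this]
      ring
    rw [e1, ← hP]
    have e2 (n : ℕ) : (if n = 0 then 0 else a n) *
        (2 * π * (smoothStep h (L - log n) : ℝ)) = (2 * π) *
        ((if n = 0 then 0 else a n) * (smoothStep h (L - log n) : ℝ)) := by ring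
    simp_rw [e2]
    rw [tsum_mul_left]
    push_cast
    field_simp
  have hlog : ∀ n ∈ Icc 1 ⌊exp L⌋₊, 0 ≤ log n ∧ log n ≤ X := by
    intro n hn
    have hn1 := mem_Icc.1 hn
    have hn1' : (1 : ℝ) ≤ n := mod_cast hn1.1
    have := log_le_log (by linarith) ((le_floor_iff (exp_nonneg L)).1 hn1.2)
    rw [log_exp] at this
    exact ⟨log_nonneg hn1', by linarith⟩
  have hae (n : ℕ) : a n = G n * (log n : ℂ) ^ 2 := by
    rw [ha, logMul_iterate, mul_comm]
  have hs1 : ‖∑ n ∈ Icc 1 ⌊exp L⌋₊, a n -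
      ∑' n : ℕ, (if n = 0 then 0 else a n) * (smoothStep h (L - log n) : ℝ)‖
      ≤ X ^ 2 * (exp L * h + 1) := by
    refine norm_sum_sub_tsum_smoothStep_le hh0 (by positivity) fun n hn => ?_
    have := hlog n hn
    rw [hae, norm_mul, norm_pow, Complex.norm_of_nonneg this.1]
    calc ‖G n‖ * log n ^ 2 ≤ 1 * X ^ 2 := by
          refine mul_le_mul (hG n) (pow_le_pow_left₀ this.1 this.2 2) (by positivity) (by norm_num)
      _ = X ^ 2 := one_mul _
  have hs2 := norm_sum_mul_sq_sub_log_sq_le hG hX0.le hL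
  have hsplit : (X : ℂ) ^ 2 * ((∑ n ∈ Icc 1 ⌊exp L⌋₊, G n) * exp (-L)) -
      (2 * π)⁻¹ * perronInt G X L = exp (-L) *
      ((∑ n ∈ Icc 1 ⌊exp L⌋₊, G n * ((X : ℂ) ^ 2 - (log n : ℂ) ^ 2)) +
      (∑ n ∈ Icc 1 ⌊exp L⌋₊, a n -
      ∑' n : ℕ, (if n = 0 then 0 else a n) * (smoothStep h (L - log n) : ℝ))) := by
    rw [hI]
    simp_rw [hae, mul_sub, sum_sub_distrib]
    rw [← sum_mul]
    ring
  rw [hsplit, norm_mul, Complex.norm_of_nonneg (exp_nonneg _)]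
  have hE : exp (-L) * exp L = 1 := by rw [← exp_add]; simp
  have hE2 : X ^ 2 * exp (-L) ≤ 8 := by
    have h1 := quadratic_le_exp_of_nonneg (x := L) (by linarith)
    have h2 : X ^ 2 ≤ 8 * exp L := by nlinarith
    calc X ^ 2 * exp (-L) ≤ 8 * exp L * exp (-L) := by gcongr
      _ = 8 := by rw [mul_assoc, mul_comm (exp L), hE, mul_one]
  have hXh : X ^ 2 * h = 1 := by rw [hh]; field_simp
  calc _ ≤ exp (-L) * (2 * X * (exp L * (X - L + 1)) + X ^ 2 * (exp L * h + 1)) := by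
        gcongr
        exact (norm_add_le _ _).trans (add_le_add hs2 hs1)
    _ = 2 * X * (X - L + 1) * (exp (-L) * exp L) +
        (X ^ 2 * h) * (exp (-L) * exp L) + X ^ 2 * exp (-L) := by ring
    _ ≤ 2 * X * (X - L + 1) + 1 + 8 := by rw [hE, hXh]; linarith
    _ ≤ 11 * X * (1 + (X - L)) := by nlinarith

lemma logMul_eq_convolution (G : ℕ →*₀ ℂ) (n : ℕ) :
    logMul G n = LSeries.convolution (fun n => G n * Λ n) G n := by
  rcases eq_or_ne n 0 with rfl | hn
  · simp [logMul]
  rw [LSeries.convolution_def]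
  have : ∀ p ∈ n.divisorsAntidiagonal, G p.1 * Λ p.1 * G p.2 =
      G n * Λ p.1 := by
    intro p hp
    rw [← (Nat.mem_divisorsAntidiagonal.1 hp).1, map_mul]
    ring
  simp only [logMul]
  rw [sum_congr rfl this, ← mul_sum,
    Nat.sum_divisorsAntidiagonal (f := fun i _ => (Λ i : ℂ)), mul_comm]
  congr 1
  rw [← natCast_log]
  exact_mod_cast congrArg (fun x : ℝ => (x : ℂ)) vonMangoldt_sum.symm

lemma abscissa_mul_vonMangoldt_le {G : ℕ → ℂ} (hG : ∀ n, ‖G n‖ ≤ 1) :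
    abscissaOfAbsConv (fun n => G n * Λ n) ≤ 1 := by
  refine abscissa_le_one_of_vonMangoldt (M := 1) fun n => ?_
  rw [norm_mul, Complex.norm_of_nonneg vonMangoldt_nonneg]
  exact mul_le_mul_of_nonneg_right (hG n) vonMangoldt_nonneg

lemma LSeries_logMul_eq {G : ℕ →*₀ ℂ} (hG : ∀ n, ‖G n‖ ≤ 1) {s : ℂ} (hs : 1 < s.re) :
    LSeries (logMul G) s =
      LSeries (fun n => G n * Λ n) s * LSeries G s := by
  have h1 : LSeriesSummable (fun n => G n * Λ n) s :=
    summable_logMul_iterate (abscissa_mul_vonMangoldt_le hG) 0 hs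
  have h2 : LSeriesSummable G s :=
    summable_logMul_iterate (abscissa_le_one_of_bounded (C := 1) hG) 0 hs
  rw [← LSeries_convolution' h1 h2]
  exact congrFun (congrArg LSeries (funext fun n => logMul_eq_convolution G n)) s

theorem LSeries_logMul_sq_eq {G : ℕ →*₀ ℂ} (hG : ∀ n, ‖G n‖ ≤ 1) {s : ℂ} (hs : 1 < s.re) :
    LSeries (logMul^[2] G) s = LSeries G s *
      (LSeries (logMul (fun n => G n * Λ n)) s +
        LSeries (fun n => G n * Λ n) s ^ 2) := by
  have lt (a : EReal) (ha : a ≤ 1) : a < s.re := lt_of_le_of_lt ha (mod_cast hs)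
  have hGa := abscissa_le_one_of_bounded (C := 1) hG
  have hd1 := LSeries_hasDerivAt (lt _ hGa)
  have hd2 := LSeries_hasDerivAt (lt _ (abscissa_mul_vonMangoldt_le hG))
  have hd3 := LSeries_hasDerivAt (f := logMul G) (s := s)
    (lt _ (LSeries.abscissaOfAbsConv_logMul.le.trans hGa))
  have hev : LSeries (logMul G) =ᶠ[nhds s]
      fun s => LSeries (fun n => G n * Λ n) s * LSeries G s := by
    filter_upwards [(isOpen_lt continuous_const continuous_re).mem_nhds hs] with z hz
    exact LSeries_logMul_eq hG hz
  have := (hd3.congr_of_eventuallyEq hev.symm).unique (hd2.mul hd1)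
  rw [LSeries_logMul_eq hG hs] at this
  change LSeries (logMul (logMul G)) s = _
  linear_combination -this

/-- The restriction of an arithmetic function to the primes. -/
def primePart (G : ℕ → ℂ) (n : ℕ) : ℂ := if n.Prime then G n else 0

lemma norm_primePart_le {G : ℕ → ℂ} (hG : ∀ n, ‖G n‖ ≤ 1) (n : ℕ) : ‖primePart G n‖ ≤ 1 := by
  unfold primePart
  split_ifs
  · exact hG n
  · simp

lemma summable_primes_sq : Summable fun p : Nat.Primes => ((p : ℝ) ^ 2)⁻¹ := by
  have := Nat.Primes.summable_rpow.2 (show (-2 : ℝ) < -1 by norm_num)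
  refine this.congr fun p => ?_
  rw [rpow_neg (by positivity)]
  norm_num

/-- The constant `∑ p⁻²` over the primes. -/
def primeSqSum : ℝ := ∑' p : Nat.Primes, ((p : ℝ) ^ 2)⁻¹

theorem norm_LSeries_le_exp_primePart {G : ℕ →*₀ ℂ} (hG : ∀ n, ‖G n‖ ≤ 1) {s : ℂ}
    (hs : 1 < s.re) :
    ‖LSeries G s‖ ≤ exp (primeSqSum + (LSeries (primePart G) s).re) := by
  have hs0 : s ≠ 0 := fun h => by simp [h] at hs; linarith
  set f : ℕ →*₀ ℂ := G * riemannZetaSummandHom hs0 with hf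
  have hfn (n : ℕ) : f n = LSeries.term G s n := by
    rcases eq_or_ne n 0 with rfl | hn
    · simp
    · rw [term_of_ne_zero hn]
      change G n * riemannZetaSummandHom hs0 n = _
      simp [riemannZetaSummandHom, Complex.cpow_neg, div_eq_mul_inv]
  have hsum0 : LSeriesSummable G s :=
    summable_logMul_iterate (abscissa_le_one_of_bounded (C := 1) hG) 0 hs
  have hsum : Summable (‖f ·‖) := by
    simp_rw [hfn]
    exact hsum0.norm
  have hE := EulerProduct.exp_tsum_primes_log_eq_tsum hsum
  have hL : LSeries G s = ∑' n, f n := by simp_rw [hfn]; rfl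
  rw [hL, ← hE, Complex.norm_exp]
  refine exp_le_exp.2 ?_
  have hfp (p : Nat.Primes) : ‖f p‖ ≤ (p : ℝ)⁻¹ := by
    have hp : (1 : ℝ) ≤ (p : ℕ) := mod_cast p.prop.one_lt.le
    rw [hfn, norm_term_eq, if_neg p.prop.ne_zero, div_eq_mul_inv]
    calc _ ≤ 1 * ((p : ℝ) ^ s.re)⁻¹ := by gcongr; exact hG _
      _ ≤ (p : ℝ)⁻¹ := by
        rw [one_mul]
        refine inv_anti₀ (by linarith) ?_
        calc (p : ℝ) = (p : ℝ) ^ (1 : ℝ) := (rpow_one _).symm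
          _ ≤ _ := rpow_le_rpow_of_exponent_le hp hs.le
  have hp2 (p : Nat.Primes) : (p : ℝ)⁻¹ ≤ 1 / 2 := by
    rw [one_div]
    exact inv_anti₀ (by norm_num) (mod_cast p.prop.two_le)
  have hlog : Summable fun p : Nat.Primes => -Complex.log (1 - f p) :=
    hsum.of_norm.clog_one_sub.neg.subtype Nat.Prime
  have hfs : Summable fun p : Nat.Primes => f p := hsum.of_norm.subtype _
  have hl : LSeries (primePart G) s = ∑' p : Nat.Primes, f p := by
    have h := tsum_subtype {p : ℕ | p.Prime} (fun n => f n)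
    refine Eq.trans (tsum_congr fun n => ?_) h.symm
    by_cases hn : n.Prime
    · rw [Set.indicator_of_mem (by exact hn), hfn, term_of_ne_zero hn.ne_zero,
        term_of_ne_zero hn.ne_zero, primePart, if_pos hn]
    · rw [Set.indicator_of_notMem (by exact hn)]
      simp [LSeries.term, primePart, hn]
  have hlr : Summable fun p : Nat.Primes => (-Complex.log (1 - f p)).re :=
    reCLM.summable hlog
  have hfr : Summable fun p : Nat.Primes => (f p).re := reCLM.summable hfs
  rw [re_tsum hlog, hl, re_tsum hfs, primeSqSum]
  refine le_trans ?_ (summable_primes_sq.tsum_add hfr).le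
  refine Summable.tsum_le_tsum (fun p => ?_) hlr (summable_primes_sq.add hfr)
  have h1 : ‖f p‖ ≤ 1 / 2 := (hfp p).trans (hp2 p)
  have h2 := Complex.norm_log_one_sub_inv_sub_self_le (z := f p) (by linarith)
  have h3 := (re_le_norm _).trans h2
  have h4 : (-Complex.log (1 - f p)).re = (Complex.log (1 - f p)⁻¹).re := by
    rw [Complex.neg_re, Complex.log_re, Complex.log_re, norm_inv, log_inv]
  have h5 : ‖f p‖ ^ 2 * (1 - ‖f p‖)⁻¹ / 2 ≤ ((p : ℝ) ^ 2)⁻¹ := by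
    have : (1 - ‖f p‖)⁻¹ ≤ 2 := by
      rw [inv_le_comm₀ (by linarith) (by norm_num)]
      linarith
    have h6 : ‖f p‖ ^ 2 ≤ ((p : ℝ) ^ 2)⁻¹ := by
      rw [← inv_pow]
      exact pow_le_pow_left₀ (norm_nonneg _) (hfp p) 2
    nlinarith [sq_nonneg ‖f p‖]
  rw [sub_re] at h3
  rw [h4]
  linarith

lemma norm_LSeries_logMul_primePart_sub_le {G : ℕ → ℂ} (hG : ∀ n, ‖G n‖ ≤ 1) {s : ℂ}
    (hs : 1 < s.re) :
    ‖LSeries (logMul (primePart G)) s -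
      LSeries (fun n => G n * Λ n) s‖ ≤ nonprimeMass := by
  have h1 : LSeriesSummable (fun n => G n * Λ n) s :=
    summable_logMul_iterate (abscissa_mul_vonMangoldt_le hG) 0 hs
  have h2 : LSeriesSummable (logMul (primePart G)) s :=
    summable_logMul_iterate (abscissa_le_one_of_bounded (C := 1) (norm_primePart_le hG)) 1 hs
  rw [norm_sub_rev, ← LSeries_sub h1 h2]
  have := norm_LSeries_le_of_sparse (M := 1) zero_le_one
    (c := (fun n => G n * Λ n) - logMul (primePart G))
    (fun n => ?_) ∅ (fun p hp _ => ?_) (a := 0) (by norm_num) hs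
  · simpa using this
  · simp only [Pi.sub_apply, logMul, primePart]
    by_cases hn : n.Prime
    · rw [if_pos hn, vonMangoldt_apply_prime hn, natCast_log, mul_comm, sub_self, norm_zero]
      exact mul_nonneg zero_le_one (log_natCast_nonneg n)
    · rw [if_neg hn, mul_zero, sub_zero, norm_mul, Complex.norm_of_nonneg vonMangoldt_nonneg]
      exact mul_le_mul_of_nonneg_right (hG n) vonMangoldt_nonneg
  · simp only [Pi.sub_apply, logMul, primePart]
    rw [if_pos hp, vonMangoldt_apply_prime hp, natCast_log, mul_comm, sub_self]

lemma hasDerivAt_LSeries_line {c : ℕ → ℂ} (hc : abscissaOfAbsConv c ≤ 1) {σ : ℝ}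
    (hσ : 1 < σ) (t : ℝ) :
    HasDerivAt (fun σ : ℝ => LSeries c ((σ : ℂ) + t * I))
      (-LSeries (logMul c) ((σ : ℂ) + t * I)) σ := by
  have h1 := LSeries_hasDerivAt (f := c) (s := (σ : ℂ) + t * I)
    (lt_of_le_of_lt hc (by simp; exact_mod_cast hσ))
  have h2 : HasDerivAt (fun σ : ℝ => (σ : ℂ) + t * I) 1 σ :=
    ofRealCLM.hasDerivAt.add_const _
  convert! h1.comp σ h2 using 1
  simp

theorem re_LSeries_le_of_re_logMul_le {c : ℕ → ℂ} (hc : abscissaOfAbsConv c ≤ 1)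
    {σ₁ σ₂ t b E : ℝ} (h1 : 1 < σ₁) (h12 : σ₁ ≤ σ₂)
    (hb : ∀ σ : ℝ, σ₁ ≤ σ → σ ≤ σ₂ →
      (LSeries (logMul c) ((σ : ℂ) + t * I)).re ≤ b / (σ - 1) + E) :
    (LSeries c ((σ₁ : ℂ) + t * I)).re ≤ (LSeries c ((σ₂ : ℂ) + t * I)).re +
      b * log ((σ₂ - 1) / (σ₁ - 1)) + E * (σ₂ - σ₁) := by
  set F : ℝ → ℝ := fun σ => (LSeries c ((σ : ℂ) + t * I)).re +
    b * log (σ - 1) + E * σ with hF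
  have hd : ∀ σ : ℝ, 1 < σ → HasDerivAt F
      (-(LSeries (logMul c) ((σ : ℂ) + t * I)).re + b * (1 / (σ - 1)) + E * 1) σ := by
    intro σ hσ
    have d1 := reCLM.hasFDerivAt.comp_hasDerivAt σ (hasDerivAt_LSeries_line hc hσ t)
    have d2 := (((hasDerivAt_id σ).sub_const 1).log (by simp; linarith)).const_mul b
    have d3 := (hasDerivAt_id σ).const_mul E
    convert! (d1.add d2).add d3 using 1
  have hmono : MonotoneOn F (Set.Icc σ₁ σ₂) := by
    refine monotoneOn_of_deriv_nonneg (convex_Icc _ _) (fun σ hσ => ?_) (fun σ hσ => ?_)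
      fun σ hσ => ?_
    · exact (hd σ (by linarith [hσ.1])).continuousAt.continuousWithinAt
    · rw [interior_Icc] at hσ
      exact (hd σ (by linarith [hσ.1])).differentiableAt.differentiableWithinAt
    · rw [interior_Icc] at hσ
      rw [(hd σ (by linarith [hσ.1])).deriv]
      have := hb σ hσ.1.le hσ.2.le
      rw [div_eq_mul_one_div] at this
      linarith
  have := hmono (Set.left_mem_Icc.2 h12) (Set.right_mem_Icc.2 h12) h12
  simp only [hF] at this
  rw [log_div (by linarith) (by linarith)]
  linarith

theorem norm_LSeries_vertical_sub_le {c : ℕ → ℂ} (hc : abscissaOfAbsConv c ≤ 1)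
    {σ t M : ℝ} (hσ : 1 < σ)
    (hM : ∀ u : ℝ, |u| ≤ |t| → ‖LSeries (logMul c) ((σ : ℂ) + u * I)‖ ≤ M) :
    ‖LSeries c ((σ : ℂ) + t * I) - LSeries c σ‖ ≤ M * |t| := by
  have hd (u : ℝ) : HasDerivAt (fun u : ℝ => LSeries c ((σ : ℂ) + u * I))
      (-LSeries (logMul c) ((σ : ℂ) + u * I) * I) u := by
    have h1 := LSeries_hasDerivAt (f := c) (s := (σ : ℂ) + u * I)
      (lt_of_le_of_lt hc (by simp; exact_mod_cast hσ))
    have h2 : HasDerivAt (fun u : ℝ => (σ : ℂ) + u * I) (1 * I) u :=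
      (ofRealCLM.hasDerivAt.mul_const _).const_add _
    convert! h1.comp u h2 using 1
    simp
  have := norm_image_sub_le_of_norm_hasDerivWithin_le (s := Set.uIcc 0 t)
    (f := fun u : ℝ => LSeries c ((σ : ℂ) + u * I)) (C := M) (x := 0) (y := t)
    (fun u _ => (hd u).hasDerivWithinAt) (fun u hu => ?_) (convex_uIcc 0 t) Set.left_mem_uIcc
    Set.right_mem_uIcc
  · simpa using this
  · rw [norm_mul, norm_neg, Complex.norm_I, mul_one]
    refine hM u ?_
    have := Set.abs_sub_left_of_mem_uIcc hu
    simpa using this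

/-- The pointwise absolute value of an arithmetic function, as a complex-valued function. -/
def absFn (G : ℕ → ℂ) (n : ℕ) : ℂ := ((‖G n‖ : ℝ) : ℂ)

lemma norm_absFn_le {G : ℕ → ℂ} (hG : ∀ n, ‖G n‖ ≤ 1) (n : ℕ) : ‖absFn G n‖ ≤ 1 := by
  simpa [absFn] using hG n

lemma LSeries_absFn (c : ℕ → ℂ) (s : ℂ) :
    LSeries (absFn c) s.re = ((∑' n, ‖LSeries.term c s n‖ : ℝ) : ℂ) := by
  rw [ofReal_tsum]
  refine tsum_congr fun n => ?_
  rw [norm_term_eq]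
  rcases eq_or_ne n 0 with rfl | hn
  · simp
  · rw [term_of_ne_zero hn, if_neg hn, absFn]
    push_cast [ofReal_cpow (Nat.cast_nonneg n)]
    rfl

lemma norm_LSeries_le_of_norm_le {c d : ℕ → ℂ} {s : ℂ} (hd : LSeriesSummable d s)
    (h : ∀ n, ‖c n‖ ≤ ‖d n‖) : ‖LSeries c s‖ ≤ (LSeries (absFn d) s.re).re := by
  rw [LSeries_absFn, ofReal_re]
  exact tsum_of_norm_bounded hd.norm.hasSum fun n => LSeries.norm_term_le s (h n)

lemma norm_LSeries_le_absFn {c : ℕ → ℂ} {s : ℂ} (hc : LSeriesSummable c s) :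
    ‖LSeries c s‖ ≤ (LSeries (absFn c) s.re).re :=
  norm_LSeries_le_of_norm_le hc fun _ => le_rfl

lemma absFn_primePart (G : ℕ → ℂ) : absFn (primePart G) = primePart (absFn G) := by
  ext n
  unfold absFn primePart
  split_ifs <;> simp

/-- The analytic input at scale `X` for a completely multiplicative function `G`: its logarithmic
derivative is close to `c₀ / (s - 1)` near `s = 1` and small up to height `X ^ 10`. -/
structure CoreHyp (G : ℕ →*₀ ℂ) (c₀ : ℂ) (α X E E' ε₀ ε₁ C₀ : ℝ) : Prop where
  norm_le : ∀ n, ‖G n‖ ≤ 1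
  three_le : 3 ≤ X
  norm_mean_le : ‖c₀‖ ≤ α
  alpha_le : α ≤ 1
  one_le_E : 1 ≤ E
  E_le : E ≤ X ^ ε₀
  E_le' : E ≤ X ^ (1 / 8 : ℝ)
  E'_nonneg : 0 ≤ E'
  E'_mul_le : E' * log X ≤ 1
  eps_pos : 0 < ε₀
  eps_le : ε₀ ≤ 1 / 2
  eps₁_pos : 0 < ε₁
  near : ∀ s : ℂ, 1 < s.re → s.re ≤ 2 → |s.im| ≤ 1 →
    ‖LSeries (fun n => G n * Λ n) s - c₀ / (s - 1)‖ ≤ E + E' / ‖s - 1‖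
  near_abs : ∀ σ : ℝ, 1 < σ → σ ≤ 2 →
    (LSeries (fun n => absFn G n * Λ n) σ).re ≤ α / (σ - 1) + (E + E' / (σ - 1))
  near_deriv : ∀ s : ℂ, 1 < s.re → s.re ≤ 2 → |s.im| ≤ 1 →
    ‖LSeries (logMul fun n => G n * Λ n) s‖ ≤ E ^ 2 + 3 / ‖s - 1‖ ^ 2
  far : ∀ s : ℂ, 1 < s.re → s.re ≤ 2 → 1 ≤ |s.im| → |s.im| ≤ X ^ 10 →
    ‖LSeries (fun n => G n * Λ n) s‖ ≤ E ∧
    ‖LSeries (logMul fun n => G n * Λ n) s‖ ≤ E ^ 2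
  start : (LSeries (primePart (absFn G)) ((1 + X ^ (-ε₀) : ℝ) : ℂ)).re ≤
    ε₁ * α * log X + C₀

namespace CoreHyp

variable {G : ℕ →*₀ ℂ} {c₀ : ℂ} {α X E E' ε₀ ε₁ C₀ : ℝ}

lemma alpha_nonneg (h : CoreHyp G c₀ α X E E' ε₀ ε₁ C₀) : 0 ≤ α :=
  (norm_nonneg _).trans h.norm_mean_le

lemma one_le_log (h : CoreHyp G c₀ α X E E' ε₀ ε₁ C₀) : 1 ≤ log X := by
  have := h.three_le
  rw [le_log_iff_exp_le (by linarith)]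
  linarith [exp_one_lt_d9]

lemma E'_le (h : CoreHyp G c₀ α X E E' ε₀ ε₁ C₀) : E' ≤ 1 := by
  nlinarith [h.one_le_log, h.E'_nonneg, h.E'_mul_le]

lemma E_mul_le (h : CoreHyp G c₀ α X E E' ε₀ ε₁ C₀) : E * X ^ (-ε₀) ≤ 1 := by
  have hX : 0 < X := by linarith [h.three_le]
  calc E * X ^ (-ε₀) ≤ X ^ ε₀ * X ^ (-ε₀) := by gcongr; exact h.E_le
    _ = 1 := by rw [← rpow_add hX]; simp

lemma rpow_neg_eps_le (h : CoreHyp G c₀ α X E E' ε₀ ε₁ C₀) : X ^ (-ε₀) ≤ 1 :=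
  rpow_le_one_of_one_le_of_nonpos (by linarith [h.three_le]) (by linarith [h.eps_pos])

/-- The common constant in the bounds for `G(s)`. -/
def growthConst (C₀ : ℝ) : ℝ := exp (primeSqSum + C₀ + 4 * nonprimeMass + 10)

lemma exp_le_growthConst {C₀ a : ℝ} {X w : ℝ} (hX : 0 < X)
    (hw : w ≤ a * log X + C₀ + 4 * nonprimeMass + 10) :
    exp (primeSqSum + w) ≤ growthConst C₀ * X ^ a := by
  rw [growthConst, rpow_def_of_pos hX, ← exp_add]
  refine exp_le_exp.2 ?_
  linarith

lemma re_LSeries_primePart_le (h : CoreHyp G c₀ α X E E' ε₀ ε₁ C₀) (t : ℝ) :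
    (LSeries (primePart G) (((1 + 1 / X : ℝ) : ℂ) + t * I)).re ≤
      (1 + ε₁) * α * log X + C₀ + nonprimeMass + 2 := by
  have hX3 := h.three_le
  have hX : 0 < X := by linarith
  have hE := h.one_le_E
  have hE' := h.E'_nonneg
  have hm := nonprimeMass_nonneg
  have h1 : LSeriesSummable (primePart G) (((1 + 1 / X : ℝ) : ℂ) + t * I) :=
    summable_logMul_iterate (abscissa_le_one_of_bounded (C := 1)
      (norm_primePart_le h.norm_le)) 0 (by simp; positivity)
  refine ((re_le_norm _).trans (norm_LSeries_le_absFn h1)).trans ?_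
  rw [absFn_primePart]
  have hre : (((1 + 1 / X : ℝ) : ℂ) + t * I).re = 1 + 1 / X := by simp
  rw [hre]
  have hle : 1 / X ≤ X ^ (-ε₀) := by
    rw [one_div, ← rpow_neg_one]
    exact rpow_le_rpow_of_exponent_le (by linarith) (by linarith [h.eps_le])
  have key := re_LSeries_le_of_re_logMul_le (c := primePart (absFn G)) (t := 0)
    (σ₁ := 1 + 1 / X) (σ₂ := 1 + X ^ (-ε₀)) (b := α + E') (E := E + nonprimeMass)
    (abscissa_le_one_of_bounded (C := 1) (norm_primePart_le (norm_absFn_le h.norm_le)))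
    (by simp; positivity) (by linarith) fun σ hσ1 hσ2 => ?_
  · simp only [ofReal_zero, zero_mul, add_zero] at key
    refine key.trans ?_
    have hs := h.start
    have hlog : log ((1 + X ^ (-ε₀) - 1) / (1 + 1 / X - 1)) ≤ log X := by
      have e : (1 + X ^ (-ε₀) - 1) / (1 + 1 / X - 1) = X ^ (-ε₀) * X := by
        rw [add_sub_cancel_left, add_sub_cancel_left]; field_simp
      rw [e]
      refine log_le_log (by positivity) ?_
      nlinarith [h.rpow_neg_eps_le]
    have hb : 0 ≤ α + E' := by linarith [h.alpha_nonneg]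
    have t1 := mul_le_mul_of_nonneg_left hlog hb
    have t2 : (E + nonprimeMass) * (1 + X ^ (-ε₀) - (1 + 1 / X)) ≤ 1 + nonprimeMass := by
      have : 1 + X ^ (-ε₀) - (1 + 1 / X) ≤ X ^ (-ε₀) := by
        have : 0 < 1 / X := by positivity
        linarith
      calc _ ≤ (E + nonprimeMass) * X ^ (-ε₀) := by gcongr
        _ = E * X ^ (-ε₀) + nonprimeMass * X ^ (-ε₀) := by ring
        _ ≤ 1 + nonprimeMass * 1 := by
            gcongr
            · exact h.E_mul_le
            · exact h.rpow_neg_eps_le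
        _ = _ := by ring
    nlinarith [h.E'_mul_le]
  · have hσ : 1 < σ := by
      have : 0 < 1 / X := by positivity
      linarith
    simp only [ofReal_zero, zero_mul, add_zero]
    have g1 := norm_LSeries_logMul_primePart_sub_le (norm_absFn_le h.norm_le) (s := σ)
      (by simpa using hσ)
    have g2 := (re_le_norm _).trans g1
    rw [sub_re] at g2
    have g3 := h.near_abs σ hσ (by linarith [h.rpow_neg_eps_le])
    have e : (α + E') / (σ - 1) = α / (σ - 1) + E' / (σ - 1) := add_div _ _ _
    rw [e]
    linarith

theorem norm_LSeries_le (h : CoreHyp G c₀ α X E E' ε₀ ε₁ C₀) (t : ℝ) :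
    ‖LSeries G (((1 + 1 / X : ℝ) : ℂ) + t * I)‖ ≤
      growthConst C₀ * X ^ ((1 + ε₁) * α) := by
  have hX : 0 < X := by linarith [h.three_le]
  refine (norm_LSeries_le_exp_primePart h.norm_le (by simp; positivity)).trans
    (exp_le_growthConst hX ?_)
  have := h.re_LSeries_primePart_le t
  have hm := nonprimeMass_nonneg
  linarith

lemma norm_logMul_primePart_sub_le (h : CoreHyp G c₀ α X E E' ε₀ ε₁ C₀) {s : ℂ}
    (h1 : 1 < s.re) (h2 : s.re ≤ 2) (h3 : |s.im| ≤ 1) :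
    ‖LSeries (logMul (primePart G)) s - c₀ / (s - 1)‖ ≤
      E + nonprimeMass + E' / (s.re - 1) := by
  have g1 := norm_LSeries_logMul_primePart_sub_le h.norm_le h1
  have g2 := h.near s h1 h2 h3
  have g3 := norm_sub_le_norm_sub_add_norm_sub (LSeries (logMul (primePart G)) s)
    (LSeries (fun n => G n * Λ n) s) (c₀ / (s - 1))
  have g4 : E' / ‖s - 1‖ ≤ E' / (s.re - 1) := by
    refine div_le_div_of_nonneg_left h.E'_nonneg (by linarith) ?_
    have := re_le_norm (s - 1)
    simpa using this
  linarith

theorem norm_LSeries_le_near (h : CoreHyp G c₀ α X E E' ε₀ ε₁ C₀) {δ η t : ℝ}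
    (hδ : c₀.re ≤ (1 - δ) * α) (hδ1 : δ ≤ 1) (hη : 0 < η) (hη' : η ≤ 1 / 2)
    (ht : |t| ≤ X ^ (η - 1)) :
    ‖LSeries G (((1 + 1 / X : ℝ) : ℂ) + t * I)‖ ≤
      growthConst C₀ * X ^ ((1 - δ + η + ε₁) * α) := by
  have hX3 := h.three_le
  have hX : 0 < X := by linarith
  have hw := h.one_le_log
  have hE := h.one_le_E
  have hE' := h.E'_nonneg
  have hE'1 := h.E'_le
  have hm := nonprimeMass_nonneg
  have hα := h.alpha_nonneg
  have hα1 := h.alpha_le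
  set τ := X ^ (η - 1) with hτ
  have hτ0 : 0 < τ := by positivity
  have hτle : τ ≤ X ^ (-ε₀) :=
    rpow_le_rpow_of_exponent_le (by linarith) (by linarith [h.eps_le])
  have hεle := h.rpow_neg_eps_le
  have hτ1 : τ ≤ 1 := hτle.trans hεle
  have hle : 1 / X ≤ τ := by
    rw [one_div, ← rpow_neg_one]
    exact rpow_le_rpow_of_exponent_le (by linarith) (by linarith)
  have hX1 : 0 < 1 / X := by positivity
  have hEτ : (E + nonprimeMass) * X ^ (-ε₀) ≤ 1 + nonprimeMass := by
    have := h.E_mul_le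
    nlinarith
  have hc := abscissa_le_one_of_bounded (C := 1) (norm_primePart_le h.norm_le)
  have hb1 : ∀ σ u : ℝ, 1 < σ → σ ≤ 2 → |u| ≤ 1 →
      ‖LSeries (logMul (primePart G)) ((σ : ℂ) + u * I)‖ ≤
        (α + E') / (σ - 1) + (E + nonprimeMass) := by
    intro σ u h1 h2 h3
    have g1 := h.norm_logMul_primePart_sub_le (s := (σ : ℂ) + u * I) (by simpa using h1)
      (by simpa using h2) (by simpa using h3)
    have hre : ((σ : ℂ) + u * I).re = σ := by simp
    rw [hre] at g1
    have g2 : ‖c₀ / ((σ : ℂ) + u * I - 1)‖ ≤ α / (σ - 1) := by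
      rw [norm_div]
      refine div_le_div₀ hα h.norm_mean_le (by linarith) ?_
      have := re_le_norm ((σ : ℂ) + u * I - 1)
      simpa using this
    have g3 := norm_le_norm_add_norm_sub (c₀ / ((σ : ℂ) + u * I - 1))
      (LSeries (logMul (primePart G)) ((σ : ℂ) + u * I))
    have e : (α + E') / (σ - 1) = α / (σ - 1) + E' / (σ - 1) := add_div _ _ _
    rw [e]
    rw [norm_sub_rev] at g1
    linarith
  have s1 := re_LSeries_le_of_re_logMul_le (c := primePart G) (t := t)
    (σ₁ := 1 + 1 / X) (σ₂ := 1 + τ) (b := α + E') (E := E + nonprimeMass) hc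
    (by linarith) (by linarith) fun σ hσ1 hσ2 =>
      (re_le_norm _).trans (hb1 σ t (by linarith) (by linarith) (ht.trans hτ1))
  have s2 := norm_LSeries_vertical_sub_le (c := primePart G) (σ := 1 + τ) (t := t)
    (M := (α + E') / τ + (E + nonprimeMass)) hc (by linarith) fun u hu => by
      have := hb1 (1 + τ) u (by linarith) (by linarith) (hu.trans (ht.trans hτ1))
      rwa [add_sub_cancel_left] at this
  have s3 := re_LSeries_le_of_re_logMul_le (c := primePart G) (t := 0)
    (σ₁ := 1 + τ) (σ₂ := 1 + X ^ (-ε₀)) (b := (1 - δ) * α + E') (E := E + nonprimeMass) hc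
    (by linarith) (by linarith) fun σ hσ1 hσ2 => by
      have hσ : 1 < σ := by linarith
      simp only [ofReal_zero, zero_mul, add_zero]
      have g1 := (re_le_norm _).trans (h.norm_logMul_primePart_sub_le (s := σ)
        (by simpa using hσ) (by simpa using (by linarith : σ ≤ 2)) (by simp))
      rw [sub_re, ofReal_re] at g1
      have g2 : (c₀ / ((σ : ℂ) - 1)).re = c₀.re / (σ - 1) := by
        rw [show ((σ : ℂ) - 1) = ((σ - 1 : ℝ) : ℂ) by push_cast; rfl, Complex.div_ofReal_re]
      rw [g2] at g1
      have g3 : c₀.re / (σ - 1) ≤ (1 - δ) * α / (σ - 1) := by gcongr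
      have e : ((1 - δ) * α + E') / (σ - 1) = (1 - δ) * α / (σ - 1) + E' / (σ - 1) := add_div _ _ _
      rw [e]
      linarith
  simp only [ofReal_zero, zero_mul, add_zero] at s3
  have s4 : (LSeries (primePart G) ((1 + X ^ (-ε₀) : ℝ) : ℂ)).re ≤ ε₁ * α * log X + C₀ := by
    have h1 : LSeriesSummable (primePart G) ((1 + X ^ (-ε₀) : ℝ) : ℂ) :=
      summable_logMul_iterate hc 0 (by simp; positivity)
    refine ((re_le_norm _).trans (norm_LSeries_le_absFn h1)).trans ?_
    rw [absFn_primePart, ofReal_re]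
    exact h.start
  have l1 : log ((1 + τ - 1) / (1 + 1 / X - 1)) = η * log X := by
    have e : (1 + τ - 1) / (1 + 1 / X - 1) = X ^ η := by
      rw [add_sub_cancel_left, add_sub_cancel_left, hτ, rpow_sub hX, rpow_one]
      field_simp
    rw [e, log_rpow hX]
  have l3 : log ((1 + X ^ (-ε₀) - 1) / (1 + τ - 1)) ≤ log X := by
    rw [add_sub_cancel_left, add_sub_cancel_left]
    refine log_le_log (by positivity) ?_
    rw [div_le_iff₀ hτ0]
    calc X ^ (-ε₀) ≤ 1 := hεle
      _ = X * (1 / X) := by field_simp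
      _ ≤ X * τ := by gcongr
  have b1 : (E + nonprimeMass) * (1 + τ - (1 + 1 / X)) ≤ 1 + nonprimeMass := by
    refine le_trans ?_ hEτ
    gcongr
    linarith
  have b3 : (E + nonprimeMass) * (1 + X ^ (-ε₀) - (1 + τ)) ≤ 1 + nonprimeMass := by
    refine le_trans ?_ hEτ
    gcongr
    linarith
  have b2 : ((α + E') / τ + (E + nonprimeMass)) * |t| ≤ 3 + nonprimeMass := by
    calc _ ≤ ((α + E') / τ + (E + nonprimeMass)) * τ := by gcongr
      _ = (α + E') + (E + nonprimeMass) * τ := by field_simp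
      _ ≤ (1 + 1) + (E + nonprimeMass) * X ^ (-ε₀) := by gcongr
      _ ≤ _ := by linarith
  have b4 : ((1 - δ) * α + E') * log ((1 + X ^ (-ε₀) - 1) / (1 + τ - 1)) ≤
      ((1 - δ) * α + E') * log X :=
    mul_le_mul_of_nonneg_left l3 (add_nonneg (mul_nonneg (by linarith) hα) hE')
  have s2' := (re_le_norm _).trans s2
  rw [sub_re] at s2'
  rw [l1] at s1
  refine (norm_LSeries_le_exp_primePart h.norm_le (by simp; positivity)).trans
    (exp_le_growthConst hX ?_)
  have hE'w := h.E'_mul_le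
  have hE'η : E' * (η * log X) ≤ 1 := by nlinarith
  nlinarith

end CoreHyp

lemma integral_le_of_le {f g : ℝ → ℝ} (hg : Integrable g) (h0 : ∀ t, 0 ≤ f t)
    (h : ∀ t, f t ≤ g t) : ∫ t, f t ≤ ∫ t, g t :=
  integral_mono_of_nonneg (.of_forall h0) hg (.of_forall h)

/-- The integral of `(1 + |t|) ^ (-9/8)`. -/
def bracketInt : ℝ := ∫ t : ℝ, (1 + ‖t‖) ^ (-(9 / 8) : ℝ)

lemma integrable_bracket : Integrable fun t : ℝ => (1 + ‖t‖) ^ (-(9 / 8) : ℝ) :=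
  integrable_one_add_norm (by norm_num)

lemma bracketInt_nonneg : 0 ≤ bracketInt := integral_nonneg fun t => by positivity

lemma one_add_abs_le_two_mul_norm {σ t : ℝ} (hσ : 1 ≤ σ) :
    1 + |t| ≤ 2 * ‖(σ : ℂ) + t * I‖ := by
  have h1 := abs_re_le_norm ((σ : ℂ) + t * I)
  have h2 := abs_im_le_norm ((σ : ℂ) + t * I)
  simp at h1 h2
  linarith [le_abs_self σ]

lemma norm_rpow_neg_le {σ t : ℝ} (hσ : 1 ≤ σ) :
    ‖(σ : ℂ) + t * I‖ ^ (-(9 / 8) : ℝ) ≤ 4 * (1 + ‖t‖) ^ (-(9 / 8) : ℝ) := by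
  have h := one_add_abs_le_two_mul_norm (t := t) hσ
  have hp : 0 < 1 + |t| := by positivity
  calc ‖(σ : ℂ) + t * I‖ ^ (-(9 / 8) : ℝ)
      ≤ ((1 + |t|) / 2) ^ (-(9 / 8) : ℝ) :=
        rpow_le_rpow_of_nonpos (by positivity) (by linarith) (by norm_num)
    _ = 2 ^ (9 / 8 : ℝ) * (1 + |t|) ^ (-(9 / 8) : ℝ) := by
        rw [div_rpow hp.le zero_le_two, rpow_neg zero_le_two, div_inv_eq_mul, mul_comm]
    _ ≤ 4 * (1 + ‖t‖) ^ (-(9 / 8) : ℝ) := by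
        rw [norm_eq_abs]
        gcongr
        calc (2 : ℝ) ^ (9 / 8 : ℝ) ≤ 2 ^ (2 : ℝ) :=
              rpow_le_rpow_of_exponent_le one_le_two (by norm_num)
          _ = 4 := by norm_num

lemma norm_smoothKernel_le_rpow {X : ℝ} {s : ℂ} (hX : 0 < X) (hs : 0 < s.re) :
    ‖smoothKernel (X ^ 2)⁻¹ s‖ ≤ 2 * X ^ (1 / 4 : ℝ) * ‖s‖ ^ (-(9 / 8) : ℝ) := by
  have hh : 0 < (X ^ 2)⁻¹ := by positivity
  have hs0 : 0 < ‖s‖ := norm_pos_iff.2 fun h => by simp [h] at hs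
  have h1 := norm_smoothKernel_le hh hs
  have h2 := norm_smoothKernel_le_sq hh hs
  have h3 : 0 ≤ ‖smoothKernel (X ^ 2)⁻¹ s‖ := norm_nonneg _
  calc ‖smoothKernel (X ^ 2)⁻¹ s‖
      = ‖smoothKernel (X ^ 2)⁻¹ s‖ ^ (7 / 8 : ℝ) * ‖smoothKernel (X ^ 2)⁻¹ s‖ ^ (1 / 8 : ℝ) := by
        rw [← rpow_add_of_nonneg h3 (by norm_num) (by norm_num)]
        norm_num
    _ ≤ (2 / ‖s‖) ^ (7 / 8 : ℝ) * (2 / ((X ^ 2)⁻¹ * ‖s‖ ^ 2)) ^ (1 / 8 : ℝ) := by gcongr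
    _ = 2 * X ^ (1 / 4 : ℝ) * ‖s‖ ^ (-(9 / 8) : ℝ) := by
        have e : 2 / ((X ^ 2)⁻¹ * ‖s‖ ^ 2) = 2 * X ^ (2 : ℝ) * ‖s‖ ^ (-2 : ℝ) := by
          rw [rpow_neg hs0.le, rpow_two, rpow_two]
          field_simp
        have e' : 2 / ‖s‖ = 2 * ‖s‖ ^ (-1 : ℝ) := by rw [rpow_neg_one, div_eq_mul_inv]
        rw [e, e', mul_rpow (by positivity) (by positivity),
          mul_rpow (by positivity) (by positivity),
          mul_rpow (by positivity) (by positivity), ← rpow_mul hs0.le,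
          ← rpow_mul hs0.le, ← rpow_mul hX.le]
        have e1 : (2 : ℝ) ^ (7 / 8 : ℝ) * 2 ^ (1 / 8 : ℝ) = 2 := by
          rw [← rpow_add zero_lt_two]; norm_num
        have e2 : ‖s‖ ^ (-1 * (7 / 8) : ℝ) * ‖s‖ ^ (-2 * (1 / 8) : ℝ) = ‖s‖ ^ (-(9 / 8) : ℝ) := by
          rw [← rpow_add hs0]; norm_num
        have e3 : (2 : ℝ) * (1 / 8) = 1 / 4 := by norm_num
        rw [e3, ← e2]
        linear_combination (X ^ (1 / 4 : ℝ) * (‖s‖ ^ (-1 * (7 / 8) : ℝ) *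
          ‖s‖ ^ (-2 * (1 / 8) : ℝ))) * e1

lemma norm_exp_sub_exp_le {z : ℂ} {L X : ℝ} (hX : 0 < X) (hz : z.re = 1 / X) (hL : L ≤ X) :
    ‖cexp (z * L) - cexp (z * X)‖ ≤ 6 * (1 + (X - L)) * min 1 ‖z‖ := by
  have hnorm (v : ℝ) (hv : v ≤ X) : ‖cexp (z * v)‖ ≤ 3 := by
    rw [Complex.norm_exp]
    have : (z * v).re ≤ 1 := by
      rw [Complex.re_mul_ofReal, hz, one_div, inv_mul_le_iff₀ hX]
      linarith
    calc exp (z * v).re ≤ exp 1 := exp_le_exp.2 this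
      _ ≤ 3 := by linarith [exp_one_lt_d9]
  have h1 : ‖cexp (z * L) - cexp (z * X)‖ ≤ 6 :=
    (norm_sub_le _ _).trans (by linarith [hnorm L hL, hnorm X le_rfl])
  have h2 : ‖cexp (z * L) - cexp (z * X)‖ ≤ 3 * ‖z‖ * (X - L) := by
    have := (convex_Icc L X).norm_image_sub_le_of_norm_hasDerivWithin_le
      (f := fun v : ℝ => cexp (z * v)) (f' := fun v : ℝ => cexp (z * v) * z)
      (C := 3 * ‖z‖) (x := X) (y := L) (fun v _ => by
        have h := ((hasDerivAt_id v).ofReal_comp.const_mul z).cexp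
        simp only [id, ofReal_one, mul_one] at h
        exact h.hasDerivWithinAt) (fun v hv => by
        rw [norm_mul]
        gcongr
        exact hnorm v hv.2) ⟨hL, le_rfl⟩ ⟨le_rfl, hL⟩
    rwa [norm_eq_abs, abs_sub_comm, abs_of_nonneg (by linarith)] at this
  have hz0 := norm_nonneg z
  rcases le_total 1 ‖z‖ with h | h
  · rw [min_eq_left h]; linarith
  · rw [min_eq_right h]; nlinarith [mul_nonneg hz0 (sub_nonneg.2 hL)]

lemma min_one_div_sq_le {c r t : ℝ} (hc : 0 < c) (hr : 0 < r) (ht : t ^ 2 ≤ r ^ 2) :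
    min 1 r / r ^ 2 ≤ c * (1 / r ^ 2) + 2 * (1 / (c ^ 2 + t ^ 2)) := by
  have hp : 0 ≤ 2 * (1 / (c ^ 2 + t ^ 2)) := by positivity
  have hq : 0 ≤ c * (1 / r ^ 2) := by positivity
  rcases le_total r c with h | h
  · have : min 1 r / r ^ 2 ≤ c * (1 / r ^ 2) := by
      rw [mul_one_div]
      gcongr
      exact (min_le_right _ _).trans h
    linarith
  · have : min 1 r / r ^ 2 ≤ 2 * (1 / (c ^ 2 + t ^ 2)) := by
      rw [mul_one_div, div_le_div_iff₀ (by positivity) (by positivity)]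
      have h1 : c ^ 2 ≤ r ^ 2 := by gcongr
      calc min 1 r * (c ^ 2 + t ^ 2) ≤ 1 * (r ^ 2 + r ^ 2) := by
            gcongr
            exact min_le_left _ _
        _ = 2 * r ^ 2 := by ring
    linarith

/-- The constant in the bound for `G''` far from the real axis. -/
def farConst : ℝ := exists_charLam_trivial_bound.choose

lemma one_le_farConst : 1 ≤ farConst := exists_charLam_trivial_bound.choose_spec.1

lemma norm_logDeriv_mul_kernel_le_far {G : ℕ → ℂ} (hG : ∀ n, ‖G n‖ ≤ 1) {X t : ℝ} (hX1 : 1 ≤ X)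
    (ht : X ^ 10 ≤ |t|) :
    (‖LSeries (logMul fun n => G n * Λ n)
        (((1 + 1 / X : ℝ) : ℂ) + t * I)‖ +
      ‖LSeries (fun n => G n * Λ n) (((1 + 1 / X : ℝ) : ℂ) + t * I)‖ ^ 2) *
      ‖smoothKernel (X ^ 2)⁻¹ (((1 + 1 / X : ℝ) : ℂ) + t * I)‖ ≤
    16 * farConst ^ 2 * (1 + ‖t‖) ^ (-(9 / 8) : ℝ) := by
  have hX : 0 < X := by linarith
  have hF := one_le_farConst
  have hbr := norm_rpow_neg_le (σ := 1 + 1 / X) (t := t) (by linarith [one_div_pos.2 hX])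
  set s : ℂ := ((1 + 1 / X : ℝ) : ℂ) + t * I with hs
  have hre : s.re = 1 + 1 / X := by simp [hs]
  have him : s.im = t := by simp [hs]
  have hs1 : 1 < s.re := by rw [hre]; linarith [one_div_pos.2 hX]
  have hs2 : s.re ≤ 2 := by
    have : 1 / X ≤ 1 := by rw [div_le_one hX]; linarith
    rw [hre]; linarith
  have hns : 1 ≤ ‖s‖ := hs1.le.trans (re_le_norm s)
  set J := (1 + ‖t‖) ^ (-(9 / 8) : ℝ)
  have hGΛ (n : ℕ) : ‖G n * Λ n‖ ≤ 1 * Λ n := by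
    rw [norm_mul, norm_real, norm_of_nonneg vonMangoldt_nonneg]
    exact mul_le_mul_of_nonneg_right (hG n) vonMangoldt_nonneg
  have hspec := exists_charLam_trivial_bound.choose_spec.2 _ 1 zero_le_one hGΛ s hs1 hs2
  have hsx : s.re - 1 = 1 / X := by rw [hre]; ring
  have h0 := hspec 0 (by norm_num)
  have h1 := hspec 1 le_rfl
  set P0 := LSeries (fun n => G n * Λ n) s
  set P1 := LSeries (logMul fun n => G n * Λ n) s
  change ‖P0‖ ≤ 1 * (farConst / _) at h0
  change ‖P1‖ ≤ 1 * (farConst / _) at h1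
  rw [hsx, one_mul, one_div, inv_pow, zero_add, pow_one, div_inv_eq_mul] at h0
  rw [hsx, one_mul, one_div, inv_pow, div_inv_eq_mul] at h1
  have h3 : ‖P1‖ + ‖P0‖ ^ 2 ≤ 2 * farConst ^ 2 * X ^ 2 := by
    have h4 : ‖P0‖ ^ 2 ≤ (farConst * X) ^ 2 := by gcongr
    have h5 : farConst * X ^ 2 ≤ farConst ^ 2 * X ^ 2 := by gcongr; nlinarith
    rw [mul_pow] at h4
    norm_num at h1
    linarith
  have hts : X ^ 10 ≤ ‖s‖ := by
    have := abs_im_le_norm s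
    rw [him] at this
    linarith
  have h4 : ‖smoothKernel (X ^ 2)⁻¹ s‖ ≤ 2 * X ^ 2 * ‖s‖ ^ (-(7 / 8) : ℝ) *
      ‖s‖ ^ (-(9 / 8) : ℝ) := by
    refine (norm_smoothKernel_le_sq (by positivity) (by linarith)).trans_eq ?_
    rw [mul_assoc, ← rpow_add (by linarith),
      show (-(7 / 8) + -(9 / 8) : ℝ) = -2 by norm_num, rpow_neg (by linarith), rpow_two]
    field_simp
  have h5 : ‖s‖ ^ (-(7 / 8) : ℝ) ≤ X ^ (-4 : ℝ) := by
    calc ‖s‖ ^ (-(7 / 8) : ℝ) ≤ (X ^ 10) ^ (-(7 / 8) : ℝ) :=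
          rpow_le_rpow_of_nonpos (by positivity) hts (by norm_num)
      _ = X ^ (-(70 / 8) : ℝ) := by
          rw [← rpow_natCast, ← rpow_mul hX.le]; norm_num
      _ ≤ X ^ (-4 : ℝ) := rpow_le_rpow_of_exponent_le (by linarith) (by norm_num)
  have h6 : X ^ (-4 : ℝ) * X ^ 4 = 1 := by
    rw [← rpow_natCast, ← rpow_add hX]
    norm_num
  calc (‖P1‖ + ‖P0‖ ^ 2) * ‖smoothKernel (X ^ 2)⁻¹ s‖
      ≤ 2 * farConst ^ 2 * X ^ 2 * (2 * X ^ 2 * X ^ (-4 : ℝ) * (4 * J)) := by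
        gcongr
        refine h4.trans ?_
        gcongr
    _ = 16 * farConst ^ 2 * J * (X ^ (-4 : ℝ) * X ^ 4) := by ring
    _ = _ := by rw [h6, mul_one]

namespace CoreHyp

variable {G : ℕ →*₀ ℂ} {c₀ : ℂ} {α X E E' ε₀ ε₁ C₀ : ℝ}

lemma E_sq_le (h : CoreHyp G c₀ α X E E' ε₀ ε₁ C₀) : E ^ 2 ≤ X ^ (1 / 4 : ℝ) := by
  have hX : 0 < X := by linarith [h.three_le]
  have := h.one_le_E
  calc E ^ 2 ≤ (X ^ (1 / 8 : ℝ)) ^ 2 := by gcongr; exact h.E_le'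
    _ = X ^ (1 / 4 : ℝ) := by rw [← rpow_natCast, ← rpow_mul hX.le]; norm_num

lemma norm_logMul_sq_mul_kernel_le (h : CoreHyp G c₀ α X E E' ε₀ ε₁ C₀) (t : ℝ) :
    ‖LSeries (logMul^[2] G) (((1 + 1 / X : ℝ) : ℂ) + t * I) *
      smoothKernel (X ^ 2)⁻¹ (((1 + 1 / X : ℝ) : ℂ) + t * I)‖ ≤
    ‖LSeries G (((1 + 1 / X : ℝ) : ℂ) + t * I)‖ *
      (24 * farConst ^ 2 * X ^ (1 / 2 : ℝ) * (1 + ‖t‖) ^ (-(9 / 8) : ℝ) +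
        22 * (1 / ((1 / X) ^ 2 + t ^ 2))) := by
  have hX3 := h.three_le
  have hX : 0 < X := by linarith
  have hE := h.one_le_E
  have hE' := h.E'_nonneg
  have hE2 := h.E_sq_le
  have hF := one_le_farConst
  have hF2 : 1 ≤ farConst ^ 2 := one_le_pow₀ hF
  set s : ℂ := ((1 + 1 / X : ℝ) : ℂ) + t * I with hs
  have hre : s.re = 1 + 1 / X := by simp [hs]
  have him : s.im = t := by simp [hs]
  have hs1 : 1 < s.re := by rw [hre]; linarith [one_div_pos.2 hX]
  have hX1 : 1 / X ≤ 1 := by rw [div_le_one hX]; linarith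
  have hs2 : s.re ≤ 2 := by rw [hre]; linarith
  have hsub : ‖s - 1‖ ^ 2 = (1 / X) ^ 2 + t ^ 2 := by
    rw [← norm_sq_add_mul_I]; congr 2; rw [hs]; push_cast; ring
  have hk1 : ‖smoothKernel (X ^ 2)⁻¹ s‖ ≤ 2 := by
    refine (norm_smoothKernel_le (by positivity) (by linarith)).trans ?_
    have := re_le_norm s
    rw [div_le_iff₀ (by linarith)]
    linarith
  have hns : 1 ≤ ‖s‖ := hs1.le.trans (re_le_norm s)
  have hbr := norm_rpow_neg_le (σ := 1 + 1 / X) (t := t) (by linarith [one_div_pos.2 hX])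
  rw [← hs] at hbr
  set J := (1 + ‖t‖) ^ (-(9 / 8) : ℝ) with hJ
  have hJ0 : 0 ≤ J := by positivity
  have hk2 : ‖smoothKernel (X ^ 2)⁻¹ s‖ ≤ 8 * X ^ (1 / 4 : ℝ) * J := by
    refine (norm_smoothKernel_le_rpow hX (by linarith)).trans ?_
    calc 2 * X ^ (1 / 4 : ℝ) * ‖s‖ ^ (-(9 / 8) : ℝ) ≤ 2 * X ^ (1 / 4 : ℝ) * (4 * J) := by gcongr
      _ = _ := by ring
  have hXX : X ^ (1 / 4 : ℝ) * X ^ (1 / 4 : ℝ) = X ^ (1 / 2 : ℝ) := by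
    rw [← rpow_add hX]; norm_num
  have hq0 : 0 ≤ 22 * (1 / ((1 / X) ^ 2 + t ^ 2)) := by positivity
  have hEk : E ^ 2 * ‖smoothKernel (X ^ 2)⁻¹ s‖ ≤ 8 * X ^ (1 / 2 : ℝ) * J := by
    calc E ^ 2 * ‖smoothKernel (X ^ 2)⁻¹ s‖ ≤ X ^ (1 / 4 : ℝ) * (8 * X ^ (1 / 4 : ℝ) * J) := by
          gcongr
      _ = _ := by rw [← hXX]; ring
  have hXJ : 0 ≤ X ^ (1 / 2 : ℝ) * J := by positivity
  have hFX : X ^ (1 / 2 : ℝ) * J ≤ farConst ^ 2 * (X ^ (1 / 2 : ℝ) * J) :=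
    le_mul_of_one_le_left hXJ hF2
  rw [LSeries_logMul_sq_eq h.norm_le hs1, norm_mul, norm_mul, mul_assoc]
  gcongr
  set P0 := LSeries (fun n => G n * Λ n) s
  set P1 := LSeries (logMul fun n => G n * Λ n) s
  have hP : ‖P1 + P0 ^ 2‖ ≤ ‖P1‖ + ‖P0‖ ^ 2 := by
    rw [← norm_pow]; exact norm_add_le _ _
  refine (mul_le_mul_of_nonneg_right hP (norm_nonneg _)).trans ?_
  rcases le_total |t| 1 with ht | ht
  · have h0 := h.near s hs1 hs2 (by rwa [him])
    have h1 := h.near_deriv s hs1 hs2 (by rwa [him])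
    set r := ‖s - 1‖ with hr
    have hr0 : 0 < r := by
      by_contra! hneg
      have : r = 0 := le_antisymm hneg (norm_nonneg _)
      rw [this] at hsub
      have : 0 < (1 / X) ^ 2 + t ^ 2 := by positivity
      linarith
    have h2 : ‖P0‖ ≤ E + 2 / r := by
      have h3 : ‖c₀ / (s - 1)‖ ≤ 1 / r := by
        rw [norm_div]; gcongr; exact h.norm_mean_le.trans h.alpha_le
      have h4 : E' / r ≤ 1 / r := by gcongr; exact h.E'_le
      have h5 := norm_le_insert' P0 (c₀ / (s - 1))
      have h6 : 1 / r + 1 / r = 2 / r := by ring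
      linarith
    have h3 : ‖P1‖ + ‖P0‖ ^ 2 ≤ 3 * E ^ 2 + 11 * (1 / r ^ 2) := by
      have h4 : ‖P0‖ ^ 2 ≤ (E + 2 / r) ^ 2 := by gcongr
      have h5 : (E + 2 / r) ^ 2 ≤ 2 * E ^ 2 + 8 * (1 / r ^ 2) := by
        have : 8 * (1 / r ^ 2) = 2 * (2 / r) ^ 2 := by field_simp; ring
        rw [this]
        nlinarith [sq_nonneg (E - 2 / r)]
      have h6 : 3 / r ^ 2 = 3 * (1 / r ^ 2) := by ring
      linarith
    rw [← hsub]
    have hrr : 0 ≤ 1 / r ^ 2 := by positivity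
    calc (‖P1‖ + ‖P0‖ ^ 2) * ‖smoothKernel (X ^ 2)⁻¹ s‖
        ≤ (3 * E ^ 2 + 11 * (1 / r ^ 2)) * ‖smoothKernel (X ^ 2)⁻¹ s‖ := by gcongr
      _ = 3 * (E ^ 2 * ‖smoothKernel (X ^ 2)⁻¹ s‖) +
          11 * (1 / r ^ 2) * ‖smoothKernel (X ^ 2)⁻¹ s‖ := by ring
      _ ≤ 3 * (8 * X ^ (1 / 2 : ℝ) * J) + 11 * (1 / r ^ 2) * 2 := by gcongr
      _ ≤ _ := by linarith
  · rcases le_total |t| (X ^ 10) with ht2 | ht2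
    · obtain ⟨h0, h1⟩ := h.far s hs1 hs2 (by rwa [him]) (by rwa [him])
      have h3 : ‖P1‖ + ‖P0‖ ^ 2 ≤ 2 * E ^ 2 := by
        have : ‖P0‖ ^ 2 ≤ E ^ 2 := by gcongr
        linarith
      calc (‖P1‖ + ‖P0‖ ^ 2) * ‖smoothKernel (X ^ 2)⁻¹ s‖
          ≤ 2 * E ^ 2 * ‖smoothKernel (X ^ 2)⁻¹ s‖ := by gcongr
        _ = 2 * (E ^ 2 * ‖smoothKernel (X ^ 2)⁻¹ s‖) := by ring
        _ ≤ 2 * (8 * X ^ (1 / 2 : ℝ) * J) := by gcongr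
        _ ≤ _ := by linarith
    · refine (norm_logDeriv_mul_kernel_le_far h.norm_le (by linarith) ht2).trans ?_
      have h7 : 1 ≤ X ^ (1 / 2 : ℝ) := one_le_rpow (by linarith) (by norm_num)
      have h8 : farConst ^ 2 * J ≤ farConst ^ 2 * J * X ^ (1 / 2 : ℝ) :=
        le_mul_of_one_le_right (by positivity) h7
      have h9 : 0 ≤ farConst ^ 2 * J * X ^ (1 / 2 : ℝ) := by positivity
      calc 16 * farConst ^ 2 * J ≤ 24 * (farConst ^ 2 * J * X ^ (1 / 2 : ℝ)) := by linarith
        _ = 24 * farConst ^ 2 * X ^ (1 / 2 : ℝ) * J := by ring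
        _ ≤ _ := by linarith

end CoreHyp

lemma continuous_LSeries_line {c : ℕ → ℂ} (hc : abscissaOfAbsConv c ≤ 1) {σ : ℝ}
    (hσ : 1 < σ) : Continuous fun t : ℝ => LSeries c ((σ : ℂ) + t * I) := by
  refine continuous_iff_continuousAt.2 fun t => ?_
  have h : abscissaOfAbsConv c < (((σ : ℂ) + t * I).re : EReal) := by
    refine hc.trans_lt ?_
    simp only [Complex.add_re, ofReal_re, Complex.mul_re, Complex.I_re, mul_zero,
      ofReal_im, Complex.I_im, mul_one, sub_self, add_zero]
    exact_mod_cast hσ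
  exact (LSeries_hasDerivAt h).continuousAt.comp_of_eq (by fun_prop) rfl

lemma integrable_perron {G : ℕ → ℂ} (hG : ∀ n, ‖G n‖ ≤ 1) {X : ℝ} (hX : 0 < X) (L : ℝ) :
    Integrable fun t : ℝ =>
      LSeries (logMul^[2] G) (((1 + 1 / X : ℝ) : ℂ) + t * I) *
      (cexp (((1 / X : ℝ) + t * I) * L) *
        smoothKernel (X ^ 2)⁻¹ (((1 + 1 / X : ℝ) : ℂ) + t * I)) := by
  have hσ : 1 < 1 + 1 / X := by linarith [one_div_pos.2 hX]
  have ha := abscissa_le_one_of_bounded (C := 1) hG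
  have hab : abscissaOfAbsConv (logMul^[2] G) ≤ 1 := by
    simpa [LSeries.abscissaOfAbsConv_logMul] using ha
  have hk := integrable_smoothKernel (h := (X ^ 2)⁻¹) (σ := 1 + 1 / X) (by positivity)
    (by linarith)
  refine (hk.norm.const_mul ((LSeries (absFn (logMul^[2] G)) (1 + 1 / X : ℝ)).re *
    exp (1 / X * L))).mono' ?_ (.of_forall fun t => ?_)
  · exact (continuous_LSeries_line hab hσ).aestronglyMeasurable.mul
      ((by fun_prop : Continuous fun t : ℝ =>
        cexp (((1 / X : ℝ) + t * I) * L)).aestronglyMeasurable.mul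
        (measurable_smoothKernel _ _).aestronglyMeasurable)
  · rw [norm_mul, norm_mul, norm_exp_line, mul_assoc]
    gcongr
    have hs : LSeriesSummable (logMul^[2] G)
        (((1 + 1 / X : ℝ) : ℂ) + t * I) :=
      summable_logMul_iterate ha 2 (by simp; positivity)
    have := norm_LSeries_le_absFn hs
    rwa [show (((1 + 1 / X : ℝ) : ℂ) + t * I).re = 1 + 1 / X by simp] at this

lemma integral_majorant {c₁ c₂ : ℝ} (h₁ : 0 < c₁) (h₂ : 0 < c₂) (a b d : ℝ) :
    Integrable (fun t : ℝ => a * (1 + ‖t‖) ^ (-(9 / 8) : ℝ) +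
      (b * (1 / (c₁ ^ 2 + t ^ 2)) + d * (1 / (c₂ ^ 2 + t ^ 2)))) ∧
    ∫ t : ℝ, (a * (1 + ‖t‖) ^ (-(9 / 8) : ℝ) +
      (b * (1 / (c₁ ^ 2 + t ^ 2)) + d * (1 / (c₂ ^ 2 + t ^ 2)))) =
      a * bracketInt + (b * (π / c₁) + d * (π / c₂)) := by
  have i0 := integrable_bracket.const_mul a
  have i1 := (integrable_inv_sq_add_sq h₁).const_mul b
  have i2 := (integrable_inv_sq_add_sq h₂).const_mul d
  have i3 : Integrable fun t : ℝ => b * (1 / (c₁ ^ 2 + t ^ 2)) + d * (1 / (c₂ ^ 2 + t ^ 2)) :=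
    i1.add i2
  refine ⟨i0.add i3, ?_⟩
  rw [integral_add i0 i3, integral_add i1 i2, integral_const_mul, integral_const_mul,
    integral_const_mul, integral_inv_sq_add_sq h₁, integral_inv_sq_add_sq h₂, bracketInt]

lemma norm_two_pi_inv_le : ‖(((2 * π)⁻¹ : ℝ) : ℂ)‖ ≤ 1 := by
  rw [norm_real, norm_of_nonneg (by positivity)]
  exact inv_le_one_of_one_le₀ (by linarith [pi_gt_three])

namespace CoreHyp

/-- The constant in the mean value estimates for `G`. -/
def coreConst (C₀ : ℝ) : ℝ := growthConst C₀ * (400 * farConst ^ 2 * (bracketInt + π))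

lemma growthConst_pos (C₀ : ℝ) : 0 < growthConst C₀ := exp_pos _

lemma coreConst_nonneg (C₀ : ℝ) : 0 ≤ coreConst C₀ := by
  have := growthConst_pos C₀
  have := bracketInt_nonneg
  have := pi_pos
  unfold coreConst
  positivity

variable {G : ℕ →*₀ ℂ} {c₀ : ℂ} {α X E E' ε₀ C₀ δ : ℝ}

lemma norm_perronInt_sub_le (h : CoreHyp G c₀ α X E E' ε₀ (δ / 16) C₀) (hδ1 : δ ≤ 1) {L : ℝ}
    (hL : L ≤ X) :
    ‖perronInt G X L - perronInt G X X‖ ≤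
      coreConst C₀ * (1 + (X - L)) * X ^ (1 + (1 - δ / 16) * α) := by
  have hX3 := h.three_le
  have hX : 0 < X := by linarith
  have hα := h.alpha_nonneg
  have hα1 := h.alpha_le
  have hδ0 := h.eps₁_pos
  have hF := one_le_farConst
  have hF2 : 1 ≤ farConst ^ 2 := one_le_pow₀ hF
  have hJ := bracketInt_nonneg
  have hπ := pi_pos
  have hgc := growthConst_pos C₀
  have hΔ : 0 ≤ X - L := by linarith
  set S := growthConst C₀ * X ^ ((1 + δ / 16) * α) with hS
  have hS0 : 0 ≤ S := by positivity
  set c := X ^ (-(1 / 2) : ℝ) with hc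
  have hc0 : 0 < c := by positivity
  rw [perronInt, perronInt, ← integral_sub (integrable_perron h.norm_le hX L)
    (integrable_perron h.norm_le hX X)]
  obtain ⟨hI, hIv⟩ := integral_majorant (by positivity : 0 < 1 / X) hc0
    (24 * farConst ^ 2 * X ^ (1 / 2 : ℝ)) (22 * c) 44
  have hmaj : Integrable fun t : ℝ => 6 * (1 + (X - L)) * S *
      (24 * farConst ^ 2 * X ^ (1 / 2 : ℝ) * (1 + ‖t‖) ^ (-(9 / 8) : ℝ) +
        (22 * c * (1 / ((1 / X) ^ 2 + t ^ 2)) + 44 * (1 / (c ^ 2 + t ^ 2)))) :=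
    hI.const_mul _
  have hpt (t : ℝ) : ‖LSeries (logMul^[2] G) (((1 + 1 / X : ℝ) : ℂ) + t * I) *
      (cexp (((1 / X : ℝ) + t * I) * L) *
        smoothKernel (X ^ 2)⁻¹ (((1 + 1 / X : ℝ) : ℂ) + t * I)) -
      LSeries (logMul^[2] G) (((1 + 1 / X : ℝ) : ℂ) + t * I) *
      (cexp (((1 / X : ℝ) + t * I) * X) *
        smoothKernel (X ^ 2)⁻¹ (((1 + 1 / X : ℝ) : ℂ) + t * I))‖ ≤
      6 * (1 + (X - L)) * S *
      (24 * farConst ^ 2 * X ^ (1 / 2 : ℝ) * (1 + ‖t‖) ^ (-(9 / 8) : ℝ) +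
        (22 * c * (1 / ((1 / X) ^ 2 + t ^ 2)) + 44 * (1 / (c ^ 2 + t ^ 2)))) := by
    set z : ℂ := (1 / X : ℝ) + t * I with hz
    have hzn : ‖z‖ ^ 2 = (1 / X) ^ 2 + t ^ 2 := norm_sq_add_mul_I _ _
    have hz0 : 0 < ‖z‖ := by
      rw [norm_pos_iff, hz]
      intro h0
      have := congrArg Complex.re h0
      simp at this
      exact hX.ne' this
    have h1 := norm_exp_sub_exp_le (z := z) hX (by simp [hz]) hL
    have h2 := h.norm_logMul_sq_mul_kernel_le t
    have h3 := h.norm_LSeries_le t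
    rw [← hS] at h3
    rw [← hzn] at h2 ⊢
    set P := LSeries (logMul^[2] G) (((1 + 1 / X : ℝ) : ℂ) + t * I)
    set k := smoothKernel (X ^ 2)⁻¹ (((1 + 1 / X : ℝ) : ℂ) + t * I)
    set J := 24 * farConst ^ 2 * X ^ (1 / 2 : ℝ) * (1 + ‖t‖) ^ (-(9 / 8) : ℝ) with hJd
    have hJ0 : 0 ≤ J := by positivity
    have e : P * (cexp (z * L) * k) - P * (cexp (z * X) * k) =
        (cexp (z * L) - cexp (z * X)) * (P * k) := by ring
    have h4 := min_one_div_sq_le (c := c) (r := ‖z‖) (t := t) hc0 hz0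
      (by rw [hzn]; nlinarith [sq_nonneg (1 / X)])
    rw [e, norm_mul]
    calc ‖cexp (z * L) - cexp (z * X)‖ * ‖P * k‖
        ≤ (6 * (1 + (X - L)) * min 1 ‖z‖) * (S * (J + 22 * (1 / ‖z‖ ^ 2))) := by
          gcongr
          exact h2.trans (by gcongr)
      _ = 6 * (1 + (X - L)) * S * (min 1 ‖z‖ * J + 22 * (min 1 ‖z‖ / ‖z‖ ^ 2)) := by ring
      _ ≤ 6 * (1 + (X - L)) * S * (1 * J + 22 * (c * (1 / ‖z‖ ^ 2) +
            2 * (1 / (c ^ 2 + t ^ 2)))) := by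
          gcongr
          exact min_le_left _ _
      _ = _ := by ring
  refine (norm_integral_le_integral_norm _).trans
    ((integral_le_of_le hmaj (fun t => norm_nonneg _) hpt).trans ?_)
  rw [integral_const_mul, hIv]
  have hcX : c * X = X ^ (1 / 2 : ℝ) := by
    rw [hc]; nth_rw 2 [← rpow_one X]; rw [← rpow_add hX]; norm_num
  have hci : 1 / c = X ^ (1 / 2 : ℝ) := by
    rw [hc, rpow_neg hX.le, one_div, inv_inv]
  have e1 : 22 * c * (π / (1 / X)) + 44 * (π / c) =
      66 * π * X ^ (1 / 2 : ℝ) := by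
    have e2 : 22 * c * (π / (1 / X)) = 22 * π * (c * X) := by field_simp
    have e3 : 44 * (π / c) = 44 * π * (1 / c) := by ring
    rw [e2, e3, hcX, hci]; ring
  rw [e1]
  calc 6 * (1 + (X - L)) * S * (24 * farConst ^ 2 * X ^ (1 / 2 : ℝ) * bracketInt +
        66 * π * X ^ (1 / 2 : ℝ))
      = (growthConst C₀ * (144 * farConst ^ 2 * bracketInt + 396 * π)) * (1 + (X - L)) *
        (X ^ ((1 + δ / 16) * α) * X ^ (1 / 2 : ℝ)) := by rw [hS]; ring
    _ ≤ coreConst C₀ * (1 + (X - L)) * X ^ (1 + (1 - δ / 16) * α) := by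
      rw [← rpow_add hX]
      have h1 : growthConst C₀ * (144 * farConst ^ 2 * bracketInt + 396 * π) ≤
          coreConst C₀ := by
        unfold coreConst
        gcongr
        nlinarith [mul_nonneg (sq_nonneg farConst) hJ]
      have h2 : X ^ ((1 + δ / 16) * α + 1 / 2) ≤ X ^ (1 + (1 - δ / 16) * α) :=
        rpow_le_rpow_of_exponent_le (by linarith) (by nlinarith)
      have := coreConst_nonneg C₀
      gcongr

lemma norm_perronInt_le (h : CoreHyp G c₀ α X E E' ε₀ (δ / 16) C₀) (hδ1 : δ ≤ 1)
    (hc₀ : c₀.re ≤ (1 - δ) * α) :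
    ‖perronInt G X X‖ ≤ coreConst C₀ * X ^ (1 + (1 - δ / 16) * α) := by
  have hX3 := h.three_le
  have hX : 0 < X := by linarith
  have hα := h.alpha_nonneg
  have hα1 := h.alpha_le
  have hδ0 : 0 < δ := by linarith [h.eps₁_pos]
  have hF := one_le_farConst
  have hF2 : 1 ≤ farConst ^ 2 := one_le_pow₀ hF
  have hJ := bracketInt_nonneg
  have hπ := pi_pos
  have hgc := growthConst_pos C₀
  set S := growthConst C₀ * X ^ ((1 + δ / 16) * α) with hS
  set S' := growthConst C₀ * X ^ ((1 - δ + δ / 4 + δ / 16) * α) with hS'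
  have hS0 : 0 ≤ S := by positivity
  have hS'0 : 0 ≤ S' := by positivity
  set τ := X ^ (δ / 4 - 1) with hτ
  have hτ0 : 0 < τ := by positivity
  obtain ⟨hI, hIv⟩ := integral_majorant (by positivity : 0 < 1 / X) hτ0
    (S * (24 * farConst ^ 2 * X ^ (1 / 2 : ℝ))) (22 * S') (44 * S)
  have hmaj : Integrable fun t : ℝ => 3 * (S * (24 * farConst ^ 2 * X ^ (1 / 2 : ℝ)) *
      (1 + ‖t‖) ^ (-(9 / 8) : ℝ) + ((22 * S') * (1 / ((1 / X) ^ 2 + t ^ 2)) +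
        (44 * S) * (1 / (τ ^ 2 + t ^ 2)))) :=
    hI.const_mul _
  have hpt (t : ℝ) : ‖LSeries (logMul^[2] G) (((1 + 1 / X : ℝ) : ℂ) + t * I) *
      (cexp (((1 / X : ℝ) + t * I) * X) *
        smoothKernel (X ^ 2)⁻¹ (((1 + 1 / X : ℝ) : ℂ) + t * I))‖ ≤
      3 * (S * (24 * farConst ^ 2 * X ^ (1 / 2 : ℝ)) *
      (1 + ‖t‖) ^ (-(9 / 8) : ℝ) + ((22 * S') * (1 / ((1 / X) ^ 2 + t ^ 2)) +
        (44 * S) * (1 / (τ ^ 2 + t ^ 2)))) := by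
    have hexp : ‖cexp (((1 / X : ℝ) + t * I) * X)‖ ≤ 3 := by
      rw [norm_exp_line, one_div, inv_mul_cancel₀ hX.ne']
      linarith [exp_one_lt_d9]
    have h2 := h.norm_logMul_sq_mul_kernel_le t
    have h3 := h.norm_LSeries_le t
    have h4 := h.norm_LSeries_le_near (t := t) hc₀ hδ1 (by linarith : 0 < δ / 4) (by linarith)
    rw [← hS] at h3
    rw [← hS', ← hτ] at h4
    set N := ‖LSeries G (((1 + 1 / X : ℝ) : ℂ) + t * I)‖
    have hN : N * (1 / ((1 / X) ^ 2 + t ^ 2)) ≤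
        S' * (1 / ((1 / X) ^ 2 + t ^ 2)) + 2 * S * (1 / (τ ^ 2 + t ^ 2)) := by
      rcases le_total |t| τ with ht | ht
      · have := h4 ht
        have : N * (1 / ((1 / X) ^ 2 + t ^ 2)) ≤ S' * (1 / ((1 / X) ^ 2 + t ^ 2)) := by gcongr
        have : 0 ≤ 2 * S * (1 / (τ ^ 2 + t ^ 2)) := by positivity
        linarith
      · have ht2 : τ ^ 2 ≤ t ^ 2 := by rw [← sq_abs t]; gcongr
        have ht0 : 0 < t ^ 2 := by nlinarith [sq_nonneg τ, mul_pos hτ0 hτ0]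
        have h5 : 1 / ((1 / X) ^ 2 + t ^ 2) ≤ 2 * (1 / (τ ^ 2 + t ^ 2)) := by
          rw [mul_one_div, div_le_div_iff₀ (by positivity) (by positivity)]
          nlinarith [sq_nonneg (1 / X)]
        have : N * (1 / ((1 / X) ^ 2 + t ^ 2)) ≤ S * (2 * (1 / (τ ^ 2 + t ^ 2))) := by gcongr
        have : 0 ≤ S' * (1 / ((1 / X) ^ 2 + t ^ 2)) := by positivity
        linarith
    rw [mul_left_comm, norm_mul]
    set J := (1 + ‖t‖) ^ (-(9 / 8) : ℝ)
    have hJ0 : 0 ≤ J := by positivity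
    refine mul_le_mul hexp (h2.trans ?_) (norm_nonneg _) (by norm_num)
    calc N * (24 * farConst ^ 2 * X ^ (1 / 2 : ℝ) * J + 22 * (1 / ((1 / X) ^ 2 + t ^ 2)))
        = N * (24 * farConst ^ 2 * X ^ (1 / 2 : ℝ) * J) +
          22 * (N * (1 / ((1 / X) ^ 2 + t ^ 2))) := by ring
      _ ≤ S * (24 * farConst ^ 2 * X ^ (1 / 2 : ℝ) * J) +
          22 * (S' * (1 / ((1 / X) ^ 2 + t ^ 2)) + 2 * S * (1 / (τ ^ 2 + t ^ 2))) := by gcongr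
      _ = _ := by ring
  refine (norm_integral_le_integral_norm _).trans
    ((integral_le_of_le hmaj (fun t => norm_nonneg _) hpt).trans ?_)
  rw [integral_const_mul, hIv]
  set Y := X ^ (1 + (1 - δ / 16) * α) with hY
  have hY0 : 0 ≤ Y := by positivity
  have b1 : X ^ ((1 + δ / 16) * α) * X ^ (1 / 2 : ℝ) ≤ Y := by
    rw [← rpow_add hX]
    exact rpow_le_rpow_of_exponent_le (by linarith) (by nlinarith)
  have b2 : X ^ ((1 - δ + δ / 4 + δ / 16) * α) * X ≤ Y := by
    nth_rw 2 [← rpow_one X]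
    rw [← rpow_add hX]
    exact rpow_le_rpow_of_exponent_le (by linarith) (by nlinarith)
  have b3 : X ^ ((1 + δ / 16) * α) * τ⁻¹ ≤ Y := by
    rw [hτ, ← rpow_neg hX.le, ← rpow_add hX]
    exact rpow_le_rpow_of_exponent_le (by linarith) (by nlinarith)
  calc 3 * (S * (24 * farConst ^ 2 * X ^ (1 / 2 : ℝ)) * bracketInt +
        (22 * S' * (π / (1 / X)) + 44 * S * (π / τ)))
      = growthConst C₀ * (72 * farConst ^ 2 * bracketInt *
          (X ^ ((1 + δ / 16) * α) * X ^ (1 / 2 : ℝ)) +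
        (66 * π * (X ^ ((1 - δ + δ / 4 + δ / 16) * α) * X) +
          132 * π * (X ^ ((1 + δ / 16) * α) * τ⁻¹))) := by
        rw [hS, hS']; field_simp; ring
    _ ≤ growthConst C₀ * (72 * farConst ^ 2 * bracketInt * Y +
        (66 * π * Y + 132 * π * Y)) := by gcongr
    _ = growthConst C₀ * (72 * farConst ^ 2 * bracketInt + 198 * π) * Y := by ring
    _ ≤ coreConst C₀ * Y := by
        unfold coreConst
        gcongr
        nlinarith [mul_nonneg (sq_nonneg farConst) hJ]

/-- The mean value `e^{-L} ∑_{n ≤ e^L} G(n)`. -/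
def _root_.CharSum.meanTo (G : ℕ → ℂ) (L : ℝ) : ℂ :=
  (∑ n ∈ Icc 1 ⌊exp L⌋₊, G n) * exp (-L)

lemma _root_.CharSum.le_of_sq_mul_le {X a B c e : ℝ} (hX : 1 ≤ X) (hB : 0 ≤ B) (he : 0 ≤ e)
    (h : X ^ 2 * a ≤ c * B * X + c * B * X ^ (1 + e)) (hc : 0 ≤ c) :
    a ≤ 2 * c * B * X ^ (-1 + e) := by
  have hX0 : 0 < X := by linarith
  have h1 : X ≤ X ^ (1 + e) := by
    nth_rw 1 [← rpow_one X]
    exact rpow_le_rpow_of_exponent_le hX (by linarith)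
  have h2 : X ^ 2 * X ^ (-1 + e) = X ^ (1 + e) := by
    rw [← rpow_two, ← rpow_add hX0]; ring_nf
  have h3 : X ^ 2 * a ≤ X ^ 2 * (2 * c * B * X ^ (-1 + e)) := by
    calc X ^ 2 * a ≤ c * B * X + c * B * X ^ (1 + e) := h
      _ ≤ c * B * X ^ (1 + e) + c * B * X ^ (1 + e) := by gcongr
      _ = 2 * c * B * X ^ (1 + e) := by ring
      _ = _ := by rw [← h2]; ring
  exact le_of_mul_le_mul_left h3 (by positivity)

theorem norm_meanTo_le (h : CoreHyp G c₀ α X E E' ε₀ (δ / 16) C₀) (hδ1 : δ ≤ 1)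
    (hc₀ : c₀.re ≤ (1 - δ) * α) :
    ‖meanTo G X‖ ≤ 2 * (coreConst C₀ + 22) * X ^ (-1 + (1 - δ / 16) * α) := by
  have hX3 := h.three_le
  have hX : 0 < X := by linarith
  have h1 := norm_sum_sub_perronInt_le (G := G) h.norm_le (X := X) (L := X) (by linarith)
    (by linarith) le_rfl
  have h2 := h.norm_perronInt_le hδ1 hc₀
  rw [sub_self, add_zero, mul_one] at h1
  change ‖_ * meanTo G X - _‖ ≤ _ at h1
  have h3 := norm_le_insert' ((X : ℂ) ^ 2 * meanTo G X) ((((2 * π)⁻¹ : ℝ) : ℂ) * perronInt G X X)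
  have hpi := norm_two_pi_inv_le
  have h4 : ‖(((2 * π)⁻¹ : ℝ) : ℂ) * perronInt G X X‖ ≤ ‖perronInt G X X‖ := by
    rw [norm_mul]; exact mul_le_of_le_one_left (norm_nonneg _) hpi
  rw [norm_mul, norm_pow, norm_real, norm_of_nonneg hX.le] at h3
  have := coreConst_nonneg C₀
  have h5 := le_of_sq_mul_le (X := X) (a := ‖meanTo G X‖) (B := 1) (c := coreConst C₀ + 22)
    (e := (1 - δ / 16) * α) (by linarith) zero_le_one
    (mul_nonneg (by linarith) h.alpha_nonneg) (by
      have : 0 ≤ X ^ (1 + (1 - δ / 16) * α) := by positivity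
      have : 0 ≤ coreConst C₀ * X := by positivity
      linarith) (by linarith)
  simpa using h5

theorem norm_meanTo_sub_le (h : CoreHyp G c₀ α X E E' ε₀ (δ / 16) C₀) (hδ1 : δ ≤ 1) {L : ℝ}
    (hXL : X / 2 ≤ L) (hL : L ≤ X) :
    ‖meanTo G L - meanTo G X‖ ≤
      2 * (coreConst C₀ + 22) * (1 + (X - L)) * X ^ (-1 + (1 - δ / 16) * α) := by
  have hX3 := h.three_le
  have hX : 0 < X := by linarith
  have h1 := norm_sum_sub_perronInt_le (G := G) h.norm_le (X := X) (L := X) (by linarith)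
    (by linarith) le_rfl
  have h1' := norm_sum_sub_perronInt_le (G := G) h.norm_le (X := X) (L := L) (by linarith)
    hXL hL
  have h2 := h.norm_perronInt_sub_le hδ1 hL
  rw [sub_self, add_zero, mul_one] at h1
  change ‖_ * meanTo G X - _‖ ≤ _ at h1
  change ‖_ * meanTo G L - _‖ ≤ _ at h1'
  have hpi := norm_two_pi_inv_le
  set κ := (((2 * π)⁻¹ : ℝ) : ℂ)
  have h4 : ‖κ * (perronInt G X L - perronInt G X X)‖ ≤ ‖perronInt G X L - perronInt G X X‖ := by
    rw [norm_mul]; exact mul_le_of_le_one_left (norm_nonneg _) hpi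
  have e : (X : ℂ) ^ 2 * (meanTo G L - meanTo G X) =
      ((X : ℂ) ^ 2 * meanTo G L - κ * perronInt G X L) -
      ((X : ℂ) ^ 2 * meanTo G X - κ * perronInt G X X) +
      κ * (perronInt G X L - perronInt G X X) := by ring
  have h3 : X ^ 2 * ‖meanTo G L - meanTo G X‖ ≤ 11 * X * (1 + (X - L)) + 11 * X +
      coreConst C₀ * (1 + (X - L)) * X ^ (1 + (1 - δ / 16) * α) := by
    have : ‖(X : ℂ) ^ 2 * (meanTo G L - meanTo G X)‖ = X ^ 2 * ‖meanTo G L - meanTo G X‖ := by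
      rw [norm_mul, norm_pow, norm_real, norm_of_nonneg hX.le]
    rw [← this, e]
    exact (norm_add_le _ _).trans (add_le_add ((norm_sub_le _ _).trans (add_le_add h1' h1))
      (h4.trans h2))
  have hc := coreConst_nonneg C₀
  have hΔ : 0 ≤ X - L := by linarith
  exact le_of_sq_mul_le (by linarith) (by linarith)
    (mul_nonneg (by linarith) h.alpha_nonneg) (h3.trans (by
      have : 0 ≤ (1 + (X - L)) * X ^ (1 + (1 - δ / 16) * α) := by positivity
      have : 0 ≤ coreConst C₀ * (1 + (X - L)) * X := by positivity
      have : 0 ≤ (X - L) * X := by positivity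
      linarith)) (by linarith)

end CoreHyp

lemma periodic_of_dvd {S : Type*} {n N : ℕ} (h : n ∣ N) {F : ℕ → S} (hF : Periodic F n) :
    Periodic F N := by
  obtain ⟨t, rfl⟩ := h
  rw [mul_comm]
  exact hF.nat_mul t

lemma periodic_val_castHom {S : Type*} {m N : ℕ} (h : m ∣ N) [NeZero m] [NeZero N] {F : ℕ → S}
    (hF : Periodic F m) (x : ZMod N) :
    F x.val = F (ZMod.castHom h (ZMod m) x).val := by
  rw [← hF.map_mod_nat]
  congr 1
  conv_rhs => rw [← ZMod.natCast_zmod_val x]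
  rw [map_natCast, ZMod.val_natCast]

section UnitAverages

variable {R : Type*} [Field R]

/-- The average of `F` over the residues modulo `n` that are coprime to `n`. -/
def unitAvg (n : ℕ) (F : ℕ → R) : R :=
  (n.totient : R)⁻¹ * ∑ a ∈ range n with n.Coprime a, F a

lemma sum_coprime_eq_sum_units (n : ℕ) [NeZero n] (F : ℕ → R) :
    ∑ a ∈ range n with n.Coprime a, F a = ∑ u : (ZMod n)ˣ, F (u : ZMod n).val := by
  symm
  refine sum_bij (fun u _ => (u : ZMod n).val) ?_ ?_ ?_ ?_
  · intro u _
    simp only [mem_filter, mem_range]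
    exact ⟨ZMod.val_lt _, (ZMod.val_coe_unit_coprime u).symm⟩
  · intro u _ v _ huv
    exact Units.ext (ZMod.val_injective n huv)
  · intro a ha
    simp only [mem_filter, mem_range] at ha
    refine ⟨ZMod.unitOfCoprime a ha.2.symm, mem_univ _, ?_⟩
    rw [ZMod.coe_unitOfCoprime, ZMod.val_natCast, Nat.mod_eq_of_lt ha.1]
  · intro u _
    rfl

lemma unitAvg_eq_sum_units (n : ℕ) [NeZero n] (F : ℕ → R) :
    unitAvg n F = (n.totient : R)⁻¹ * ∑ u : (ZMod n)ˣ, F (u : ZMod n).val := by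
  rw [unitAvg, sum_coprime_eq_sum_units]

lemma unitAvg_one (n : ℕ) [CharZero R] (hn : 0 < n) : unitAvg n (fun _ => (1 : R)) = 1 := by
  have h : (n.totient : R) ≠ 0 := mod_cast (totient_pos.2 hn).ne'
  rw [unitAvg, sum_const, nsmul_eq_mul, mul_one, ← Nat.totient]
  exact inv_mul_cancel₀ h

lemma unitAvg_sub (n : ℕ) (F G : ℕ → R) :
    unitAvg n (fun a => F a - G a) = unitAvg n F - unitAvg n G := by
  unfold unitAvg
  rw [sum_sub_distrib, mul_sub]

lemma unitAvg_mul {m n : ℕ} (hm : 0 < m) (hn : 0 < n) (h : Coprime m n) {F G : ℕ → R}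
    (hF : Periodic F m) (hG : Periodic G n) :
    unitAvg (m * n) (fun a => F a * G a) = unitAvg m F * unitAvg n G := by
  have : NeZero m := ⟨hm.ne'⟩
  have : NeZero n := ⟨hn.ne'⟩
  have : NeZero (m * n) := ⟨(Nat.mul_pos hm hn).ne'⟩
  simp only [unitAvg_eq_sum_units]
  have e : ∑ u : (ZMod (m * n))ˣ, F (u : ZMod (m * n)).val * G (u : ZMod (m * n)).val =
      (∑ u : (ZMod m)ˣ, F (u : ZMod m).val) * ∑ v : (ZMod n)ˣ, G (v : ZMod n).val := by
    rw [sum_mul_sum, ← sum_product', univ_product_univ]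
    refine Fintype.sum_equiv (unitsCRT h).toEquiv _ _ fun u => ?_
    have h1 := unitsCRT_fst h u
    have h2 := unitsCRT_snd h u
    change _ = F ((unitsCRT h u).1 : ZMod m).val * G ((unitsCRT h u).2 : ZMod n).val
    rw [h1, h2, ← periodic_val_castHom _ hF, ← periodic_val_castHom _ hG]
  rw [e, Nat.totient_mul h, Nat.cast_mul, mul_inv]
  ring

lemma unitAvg_of_dvd [CharZero R] {n N : ℕ} (hN : 0 < N) (hnN : n ∣ N) {F : ℕ → R}
    (hF : Periodic F n) : unitAvg N F = unitAvg n F := by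
  have : NeZero N := ⟨hN.ne'⟩
  have hn : 0 < n := Nat.pos_of_dvd_of_pos hnN hN
  have : NeZero n := ⟨hn.ne'⟩
  simp only [unitAvg_eq_sum_units]
  have hs := ZMod.unitsMap_surjective hnN
  have hfib : ∀ v : (ZMod n)ˣ, ((univ.filter fun u : (ZMod N)ˣ =>
      ZMod.unitsMap hnN u = v).card) =
      ((univ.filter fun u : (ZMod N)ˣ => ZMod.unitsMap hnN u = 1).card) := fun v =>
    MonoidHom.card_fiber_eq_of_mem_range (ZMod.unitsMap hnN) (hs v) (hs 1)
  set c := (univ.filter fun u : (ZMod N)ˣ => ZMod.unitsMap hnN u = 1).card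
  have e1 : ∑ u : (ZMod N)ˣ, F (u : ZMod N).val =
      (c : R) * ∑ v : (ZMod n)ˣ, F (v : ZMod n).val := by
    rw [← sum_fiberwise univ (ZMod.unitsMap hnN), mul_sum]
    refine sum_congr rfl fun v _ => ?_
    rw [← hfib v, ← nsmul_eq_mul]
    refine sum_eq_card_nsmul fun u hu => ?_
    rw [mem_filter] at hu
    rw [periodic_val_castHom hnN hF, ← hu.2]
    rfl
  have e2 : N.totient = c * n.totient := by
    rw [← ZMod.card_units_eq_totient N, ← ZMod.card_units_eq_totient n,
      ← card_univ, ← card_univ, card_eq_sum_card_fiberwise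
      (f := ZMod.unitsMap hnN) (t := univ) (fun _ _ => mem_coe.2 (mem_univ _)),
      sum_congr rfl (fun v _ => hfib v), sum_const, smul_eq_mul, mul_comm]
  have hφ : (N.totient : R) ≠ 0 := mod_cast (totient_pos.2 hN).ne'
  rw [e1, e2, Nat.cast_mul] at *
  have h1 := left_ne_zero_of_mul hφ
  have h2 := right_ne_zero_of_mul hφ
  field_simp

lemma periodic_mul_prod {m : ℕ} {S : Finset ℕ} {F : ℕ → R} {g : ℕ → ℕ → R}
    (hF : Periodic F m) (hg : ∀ ℓ ∈ S, Periodic (g ℓ) ℓ) :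
    Periodic (fun a => F a * ∏ ℓ ∈ S, g ℓ a) (m * ∏ ℓ ∈ S, ℓ) := by
  intro a
  beta_reduce
  rw [periodic_of_dvd (dvd_mul_right _ _) hF a]
  congr 1
  exact prod_congr rfl fun ℓ hℓ =>
    periodic_of_dvd ((dvd_prod_of_mem _ hℓ).trans (dvd_mul_left _ _)) (hg ℓ hℓ) a

lemma coprime_mul_prod {m : ℕ} {S : Finset ℕ} {p : ℕ} (hp : p.Prime) (hpm : Coprime m p)
    (hS : ∀ ℓ ∈ S, ℓ.Prime) (hpS : p ∉ S) : Coprime (m * ∏ ℓ ∈ S, ℓ) p := by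
  refine Nat.Coprime.mul_left hpm (Nat.Coprime.prod_left fun ℓ hℓ => ?_)
  exact (Nat.coprime_primes (hS ℓ hℓ) hp).mpr fun h => hpS (h ▸ hℓ)

lemma unitAvg_mul_prod {m : ℕ} (hm : 0 < m) {S : Finset ℕ} (hS : ∀ ℓ ∈ S, ℓ.Prime)
    (hmS : ∀ ℓ ∈ S, Coprime m ℓ) {F : ℕ → R} {g : ℕ → ℕ → R}
    (hF : Periodic F m) (hg : ∀ ℓ ∈ S, Periodic (g ℓ) ℓ) :
    unitAvg (m * ∏ ℓ ∈ S, ℓ) (fun a => F a * ∏ ℓ ∈ S, g ℓ a) =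
      unitAvg m F * ∏ ℓ ∈ S, unitAvg ℓ (g ℓ) := by
  induction S using Finset.induction_on with
  | empty => simp
  | insert p S hp ih =>
    have hS' : ∀ ℓ ∈ S, ℓ.Prime := fun ℓ hℓ => hS ℓ (mem_insert_of_mem hℓ)
    have hpp := hS p (mem_insert_self _ _)
    have hg' : ∀ ℓ ∈ S, Periodic (g ℓ) ℓ := fun ℓ hℓ => hg ℓ (mem_insert_of_mem hℓ)
    have hmp := hmS p (mem_insert_self _ _)
    simp only [prod_insert hp]
    have e : (fun a => F a * (g p a * ∏ ℓ ∈ S, g ℓ a)) =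
        fun a => (F a * ∏ ℓ ∈ S, g ℓ a) * g p a := by
      funext a
      ring
    rw [e, show m * (p * ∏ ℓ ∈ S, ℓ) = (m * ∏ ℓ ∈ S, ℓ) * p by ring,
      unitAvg_mul (Nat.mul_pos hm (prod_pos fun ℓ hℓ => (hS' ℓ hℓ).pos)) hpp.pos
        (coprime_mul_prod hpp hmp hS' hp) (periodic_mul_prod hF hg')
        (hg p (mem_insert_self _ _)),
      ih hS' (fun ℓ hℓ => hmS ℓ (mem_insert_of_mem hℓ)) hg']
    ring

end UnitAverages

/-- Dirichlet series of `b Λ` for a function `b` supported on reduced residues: the deviation from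
the main term is controlled by that of the individual residue classes. -/
lemma norm_LSeries_periodic_sub_le {m : ℕ} (hm : 0 < m) {b : ℕ → ℂ} (hb : Periodic b m)
    (a : ℕ) {s : ℂ} (hs : 1 < s.re) {z : ℂ} {B : ℝ}
    (h : ∀ u : (ZMod m)ˣ, ‖residueLam (u : ZMod m) a s - (1 / (m.totient : ℂ)) * z‖ ≤ B) :
    ‖LSeries (logMul^[a] fun n => if m.Coprime n then
        b n * Λ n else 0) s - unitAvg m b * z‖ ≤
      (∑ c ∈ range m with m.Coprime c, ‖b c‖) * B := by
  have : NeZero m := ⟨hm.ne'⟩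
  have hval : ∀ (u : (ZMod m)ˣ) (n : ℕ), (n : ZMod m) = u → b n = b (u : ZMod m).val := by
    intro u n h
    rw [← h, ZMod.val_natCast, hb.map_mod_nat]
  have e : (logMul^[a] fun n => if m.Coprime n then
      b n * Λ n else 0) =
      ∑ u : (ZMod m)ˣ, b (u : ZMod m).val • logMul^[a] (fun n => if (n : ZMod m) = u then
        (Λ n : ℂ) else 0) := by
    funext n
    simp only [logMul_iterate, Finset.sum_apply, Pi.smul_apply, smul_eq_mul]
    split_ifs with hn
    · rw [sum_eq_single (ZMod.unitOfCoprime n hn.symm)]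
      · rw [if_pos (by simp), hval (ZMod.unitOfCoprime n hn.symm) n (by simp)]
        ring
      · intro u _ hu
        rw [if_neg, mul_zero, mul_zero]
        intro h'
        exact hu (Units.ext (by simp [h']))
      · simp
    · rw [mul_zero, sum_eq_zero]
      intro u _
      rw [if_neg, mul_zero, mul_zero]
      intro h'
      exact hn (Nat.Coprime.symm ((ZMod.isUnit_iff_coprime n m).mp (h' ▸ u.isUnit)))
  have hsum : ∀ u : (ZMod m)ˣ, LSeriesSummable (b (u : ZMod m).val • logMul^[a] (fun n =>
      if (n : ZMod m) = u then (Λ n : ℂ) else 0)) s := by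
    intro u
    refine LSeriesSummable.smul _ (summable_logMul_iterate ?_ a hs)
    refine abscissa_le_one_of_vonMangoldt (M := 1) fun n => ?_
    split_ifs <;> simp [vonMangoldt_nonneg, abs_of_nonneg]
  rw [e, LSeries_sum (fun u _ => hsum u), unitAvg_eq_sum_units, sum_coprime_eq_sum_units m
    (fun c => ‖b c‖), sum_mul, mul_assoc, sum_mul, mul_sum,
    ← sum_sub_distrib]
  refine (norm_sum_le _ _).trans (sum_le_sum fun u _ => ?_)
  rw [LSeries_smul]
  have e3 : b (u : ZMod m).val * LSeries (logMul^[a] (fun n => if (n : ZMod m) = u then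
      (Λ n : ℂ) else 0)) s - (m.totient : ℂ)⁻¹ * (b (u : ZMod m).val * z)
      = b (u : ZMod m).val * (residueLam (u : ZMod m) a s - (1 / (m.totient : ℂ)) * z) := by
    rw [residueLam]
    ring
  rw [e3, norm_mul]
  exact mul_le_mul_of_nonneg_left (h u) (norm_nonneg _)

/-- The indicator function of the integers at which `P` vanishes modulo `ℓ`. -/
def rootInd (R : Type*) [Field R] (P : ℤ[X]) (ℓ n : ℕ) : R :=
  if (ℓ : ℤ) ∣ P.eval (n : ℤ) then 1 else 0

/-- The proportion of reduced residues modulo `ℓ` at which `P` vanishes. -/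
def rootDensity (P : ℤ[X]) (ℓ : ℕ) : ℝ := unitAvg ℓ (rootInd ℝ P ℓ)

lemma periodic_dvd_eval (P : ℤ[X]) (ℓ : ℕ) (n : ℕ) :
    (ℓ : ℤ) ∣ P.eval ((n + ℓ : ℕ) : ℤ) ↔ (ℓ : ℤ) ∣ P.eval (n : ℤ) := by
  have h : (((n + ℓ : ℕ) : ℤ) - (n : ℤ)) ∣ P.eval ((n + ℓ : ℕ) : ℤ) - P.eval (n : ℤ) :=
    Polynomial.sub_dvd_eval_sub _ _ _
  rw [show ((n + ℓ : ℕ) : ℤ) - (n : ℤ) = ℓ by push_cast; ring] at h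
  exact (dvd_iff_dvd_of_dvd_sub h)

lemma periodic_rootInd (R : Type*) [Field R] (P : ℤ[X]) (ℓ : ℕ) :
    Periodic (rootInd R P ℓ) ℓ := fun n => by
  simp only [rootInd, periodic_dvd_eval]

lemma rootInd_nonneg (P : ℤ[X]) (ℓ n : ℕ) : 0 ≤ rootInd ℝ P ℓ n := by
  unfold rootInd
  split_ifs <;> norm_num

lemma norm_rootInd (P : ℤ[X]) (ℓ n : ℕ) : ‖rootInd ℂ P ℓ n‖ = rootInd ℝ P ℓ n := by
  unfold rootInd
  split_ifs <;> norm_num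

lemma ofReal_unitAvg (n : ℕ) (F : ℕ → ℝ) :
    ((unitAvg n F : ℝ) : ℂ) = unitAvg n fun a => ((F a : ℝ) : ℂ) := by
  simp [unitAvg]

lemma ofReal_rootDensity (P : ℤ[X]) (ℓ : ℕ) :
    ((rootDensity P ℓ : ℝ) : ℂ) = unitAvg ℓ (rootInd ℂ P ℓ) := by
  rw [rootDensity, ofReal_unitAvg]
  congr 1
  funext a
  simp only [rootInd]
  split_ifs <;> simp

/-- The number of reduced residues times the density of roots is at most the degree. -/
lemma totient_mul_rootDensity_le {P : ℤ[X]} {ℓ : ℕ} (hℓ : ℓ.Prime)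
    (h : ∃ a : ℕ, ¬ (ℓ : ℤ) ∣ P.eval (a : ℤ)) :
    (ℓ.totient : ℝ) * rootDensity P ℓ ≤ P.natDegree := by
  have : Fact ℓ.Prime := ⟨hℓ⟩
  have hφ : (ℓ.totient : ℝ) ≠ 0 := mod_cast (totient_pos.2 hℓ.pos).ne'
  rw [rootDensity, unitAvg, mul_inv_cancel_left₀ hφ]
  have heval : ∀ a : ℕ, (ℓ : ℤ) ∣ P.eval (a : ℤ) ↔
      (P.map (Int.castRingHom (ZMod ℓ))).eval (a : ZMod ℓ) = 0 := by
    intro a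
    rw [← ZMod.intCast_zmod_eq_zero_iff_dvd, ← Int.cast_natCast (R := ZMod ℓ) a,
      ← eq_intCast (Int.castRingHom (ZMod ℓ)) (a : ℤ), Polynomial.eval_map_apply]
    rfl
  have hne : P.map (Int.castRingHom (ZMod ℓ)) ≠ 0 := by
    obtain ⟨a, ha⟩ := h
    intro h0
    exact ha ((heval a).mpr (by rw [h0, Polynomial.eval_zero]))
  simp only [rootInd]
  rw [sum_ite, sum_const_zero, add_zero, sum_const, nsmul_eq_mul, mul_one]
  norm_cast
  calc _ ≤ (P.map (Int.castRingHom (ZMod ℓ))).roots.toFinset.card := by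
        refine card_le_card_of_injOn (fun a => (a : ZMod ℓ)) ?_ ?_
        · intro a ha
          simp only [coe_filter, Set.mem_ofPred_eq, mem_filter] at ha
          simp only [mem_coe, Multiset.mem_toFinset, Polynomial.mem_roots hne,
            Polynomial.IsRoot.def]
          exact (heval a).mp ha.2
        · intro a ha b hb hab
          simp only [coe_filter, Set.mem_ofPred_eq, mem_filter,
            mem_range] at ha hb
          have := (ZMod.natCast_eq_natCast_iff' a b ℓ).mp hab
          rwa [Nat.mod_eq_of_lt ha.1.1, Nat.mod_eq_of_lt hb.1.1] at this
    _ ≤ (P.map (Int.castRingHom (ZMod ℓ))).roots.card := Multiset.toFinset_card_le _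
    _ ≤ (P.map (Int.castRingHom (ZMod ℓ))).natDegree := Polynomial.card_roots' _
    _ ≤ P.natDegree := Polynomial.natDegree_map_le

lemma rootDensity_nonneg (P : ℤ[X]) (ℓ : ℕ) : 0 ≤ rootDensity P ℓ := by
  unfold rootDensity unitAvg
  exact mul_nonneg (by positivity) (sum_nonneg fun a _ => rootInd_nonneg P ℓ a)

lemma one_sub_rootDensity {P : ℤ[X]} {ℓ : ℕ} (hℓ : 0 < ℓ) :
    1 - rootDensity P ℓ = unitAvg ℓ (fun a => 1 - rootInd ℝ P ℓ a) := by
  rw [unitAvg_sub, unitAvg_one ℓ hℓ, rootDensity]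

lemma inv_totient_le_unitAvg {n : ℕ} {F : ℕ → ℝ} (hF : ∀ a, 0 ≤ F a) {a : ℕ} (hn : 0 < n)
    (hper : Periodic F n) (ha : n.Coprime a) (h1 : 1 ≤ F a) :
    (n.totient : ℝ)⁻¹ ≤ unitAvg n F := by
  unfold unitAvg
  refine le_mul_of_one_le_right (by positivity) ?_
  have hmem : a % n ∈ filter (fun a => n.Coprime a) (range n) := by
    rw [mem_filter, mem_range]
    refine ⟨Nat.mod_lt _ hn, ?_⟩
    rw [Nat.coprime_iff_gcd_eq_one, Nat.gcd_comm, ← Nat.gcd_rec]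
    exact ha
  refine le_trans ?_ (single_le_sum (fun b _ => hF b) hmem)
  rwa [hper.map_mod_nat]

/-- The sieving setup: a modulus `m`, a finite set `T` of primes coprime to `m`, and a polynomial
which has a unit value at a unit modulo each prime in `T`. -/
structure SieveData (P : ℤ[X]) (m : ℕ) (T : Finset ℕ) : Prop where
  pos : 0 < m
  prime : ∀ ℓ ∈ T, ℓ.Prime
  coprime : ∀ ℓ ∈ T, Coprime m ℓ
  unit : ∀ ℓ ∈ T, ∃ a : ℕ, ℓ.Coprime a ∧ ¬ (ℓ : ℤ) ∣ P.eval (a : ℤ)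

namespace SieveData

variable {P : ℤ[X]} {m : ℕ} {T : Finset ℕ}

lemma mono (h : SieveData P m T) {S : Finset ℕ} (hS : S ⊆ T) : SieveData P m S :=
  ⟨h.pos, fun ℓ hℓ => h.prime ℓ (hS hℓ), fun ℓ hℓ => h.coprime ℓ (hS hℓ),
    fun ℓ hℓ => h.unit ℓ (hS hℓ)⟩

lemma modulus_pos (h : SieveData P m T) : 0 < m * ∏ ℓ ∈ T, ℓ :=
  Nat.mul_pos h.pos (prod_pos fun ℓ hℓ => (h.prime ℓ hℓ).pos)

lemma density_le (h : SieveData P m T) {ℓ : ℕ} (hℓ : ℓ ∈ T) :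
    (ℓ.totient : ℝ) * rootDensity P ℓ ≤ P.natDegree := by
  obtain ⟨a, -, ha⟩ := h.unit ℓ hℓ
  exact totient_mul_rootDensity_le (h.prime ℓ hℓ) ⟨a, ha⟩

lemma le_one_sub_density (h : SieveData P m T) {ℓ : ℕ} (hℓ : ℓ ∈ T) :
    (ℓ.totient : ℝ)⁻¹ ≤ 1 - rootDensity P ℓ := by
  obtain ⟨a, ha1, ha⟩ := h.unit ℓ hℓ
  rw [one_sub_rootDensity (h.prime ℓ hℓ).pos]
  refine inv_totient_le_unitAvg (a := a) (fun b => ?_) (h.prime ℓ hℓ).pos ?_ ha1 ?_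
  · unfold rootInd
    split_ifs <;> norm_num
  · intro b
    simp only [periodic_rootInd ℝ P ℓ b]
  · simp [rootInd, ha]

/-- The sum of the sieved function over the reduced residues. -/
lemma sum_norm_le (h : SieveData P m T) {h₀ : ℕ → ℂ} (hper : Periodic h₀ m)
    (hle : ∀ n, ‖h₀ n‖ ≤ 1) :
    ∑ c ∈ range (m * ∏ ℓ ∈ T, ℓ) with (m * ∏ ℓ ∈ T, ℓ).Coprime c,
      ‖h₀ c * ∏ ℓ ∈ T, rootInd ℂ P ℓ c‖ ≤ m * (P.natDegree : ℝ) ^ T.card := by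
  have e : ∑ c ∈ range (m * ∏ ℓ ∈ T, ℓ) with (m * ∏ ℓ ∈ T, ℓ).Coprime c,
      ‖h₀ c * ∏ ℓ ∈ T, rootInd ℂ P ℓ c‖ = ((m * ∏ ℓ ∈ T, ℓ).totient : ℝ) *
        unitAvg (m * ∏ ℓ ∈ T, ℓ) (fun c => ‖h₀ c‖ * ∏ ℓ ∈ T, rootInd ℝ P ℓ c) := by
    have hφ : ((m * ∏ ℓ ∈ T, ℓ).totient : ℝ) ≠ 0 := by
      exact_mod_cast (totient_pos.2 h.modulus_pos).ne'
    rw [unitAvg, mul_inv_cancel_left₀ hφ]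
    simp only [norm_mul, norm_prod, norm_rootInd]
  have hco : Coprime m (∏ ℓ ∈ T, ℓ) := Nat.Coprime.prod_right h.coprime
  have htot : ∀ S ⊆ T, (∏ ℓ ∈ S, ℓ).totient = ∏ ℓ ∈ S, ℓ.totient := by
    intro S
    induction S using Finset.induction_on with
    | empty => simp
    | insert p S hp ih =>
      intro hS
      rw [prod_insert hp, prod_insert hp, Nat.totient_mul, ih
        ((subset_insert _ _).trans hS)]
      refine Nat.Coprime.prod_right fun ℓ hℓ => ?_
      refine (Nat.coprime_primes (h.prime p (hS (mem_insert_self _ _)))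
        (h.prime ℓ (hS (mem_insert_of_mem hℓ)))).mpr ?_
      rintro rfl
      exact hp hℓ
  have hper' : Periodic (fun c => ‖h₀ c‖) m := fun c => by simp only [hper c]
  rw [e, unitAvg_mul_prod h.pos h.prime h.coprime hper' (fun ℓ _ => periodic_rootInd ℝ P ℓ),
    Nat.totient_mul hco, htot T subset_rfl, Nat.cast_mul, Nat.cast_prod,
    mul_mul_mul_comm, ← prod_mul_distrib]
  have h1 : (m.totient : ℝ) * unitAvg m (fun c => ‖h₀ c‖) ≤ m := by
    have hφ : (m.totient : ℝ) ≠ 0 := mod_cast (totient_pos.2 h.pos).ne'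
    rw [unitAvg, mul_inv_cancel_left₀ hφ]
    refine (sum_le_card_nsmul _ _ 1 fun c _ => hle c).trans ?_
    rw [nsmul_eq_mul, mul_one]
    exact_mod_cast (card_filter_le _ _).trans (card_range m).le
  have h2 : ∏ ℓ ∈ T, ((ℓ.totient : ℝ) * rootDensity P ℓ) ≤ (P.natDegree : ℝ) ^ T.card :=
    (prod_le_prod (fun ℓ _ => mul_nonneg (by positivity) (rootDensity_nonneg P ℓ))
      fun ℓ hℓ => h.density_le hℓ).trans_eq (prod_const _)
  refine mul_le_mul h1 h2 (prod_nonneg fun ℓ _ => mul_nonneg (by positivity)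
    (rootDensity_nonneg P ℓ)) (by positivity)

lemma sum_powerset_unitAvg (h : SieveData P m T) {h₀ : ℕ → ℂ} (hper : Periodic h₀ m) :
    ∑ S ∈ T.powerset, (-1) ^ S.card * unitAvg (m * ∏ ℓ ∈ S, ℓ)
      (fun c => h₀ c * ∏ ℓ ∈ S, rootInd ℂ P ℓ c) =
    unitAvg m h₀ * ((∏ ℓ ∈ T, (1 - rootDensity P ℓ) : ℝ) : ℂ) := by
  have e : ((∏ ℓ ∈ T, (1 - rootDensity P ℓ) : ℝ) : ℂ) =
      ∑ S ∈ T.powerset, ∏ ℓ ∈ S, (-(rootDensity P ℓ : ℂ)) := by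
    rw [← prod_one_add]
    push_cast
    simp only [sub_eq_add_neg]
  rw [e, mul_sum]
  refine sum_congr rfl fun S hS => ?_
  have h' := h.mono (mem_powerset.1 hS)
  rw [unitAvg_mul_prod h'.pos h'.prime h'.coprime hper (fun ℓ _ => periodic_rootInd ℂ P ℓ),
    prod_neg]
  simp only [ofReal_rootDensity]
  ring

lemma prod_one_sub_rootInd (n : ℕ) :
    ∏ ℓ ∈ T, (1 - rootInd ℂ P ℓ n) =
      ∑ S ∈ T.powerset, (-1) ^ S.card * ∏ ℓ ∈ S, rootInd ℂ P ℓ n := by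
  simp only [sub_eq_add_neg, prod_one_add, prod_neg]

lemma quadCount_le (h : SieveData P m T) :
    (quadCount (m * ∏ ℓ ∈ T, ℓ) : ℝ) ≤ m * 2 ^ T.card := by
  have key : ∀ S ⊆ T, quadCount (m * ∏ ℓ ∈ S, ℓ) ≤ m * 2 ^ S.card := by
    intro S
    induction S using Finset.induction_on with
    | empty =>
      intro _
      have : NeZero m := ⟨h.pos.ne'⟩
      simpa using CharSum.quadCount_le m
    | insert p S hp ih =>
      intro hS
      have hS' := (subset_insert p S).trans hS
      have hpT := hS (mem_insert_self _ _)
      have hpp := h.prime p hpT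
      have : NeZero p := ⟨hpp.ne_zero⟩
      have : NeZero (m * ∏ ℓ ∈ S, ℓ) := ⟨(h.mono hS').modulus_pos.ne'⟩
      rw [prod_insert hp, card_insert_of_notMem hp, mul_left_comm, mul_comm p]
      refine (quadCount_mul_le (coprime_mul_prod hpp (h.coprime p hpT)
        (fun ℓ hℓ => h.prime ℓ (hS' hℓ)) hp)).trans ?_
      calc quadCount (m * ∏ ℓ ∈ S, ℓ) * quadCount p ≤ (m * 2 ^ S.card) * 2 :=
            Nat.mul_le_mul (ih hS') (quadCount_prime_le hpp)
        _ = m * 2 ^ (S.card + 1) := by ring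
  exact_mod_cast key T subset_rfl

lemma le_totient (h : SieveData P m T) :
    ((m * ∏ ℓ ∈ T, ℓ : ℕ) : ℝ) ≤ m * 2 ^ T.card * (m * ∏ ℓ ∈ T, ℓ).totient := by
  have key : ∀ S ⊆ T, m * ∏ ℓ ∈ S, ℓ ≤ m * 2 ^ S.card * (m * ∏ ℓ ∈ S, ℓ).totient := by
    intro S
    induction S using Finset.induction_on with
    | empty =>
      intro _
      simpa using Nat.le_mul_of_pos_right m (totient_pos.2 h.pos)
    | insert p S hp ih =>
      intro hS
      have hS' := (subset_insert p S).trans hS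
      have hpT := hS (mem_insert_self _ _)
      have hpp := h.prime p hpT
      rw [prod_insert hp, card_insert_of_notMem hp, mul_left_comm, mul_comm p,
        Nat.totient_mul (coprime_mul_prod hpp (h.coprime p hpT)
        (fun ℓ hℓ => h.prime ℓ (hS' hℓ)) hp), Nat.totient_prime hpp]
      have h2 : p ≤ 2 * (p - 1) := by have := hpp.two_le; omega
      calc (m * ∏ ℓ ∈ S, ℓ) * p ≤ (m * 2 ^ S.card * (m * ∏ ℓ ∈ S, ℓ).totient) * (2 * (p - 1)) :=
            Nat.mul_le_mul (ih hS') h2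
        _ = m * 2 ^ (S.card + 1) * ((m * ∏ ℓ ∈ S, ℓ).totient * (p - 1)) := by ring
  exact_mod_cast key T subset_rfl

end SieveData

/-- The error scale attached to a sieving setup. -/
def sieveError (C : ℝ) (D m N t : ℕ) (y : ℝ) : ℝ :=
  C * m ^ 3 * (4 + 4 * D) ^ t * log (N * (y + 4)) ^ 18

lemma one_le_log_conductor {N : ℕ} (hN : 1 ≤ N) {y : ℝ} (hy : 0 ≤ y) :
    1 ≤ log (N * (y + 4)) := by
  have hN' : (1 : ℝ) ≤ N := mod_cast hN
  rw [le_log_iff_exp_le (by positivity)]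
  have h1 := exp_one_lt_three
  nlinarith

namespace SieveData

variable {P : ℤ[X]} {m : ℕ} {T : Finset ℕ}

lemma dvd_modulus {S : Finset ℕ} (hS : S ⊆ T) : (m * ∏ ℓ ∈ S, ℓ) ∣ (m * ∏ ℓ ∈ T, ℓ) :=
  Nat.mul_dvd_mul_left _ (prod_dvd_prod_of_subset _ _ _ hS)

/-- The function with the sieve condition expanded. -/
def expanded (P : ℤ[X]) (m : ℕ) (T : Finset ℕ) (h₀ : ℕ → ℂ) (n : ℕ) : ℂ :=
  ∑ S ∈ T.powerset, (-1) ^ S.card * (if (m * ∏ ℓ ∈ S, ℓ).Coprime n then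
    (h₀ n * ∏ ℓ ∈ S, rootInd ℂ P ℓ n) * Λ n else 0)

lemma norm_expanded_le {h₀ : ℕ → ℂ} (hle : ∀ n, ‖h₀ n‖ ≤ 1) (n : ℕ) :
    ‖expanded P m T h₀ n‖ ≤ 2 ^ T.card * Λ n := by
  refine (norm_sum_le _ _).trans ?_
  rw [show (2 : ℝ) ^ T.card * Λ n =
    ∑ S ∈ T.powerset, Λ n by
    rw [sum_const, card_powerset, nsmul_eq_mul]; push_cast; ring]
  refine sum_le_sum fun S _ => ?_
  have hΛ := vonMangoldt_nonneg (n := n)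
  rw [norm_mul, norm_pow, norm_neg, norm_one, one_pow, one_mul]
  split_ifs
  · rw [norm_mul, norm_mul, norm_prod, norm_real, norm_of_nonneg hΛ]
    refine mul_le_of_le_one_left hΛ (mul_le_one₀ (hle n) (by positivity) ?_)
    refine prod_le_one (fun _ _ => norm_nonneg _) fun ℓ _ => ?_
    rw [norm_rootInd]
    unfold rootInd
    split_ifs <;> norm_num
  · simp [hΛ]

lemma expanded_prime {h₀ : ℕ → ℂ} {p : ℕ} (hp : (m * ∏ ℓ ∈ T, ℓ).Coprime p) :
    expanded P m T h₀ p =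
      h₀ p * (∏ ℓ ∈ T, (1 - rootInd ℂ P ℓ p)) * Λ p := by
  rw [prod_one_sub_rootInd, mul_sum, sum_mul]
  refine sum_congr rfl fun S hS => ?_
  rw [if_pos (Nat.Coprime.coprime_dvd_left (dvd_modulus (mem_powerset.1 hS)) hp)]
  ring

/-- Passing from `G Λ` to the expanded function costs only the contribution of prime powers and
of the primes dividing the modulus. -/
lemma norm_LSeries_sub_expanded_le (h : SieveData P m T) {h₀ : ℕ → ℂ} (hle : ∀ n, ‖h₀ n‖ ≤ 1)
    {G : ℕ → ℂ} (hG : ∀ n, ‖G n‖ ≤ 1)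
    (hGp : ∀ p : ℕ, p.Prime → (m * ∏ ℓ ∈ T, ℓ).Coprime p →
      G p = h₀ p * ∏ ℓ ∈ T, (1 - rootInd ℂ P ℓ p)) {a : ℕ} (ha : a ≤ 1) {s : ℂ} (hs : 1 < s.re) :
    ‖LSeries (logMul^[a] fun n => G n * Λ n) s -
      LSeries (logMul^[a] (expanded P m T h₀)) s‖ ≤
      (2 * 2 ^ T.card) * (nonprimeMass + 32 * log (m * ∏ ℓ ∈ T, ℓ : ℕ)) := by
  have hexp := norm_expanded_le (P := P) (m := m) (T := T) hle
  have hGn : ∀ n, ‖G n * Λ n‖ ≤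
      1 * Λ n := by
    intro n
    rw [norm_mul, norm_real, norm_of_nonneg vonMangoldt_nonneg]
    exact mul_le_mul_of_nonneg_right (hG n) vonMangoldt_nonneg
  rw [← LSeries_sub (summable_logMul_iterate (abscissa_le_one_of_vonMangoldt hGn) a hs)
    (summable_logMul_iterate (abscissa_le_one_of_vonMangoldt hexp) a hs)]
  have e : (logMul^[a] fun n => G n * Λ n) -
      logMul^[a] (expanded P m T h₀) = logMul^[a] (fun n =>
        G n * Λ n - expanded P m T h₀ n) := by
    funext n
    simp only [Pi.sub_apply, logMul_iterate]
    ring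
  rw [e]
  have h1 : (1 : ℝ) ≤ 2 ^ T.card := one_le_pow₀ (by norm_num)
  refine (norm_LSeries_le_of_sparse (M := 2 * 2 ^ T.card) (by positivity) (fun n => ?_)
    (m * ∏ ℓ ∈ T, ℓ).primeFactors (fun p hp hpT => ?_) ha hs).trans ?_
  · refine (norm_sub_le _ _).trans ((add_le_add (hGn n) (hexp n)).trans ?_)
    rw [← add_mul]
    exact mul_le_mul_of_nonneg_right (by linarith) vonMangoldt_nonneg
  · have hco : (m * ∏ ℓ ∈ T, ℓ).Coprime p := by
      refine Nat.Coprime.symm ((Nat.Prime.coprime_iff_not_dvd hp).mpr fun hd => hpT ?_)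
      exact mem_primeFactors.2 ⟨hp, hd, h.modulus_pos.ne'⟩
    rw [expanded_prime hco, hGp p hp hco, sub_self]
  · have := card_primeFactors_le_log h.modulus_pos.ne'
    exact mul_le_mul_of_nonneg_left (by linarith) (by positivity)

/-- Summing the errors of the residue classes over the expansion of the sieve. -/
lemma norm_LSeries_expanded_sub_le (h : SieveData P m T) {h₀ : ℕ → ℂ}
    (hper : Periodic h₀ m) (hle : ∀ n, ‖h₀ n‖ ≤ 1) (a : ℕ) {s : ℂ} (hs : 1 < s.re) {z : ℂ}
    {B : ℝ} (hB : 0 ≤ B) (hres : ∀ S ⊆ T, ∀ u : (ZMod (m * ∏ ℓ ∈ S, ℓ))ˣ,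
      ‖residueLam (u : ZMod (m * ∏ ℓ ∈ S, ℓ)) a s -
        (1 / ((m * ∏ ℓ ∈ S, ℓ).totient : ℂ)) * z‖ ≤ B) :
    ‖LSeries (logMul^[a] (expanded P m T h₀)) s -
      unitAvg m h₀ * ((∏ ℓ ∈ T, (1 - rootDensity P ℓ) : ℝ) : ℂ) * z‖ ≤
      m * (1 + P.natDegree) ^ T.card * B := by
  set b : Finset ℕ → ℕ → ℂ := fun S n => if (m * ∏ ℓ ∈ S, ℓ).Coprime n then
    (h₀ n * ∏ ℓ ∈ S, rootInd ℂ P ℓ n) * Λ n else 0 with hb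
  have e : logMul^[a] (expanded P m T h₀) =
      ∑ S ∈ T.powerset, ((-1) ^ S.card : ℂ) • logMul^[a] (b S) := by
    funext n
    simp only [logMul_iterate, expanded, Finset.sum_apply, Pi.smul_apply, smul_eq_mul,
      mul_sum, hb]
    refine sum_congr rfl fun S _ => ?_
    ring
  have hsum : ∀ S ∈ T.powerset,
      LSeriesSummable (((-1) ^ S.card : ℂ) • logMul^[a] (b S)) s := by
    intro S hS
    refine LSeriesSummable.smul _ (summable_logMul_iterate ?_ a hs)
    refine abscissa_le_one_of_vonMangoldt (M := 1) fun n => ?_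
    simp only [hb]
    have hΛ := vonMangoldt_nonneg (n := n)
    split_ifs
    · rw [norm_mul, norm_mul, norm_prod, norm_real, norm_of_nonneg hΛ]
      refine mul_le_mul_of_nonneg_right (mul_le_one₀ (hle n) (by positivity) ?_) hΛ
      refine prod_le_one (fun _ _ => norm_nonneg _) fun ℓ _ => ?_
      rw [norm_rootInd]
      unfold rootInd
      split_ifs <;> norm_num
    · simp [hΛ]
  rw [e, LSeries_sum hsum, ← h.sum_powerset_unitAvg hper, sum_mul, ← sum_sub_distrib]
  have e2 : (m * (1 + P.natDegree) ^ T.card * B : ℝ) =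
      ∑ S ∈ T.powerset, m * (P.natDegree : ℝ) ^ S.card * B := by
    rw [← sum_mul, ← mul_sum, add_comm (1 : ℝ),
      ← sum_pow_mul_eq_add_pow (P.natDegree : ℝ) 1 T]
    simp
  rw [e2]
  refine (norm_sum_le _ _).trans (sum_le_sum fun S hS => ?_)
  have hS' := mem_powerset.1 hS
  have h' := h.mono hS'
  rw [LSeries_smul, mul_assoc, ← mul_sub, norm_mul, norm_pow, norm_neg, norm_one, one_pow, one_mul]
  have hper' : Periodic (fun c => h₀ c * ∏ ℓ ∈ S, rootInd ℂ P ℓ c) (m * ∏ ℓ ∈ S, ℓ) :=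
    periodic_mul_prod hper (fun ℓ _ => periodic_rootInd ℂ P ℓ)
  refine (norm_LSeries_periodic_sub_le h'.modulus_pos hper' a hs (hres S hS')).trans ?_
  exact mul_le_mul_of_nonneg_right (h'.sum_norm_le hper hle) hB

end SieveData

lemma logCond_le_log_conductor {m N : ℕ} (hm : 1 ≤ m) (h : m ≤ N) (s : ℂ) :
    logCond m s ≤ log (N * (|s.im| + 4)) := by
  have hm' : (1 : ℝ) ≤ m := mod_cast hm
  have h' : (m : ℝ) ≤ N := mod_cast h
  unfold logCond
  have := abs_nonneg s.im
  apply log_le_log (by positivity)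
  gcongr
  norm_num

lemma log_four_mul_le_log_conductor {m N : ℕ} (hm : 1 ≤ m) (h : m ≤ N) (s : ℂ) :
    log (4 * m) ≤ log (N * (|s.im| + 4)) := by
  have hm' : (1 : ℝ) ≤ m := mod_cast hm
  have h' : (m : ℝ) ≤ N := mod_cast h
  have := abs_nonneg s.im
  apply log_le_log (by positivity)
  nlinarith

lemma scaled_pow_le {C l l' : ℝ} (hC : 1 ≤ C) (hl : 0 ≤ l) (hl' : 1 ≤ l') (hll : l ≤ l') {a : ℕ}
    (ha : a ≤ 1) : (C * l ^ 9) ^ (a + 1) ≤ C ^ 2 * l' ^ 18 := by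
  have h1 : 1 ≤ C * l' ^ 9 := by nlinarith [one_le_pow₀ hl' (n := 9)]
  calc (C * l ^ 9) ^ (a + 1) ≤ (C * l' ^ 9) ^ (a + 1) := by gcongr
    _ ≤ (C * l' ^ 9) ^ 2 := pow_le_pow_right₀ h1 (by omega)
    _ = C ^ 2 * l' ^ 18 := by ring

/-- The error for a single modulus of the sieve, near the real axis. -/
lemma SieveData.residue_error_le {P : ℤ[X]} {m : ℕ} {T : Finset ℕ} (h : SieveData P m T)
    {C : ℝ} (hC : 1 ≤ C) {Y L R : ℝ} (hY : 1 ≤ Y) (hR : 0 ≤ R)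
    (hl : log (4 * (m * ∏ ℓ ∈ T, ℓ : ℕ)) ≤ L) {a : ℕ} (ha : a ≤ 1) {e : ℝ}
    (h1 : e ≤ (C * log (4 * (m * ∏ ℓ ∈ T, ℓ : ℕ)) ^ 9) ^ (a + 1) +
      quadCount (m * ∏ ℓ ∈ T, ℓ) / (m * ∏ ℓ ∈ T, ℓ).totient *
        (C * ((m * ∏ ℓ ∈ T, ℓ : ℕ) : ℝ) ^ 12) ^ (a + 1))
    (h2 : e ≤ (C * log (4 * (m * ∏ ℓ ∈ T, ℓ : ℕ)) ^ 9) ^ (a + 1) +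
      quadCount (m * ∏ ℓ ∈ T, ℓ) / (m * ∏ ℓ ∈ T, ℓ).totient *
        (C * log (4 * (m * ∏ ℓ ∈ T, ℓ : ℕ)) ^ 9 / R) ^ (a + 1)) :
    e ≤ C ^ 2 * L ^ 18 * (m ^ 2 * 4 ^ T.card) * (2 * Y ^ (12 * a + 13) + 1 / Y / R ^ (a + 1)) := by
  set n := m * ∏ ℓ ∈ T, ℓ with hn
  have hn1 : 1 ≤ n := h.modulus_pos
  have : NeZero n := ⟨by omega⟩
  have hl1 : 1 ≤ log (4 * n) := one_le_log_four_mul hn1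
  have hL : 1 ≤ L := hl1.trans hl
  have hm1 : (1 : ℝ) ≤ m := mod_cast h.pos
  have hφ : 0 < (n.totient : ℝ) := mod_cast totient_pos.2 hn1
  have hφ1 : (1 : ℝ) ≤ n.totient := mod_cast totient_pos.2 hn1
  have hk := scaled_pow_le hC (by linarith) hL hl ha
  have hCL : 1 ≤ C ^ 2 * L ^ 18 := one_le_mul_of_one_le_of_one_le (one_le_pow₀ hC) (one_le_pow₀ hL)
  have hm4 : (1 : ℝ) ≤ m ^ 2 * 4 ^ T.card :=
    one_le_mul_of_one_le_of_one_le (one_le_pow₀ hm1) (one_le_pow₀ (by norm_num))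
  have hY' : 1 ≤ Y ^ (12 * a + 13) := one_le_pow₀ hY
  have hfirst : (C * log (4 * n) ^ 9) ^ (a + 1) ≤
      C ^ 2 * L ^ 18 * (m ^ 2 * 4 ^ T.card) * Y ^ (12 * a + 13) :=
    hk.trans (by
      rw [mul_assoc]
      exact le_mul_of_one_le_right (by positivity) (one_le_mul_of_one_le_of_one_le hm4 hY'))
  have hR' : 0 ≤ 1 / Y / R ^ (a + 1) := by positivity
  by_cases hnY : (n : ℝ) ≤ Y
  · refine h1.trans ?_
    have hq : (quadCount n : ℝ) / n.totient ≤ Y := by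
      rw [div_le_iff₀ hφ]
      have : (quadCount n : ℝ) ≤ n := mod_cast CharSum.quadCount_le n
      nlinarith
    have h3 : (quadCount n : ℝ) / n.totient * (C * (n : ℝ) ^ 12) ^ (a + 1) ≤
        C ^ 2 * L ^ 18 * (m ^ 2 * 4 ^ T.card) * Y ^ (12 * a + 13) := by
      have hCa : C ^ (a + 1) ≤ C ^ 2 := pow_le_pow_right₀ hC (by omega)
      calc (quadCount n : ℝ) / n.totient * (C * (n : ℝ) ^ 12) ^ (a + 1)
          ≤ Y * (C * Y ^ 12) ^ (a + 1) := by gcongr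
        _ = C ^ (a + 1) * Y ^ (12 * a + 13) := by ring
        _ ≤ C ^ 2 * Y ^ (12 * a + 13) := by gcongr
        _ ≤ _ := by
          gcongr
          rw [mul_assoc]
          refine le_mul_of_one_le_right (by positivity)
            (one_le_mul_of_one_le_of_one_le (one_le_pow₀ hL) hm4)
    have : 0 ≤ C ^ 2 * L ^ 18 * (m ^ 2 * 4 ^ T.card) * (1 / Y / R ^ (a + 1)) := by positivity
    linarith
  · refine h2.trans ?_
    push Not at hnY
    have hq : (quadCount n : ℝ) / n.totient ≤ m ^ 2 * 4 ^ T.card * (1 / Y) := by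
      rw [div_le_iff₀ hφ, mul_one_div, div_mul_eq_mul_div, le_div_iff₀ (by linarith)]
      have e1 := h.quadCount_le
      have e2 := h.le_totient
      rw [← hn] at e1 e2
      calc (quadCount n : ℝ) * Y ≤ (m * 2 ^ T.card) * (m * 2 ^ T.card * n.totient) :=
            mul_le_mul e1 (hnY.le.trans e2) (by linarith) (by positivity)
        _ = m ^ 2 * 4 ^ T.card * n.totient := by
            rw [show (4 : ℝ) = 2 * 2 by norm_num, mul_pow]; ring
    have h3 : (quadCount n : ℝ) / n.totient * (C * log (4 * n) ^ 9 / R) ^ (a + 1) ≤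
        C ^ 2 * L ^ 18 * (m ^ 2 * 4 ^ T.card) * (1 / Y / R ^ (a + 1)) := by
      rw [div_pow]
      calc (quadCount n : ℝ) / n.totient * ((C * log (4 * n) ^ 9) ^ (a + 1) / R ^ (a + 1))
          ≤ (m ^ 2 * 4 ^ T.card * (1 / Y)) * ((C ^ 2 * L ^ 18) / R ^ (a + 1)) := by gcongr
        _ = _ := by ring
    have : 0 ≤ C ^ 2 * L ^ 18 * (m ^ 2 * 4 ^ T.card) * Y ^ (12 * a + 13) := by positivity
    linarith

/-- The analytic behaviour of the Dirichlet series of `G Λ` when `G` is, on primes, a periodic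
function sieved by the roots of `P`. -/
lemma exists_sieve_bound : ∃ C : ℝ, 1 ≤ C ∧ ∀ (P : ℤ[X]) (m : ℕ) (T : Finset ℕ), SieveData P m T →
    ∀ h₀ : ℕ → ℂ, Periodic h₀ m → (∀ n, ‖h₀ n‖ ≤ 1) →
    ∀ G : ℕ → ℂ, (∀ n, ‖G n‖ ≤ 1) → (∀ p : ℕ, p.Prime → (m * ∏ ℓ ∈ T, ℓ).Coprime p →
      G p = h₀ p * ∏ ℓ ∈ T, (1 - rootInd ℂ P ℓ p)) →
    ∀ s : ℂ, 1 < s.re → s.re ≤ 2 → ∀ a ≤ 1,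
    (1 ≤ |s.im| → ‖LSeries (logMul^[a] fun n =>
        G n * Λ n) s‖ ≤
      sieveError C P.natDegree m (m * ∏ ℓ ∈ T, ℓ) T.card |s.im|) ∧
    (|s.im| ≤ 1 → ∀ Y : ℝ, 1 ≤ Y → ‖LSeries (logMul^[a] fun n =>
        G n * Λ n) s -
          unitAvg m h₀ * ((∏ ℓ ∈ T, (1 - rootDensity P ℓ) : ℝ) : ℂ) * (1 / (s - 1) ^ (a + 1))‖ ≤
      sieveError C P.natDegree m (m * ∏ ℓ ∈ T, ℓ) T.card |s.im| *
        (Y ^ (12 * a + 13) + 1 / Y / ‖s - 1‖ ^ (a + 1))) := by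
  obtain ⟨C, hC, hres⟩ := exists_residueLam_bound
  have hnp := nonprimeMass_nonneg
  refine ⟨2 * C ^ 2 + 2 * (nonprimeMass + 32), by nlinarith, ?_⟩
  intro P m T h h₀ hper hle G hG hGp s hs hs2 a ha
  set N := m * ∏ ℓ ∈ T, ℓ with hN
  set L := log (N * (|s.im| + 4)) with hL
  have hN1 : 1 ≤ N := h.modulus_pos
  have hL1 : 1 ≤ L := one_le_log_conductor hN1 (abs_nonneg _)
  have hm1 : (1 : ℝ) ≤ m := mod_cast h.pos
  set D := P.natDegree with hD
  have hcard : ∀ S ⊆ T, S.card ≤ T.card := fun S hS => card_le_card hS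
  have hSN : ∀ S ⊆ T, m * ∏ ℓ ∈ S, ℓ ≤ N := fun S hS =>
    Nat.le_of_dvd hN1 (SieveData.dvd_modulus hS)
  have hdiff := h.norm_LSeries_sub_expanded_le hle hG hGp ha hs
  have hD4 : (2 : ℝ) ^ T.card ≤ m ^ 3 * (4 + 4 * D) ^ T.card := by
    refine (pow_le_pow_left₀ (by norm_num) (show (2 : ℝ) ≤ 4 + 4 * D by
      have : (0 : ℝ) ≤ D := by positivity
      linarith) _).trans (le_mul_of_one_le_left (by positivity) (one_le_pow₀ hm1))
  have hL18 : L ≤ L ^ 18 := le_self_pow₀ hL1 (by norm_num)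
  have hlogN : log N ≤ L := by
    have hN1' : (1 : ℝ) ≤ N := mod_cast hN1
    refine log_le_log (by linarith) ?_
    nlinarith [abs_nonneg s.im]
  set Z₁ : ℝ := m ^ 3 * (4 + 4 * D) ^ T.card * L ^ 18 with hZ₁
  have hdiff' : (2 * 2 ^ T.card) * (nonprimeMass + 32 * log N) ≤
      2 * (nonprimeMass + 32) * Z₁ := by
    have e1 : nonprimeMass + 32 * log N ≤ (nonprimeMass + 32) * L ^ 18 := by
      have : nonprimeMass ≤ nonprimeMass * L ^ 18 := le_mul_of_one_le_right hnp (one_le_pow₀ hL1)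
      linarith
    calc (2 * 2 ^ T.card) * (nonprimeMass + 32 * log N)
        ≤ (2 * (m ^ 3 * (4 + 4 * D) ^ T.card)) * ((nonprimeMass + 32) * L ^ 18) := by gcongr
      _ = _ := by rw [hZ₁]; ring
  have hZ0 : 0 ≤ Z₁ := by positivity
  have hsplit : (4 : ℝ) ^ T.card * (1 + D) ^ T.card = (4 + 4 * D) ^ T.card := by
    rw [← mul_pow]; congr 1; ring
  constructor
  · intro him
    have hB : ∀ S ⊆ T, ∀ u : (ZMod (m * ∏ ℓ ∈ S, ℓ))ˣ,
        ‖residueLam (u : ZMod (m * ∏ ℓ ∈ S, ℓ)) a s -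
        (1 / ((m * ∏ ℓ ∈ S, ℓ).totient : ℂ)) * 0‖ ≤ C ^ 2 * L ^ 18 := by
      intro S hS u
      have hS1 : 1 ≤ m * ∏ ℓ ∈ S, ℓ := (h.mono hS).modulus_pos
      rw [mul_zero, sub_zero]
      refine ((hres _ hS1 u s hs hs2 a ha).1 him).trans ?_
      exact scaled_pow_le hC (by linarith [one_le_logCond hS1 s]) hL1
        (logCond_le_log_conductor hS1 (hSN S hS) s) ha
    have hmain := h.norm_LSeries_expanded_sub_le hper hle a hs (by positivity) hB
    rw [mul_zero, sub_zero] at hmain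
    have h1 : (m * (1 + D) ^ T.card * (C ^ 2 * L ^ 18) : ℝ) ≤ 2 * C ^ 2 * Z₁ := by
      have e1 : (m * (1 + D) ^ T.card : ℝ) ≤ m ^ 3 * (4 + 4 * D) ^ T.card := by
        rw [← hsplit]
        refine mul_le_mul (le_self_pow₀ hm1 (by norm_num)) ?_ (by positivity) (by positivity)
        exact le_mul_of_one_le_left (by positivity) (one_le_pow₀ (by norm_num))
      calc (m * (1 + D) ^ T.card * (C ^ 2 * L ^ 18) : ℝ)
          ≤ (m ^ 3 * (4 + 4 * D) ^ T.card) * (C ^ 2 * L ^ 18) := by gcongr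
        _ ≤ 2 * C ^ 2 * Z₁ := by
          have : 0 ≤ C ^ 2 * Z₁ := by positivity
          rw [hZ₁] at *
          linarith
    calc _ ≤ _ := norm_le_norm_sub_add _ (LSeries (logMul^[a] (SieveData.expanded P m T h₀)) s)
      _ ≤ 2 * (nonprimeMass + 32) * Z₁ + 2 * C ^ 2 * Z₁ :=
        add_le_add (hdiff.trans hdiff') (hmain.trans h1)
      _ = sieveError (2 * C ^ 2 + 2 * (nonprimeMass + 32)) D m N T.card |s.im| := by
        rw [sieveError, ← hL, hZ₁]; ring
  · intro him Y hY
    set B : ℝ := C ^ 2 * L ^ 18 * (m ^ 2 * 4 ^ T.card) *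
      (2 * Y ^ (12 * a + 13) + 1 / Y / ‖s - 1‖ ^ (a + 1)) with hBdef
    have hB : ∀ S ⊆ T, ∀ u : (ZMod (m * ∏ ℓ ∈ S, ℓ))ˣ,
        ‖residueLam (u : ZMod (m * ∏ ℓ ∈ S, ℓ)) a s -
        (1 / ((m * ∏ ℓ ∈ S, ℓ).totient : ℂ)) * (1 / (s - 1) ^ (a + 1))‖ ≤ B := by
      intro S hS u
      have hS1 : 1 ≤ m * ∏ ℓ ∈ S, ℓ := (h.mono hS).modulus_pos
      obtain ⟨h1, h2⟩ := (hres _ hS1 u s hs hs2 a ha).2 him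
      refine ((h.mono hS).residue_error_le hC hY (norm_nonneg _)
        (log_four_mul_le_log_conductor hS1 (hSN S hS) s) ha h1 h2).trans ?_
      rw [hBdef]
      gcongr
      norm_num
    have hmain := h.norm_LSeries_expanded_sub_le hper hle a hs (by positivity) hB
    set Q : ℝ := Y ^ (12 * a + 13) + 1 / Y / ‖s - 1‖ ^ (a + 1) with hQ
    have hr : 0 ≤ 1 / Y / ‖s - 1‖ ^ (a + 1) := by positivity
    have hY1 : 1 ≤ Y ^ (12 * a + 13) := one_le_pow₀ hY
    have hQ1 : 1 ≤ Q := by linarith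
    have h1 : (m * (1 + D) ^ T.card * B : ℝ) ≤ 2 * C ^ 2 * Z₁ * Q := by
      calc (m * (1 + D) ^ T.card * B : ℝ)
          = C ^ 2 * Z₁ * (2 * Y ^ (12 * a + 13) + 1 / Y / ‖s - 1‖ ^ (a + 1)) := by
            rw [hBdef, hZ₁, ← hsplit]; ring
        _ ≤ C ^ 2 * Z₁ * (2 * Q) := by
            gcongr
            linarith
        _ = _ := by ring
    calc _ ≤ _ := norm_sub_le_norm_sub_add_norm_sub _
          (LSeries (logMul^[a] (SieveData.expanded P m T h₀)) s) _
      _ ≤ 2 * (nonprimeMass + 32) * Z₁ * Q + 2 * C ^ 2 * Z₁ * Q :=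
        add_le_add ((hdiff.trans hdiff').trans (le_mul_of_one_le_right (by positivity) hQ1))
          (hmain.trans h1)
      _ = sieveError (2 * C ^ 2 + 2 * (nonprimeMass + 32)) D m N T.card |s.im| * Q := by
        rw [sieveError, ← hL, hZ₁]; ring

/-- A weak form of Mertens' first theorem. -/
lemma exists_sum_log_div_prime_le : ∃ C : ℝ, 1 ≤ C ∧ ∀ w : ℝ, 3 ≤ w → ∀ S : Finset ℕ,
    (∀ p ∈ S, p.Prime ∧ (p : ℝ) ≤ w) → ∑ p ∈ S, log p / p ≤ C * log w := by
  obtain ⟨C, hC, h⟩ := exists_charLam_trivial_bound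
  have he := exp_one_gt_d9
  refine ⟨exp 1 * C, by nlinarith, ?_⟩
  intro w hw S hS
  have hlog1 : 1 ≤ log w := by
    rw [le_log_iff_exp_le (by linarith)]
    linarith [exp_one_lt_three]
  set σ : ℝ := 1 + 1 / log w with hσ
  have hσ1 : 0 < 1 / log w := by positivity
  have hσ2 : 1 / log w ≤ 1 := by rw [div_le_one (by linarith)]; exact hlog1
  set c : ℕ → ℂ := fun n => if n ∈ S then (Λ n : ℂ) else 0 with hc
  have hb := h c 1 zero_le_one (fun n => by
    simp only [hc]
    split_ifs <;> simp [vonMangoldt_nonneg, abs_of_nonneg]) (σ : ℂ)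
    (by rw [ofReal_re]; linarith) (by rw [ofReal_re]; linarith) 0 (by norm_num)
  have hS0 : ∀ p ∈ S, 0 < (p : ℝ) := fun p hp => mod_cast (hS p hp).1.pos
  have e : LSeries c (σ : ℂ) = ((∑ p ∈ S, log p / (p : ℝ) ^ σ : ℝ) : ℂ) := by
    rw [LSeries, tsum_eq_sum (s := S)]
    · push_cast
      refine sum_congr rfl fun p hp => ?_
      have hp' := (hS p hp).1
      rw [term_of_ne_zero hp'.ne_zero]
      simp only [hc, if_pos hp, vonMangoldt_apply_prime hp']
      push_cast [ofReal_cpow (Nat.cast_nonneg p)]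
      rfl
    · intro n hn
      rcases eq_or_ne n 0 with rfl | h0
      · simp
      · rw [term_of_ne_zero h0]
        simp [hc, hn]
  rw [Function.iterate_zero, id, e, norm_real, ofReal_re, one_mul, zero_add, pow_one,
    hσ, add_sub_cancel_left, div_div_eq_mul_div, div_one] at hb
  have hterm : ∀ p ∈ S, log p / p ≤ exp 1 * (log p / (p : ℝ) ^ σ) := by
    intro p hp
    have hp0 := hS0 p hp
    have hp1 : (1 : ℝ) ≤ p := mod_cast (hS p hp).1.one_le
    have hl := log_nonneg hp1
    have h1 : (p : ℝ) ^ σ ≤ p * exp 1 := by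
      rw [hσ, rpow_add hp0, rpow_one]
      gcongr
      rw [rpow_def_of_pos hp0]
      apply exp_le_exp.2
      rw [mul_one_div, div_le_one (by linarith)]
      exact log_le_log hp0 (hS p hp).2
    rw [mul_div_assoc', div_le_div_iff₀ hp0 (by positivity)]
    calc log p * (p : ℝ) ^ σ ≤ log p * (p * exp 1) := by gcongr
      _ = _ := by ring
  calc ∑ p ∈ S, log p / p ≤ ∑ p ∈ S, exp 1 * (log p / (p : ℝ) ^ σ) :=
        sum_le_sum hterm
    _ = exp 1 * ∑ p ∈ S, log p / (p : ℝ) ^ σ := by rw [mul_sum]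
    _ ≤ exp 1 * (C * log w) := by
        gcongr
        exact (le_abs_self _).trans hb
    _ = _ := by ring

lemma exists_sum_inv_prime_le : ∃ C : ℝ, 1 ≤ C ∧ ∀ w : ℝ, 3 ≤ w → ∀ S : Finset ℕ,
    (∀ p ∈ S, p.Prime ∧ w ^ (1 / 2 : ℝ) < p ∧ (p : ℝ) ≤ w) → ∑ p ∈ S, 1 / (p : ℝ) ≤ C := by
  obtain ⟨C, hC, h⟩ := exists_sum_log_div_prime_le
  refine ⟨2 * C, by linarith, fun w hw S hS => ?_⟩
  have hlog : 0 < log w := log_pos (by linarith)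
  have h1 := h w hw S fun p hp => ⟨(hS p hp).1, (hS p hp).2.2⟩
  have h2 : ∑ p ∈ S, 1 / (p : ℝ) * (log w / 2) ≤ ∑ p ∈ S, log p / p := by
    refine sum_le_sum fun p hp => ?_
    have hp0 : 0 < (p : ℝ) := mod_cast (hS p hp).1.pos
    rw [one_div_mul_eq_div]
    gcongr
    have := log_le_log (by positivity) (hS p hp).2.1.le
    rw [log_rpow (by linarith)] at this
    linarith
  rw [← sum_mul] at h2
  nlinarith

lemma sum_inv_le_harmonic {w : ℝ} (hw : 1 ≤ w) {S : Finset ℕ}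
    (hS : ∀ p ∈ S, p.Prime ∧ (p : ℝ) ≤ w) : ∑ p ∈ S, 1 / (p : ℝ) ≤ 1 + log w := by
  calc ∑ p ∈ S, 1 / (p : ℝ) ≤ ∑ p ∈ Icc 1 ⌊w⌋₊, 1 / (p : ℝ) := by
        refine sum_le_sum_of_subset_of_nonneg (fun p hp => ?_) fun _ _ _ => by positivity
        rw [mem_Icc]
        exact ⟨(hS p hp).1.one_le, Nat.le_floor (hS p hp).2⟩
    _ = harmonic ⌊w⌋₊ := by
        rw [harmonic_eq_sum_Icc]
        push_cast
        simp
    _ ≤ 1 + log w := harmonic_floor_le_one_add_log w hw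

/-- The sum of the reciprocals of the primes up to `w` is `o(log w)`. -/
lemma exists_sum_inv_prime_le_small (ε : ℝ) (hε : 0 < ε) : ∃ C : ℝ, 1 ≤ C ∧ ∀ w : ℝ, 1 ≤ w →
    ∀ S : Finset ℕ, (∀ p ∈ S, p.Prime ∧ (p : ℝ) ≤ w) →
    ∑ p ∈ S, 1 / (p : ℝ) ≤ ε * log w + C := by
  obtain ⟨C₁, hC₁, h⟩ := exists_sum_inv_prime_le
  have key : ∀ j : ℕ, ∃ C : ℝ, 1 ≤ C ∧ ∀ w : ℝ, 1 ≤ w →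
      ∀ S : Finset ℕ, (∀ p ∈ S, p.Prime ∧ (p : ℝ) ≤ w) →
      ∑ p ∈ S, 1 / (p : ℝ) ≤ (1 / 2 : ℝ) ^ j * log w + C := by
    intro j
    induction j with
    | zero =>
      refine ⟨1, le_rfl, fun w hw S hS => ?_⟩
      have := sum_inv_le_harmonic hw hS
      simpa [add_comm] using this
    | succ j ih =>
      obtain ⟨C, hC, ih⟩ := ih
      refine ⟨C + C₁ + 3, by linarith, fun w hw S hS => ?_⟩
      have hlog := log_nonneg hw
      rcases le_or_gt 3 w with h3 | h3
      · rw [← sum_filter_add_sum_filter_not S (fun p => (p : ℝ) ≤ w ^ (1 / 2 : ℝ))]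
        have e1 := ih (w ^ (1 / 2 : ℝ)) (one_le_rpow hw (by norm_num))
          (S.filter fun p => (p : ℝ) ≤ w ^ (1 / 2 : ℝ)) (fun p hp => by
            rw [mem_filter] at hp
            exact ⟨(hS p hp.1).1, hp.2⟩)
        have e2 := h w h3 (S.filter fun p => ¬ (p : ℝ) ≤ w ^ (1 / 2 : ℝ)) (fun p hp => by
            rw [mem_filter, not_le] at hp
            exact ⟨(hS p hp.1).1, hp.2, (hS p hp.1).2⟩)
        rw [log_rpow (by linarith)] at e1
        rw [pow_succ, mul_assoc]
        linarith
      · have e1 := sum_inv_le_harmonic hw hS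
        have e2 : log w ≤ 2 := by
          rw [log_le_iff_le_exp (by linarith)]
          have := add_one_le_exp (2 : ℝ)
          linarith
        have e3 : 0 ≤ (1 / 2 : ℝ) ^ (j + 1) * log w := by positivity
        linarith
  obtain ⟨j, hj⟩ := exists_pow_lt_of_lt_one hε (show (1 / 2 : ℝ) < 1 by norm_num)
  obtain ⟨C, hC, h'⟩ := key j
  refine ⟨C, hC, fun w hw S hS => (h' w hw S hS).trans ?_⟩
  have := log_nonneg hw
  gcongr

namespace SieveData

variable {P : ℤ[X]} {m : ℕ} {T : Finset ℕ}

lemma exp_le_one_sub_density (h : SieveData P m T) {ℓ : ℕ} (hℓ : ℓ ∈ T) :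
    exp (-(16 * P.natDegree ^ 2 + 4 * P.natDegree) * (1 / (ℓ : ℝ))) ≤ 1 - rootDensity P ℓ := by
  set D := P.natDegree with hD
  have hp := h.prime ℓ hℓ
  have hl2 : (2 : ℝ) ≤ ℓ := mod_cast hp.two_le
  have htot : (ℓ.totient : ℝ) = ℓ - 1 := by
    rw [Nat.totient_prime hp, Nat.cast_sub hp.one_le, Nat.cast_one]
  have h1 := h.density_le hℓ
  have h2 := h.le_one_sub_density hℓ
  rw [htot] at h1 h2
  have hD0 : (0 : ℝ) ≤ D := by positivity
  rcases le_or_gt (4 * D : ℝ) ℓ with h4 | h4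
  · have h3 : rootDensity P ℓ ≤ 2 * D / ℓ := by
      rw [le_div_iff₀ (by linarith)]
      have := rootDensity_nonneg P ℓ
      nlinarith
    have hx : 2 * D / (ℓ : ℝ) ≤ 1 / 2 := by
      rw [div_le_div_iff₀ (by linarith) (by norm_num)]
      linarith
    have hx0 : 0 ≤ 2 * D / (ℓ : ℝ) := by positivity
    have hexp : exp (-(2 * (2 * D / (ℓ : ℝ)))) ≤ 1 - 2 * D / ℓ := by
      rw [exp_neg, inv_le_comm₀ (exp_pos _) (by linarith)]
      refine le_trans ?_ (add_one_le_exp _)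
      rw [inv_le_iff_one_le_mul₀ (by linarith)]
      nlinarith
    refine (exp_le_exp.2 ?_).trans (hexp.trans (by linarith))
    have : 0 ≤ 16 * (D : ℝ) ^ 2 * (1 / ℓ) := by positivity
    have e : 2 * (2 * (D : ℝ) / ℓ) = 4 * D * (1 / ℓ) := by ring
    rw [e]
    linarith
  · refine le_trans ?_ (le_trans ?_ h2) (b := (ℓ : ℝ)⁻¹)
    · rw [← exp_log (show (0 : ℝ) < (ℓ : ℝ)⁻¹ by positivity), log_inv]
      apply exp_le_exp.2
      have e1 : log ℓ ≤ ℓ := (log_le_sub_one_of_pos (by linarith)).trans (by linarith)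
      have e2 : (ℓ : ℝ) ≤ (16 * D ^ 2 + 4 * D) * (1 / ℓ) := by
        rw [mul_one_div, le_div_iff₀ (by linarith)]
        nlinarith
      linarith
    · exact inv_anti₀ (by linarith) (by linarith)

lemma exp_le_prod_one_sub_density (h : SieveData P m T) {b : ℝ} (hb : ∑ ℓ ∈ T, 1 / (ℓ : ℝ) ≤ b) :
    exp (-(16 * P.natDegree ^ 2 + 4 * P.natDegree) * b) ≤ ∏ ℓ ∈ T, (1 - rootDensity P ℓ) := by
  calc exp (-(16 * P.natDegree ^ 2 + 4 * P.natDegree) * b)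
      ≤ exp (∑ ℓ ∈ T, -(16 * P.natDegree ^ 2 + 4 * P.natDegree) * (1 / (ℓ : ℝ))) := by
        apply exp_le_exp.2
        rw [← mul_sum]
        exact mul_le_mul_of_nonpos_left hb (by
          rw [neg_nonpos]
          positivity)
    _ = ∏ ℓ ∈ T, exp (-(16 * P.natDegree ^ 2 + 4 * P.natDegree) * (1 / (ℓ : ℝ))) :=
        exp_sum _ _
    _ ≤ _ := prod_le_prod (fun _ _ => (exp_pos _).le)
        fun ℓ hℓ => h.exp_le_one_sub_density hℓ

lemma prod_one_sub_density_le_one (h : SieveData P m T) :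
    ∏ ℓ ∈ T, (1 - rootDensity P ℓ) ≤ 1 :=
  prod_le_one (fun _ hℓ => le_trans (by positivity) (h.le_one_sub_density hℓ))
    fun ℓ _ => by linarith [rootDensity_nonneg P ℓ]

end SieveData

lemma exists_pow_card_primeFactors_le {A ε : ℝ} (hA : 1 ≤ A) (hε : 0 < ε) :
    ∃ C : ℝ, 1 ≤ C ∧ ∀ q : ℕ, q ≠ 0 → A ^ q.primeFactors.card ≤ C * (q : ℝ) ^ ε := by
  have hA0 : 0 < A := by linarith
  set B : ℕ := ⌈A ^ (1 / ε)⌉₊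
  refine ⟨A ^ B, one_le_pow₀ hA, fun q hq => ?_⟩
  have hterm : ∀ p ∈ q.primeFactors, A ≤ (if p < B then A else 1) * (p : ℝ) ^ ε := by
    intro p hp
    have hp1 : (1 : ℝ) ≤ p := mod_cast (prime_of_mem_primeFactors hp).one_lt.le
    split_ifs with h
    · exact le_mul_of_one_le_right hA0.le (one_le_rpow hp1 hε.le)
    · have h1 : A ^ (1 / ε) ≤ p := (Nat.le_ceil _).trans (mod_cast not_lt.mp h)
      calc A = (A ^ (1 / ε)) ^ ε := by rw [← rpow_mul hA0.le]; field_simp; simp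
        _ ≤ (p : ℝ) ^ ε := by gcongr
        _ = _ := (one_mul _).symm
  calc A ^ q.primeFactors.card = ∏ _p ∈ q.primeFactors, A := by simp
    _ ≤ ∏ p ∈ q.primeFactors, (if p < B then A else 1) * (p : ℝ) ^ ε :=
        prod_le_prod (fun _ _ => hA0.le) hterm
    _ = A ^ (q.primeFactors.filter (· < B)).card * ((∏ p ∈ q.primeFactors, p : ℕ) : ℝ) ^ ε := by
        rw [prod_mul_distrib, prod_ite, prod_const, prod_const_one,
          mul_one, Nat.cast_prod, finsetProd_rpow _ _ fun _ _ => Nat.cast_nonneg _]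
    _ ≤ A ^ B * (q : ℝ) ^ ε := by
        have h1 : (q.primeFactors.filter (· < B)).card ≤ B := by
          calc _ ≤ (range B).card := card_le_card fun p hp => by
                simpa using (mem_filter.1 hp).2
            _ = B := card_range B
        have h2 : ((∏ p ∈ q.primeFactors, p : ℕ) : ℝ) ≤ q := by
          exact_mod_cast Nat.le_of_dvd (pos_of_ne_zero hq) (prod_primeFactors_dvd q)
        gcongr

lemma exists_sieveError_le {C lam K₁ β : ℝ} (hC : 1 ≤ C) (hlam : 1 ≤ lam) (hK : 0 < K₁) (hβ : 0 < β)
    (D : ℕ) : ∃ X₀ : ℝ, 3 ≤ X₀ ∧ ∀ X : ℝ, X₀ ≤ X → ∀ q : ℕ, q ≠ 0 → (q : ℝ) ≤ X ^ K₁ →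
      ∀ (m N : ℕ) (T : Finset ℕ), (m : ℝ) ≤ lam → T ⊆ q.primeFactors → 1 ≤ N → N ≤ q →
        ∀ y : ℝ, 0 ≤ y → y ≤ X ^ 10 → sieveError C D m N T.card y ≤ X ^ β := by
  obtain ⟨C₁, hC₁, h₁⟩ := exists_pow_card_primeFactors_le (A := 4 + 4 * D) (ε := β / (2 * K₁))
    (by have : (0 : ℝ) ≤ D := by positivity
        linarith) (by positivity)
  have hc : 0 < (C * lam ^ 3 * C₁ * (K₁ + 12) ^ 18)⁻¹ := by positivity
  have hlim := (isLittleO_log_rpow_rpow_atTop (s := β / 2) 18 (by positivity)).bound hc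
  obtain ⟨X₁, hX₁⟩ := eventually_atTop.mp hlim
  refine ⟨max X₁ 3, le_max_right _ _, fun X hX q hq hqX m N T hm hT hN hNq y hy0 hy => ?_⟩
  have hX3 : 3 ≤ X := (le_max_right _ _).trans hX
  have hX0 : 0 < X := by linarith
  have hlog0 : 0 ≤ log X := log_nonneg (by linarith)
  have h2 : log X ^ 18 ≤ (C * lam ^ 3 * C₁ * (K₁ + 12) ^ 18)⁻¹ * X ^ (β / 2) := by
    have := hX₁ X ((le_max_left _ _).trans hX)
    rw [norm_of_nonneg (by positivity), norm_of_nonneg (by positivity)] at this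
    exact_mod_cast this
  have hl : log (N * (y + 4)) ≤ (K₁ + 12) * log X := by
    have hN0 : (0 : ℝ) < N := mod_cast hN
    have hy4 : y + 4 ≤ X ^ 12 := by
      nlinarith [pow_le_pow_left₀ (by norm_num) hX3 10, pow_le_pow_left₀ (by norm_num) hX3 2,
        pow_pos hX0 10]
    rw [log_mul hN0.ne' (by positivity), add_mul, ← log_rpow hX0]
    refine add_le_add (log_le_log hN0 (le_trans (mod_cast hNq) hqX)) ?_
    calc log (y + 4) ≤ log (X ^ 12) := log_le_log (by positivity) hy4
      _ = _ := by rw [log_pow]; norm_num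
  have hl0 : 0 ≤ log (N * (y + 4)) := zero_le_one.trans (one_le_log_conductor hN hy0)
  have h3 : (4 + 4 * D : ℝ) ^ T.card ≤ C₁ * X ^ (β / 2) := by
    have hD : (1 : ℝ) ≤ 4 + 4 * D := by
      have : (0 : ℝ) ≤ D := by positivity
      linarith
    calc (4 + 4 * D : ℝ) ^ T.card ≤ (4 + 4 * D : ℝ) ^ q.primeFactors.card := by
          gcongr
      _ ≤ C₁ * (q : ℝ) ^ (β / (2 * K₁)) := h₁ q hq
      _ ≤ C₁ * (X ^ K₁) ^ (β / (2 * K₁)) := by gcongr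
      _ = C₁ * X ^ (β / 2) := by
          rw [← rpow_mul hX0.le]
          congr 2
          field_simp
  unfold sieveError
  calc C * m ^ 3 * (4 + 4 * D) ^ T.card * log (N * (y + 4)) ^ 18
      ≤ C * lam ^ 3 * (C₁ * X ^ (β / 2)) * ((K₁ + 12) * log X) ^ 18 := by gcongr
    _ = C * lam ^ 3 * C₁ * (K₁ + 12) ^ 18 * log X ^ 18 * X ^ (β / 2) := by ring
    _ ≤ C * lam ^ 3 * C₁ * (K₁ + 12) ^ 18 *
          ((C * lam ^ 3 * C₁ * (K₁ + 12) ^ 18)⁻¹ * X ^ (β / 2)) * X ^ (β / 2) := by gcongr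
    _ = X ^ β := by
        rw [← mul_assoc, mul_inv_cancel₀ (by positivity), one_mul, ← rpow_add hX0]
        ring_nf

lemma exists_sieveError_smooth_le {C lam : ℝ} (hC : 1 ≤ C) (hlam : 1 ≤ lam) (D : ℕ) :
    ∃ C' : ℝ, 1 ≤ C' ∧ ∀ z : ℝ, 1 ≤ z → ∀ (m : ℕ) (T : Finset ℕ), 1 ≤ m → (m : ℝ) ≤ lam →
      (∀ ℓ ∈ T, ℓ.Prime ∧ (ℓ : ℝ) ≤ z) →
        ∀ y : ℝ, 0 ≤ y → y ≤ 1 → sieveError C D m (m * ∏ ℓ ∈ T, ℓ) T.card y ≤ exp (C' * z) := by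
  set A : ℝ := C * lam ^ 3 * (5 * lam) ^ 18
  have hA : 0 < A := by positivity
  have hA1 : 1 ≤ A := by
    have : 1 ≤ lam ^ 3 := one_le_pow₀ hlam
    have h2 : 1 ≤ (5 * lam) ^ 18 := one_le_pow₀ (by linarith)
    exact one_le_mul_of_one_le_of_one_le (one_le_mul_of_one_le_of_one_le hC this) h2
  have hD : (1 : ℝ) ≤ 4 + 4 * D := by
    have : (0 : ℝ) ≤ D := by positivity
    linarith
  refine ⟨log A + log (4 + 4 * D) + 18 * log 4 + 1, ?_,
    fun z hz m T hm hml hT y hy0 hy => ?_⟩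
  · have := log_nonneg hA1
    have := log_nonneg hD
    have := log_nonneg (show (1 : ℝ) ≤ 4 by norm_num)
    linarith
  have hsub : T ⊆ (range (⌊z⌋₊ + 1)).filter Nat.Prime := fun ℓ hℓ => by
    simp only [mem_filter, mem_range]
    exact ⟨Nat.lt_succ_of_le (Nat.le_floor (hT ℓ hℓ).2), (hT ℓ hℓ).1⟩
  have hprod : ((∏ ℓ ∈ T, ℓ : ℕ) : ℝ) ≤ 4 ^ z := by
    have h1 : ∏ ℓ ∈ T, ℓ ≤ 4 ^ ⌊z⌋₊ := (prod_le_prod_of_subset_of_one_le' hsub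
      fun i hi _ => (mem_filter.1 hi).2.one_lt.le).trans (primorial_le_four_pow _)
    calc ((∏ ℓ ∈ T, ℓ : ℕ) : ℝ) ≤ (4 : ℝ) ^ (⌊z⌋₊ : ℝ) := by
          rw [rpow_natCast]; exact_mod_cast h1
      _ ≤ 4 ^ z := by
          gcongr
          · norm_num
          · exact Nat.floor_le (by linarith)
  have hcard : ((4 + 4 * D : ℝ)) ^ T.card ≤ (4 + 4 * D : ℝ) ^ z := by
    have h1 : T.card ≤ ⌊z⌋₊ := by
      calc T.card ≤ (Icc 1 ⌊z⌋₊).card := card_le_card fun ℓ hℓ => by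
            simp only [mem_Icc]
            exact ⟨(hT ℓ hℓ).1.one_lt.le, Nat.le_floor (hT ℓ hℓ).2⟩
        _ = ⌊z⌋₊ := by simp
    rw [← rpow_natCast]
    refine rpow_le_rpow_of_exponent_le hD ?_
    exact le_trans (mod_cast h1) (Nat.floor_le (by linarith))
  have hN1 : 1 ≤ m * ∏ ℓ ∈ T, ℓ :=
    Nat.one_le_iff_ne_zero.2 (mul_ne_zero (by omega)
      (prod_ne_zero_iff.2 fun ℓ hℓ => (hT ℓ hℓ).1.ne_zero))
  have hl0 := zero_le_one.trans (one_le_log_conductor hN1 hy0)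
  have hl : log (((m * ∏ ℓ ∈ T, ℓ : ℕ) : ℝ) * (y + 4)) ≤ (5 * lam) * 4 ^ z := by
    have hN0 : (0 : ℝ) < ((m * ∏ ℓ ∈ T, ℓ : ℕ) : ℝ) := mod_cast hN1
    refine (log_le_self (by positivity)).trans ?_
    push_cast at hprod ⊢
    calc (m : ℝ) * (∏ ℓ ∈ T, (ℓ : ℝ)) * (y + 4) ≤ lam * 4 ^ z * 5 := by
          gcongr
          linarith
      _ = _ := by ring
  unfold sieveError
  calc C * m ^ 3 * (4 + 4 * D) ^ T.card * log (((m * ∏ ℓ ∈ T, ℓ : ℕ) : ℝ) * (y + 4)) ^ 18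
      ≤ C * lam ^ 3 * (4 + 4 * D) ^ z * ((5 * lam) * 4 ^ z) ^ 18 := by gcongr
    _ = A * ((4 + 4 * D) ^ z * (4 ^ z) ^ 18) := by simp only [A]; ring
    _ ≤ A ^ z * ((4 + 4 * D) ^ z * (4 ^ z) ^ 18) := by
        gcongr
        exact self_le_rpow_of_one_le hA1 hz
    _ = exp ((log A + log (4 + 4 * D) + 18 * log 4) * z) := by
        rw [rpow_def_of_pos hA, rpow_def_of_pos (by linarith), rpow_def_of_pos
          (by norm_num), ← exp_nat_mul, ← exp_add, ← exp_add]
        congr 1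
        push_cast
        ring
    _ ≤ _ := exp_le_exp.2 (mul_le_mul_of_nonneg_right (by linarith) (by linarith))

lemma sum_inv_le_of_large {K₁ w : ℝ} (hw : 0 < w) {S : Finset ℕ} {N : ℕ} (hN : N ≠ 0)
    (hS : S ⊆ N.primeFactors) (hl : ∀ ℓ ∈ S, w ≤ ℓ) (hlog : log N ≤ K₁ * w) :
    ∑ ℓ ∈ S, 1 / (ℓ : ℝ) ≤ 2 * K₁ := by
  calc ∑ ℓ ∈ S, 1 / (ℓ : ℝ) ≤ ∑ _ℓ ∈ S, 1 / w :=
        sum_le_sum fun ℓ hℓ => one_div_le_one_div_of_le hw (hl ℓ hℓ)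
    _ = S.card / w := by rw [sum_const, nsmul_eq_mul, mul_one_div]
    _ ≤ (2 * (K₁ * w)) / w := by
        gcongr
        calc (S.card : ℝ) ≤ N.primeFactors.card := mod_cast card_le_card hS
          _ ≤ 2 * log N := card_primeFactors_le_log hN
          _ ≤ _ := by gcongr
    _ = 2 * K₁ := by field_simp

/-- The product of the local densities of the sieve. -/
def sieveDensity (P : ℤ[X]) (T : Finset ℕ) : ℝ := ∏ ℓ ∈ T, (1 - rootDensity P ℓ)

namespace SieveData

variable {P : ℤ[X]} {m : ℕ} {T : Finset ℕ}

lemma subset_primeFactors (h : SieveData P m T) : T ⊆ (m * ∏ ℓ ∈ T, ℓ).primeFactors :=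
  fun ℓ hℓ => mem_primeFactors.2
    ⟨h.prime ℓ hℓ, (dvd_prod_of_mem _ hℓ).mul_left m, h.modulus_pos.ne'⟩

lemma sieveDensity_pos (h : SieveData P m T) : 0 < sieveDensity P T :=
  prod_pos fun ℓ hℓ => lt_of_lt_of_le
    (by have := totient_pos.2 (h.prime ℓ hℓ).pos; positivity) (h.le_one_sub_density hℓ)

end SieveData

lemma exists_sieveDensity_ge (P : ℤ[X]) {K₁ κ : ℝ} (hκ : 0 < κ) :
    ∃ c : ℝ, 0 < c ∧ ∀ w : ℝ, 3 ≤ w → ∀ (m : ℕ) (T : Finset ℕ), SieveData P m T →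
      log (m * ∏ ℓ ∈ T, ℓ : ℕ) ≤ K₁ * w → c * w ^ (-κ) ≤ sieveDensity P T := by
  set B : ℝ := 16 * P.natDegree ^ 2 + 4 * P.natDegree
  have hB : 0 ≤ B := by positivity
  obtain ⟨C, -, h⟩ := exists_sum_inv_prime_le_small (κ / (B + 1)) (by positivity)
  refine ⟨exp (-B * (C + 2 * K₁)), exp_pos _, fun w hw m T hT hlog => ?_⟩
  have hw0 : 0 < w := by linarith
  have h1 := h w (by linarith) (T.filter fun ℓ => (ℓ : ℝ) ≤ w) fun p hp =>
    ⟨hT.prime p (mem_filter.1 hp).1, (mem_filter.1 hp).2⟩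
  have h2 := sum_inv_le_of_large hw0 hT.modulus_pos.ne' (S := T.filter fun ℓ => ¬ (ℓ : ℝ) ≤ w)
    ((filter_subset _ _).trans hT.subset_primeFactors)
    (fun ℓ hℓ => (not_le.mp (mem_filter.1 hℓ).2).le) hlog
  have h3 : ∑ ℓ ∈ T, 1 / (ℓ : ℝ) ≤ κ / (B + 1) * log w + C + 2 * K₁ := by
    rw [← sum_filter_add_sum_filter_not T (fun ℓ => (ℓ : ℝ) ≤ w)]
    linarith
  refine le_trans ?_ (hT.exp_le_prod_one_sub_density h3)
  rw [rpow_def_of_pos hw0, ← exp_add]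
  apply exp_le_exp.2
  have h4 : B * (κ / (B + 1)) ≤ κ := by
    rw [mul_div_assoc', div_le_iff₀ (by positivity)]
    nlinarith
  have h5 : 0 ≤ log w := log_nonneg (by linarith)
  nlinarith [mul_le_mul_of_nonneg_right h4 h5]

lemma exists_sieveDensity_filter_le (P : ℤ[X]) (K₁ : ℝ) :
    ∃ C : ℝ, 1 ≤ C ∧ ∀ w : ℝ, 3 ≤ w → ∀ (m : ℕ) (T : Finset ℕ), SieveData P m T →
      log (m * ∏ ℓ ∈ T, ℓ : ℕ) ≤ K₁ * w →
      sieveDensity P (T.filter fun ℓ => (ℓ : ℝ) ≤ w ^ (1 / 2 : ℝ)) ≤ C * sieveDensity P T := by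
  set B : ℝ := 16 * P.natDegree ^ 2 + 4 * P.natDegree
  have hB : 0 ≤ B := by positivity
  obtain ⟨C, -, h⟩ := exists_sum_inv_prime_le
  refine ⟨max 1 (exp (B * (C + 2 * K₁))), le_max_left _ _, fun w hw m T hT hlog => ?_⟩
  have hw0 : 0 < w := by linarith
  set S : Finset ℕ := T.filter fun ℓ : ℕ => ¬ (ℓ : ℝ) ≤ w ^ (1 / 2 : ℝ)
  have hST : S ⊆ T := filter_subset _ _
  have h1 := h w (by linarith) (S.filter fun ℓ => (ℓ : ℝ) ≤ w) fun p hp => by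
    have hp' := mem_filter.1 hp
    exact ⟨hT.prime p (hST hp'.1), not_le.mp (mem_filter.1 hp'.1).2, hp'.2⟩
  have h2 := sum_inv_le_of_large hw0 hT.modulus_pos.ne' (S := S.filter fun ℓ => ¬ (ℓ : ℝ) ≤ w)
    (((filter_subset _ _).trans hST).trans hT.subset_primeFactors)
    (fun ℓ hℓ => (not_le.mp (mem_filter.1 hℓ).2).le) hlog
  have h3 : ∑ ℓ ∈ S, 1 / (ℓ : ℝ) ≤ C + 2 * K₁ := by
    rw [← sum_filter_add_sum_filter_not S (fun ℓ => (ℓ : ℝ) ≤ w)]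
    linarith
  have h4 : exp (-B * (C + 2 * K₁)) ≤ sieveDensity P S :=
    (hT.mono hST).exp_le_prod_one_sub_density h3
  have h5 : sieveDensity P T =
      sieveDensity P (T.filter fun ℓ => (ℓ : ℝ) ≤ w ^ (1 / 2 : ℝ)) * sieveDensity P S :=
    (prod_filter_mul_prod_filter_not T _ _).symm
  have h6 := (hT.mono (filter_subset (fun ℓ : ℕ => (ℓ : ℝ) ≤ w ^ (1 / 2 : ℝ)) T)).sieveDensity_pos
  set d := sieveDensity P (T.filter fun ℓ => (ℓ : ℝ) ≤ w ^ (1 / 2 : ℝ))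
  calc d = exp (B * (C + 2 * K₁)) * (d * exp (-B * (C + 2 * K₁))) := by
        rw [mul_left_comm, ← exp_add]
        simp
    _ ≤ max 1 (exp (B * (C + 2 * K₁))) * (d * sieveDensity P S) := by
        gcongr
        exact le_max_right _ _
    _ = _ := by rw [h5]

/-- A completely multiplicative function of modulus at most one which on primes is a periodic
function sieved by the roots of a polynomial. -/
structure SieveModel (P : ℤ[X]) (m : ℕ) (T : Finset ℕ) (h₀ : ℕ → ℂ) (G : ℕ →*₀ ℂ) : Prop where
  data : SieveData P m T
  periodic : Periodic h₀ m
  norm_twist_le : ∀ n, ‖h₀ n‖ ≤ 1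
  exists_norm_twist : ∃ a : ℕ, m.Coprime a ∧ ‖h₀ a‖ = 1
  norm_le : ∀ n, ‖G n‖ ≤ 1
  apply_of_not_coprime : ∀ p : ℕ, p.Prime → ¬ (m * ∏ ℓ ∈ T, ℓ).Coprime p → G p = 0
  apply_of_coprime : ∀ p : ℕ, p.Prime → (m * ∏ ℓ ∈ T, ℓ).Coprime p →
    G p = h₀ p * ∏ ℓ ∈ T, (1 - rootInd ℂ P ℓ p)

/-- The mean value on primes of the absolute value of the model function. -/
def modelDensity (P : ℤ[X]) (m : ℕ) (T : Finset ℕ) (h₀ : ℕ → ℂ) : ℝ :=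
  unitAvg m (fun n => ‖h₀ n‖) * sieveDensity P T

namespace SieveModel

variable {P : ℤ[X]} {m : ℕ} {T : Finset ℕ} {h₀ : ℕ → ℂ} {G : ℕ →*₀ ℂ}

lemma periodic_norm (h : SieveModel P m T h₀ G) : Periodic (fun n => ‖h₀ n‖) m :=
  fun n => by simp only [h.periodic n]

lemma inv_totient_le_unitAvg (h : SieveModel P m T h₀ G) :
    (m.totient : ℝ)⁻¹ ≤ unitAvg m (fun n => ‖h₀ n‖) := by
  obtain ⟨a, ha, h1⟩ := h.exists_norm_twist
  exact CharSum.inv_totient_le_unitAvg (fun _ => norm_nonneg _) h.data.pos h.periodic_norm ha h1.ge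

lemma inv_le_unitAvg (h : SieveModel P m T h₀ G) {lam : ℝ} (hm : (m : ℝ) ≤ lam) :
    lam⁻¹ ≤ unitAvg m (fun n => ‖h₀ n‖) := by
  refine le_trans ?_ h.inv_totient_le_unitAvg
  have h0 : (0 : ℝ) < m.totient := mod_cast totient_pos.2 h.data.pos
  exact inv_anti₀ h0 (le_trans (mod_cast Nat.totient_le m) hm)

lemma unitAvg_pos (h : SieveModel P m T h₀ G) : 0 < unitAvg m (fun n => ‖h₀ n‖) :=
  lt_of_lt_of_le (by have := totient_pos.2 h.data.pos; positivity) h.inv_totient_le_unitAvg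

lemma norm_unitAvg_le (m : ℕ) (h₀ : ℕ → ℂ) : ‖unitAvg m h₀‖ ≤ unitAvg m (fun n => ‖h₀ n‖) := by
  unfold unitAvg
  rw [norm_mul, norm_inv, Complex.norm_natCast]
  gcongr
  exact norm_sum_le _ _

lemma unitAvg_norm_le_one (h : SieveModel P m T h₀ G) : unitAvg m (fun n => ‖h₀ n‖) ≤ 1 := by
  rw [← unitAvg_one (R := ℝ) m h.data.pos]
  unfold unitAvg
  gcongr
  exact h.norm_twist_le _

lemma modelDensity_pos (h : SieveModel P m T h₀ G) : 0 < modelDensity P m T h₀ :=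
  mul_pos h.unitAvg_pos h.data.sieveDensity_pos

lemma modelDensity_le_one (h : SieveModel P m T h₀ G) : modelDensity P m T h₀ ≤ 1 :=
  mul_le_one₀ h.unitAvg_norm_le_one h.data.sieveDensity_pos.le h.data.prod_one_sub_density_le_one

end SieveModel

lemma exists_modelDensity_ge (P : ℤ[X]) {lam K₁ κ : ℝ} (hlam : 0 < lam) (hκ : 0 < κ) :
    ∃ c : ℝ, 0 < c ∧ ∀ w : ℝ, 3 ≤ w → ∀ (m : ℕ) (T : Finset ℕ) (h₀ : ℕ → ℂ) (G : ℕ →*₀ ℂ),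
      SieveModel P m T h₀ G → (m : ℝ) ≤ lam → log (m * ∏ ℓ ∈ T, ℓ : ℕ) ≤ K₁ * w →
      c * w ^ (-κ) ≤ modelDensity P m T h₀ := by
  obtain ⟨c, hc, h⟩ := exists_sieveDensity_ge P (K₁ := K₁) hκ
  refine ⟨lam⁻¹ * c, by positivity, fun w hw m T h₀ G hM hm hlog => ?_⟩
  rw [mul_assoc]
  exact mul_le_mul (hM.inv_le_unitAvg hm) (h w hw m T hM.data hlog) (by positivity)
    hM.unitAvg_pos.le

/-- The mass of the Dirichlet series of the constant function one at `2`. -/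
def squareMass : ℝ := (LSeries (absFn fun _ => 1) ((2 : ℝ) : ℂ)).re

lemma re_LSeries_two_le {c : ℕ → ℂ} (hc : ∀ n, ‖c n‖ ≤ 1) :
    (LSeries c ((2 : ℝ) : ℂ)).re ≤ squareMass := by
  have hs : LSeriesSummable (fun _ : ℕ => (1 : ℂ)) ((2 : ℝ) : ℂ) :=
    summable_logMul_iterate (abscissa_le_one_of_bounded (C := 1) (by simp)) 0 (by simp)
  refine (re_le_norm _).trans
    ((norm_LSeries_le_of_norm_le hs fun n => by simpa using hc n).trans_eq ?_)
  simp [squareMass]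

lemma squareMass_nonneg : 0 ≤ squareMass := by
  have := re_LSeries_two_le (c := 0) (by simp)
  simpa using this

/-- The growth of a prime Dirichlet series towards `1` is at most logarithmic. -/
lemma exists_re_LSeries_primePart_le : ∃ C : ℝ, 1 ≤ C ∧ ∀ F : ℕ → ℂ, (∀ n, ‖F n‖ ≤ 1) →
    ∀ σ : ℝ, 1 < σ → σ ≤ 2 →
      (LSeries (primePart F) σ).re ≤ squareMass + C * log (1 / (σ - 1)) := by
  obtain ⟨C, hC, h⟩ := exists_charLam_trivial_bound
  refine ⟨C, hC, fun F hF σ hσ hσ2 => ?_⟩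
  have key := re_LSeries_le_of_re_logMul_le (c := primePart F) (t := 0) (σ₁ := σ) (σ₂ := 2)
    (b := C) (E := 0) (abscissa_le_one_of_bounded (C := 1) (norm_primePart_le hF)) hσ hσ2
    fun τ hτ hτ2 => ?_
  · simp only [ofReal_zero, zero_mul, add_zero] at key
    have h2 := re_LSeries_two_le (norm_primePart_le hF)
    norm_num at key h2 ⊢
    linarith
  · simp only [ofReal_zero, zero_mul, add_zero]
    have h1 := h (logMul (primePart F)) 1 zero_le_one (fun n => ?_) (τ : ℂ)
      (by simp; linarith) (by simp; linarith) 0 zero_le_one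
    · refine (re_le_norm _).trans ?_
      simpa using h1
    · rw [one_mul, logMul, primePart]
      split_ifs with hp
      · rw [vonMangoldt_apply_prime hp, norm_mul, ← natCast_log,
          norm_real, norm_of_nonneg (log_natCast_nonneg n)]
        exact mul_le_of_le_one_right (log_natCast_nonneg n) (hF n)
      · simp [vonMangoldt_nonneg]

/-- The nonnegative majorant of a model function obtained by sieving with a subset of the
primes. -/
def sieveMajorant (P : ℤ[X]) (S : Finset ℕ) (h₀ : ℕ → ℂ) (n : ℕ) : ℂ :=
  ((‖h₀ n‖ : ℝ) : ℂ) * ∏ ℓ ∈ S, (1 - rootInd ℂ P ℓ n)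

lemma prod_one_sub_rootInd_mem (P : ℤ[X]) (S : Finset ℕ) (n : ℕ) :
    (∏ ℓ ∈ S, (1 - rootInd ℂ P ℓ n) : ℂ) = 0 ∨ (∏ ℓ ∈ S, (1 - rootInd ℂ P ℓ n) : ℂ) = 1 := by
  by_cases h : ∃ ℓ ∈ S, (ℓ : ℤ) ∣ P.eval (n : ℤ)
  · obtain ⟨ℓ, hℓ, hd⟩ := h
    exact Or.inl (prod_eq_zero hℓ (by simp [rootInd, hd]))
  · push Not at h
    exact Or.inr (prod_eq_one fun ℓ hℓ => by simp [rootInd, h ℓ hℓ])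

lemma norm_prod_one_sub_rootInd_le (P : ℤ[X]) (S : Finset ℕ) (n : ℕ) :
    ‖(∏ ℓ ∈ S, (1 - rootInd ℂ P ℓ n) : ℂ)‖ ≤ 1 := by
  rcases prod_one_sub_rootInd_mem P S n with h | h <;> simp [h]

lemma norm_sieveMajorant_le {P : ℤ[X]} {S : Finset ℕ} {h₀ : ℕ → ℂ} (h : ∀ n, ‖h₀ n‖ ≤ 1) (n : ℕ) :
    ‖sieveMajorant P S h₀ n‖ ≤ 1 := by
  rw [sieveMajorant, norm_mul]
  exact mul_le_one₀ (by simpa using h n) (norm_nonneg _) (norm_prod_one_sub_rootInd_le P S n)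

lemma absFn_sieveMajorant (P : ℤ[X]) (S : Finset ℕ) (h₀ : ℕ → ℂ) :
    absFn (sieveMajorant P S h₀) = sieveMajorant P S h₀ := by
  ext n
  unfold absFn sieveMajorant
  rcases prod_one_sub_rootInd_mem P S n with h | h <;> simp [h]

lemma SieveModel.norm_apply_le_sieveMajorant {P : ℤ[X]} {m : ℕ} {T S : Finset ℕ} {h₀ : ℕ → ℂ}
    {G : ℕ →*₀ ℂ} (h : SieveModel P m T h₀ G) (hS : S ⊆ T) {p : ℕ} (hp : p.Prime) :
    ‖G p‖ ≤ ‖sieveMajorant P S h₀ p‖ := by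
  by_cases hc : (m * ∏ ℓ ∈ T, ℓ).Coprime p
  · rw [h.apply_of_coprime p hp hc, sieveMajorant, norm_mul, norm_mul, norm_real, norm_norm,
      ← prod_sdiff hS, norm_mul]
    exact mul_le_mul_of_nonneg_left (mul_le_of_le_one_left (norm_nonneg _)
      (norm_prod_one_sub_rootInd_le P _ p)) (norm_nonneg _)
  · rw [h.apply_of_not_coprime p hp hc, norm_zero]
    exact norm_nonneg _

lemma SieveModel.re_LSeries_absFn_le {P : ℤ[X]} {m : ℕ} {T S : Finset ℕ} {h₀ : ℕ → ℂ}
    {G : ℕ →*₀ ℂ} (h : SieveModel P m T h₀ G) (hS : S ⊆ T) {σ : ℝ} (hσ : 1 < σ) :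
    (LSeries (primePart (absFn G)) σ).re ≤ (LSeries (primePart (sieveMajorant P S h₀)) σ).re := by
  refine (re_le_norm _).trans ?_
  have hs : LSeriesSummable (primePart (sieveMajorant P S h₀)) (σ : ℂ) :=
    summable_logMul_iterate (abscissa_le_one_of_bounded (C := 1)
      (norm_primePart_le (norm_sieveMajorant_le h.norm_twist_le))) 0 (by simpa using hσ)
  have key := norm_LSeries_le_of_norm_le (c := primePart (absFn G)) hs fun n => by
    unfold primePart
    split_ifs with hp
    · simpa [absFn] using h.norm_apply_le_sieveMajorant hS hp
    · simp
  rwa [absFn_primePart, absFn_sieveMajorant, ofReal_re] at key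

lemma exists_re_sieveMajorant_le (P : ℤ[X]) {lam : ℝ} (hlam : 1 ≤ lam) : ∃ C : ℝ, 1 ≤ C ∧
    ∀ w : ℝ, 3 ≤ w → ∀ (m : ℕ) (T : Finset ℕ) (h₀ : ℕ → ℂ) (G : ℕ →*₀ ℂ),
      SieveModel P m T h₀ G → (m : ℝ) ≤ lam → ∀ S ⊆ T, (∀ ℓ ∈ S, (ℓ : ℝ) ≤ w ^ (1 / 2 : ℝ)) →
      ∀ σ : ℝ, 1 < σ → σ ≤ 2 →
        (LSeries (logMul (primePart (sieveMajorant P S h₀))) σ).re ≤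
          (unitAvg m (fun n => ‖h₀ n‖) * sieveDensity P S + 1 / w) / (σ - 1) +
            (exp (C * w ^ (1 / 2 : ℝ)) * w ^ 13 + nonprimeMass) := by
  obtain ⟨C₁, hC₁, h₁⟩ := exists_sieve_bound
  obtain ⟨C₂, hC₂, h₂⟩ := exists_sieveError_smooth_le hC₁ hlam P.natDegree
  refine ⟨14 * C₂, by linarith, fun w hw m T h₀ G hM hm S hS hSw σ hσ hσ2 => ?_⟩
  have hw0 : 0 < w := by linarith
  have hz1 : 1 ≤ w ^ (1 / 2 : ℝ) := one_le_rpow (by linarith) (by norm_num)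
  set F := sieveMajorant P S h₀ with hF
  set ζ := exp (C₂ * w ^ (1 / 2 : ℝ)) with hζ
  have hζ1 : 1 ≤ ζ := one_le_exp (by positivity)
  have hSd := hM.data.mono hS
  have hFle : ∀ n, ‖F n‖ ≤ 1 := norm_sieveMajorant_le hM.norm_twist_le
  have hσ' : 1 < (σ : ℂ).re := by simpa using hσ
  have e1 := h₂ _ hz1 m S hSd.pos hm (fun ℓ hℓ => ⟨hSd.prime ℓ hℓ, hSw ℓ hℓ⟩) 0 le_rfl zero_le_one
  have e2 := (h₁ P m S hSd (fun n => ((‖h₀ n‖ : ℝ) : ℂ))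
    (fun n => by simp only [hM.periodic n]) (fun n => by simpa using hM.norm_twist_le n) F hFle
    (fun p _ _ => rfl) (σ : ℂ) hσ' (by simpa using hσ2) 0 zero_le_one).2 (by simp) (ζ * w)
    (by nlinarith)
  simp only [Function.iterate_zero, id, ofReal_im, abs_zero, mul_zero, zero_add,
    pow_one] at e2
  have hnorm : ‖(σ : ℂ) - 1‖ = σ - 1 := by
    rw [← ofReal_one, ← ofReal_sub, norm_real,
      norm_of_nonneg (by linarith)]
  have hσ1 : 0 < σ - 1 := by linarith
  have e3 : (LSeries (fun n => F n * Λ n) σ).re ≤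
      unitAvg m (fun n => ‖h₀ n‖) * sieveDensity P S / (σ - 1) +
        ζ * ((ζ * w) ^ 13 + 1 / (ζ * w) / (σ - 1)) := by
    have e4 := (re_le_norm _).trans (e2.trans
      (mul_le_mul_of_nonneg_right e1 (by positivity)))
    rw [sub_re, hnorm] at e4
    have e5 : (unitAvg m (fun n => ((‖h₀ n‖ : ℝ) : ℂ)) *
        ((∏ ℓ ∈ S, (1 - rootDensity P ℓ) : ℝ) : ℂ) * (1 / ((σ : ℂ) - 1))).re =
        unitAvg m (fun n => ‖h₀ n‖) * sieveDensity P S / (σ - 1) := by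
      rw [← ofReal_unitAvg, ← ofReal_one, ← ofReal_sub, ← ofReal_div,
        ← ofReal_mul, ← ofReal_mul, ofReal_re, sieveDensity, mul_one_div]
    rw [e5] at e4
    linarith
  have e6 := (re_le_norm _).trans
    (norm_LSeries_logMul_primePart_sub_le hFle (s := σ) hσ')
  rw [sub_re] at e6
  have e7 : ζ * ((ζ * w) ^ 13 + 1 / (ζ * w) / (σ - 1)) =
      exp (14 * C₂ * w ^ (1 / 2 : ℝ)) * w ^ 13 + 1 / w / (σ - 1) := by
    rw [show exp (14 * C₂ * w ^ (1 / 2 : ℝ)) = ζ ^ 14 by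
      rw [hζ, ← exp_nat_mul]; push_cast; ring_nf]
    field_simp
  rw [e7] at e3
  rw [add_div]
  linarith

lemma rpow_neg_eq_exp {X : ℝ} (hX : 0 < X) (ε : ℝ) : X ^ (-ε) = exp (-(ε * log X)) := by
  rw [rpow_def_of_pos hX]
  congr 1
  ring

lemma exp_mul_pow_mul_le_one {A c ε w α : ℝ} (hA : 0 ≤ A) (hc : 0 < c) (hε : 0 < ε)
    (hw : 1 ≤ w) (hα : c * w ^ (-(1 / 4) : ℝ) ≤ α) (hwA : ((A + 26) / (ε * c)) ^ 4 ≤ w) :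
    exp (A * w ^ (1 / 2 : ℝ)) * w ^ 13 * exp (-(ε * α * w)) ≤ 1 := by
  have hw0 : 0 < w := by linarith
  have h1 : log w ≤ 2 * w ^ (1 / 2 : ℝ) := by
    have := log_le_rpow_div hw0.le (show (0 : ℝ) < 1 / 2 by norm_num)
    linarith
  have h2 : (A + 26) / (ε * c) ≤ w ^ (1 / 4 : ℝ) := by
    calc (A + 26) / (ε * c) = (((A + 26) / (ε * c)) ^ 4) ^ (1 / 4 : ℝ) := by
          rw [← rpow_natCast, ← rpow_mul (by positivity)]
          norm_num
      _ ≤ _ := by gcongr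
  have h3 : (A + 26) * w ^ (1 / 2 : ℝ) ≤ ε * α * w := by
    rw [div_le_iff₀ (by positivity)] at h2
    calc (A + 26) * w ^ (1 / 2 : ℝ) ≤ w ^ (1 / 4 : ℝ) * (ε * c) * w ^ (1 / 2 : ℝ) := by gcongr
      _ = ε * (c * w ^ (-(1 / 4) : ℝ)) * w := by
          have e : w ^ (1 / 4 : ℝ) * w ^ (1 / 2 : ℝ) = w ^ (-(1 / 4) : ℝ) * w := by
            rw [← rpow_add hw0, ← rpow_add_one hw0.ne']
            norm_num
          linear_combination (ε * c) * e
      _ ≤ ε * α * w := by gcongr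
  rw [← exp_log (pow_pos hw0 13), ← exp_add, ← exp_add, log_pow,
    exp_le_one_iff]
  push_cast
  linarith

lemma exists_start_le (P : ℤ[X]) {lam K₁ : ℝ} (hlam : 1 ≤ lam) : ∃ C : ℝ, 1 ≤ C ∧
    ∀ ε : ℝ, 0 < ε → ε ≤ 1 → ∃ X₀ C₀ : ℝ, 0 ≤ C₀ ∧ ∀ X : ℝ, X₀ ≤ X →
      ∀ (m : ℕ) (T : Finset ℕ) (h₀ : ℕ → ℂ) (G : ℕ →*₀ ℂ), SieveModel P m T h₀ G →
        (m : ℝ) ≤ lam → log (m * ∏ ℓ ∈ T, ℓ : ℕ) ≤ K₁ * log X →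
        (LSeries (primePart (absFn G)) ((1 + X ^ (-ε) : ℝ) : ℂ)).re ≤
          C * ε * modelDensity P m T h₀ * log X + C₀ := by
  obtain ⟨C₁, hC₁, h₁⟩ := exists_re_LSeries_primePart_le
  obtain ⟨C₂, hC₂, h₂⟩ := exists_sieveDensity_filter_le P K₁
  obtain ⟨C₃, hC₃, h₃⟩ := exists_re_sieveMajorant_le P hlam
  obtain ⟨c, hc, h₄⟩ := exists_modelDensity_ge P (lam := lam) (K₁ := K₁) (κ := 1 / 4)
    (by linarith) (by norm_num)
  have hnp := nonprimeMass_nonneg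
  have hsq := squareMass_nonneg
  refine ⟨C₁ + C₂, by linarith, fun ε hε hε1 => ⟨exp (max 3 (((C₃ + 26) / (ε * c)) ^ 4)),
    squareMass + nonprimeMass + 2, by linarith, fun X hX m T h₀ G hM hm hN => ?_⟩⟩
  have hX0 : 0 < X := (exp_pos _).trans_le hX
  have hw := (le_log_iff_exp_le hX0).mpr hX
  set w := log X with hw_def
  have hw3 : 3 ≤ w := (le_max_left _ _).trans hw
  have hw0 : 0 < w := by linarith
  set α := modelDensity P m T h₀ with hα
  have hα0 : 0 < α := hM.modelDensity_pos
  have hα1 : α ≤ 1 := hM.modelDensity_le_one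
  have hαc := h₄ w hw3 m T h₀ G hM hm hN
  have hdecay := exp_mul_pow_mul_le_one (by linarith) hc hε (by linarith) hαc
    ((le_max_right _ _).trans hw)
  set S : Finset ℕ := T.filter fun ℓ : ℕ => (ℓ : ℝ) ≤ w ^ (1 / 2 : ℝ) with hS
  have hST : S ⊆ T := filter_subset _ _
  have hαS : unitAvg m (fun n => ‖h₀ n‖) * sieveDensity P S ≤ C₂ * α := by
    rw [hα, modelDensity, mul_left_comm]
    exact mul_le_mul_of_nonneg_left (h₂ w hw3 m T hM.data hN) hM.unitAvg_pos.le
  set u₁ := exp (-(ε * w)) with hu₁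
  set u₂ := exp (-(ε * α * w)) with hu₂
  have hu₁0 : 0 < u₁ := exp_pos _
  have hu₂0 : 0 < u₂ := exp_pos _
  have hu12 : u₁ ≤ u₂ := exp_le_exp.2 (by
    have : ε * α * w ≤ ε * 1 * w := by gcongr
    linarith)
  have hu₂1 : u₂ ≤ 1 := exp_le_one_iff.2 (by
    have : 0 ≤ ε * α * w := by positivity
    linarith)
  rw [rpow_neg_eq_exp hX0, ← hw_def, ← hu₁]
  refine (hM.re_LSeries_absFn_le hST (by linarith)).trans ?_
  set F := sieveMajorant P S h₀ with hF
  have hFle : ∀ n, ‖F n‖ ≤ 1 := norm_sieveMajorant_le hM.norm_twist_le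
  have key := re_LSeries_le_of_re_logMul_le (c := primePart F) (t := 0) (σ₁ := 1 + u₁)
    (σ₂ := 1 + u₂) (b := C₂ * α + 1 / w)
    (E := exp (C₃ * w ^ (1 / 2 : ℝ)) * w ^ 13 + nonprimeMass)
    (abscissa_le_one_of_bounded (C := 1) (norm_primePart_le hFle)) (by linarith) (by linarith)
    fun σ hσ1 hσ2 => ?_
  · simp only [ofReal_zero, zero_mul, add_zero, add_sub_cancel_left] at key
    refine key.trans ?_
    have e1 := h₁ F hFle (1 + u₂) (by linarith) (by linarith)
    rw [add_sub_cancel_left, one_div, ← exp_neg, neg_neg, log_exp] at e1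
    have e2 : log (u₂ / u₁) ≤ ε * w := by
      rw [hu₁, hu₂, ← exp_sub, log_exp]
      have : 0 ≤ ε * α * w := by positivity
      linarith
    have e3 : (C₂ * α + 1 / w) * log (u₂ / u₁) ≤ C₂ * α * ε * w + 1 := by
      calc _ ≤ (C₂ * α + 1 / w) * (ε * w) := by gcongr
        _ = C₂ * α * ε * w + ε := by field_simp
        _ ≤ _ := by linarith
    have e4 : (exp (C₃ * w ^ (1 / 2 : ℝ)) * w ^ 13 + nonprimeMass) * (1 + u₂ - (1 + u₁)) ≤
        1 + nonprimeMass := by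
      calc _ ≤ (exp (C₃ * w ^ (1 / 2 : ℝ)) * w ^ 13 + nonprimeMass) * u₂ := by
            gcongr
            linarith
        _ = exp (C₃ * w ^ (1 / 2 : ℝ)) * w ^ 13 * u₂ + nonprimeMass * u₂ := by ring
        _ ≤ 1 + nonprimeMass * 1 := by gcongr
        _ = _ := by ring
    linarith
  · simp only [ofReal_zero, zero_mul, add_zero]
    refine (h₃ w hw3 m T h₀ G hM hm S hST (fun ℓ hℓ => (mem_filter.1 hℓ).2) σ
      (by linarith) (by linarith)).trans ?_
    have : 0 < σ - 1 := by linarith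
    gcongr

lemma SieveModel.absFn_apply_of_coprime {P : ℤ[X]} {m : ℕ} {T : Finset ℕ} {h₀ : ℕ → ℂ}
    {G : ℕ →*₀ ℂ} (h : SieveModel P m T h₀ G) {p : ℕ} (hp : p.Prime)
    (hc : (m * ∏ ℓ ∈ T, ℓ).Coprime p) :
    absFn G p = ((‖h₀ p‖ : ℝ) : ℂ) * ∏ ℓ ∈ T, (1 - rootInd ℂ P ℓ p) := by
  rw [absFn, h.apply_of_coprime p hp hc]
  rcases prod_one_sub_rootInd_mem P T p with h | h <;> simp [h]

lemma SieveModel.norm_mean_le {P : ℤ[X]} {m : ℕ} {T : Finset ℕ} {h₀ : ℕ → ℂ}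
    {G : ℕ →*₀ ℂ} (h : SieveModel P m T h₀ G) :
    ‖unitAvg m h₀ * ((sieveDensity P T : ℝ) : ℂ)‖ ≤ modelDensity P m T h₀ := by
  have hd := h.data.sieveDensity_pos.le
  rw [norm_mul, norm_real, norm_of_nonneg hd]
  exact mul_le_mul_of_nonneg_right (norm_unitAvg_le m h₀) hd

/-- With a sufficiently small sieve error, the near and far bounds hold at the scale
`E = X ^ ε`, `E' = X ^ (-ε / 40)`. -/
lemma scaled_error_le {X ε e r : ℝ} (hX : 1 ≤ X) (hε : 0 < ε) (he : e ≤ X ^ (ε / 40)) (hr : 0 ≤ r) :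
    e * ((X ^ (ε / 20)) ^ 13 + 1 / X ^ (ε / 20) / r) ≤ X ^ ε + X ^ (-(ε / 40)) / r ∧
    e * ((X ^ (ε / 20)) ^ 25 + 1 / X ^ (ε / 20) / r) ≤ (X ^ ε) ^ 2 + 1 / r := by
  have hX0 : 0 < X := by linarith
  have e1 : X ^ (ε / 40) * (1 / X ^ (ε / 20)) = X ^ (-(ε / 40)) := by
    rw [one_div, ← rpow_neg hX0.le, ← rpow_add hX0]
    ring_nf
  constructor
  · calc e * ((X ^ (ε / 20)) ^ 13 + 1 / X ^ (ε / 20) / r)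
        ≤ X ^ (ε / 40) * ((X ^ (ε / 20)) ^ 13 + 1 / X ^ (ε / 20) / r) := by gcongr
      _ = X ^ (ε / 40) * (X ^ (ε / 20)) ^ 13 + X ^ (ε / 40) * (1 / X ^ (ε / 20)) / r := by ring
      _ ≤ X ^ ε + X ^ (-(ε / 40)) / r := by
          rw [e1, ← rpow_natCast, ← rpow_mul hX0.le, ← rpow_add hX0]
          gcongr
          norm_num
          linarith
  · calc e * ((X ^ (ε / 20)) ^ 25 + 1 / X ^ (ε / 20) / r)
        ≤ X ^ (ε / 40) * ((X ^ (ε / 20)) ^ 25 + 1 / X ^ (ε / 20) / r) := by gcongr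
      _ = X ^ (ε / 40) * (X ^ (ε / 20)) ^ 25 + X ^ (ε / 40) * (1 / X ^ (ε / 20)) / r := by ring
      _ ≤ (X ^ ε) ^ 2 + 1 / r := by
          rw [e1, ← rpow_natCast, ← rpow_natCast, ← rpow_mul hX0.le,
            ← rpow_mul hX0.le, ← rpow_add hX0]
          gcongr
          · norm_num
            linarith
          · exact rpow_le_one_of_one_le_of_nonpos hX (by linarith)

lemma exists_log_le_rpow {ε : ℝ} (hε : 0 < ε) : ∃ X₀ : ℝ, 3 ≤ X₀ ∧ ∀ X : ℝ, X₀ ≤ X →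
    log X ≤ X ^ ε := by
  obtain ⟨X₁, h⟩ := eventually_atTop.mp ((isLittleO_log_rpow_atTop hε).bound one_pos)
  refine ⟨max X₁ 3, le_max_right _ _, fun X hX => ?_⟩
  have hX3 : 3 ≤ X := (le_max_right _ _).trans hX
  have := h X ((le_max_left _ _).trans hX)
  rw [one_mul, norm_of_nonneg (rpow_nonneg (by linarith) _)] at this
  exact (le_abs_self _).trans this

/-- Sieve models satisfy the analytic hypotheses of the mean value theorem. -/
theorem exists_coreHyp (P : ℤ[X]) {lam K₁ δ : ℝ} (hlam : 1 ≤ lam) (hK : 0 < K₁) (hδ : 0 < δ) :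
    ∃ ε C₀ X₀ : ℝ, 0 ≤ C₀ ∧ 3 ≤ X₀ ∧ ∀ X : ℝ, X₀ ≤ X →
      ∀ (m : ℕ) (T : Finset ℕ) (h₀ : ℕ → ℂ) (G : ℕ →*₀ ℂ), SieveModel P m T h₀ G →
        (m : ℝ) ≤ lam → ((m * ∏ ℓ ∈ T, ℓ : ℕ) : ℝ) ≤ X ^ K₁ →
        ∃ E E' : ℝ, CoreHyp G (unitAvg m h₀ * ((sieveDensity P T : ℝ) : ℂ))
          (modelDensity P m T h₀) X E E' ε (δ / 16) C₀ := by
  obtain ⟨C₁, hC₁, h₁⟩ := exists_start_le P (K₁ := K₁) hlam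
  set ε := min (1 / 8) (δ / (16 * C₁)) with hε_def
  have hε : 0 < ε := by positivity
  have hε8 : ε ≤ 1 / 8 := min_le_left _ _
  have hεC : C₁ * ε ≤ δ / 16 := by
    calc C₁ * ε ≤ C₁ * (δ / (16 * C₁)) := by gcongr; exact min_le_right _ _
      _ = _ := by field_simp
  obtain ⟨X₁, C₀, hC₀, h₂⟩ := h₁ ε hε (by linarith)
  obtain ⟨C, hC, hsieve⟩ := exists_sieve_bound
  obtain ⟨X₂, hX₂, h₃⟩ := exists_sieveError_le hC hlam hK (show 0 < ε / 40 by positivity)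
    P.natDegree
  obtain ⟨X₃, hX₃, h₄⟩ := exists_log_le_rpow (show 0 < ε / 40 by positivity)
  refine ⟨ε, C₀, max X₁ (max X₂ X₃), hC₀, hX₂.trans ((le_max_left _ _).trans (le_max_right _ _)),
    fun X hX m T h₀ G hM hm hN => ⟨X ^ ε, X ^ (-(ε / 40)), ?_⟩⟩
  have hX1 : X₁ ≤ X := (le_max_left _ _).trans hX
  have hX2 : X₂ ≤ X := ((le_max_left _ _).trans (le_max_right _ _)).trans hX
  have hX3 : X₃ ≤ X := ((le_max_right _ _).trans (le_max_right _ _)).trans hX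
  have hX3' : 3 ≤ X := hX₂.trans hX2
  have hX0 : 0 < X := by linarith
  have hXone : 1 ≤ X := by linarith
  have hN0 := hM.data.modulus_pos
  have herr : ∀ y : ℝ, 0 ≤ y → y ≤ X ^ 10 →
      sieveError C P.natDegree m (m * ∏ ℓ ∈ T, ℓ) T.card y ≤ X ^ (ε / 40) :=
    h₃ X hX2 _ hN0.ne' hN m _ T hm hM.data.subset_primeFactors hN0 le_rfl
  have hX10 : 1 ≤ X ^ 10 := one_le_pow₀ hXone
  have hE1 : 1 ≤ X ^ ε := one_le_rpow hXone hε.le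
  have hY1 : 1 ≤ X ^ (ε / 20) := one_le_rpow hXone (by positivity)
  have hsmall : X ^ (ε / 40) ≤ X ^ ε := rpow_le_rpow_of_exponent_le hXone (by linarith)
  have hα0 := hM.modelDensity_pos
  have hα1 := hM.modelDensity_le_one
  have hb := hsieve P m T hM.data h₀ hM.periodic hM.norm_twist_le G hM.norm_le
    hM.apply_of_coprime
  refine
    { norm_le := hM.norm_le
      three_le := hX3'
      norm_mean_le := hM.norm_mean_le
      alpha_le := hα1
      one_le_E := hE1
      E_le := le_rfl
      E_le' := rpow_le_rpow_of_exponent_le hXone hε8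
      E'_nonneg := by positivity
      E'_mul_le := ?_
      eps_pos := hε
      eps_le := by linarith
      eps₁_pos := by positivity
      near := ?_
      near_abs := ?_
      near_deriv := ?_
      far := ?_
      start := ?_ }
  · calc X ^ (-(ε / 40)) * log X ≤ X ^ (-(ε / 40)) * X ^ (ε / 40) := by gcongr; exact h₄ X hX3
      _ = 1 := by rw [← rpow_add hX0]; simp
  · intro s hs hs2 him
    have e1 := (hb s hs hs2 0 zero_le_one).2 him _ hY1
    simp only [Function.iterate_zero, id, mul_zero, zero_add, pow_one, mul_one_div] at e1
    exact e1.trans (scaled_error_le hXone hε (herr _ (abs_nonneg _) (him.trans hX10))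
      (norm_nonneg _)).1
  · intro σ hσ hσ2
    have e1 := (hsieve P m T hM.data (fun n => ((‖h₀ n‖ : ℝ) : ℂ))
      (fun n => by simp only [hM.periodic n]) (fun n => by simpa using hM.norm_twist_le n)
      (absFn G) (norm_absFn_le hM.norm_le) (fun p hp hc => hM.absFn_apply_of_coprime hp hc)
      (σ : ℂ) (by simpa using hσ) (by simpa using hσ2) 0 zero_le_one).2 (by simp) _ hY1
    simp only [Function.iterate_zero, id, mul_zero, zero_add, pow_one, ofReal_im,
      abs_zero] at e1
    have hnorm : ‖(σ : ℂ) - 1‖ = σ - 1 := by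
      rw [← ofReal_one, ← ofReal_sub, norm_real,
        norm_of_nonneg (by linarith)]
    rw [hnorm] at e1
    have e2 := (re_le_norm _).trans (e1.trans (scaled_error_le hXone hε
      (herr 0 le_rfl (by positivity)) (by linarith)).1)
    rw [sub_re] at e2
    have e5 : (unitAvg m (fun n => ((‖h₀ n‖ : ℝ) : ℂ)) *
        ((∏ ℓ ∈ T, (1 - rootDensity P ℓ) : ℝ) : ℂ) * (1 / ((σ : ℂ) - 1))).re =
        modelDensity P m T h₀ / (σ - 1) := by
      rw [← ofReal_unitAvg, ← ofReal_one, ← ofReal_sub, ← ofReal_div,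
        ← ofReal_mul, ← ofReal_mul, ofReal_re, modelDensity,
        sieveDensity, mul_one_div]
    rw [e5] at e2
    linarith
  · intro s hs hs2 him
    have e1 := (hb s hs hs2 1 le_rfl).2 him _ hY1
    simp only [Function.iterate_one, mul_one, one_add_one_eq_two] at e1
    have hne : 0 < ‖s - 1‖ := norm_pos_iff.2 fun h0 => by
      rw [sub_eq_zero.1 h0] at hs
      simp at hs
    have e2 := e1.trans (scaled_error_le hXone hε (herr _ (abs_nonneg _) (him.trans hX10))
      (sq_nonneg ‖s - 1‖)).2
    have e3 : ‖unitAvg m h₀ * ((∏ ℓ ∈ T, (1 - rootDensity P ℓ) : ℝ) : ℂ) * (1 / (s - 1) ^ 2)‖ ≤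
        1 / ‖s - 1‖ ^ 2 := by
      rw [norm_mul, norm_div, norm_one, norm_pow]
      exact mul_le_of_le_one_left (by positivity) (hM.norm_mean_le.trans hα1)
    have e4 := norm_le_norm_add_norm_sub' (LSeries (logMul fun n =>
      G n * Λ n) s)
      (unitAvg m h₀ * ((∏ ℓ ∈ T, (1 - rootDensity P ℓ) : ℝ) : ℂ) * (1 / (s - 1) ^ 2))
    have e5 : 3 / ‖s - 1‖ ^ 2 = 3 * (1 / ‖s - 1‖ ^ 2) := by ring
    have e6 : 0 < 1 / ‖s - 1‖ ^ 2 := by positivity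
    rw [e5]
    linarith
  · intro s hs hs2 him1 him
    have e0 := (hb s hs hs2 0 zero_le_one).1 him1
    have e1 := (hb s hs hs2 1 le_rfl).1 him1
    have e2 := herr _ (abs_nonneg _) him
    exact ⟨(e0.trans e2).trans hsmall, (e1.trans e2).trans (hsmall.trans (by nlinarith))⟩
  · have hlogN : log (m * ∏ ℓ ∈ T, ℓ : ℕ) ≤ K₁ * log X := by
      rw [← log_rpow hX0]
      exact log_le_log (mod_cast hN0) hN
    have hlogX : 0 ≤ log X := log_nonneg hXone
    refine (h₂ X hX1 m T h₀ G hM hm hlogN).trans ?_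
    gcongr

/-- Bounds for the mean values of a sieve model near the scale `X`. -/
lemma exists_meanTo_bounds (P : ℤ[X]) {lam K₁ δ : ℝ} (hlam : 1 ≤ lam) (hK : 0 < K₁)
    (hδ : 0 < δ) (hδ1 : δ ≤ 1) :
    ∃ C X₀ : ℝ, 0 ≤ C ∧ 3 ≤ X₀ ∧ ∀ X ≥ X₀, ∀ (m : ℕ) (T : Finset ℕ) (h₀ : ℕ → ℂ) (G : ℕ →*₀ ℂ),
      SieveModel P m T h₀ G → (m : ℝ) ≤ lam → ((m * ∏ ℓ ∈ T, ℓ : ℕ) : ℝ) ≤ X ^ K₁ →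
      ((unitAvg m h₀).re ≤ (1 - δ) * unitAvg m (fun n => ‖h₀ n‖) →
        ‖meanTo G X‖ ≤ C * X ^ (-1 + (1 - δ / 16) * modelDensity P m T h₀)) ∧
      ∀ L, X / 2 ≤ L → L ≤ X → ‖meanTo G L - meanTo G X‖ ≤
        C * (1 + (X - L)) * X ^ (-1 + (1 - δ / 16) * modelDensity P m T h₀) := by
  obtain ⟨ε, C₀, X₀, hC₀, hX₀, H⟩ := exists_coreHyp P hlam hK hδ
  refine ⟨2 * (CoreHyp.coreConst C₀ + 22), X₀,
    by linarith [CoreHyp.coreConst_nonneg C₀], hX₀, ?_⟩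
  intro X hX m T h₀ G hG hm hq
  obtain ⟨E, E', h⟩ := H X hX m T h₀ G hG hm hq
  refine ⟨fun hre => h.norm_meanTo_le hδ1 ?_, fun L h1 h2 => h.norm_meanTo_sub_le hδ1 h1 h2⟩
  rw [Complex.re_mul_ofReal, modelDensity, ← mul_assoc]
  exact mul_le_mul_of_nonneg_right hre hG.data.sieveDensity_pos.le

/-- The arithmetic function built multiplicatively from the values `a p v` at the prime powers
`p ^ v`. -/
def mulExt (a : ℕ → ℕ → ℂ) : ArithmeticFunction ℂ :=
  ⟨fun n => if n = 0 then 0 else n.factorization.prod a, if_pos rfl⟩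

lemma mulExt_apply {a : ℕ → ℕ → ℂ} {n : ℕ} (hn : n ≠ 0) : mulExt a n = n.factorization.prod a :=
  if_neg hn

lemma isMultiplicative_mulExt (a : ℕ → ℕ → ℂ) : (mulExt a).IsMultiplicative := by
  refine ⟨by simp [mulExt_apply], fun {m n} hmn => ?_⟩
  rcases eq_or_ne m 0 with rfl | hm
  · simp
  rcases eq_or_ne n 0 with rfl | hn
  · simp
  rw [mulExt_apply hm, mulExt_apply hn, mulExt_apply (mul_ne_zero hm hn),
    Nat.factorization_mul_of_coprime hmn]
  exact Finsupp.prod_add_index_of_disjoint hmn.disjoint_primeFactors a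

lemma mulExt_prime_pow {a : ℕ → ℕ → ℂ} (ha : ∀ p, a p 0 = 1) {p : ℕ} (hp : p.Prime) (v : ℕ) :
    mulExt a (p ^ v) = a p v := by
  rw [mulExt_apply (pow_ne_zero _ hp.ne_zero), hp.factorization_pow]
  exact Finsupp.prod_single_index (ha p)

/-- The completely multiplicative function with values `b p` at the primes `p`. -/
def cmul (b : ℕ → ℂ) : ℕ →*₀ ℂ where
  toFun := mulExt fun p e => b p ^ e
  map_zero' := map_zero
  map_one' := (isMultiplicative_mulExt _).1
  map_mul' m n := by
    rcases eq_or_ne m 0 with rfl | hm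
    · simp
    rcases eq_or_ne n 0 with rfl | hn
    · simp
    rw [mulExt_apply hm, mulExt_apply hn, mulExt_apply (mul_ne_zero hm hn),
      Nat.factorization_mul hm hn]
    exact Finsupp.prod_add_index' (fun _ => pow_zero _) fun _ _ _ => pow_add _ _ _

lemma cmul_prime (b : ℕ → ℂ) {p : ℕ} (hp : p.Prime) : cmul b p = b p := by
  have h := mulExt_prime_pow (a := fun p e => b p ^ e) (fun _ => pow_zero _) hp 1
  rwa [pow_one, pow_one] at h

lemma norm_cmul_le {b : ℕ → ℂ} (hb : ∀ p, ‖b p‖ ≤ 1) (n : ℕ) : ‖cmul b n‖ ≤ 1 := by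
  rcases eq_or_ne n 0 with rfl | hn
  · simp
  change ‖mulExt _ n‖ ≤ 1
  rw [mulExt_apply hn, Finsupp.prod, norm_prod]
  exact prod_le_one (fun _ _ => norm_nonneg _) fun p _ => by
    rw [norm_pow]
    exact pow_le_one₀ (norm_nonneg _) (hb p)

/-- The function supported on `k`-th powers with `r ^ k ↦ G r`. -/
def powLift (k : ℕ) (G : ℕ →*₀ ℂ) : ArithmeticFunction ℂ :=
  mulExt fun p v => if k ∣ v then G p ^ (v / k) else 0

lemma powLift_pow {k : ℕ} (hk : k ≠ 0) (G : ℕ →*₀ ℂ) {r : ℕ} (hr : r ≠ 0) :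
    powLift k G (r ^ k) = G r := by
  rw [powLift, mulExt_apply (pow_ne_zero _ hr), Finsupp.prod, Nat.support_factorization,
    Nat.primeFactors_pow _ hk]
  conv_rhs => rw [← Nat.prod_factorization_pow_eq_self hr, Finsupp.prod, map_prod]
  refine prod_congr rfl fun p _ => ?_
  rw [Nat.factorization_pow, Finsupp.smul_apply, smul_eq_mul, if_pos (Dvd.intro _ rfl),
    Nat.mul_div_cancel_left _ (pos_of_ne_zero hk), map_pow]

lemma powLift_eq_zero {k : ℕ} (G : ℕ →*₀ ℂ) {n : ℕ} (hn : ∀ r, r ^ k ≠ n) :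
    powLift k G n = 0 := by
  rcases eq_or_ne n 0 with rfl | hn0
  · exact map_zero
  by_contra h
  rw [powLift, mulExt_apply hn0, Finsupp.prod, ← ne_eq, prod_ne_zero_iff] at h
  refine hn (n.factorization.prod fun p v => p ^ (v / k)) ?_
  conv_rhs => rw [← Nat.prod_factorization_pow_eq_self hn0]
  rw [Finsupp.prod, Finsupp.prod, ← prod_pow]
  refine prod_congr rfl fun p hp => ?_
  rw [← pow_mul, Nat.div_mul_cancel]
  by_contra hd
  exact h p hp (if_neg hd)

lemma sum_powLift {k : ℕ} (hk : k ≠ 0) (G : ℕ →*₀ ℂ) (L : ℝ) :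
    ∑ r ∈ Ioc 0 ⌊exp (k * L)⌋₊, powLift k G r =
      ∑ r ∈ Icc 1 ⌊exp L⌋₊, G r := by
  have hle (s : ℕ) : s ^ k ≤ ⌊exp (k * L)⌋₊ ↔ s ≤ ⌊exp L⌋₊ := by
    rw [le_floor_iff (exp_pos _).le, le_floor_iff (exp_pos _).le,
      exp_nat_mul, Nat.cast_pow]
    exact pow_le_pow_iff_left₀ (Nat.cast_nonneg _) (exp_pos _).le hk
  symm
  refine sum_of_injOn (· ^ k) (fun a _ b _ h => Nat.pow_left_injective hk h) ?_ ?_ ?_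
  · intro s hs
    have hs := mem_Icc.1 hs
    exact mem_coe.2 (mem_Ioc.2 ⟨pow_pos hs.1 k, (hle s).2 hs.2⟩)
  · intro n hn hn'
    refine powLift_eq_zero G fun s hs => hn' ⟨s, ?_, hs⟩
    obtain ⟨h1, h2⟩ := mem_Ioc.1 hn
    subst hs
    exact mem_coe.2 (mem_Icc.2
      ⟨Nat.pos_of_ne_zero fun h => by simp [h, hk] at h1, (hle s).1 h2⟩)
  · intro s hs
    exact (powLift_pow hk G (Nat.one_le_iff_ne_zero.1 (mem_Icc.1 hs).1)).symm

/-- The local factor of the quotient of the Dirichlet series of `g` by that of `powLift k G`. -/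
def corrector (k : ℕ) (g : ℕ → ℂ) (G : ℕ → ℂ) : ArithmeticFunction ℂ :=
  mulExt fun p v => g (p ^ v) - if k ≤ v then G p * g (p ^ (v - k)) else 0

lemma corrector_prime_pow {k : ℕ} (hk : k ≠ 0) {g : ℕ → ℂ} (hg : g 1 = 1) (G : ℕ → ℂ) {p : ℕ}
    (hp : p.Prime) (v : ℕ) : corrector k g G (p ^ v) =
      g (p ^ v) - if k ≤ v then G p * g (p ^ (v - k)) else 0 :=
  mulExt_prime_pow (fun p => by simp [hg, hk]) hp v

lemma sum_range_geom_mul {k : ℕ} (hk : k ≠ 0) {b : ℂ} {c g : ℕ → ℂ} (h0 : c 0 = 1)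
    (hlt : ∀ j, 0 < j → j < k → c j = 0) (hadd : ∀ j, c (k + j) = b * c j) (n : ℕ) :
    ∑ j ∈ range (n + 1),
      c j * (g (n - j) - if k ≤ n - j then b * g (n - j - k) else 0) = g n := by
  induction n using Nat.strong_induction_on with
  | _ n ih =>
    have hsmall (s : ℕ) (hs : 0 < s) (hsk : s ≤ k) (F : ℕ → ℂ) :
        ∑ j ∈ range s, c j * F j = F 0 := by
      rw [sum_eq_single_of_mem 0 (mem_range.2 hs), h0, one_mul]
      intro j hj hj0
      rw [hlt j (pos_of_ne_zero hj0) ((mem_range.1 hj).trans_le hsk), zero_mul]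
    rcases lt_or_ge n k with hn | hn
    · rw [hsmall (n + 1) n.succ_pos hn, if_neg (by simpa using hn)]
      simp
    · obtain ⟨a, rfl⟩ := Nat.exists_eq_add_of_le hn
      rw [add_assoc, sum_range_add, hsmall k (pos_of_ne_zero hk) le_rfl]
      have e : ∀ j ∈ range (a + 1), c (k + j) * (g (k + a - (k + j)) -
          if k ≤ k + a - (k + j) then b * g (k + a - (k + j) - k) else 0) =
          b * (c j * (g (a - j) - if k ≤ a - j then b * g (a - j - k) else 0)) := fun j _ => by
        rw [hadd, Nat.add_sub_add_left, mul_assoc]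
      rw [sum_congr rfl e, ← mul_sum, ih a (by omega)]
      simp

/-- A multiplicative function is the convolution of its corrector with `powLift k G`. -/
lemma powLift_mul_corrector {k : ℕ} (hk : k ≠ 0) {g : ArithmeticFunction ℂ}
    (hg : g.IsMultiplicative) (G : ℕ →*₀ ℂ) : powLift k G * corrector k g G = g := by
  refine (((isMultiplicative_mulExt _).mul (isMultiplicative_mulExt _)).eq_iff_eq_on_prime_powers
    _ _ hg).2 fun p n hp => ?_
  change ∑ x ∈ (p ^ n).divisorsAntidiagonal, powLift k G x.1 * corrector k g G x.2 = _
  rw [Nat.sum_divisorsAntidiagonal (fun a b => powLift k G a * corrector k g G b),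
    Nat.sum_divisors_prime_pow hp]
  refine Eq.trans (sum_congr rfl fun j hj => ?_)
    (sum_range_geom_mul hk (b := G p) (c := fun j => powLift k G (p ^ j))
      (g := fun v => g (p ^ v)) ?_ ?_ ?_ n)
  · rw [Nat.pow_div (Nat.lt_succ_iff.1 (mem_range.1 hj)) hp.pos,
      corrector_prime_pow hk hg.1 _ hp]
  · rw [pow_zero]
    exact (isMultiplicative_mulExt _).1
  all_goals
    intro j
    simp only [powLift, mulExt_prime_pow (a := fun p v => if k ∣ v then G p ^ (v / k) else 0)
      (fun p => by simp) hp]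
  · exact fun h1 h2 => if_neg (Nat.not_dvd_of_pos_of_lt h1 h2)
  · simp only [Nat.dvd_add_right (dvd_refl k)]
    rw [Nat.add_div_left _ (pos_of_ne_zero hk), pow_succ']
    split_ifs <;> simp

/-- The summatory function of `g` in terms of the normalized summatory function of `G`. -/
lemma sum_eq_exp_mul_sum_corrector {k : ℕ} (hk : k ≠ 0) {g : ArithmeticFunction ℂ}
    (hg : g.IsMultiplicative) (G : ℕ →*₀ ℂ) (X : ℝ) :
    ∑ n ∈ Icc 1 ⌊exp (k * X)⌋₊, g n = exp X *
      ∑ m ∈ Icc 1 ⌊exp (k * X)⌋₊, corrector k g G m *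
        ((exp (-(log m / k)) : ℝ) : ℂ) * meanTo G (X - log m / k) := by
  conv_lhs => rw [← powLift_mul_corrector hk hg G, mul_comm (powLift k G)]
  have hI (N : ℕ) : Icc 1 N = Ioc 0 N := rfl
  rw [hI, sum_Ioc_mul_eq_sum_sum, mul_sum]
  refine sum_congr rfl fun m hm => ?_
  have hm0 : (0 : ℝ) < m := Nat.cast_pos.2 (mem_Ioc.1 hm).1
  have hk' : (k : ℝ) ≠ 0 := Nat.cast_ne_zero.2 hk
  have e : exp (k * X) / m = exp (k * (X - log m / k)) := by
    rw [mul_sub, mul_div_cancel₀ _ hk', exp_sub, exp_log hm0]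
  rw [← Nat.floor_div_natCast, e, sum_powLift hk, meanTo]
  have e2 : (exp X : ℂ) * (exp (-(log m / k)) : ℝ) *
      (exp (-(X - log m / k)) : ℝ) = 1 := by
    rw [← ofReal_mul, ← ofReal_mul, ← exp_add, ← exp_add,
      ← ofReal_one, ← exp_zero]
    congr 2
    ring
  linear_combination (-(corrector k g G m) *
    ∑ r ∈ Icc 1 ⌊exp (X - log m / k)⌋₊, G r) * e2

/-- A multiplicative function `g` bounded by `1` whose values at the primes not dividing `N` first
appear at the `k`-th powers, where they are given by `G`. -/
structure PowerSupported (k N : ℕ) (g : ArithmeticFunction ℂ) (G : ℕ →*₀ ℂ) : Prop where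
  one_le : 1 ≤ k
  ne_zero : N ≠ 0
  mult : g.IsMultiplicative
  norm_le : ∀ n, ‖g n‖ ≤ 1
  apply_of_dvd : ∀ p : ℕ, p.Prime → p ∣ N → G p = 0
  apply_of_not_dvd : ∀ p : ℕ, p.Prime → ¬ p ∣ N → G p = g (p ^ k)
  apply_pow : ∀ p : ℕ, p.Prime → ¬ p ∣ N → ∀ v, 1 ≤ v → v < k → g (p ^ v) = 0

lemma summable_and_tsum_le_of_geometric {u : ℕ → ℝ} {y y₀ : ℝ} {j : ℕ} (hu : ∀ v, 0 ≤ u v)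
    (h0 : u 0 ≤ 1) (hlt : ∀ v, 0 < v → v < j → u v = 0) (hj : 0 < j) (hle : ∀ v, u v ≤ 2 * y ^ v)
    (hy : 0 ≤ y) (hyy : y ≤ y₀) (hy₀ : y₀ < 1) :
    Summable u ∧ ∑' v, u v ≤ 1 + 2 / (1 - y₀) * y ^ j := by
  have hy1 : y < 1 := hyy.trans_lt hy₀
  have hs : Summable u := Summable.of_nonneg_of_le hu hle
    ((summable_geometric_of_lt_one hy hy1).mul_left 2)
  refine ⟨hs, ?_⟩
  rw [← hs.sum_add_tsum_nat_add j, sum_eq_single_of_mem 0 (mem_range.2 hj)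
    fun v hv hv0 => hlt v (pos_of_ne_zero hv0) (mem_range.1 hv)]
  refine add_le_add h0 ?_
  have hg : HasSum (fun v : ℕ => 2 * y ^ j * y ^ v) (2 * y ^ j * (1 - y)⁻¹) :=
    (hasSum_geometric_of_lt_one hy hy1).mul_left _
  calc ∑' v, u (v + j) ≤ 2 * y ^ j * (1 - y)⁻¹ := by
        rw [← hg.tsum_eq]
        refine ((summable_nat_add_iff j).2 hs).tsum_le_tsum (fun v => (hle _).trans_eq ?_)
          hg.summable
        rw [pow_add]
        ring
    _ ≤ 2 * y ^ j * (1 - y₀)⁻¹ := by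
        have : 0 < 1 - y₀ := by linarith
        gcongr
    _ = 2 / (1 - y₀) * y ^ j := by ring

/-- The exponent at which the corrector series still converges. -/
def corrExp (k : ℕ) : ℝ := 1 / (k + 1 / 2)

lemma corrExp_pos (k : ℕ) : 0 < corrExp k := by
  unfold corrExp
  positivity

lemma corrExp_le {k : ℕ} (hk : 1 ≤ k) : corrExp k ≤ 2 / 3 := by
  have : (1 : ℝ) ≤ k := mod_cast hk
  rw [corrExp, div_le_div_iff₀ (by positivity) (by norm_num)]
  linarith

/-- The Euler factor constant of the corrector series. -/
def corrConst (k : ℕ) : ℝ := 2 / (1 - 2 ^ (-corrExp k))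

lemma two_rpow_neg_corrExp_lt (k : ℕ) : (2 : ℝ) ^ (-corrExp k) < 1 :=
  rpow_lt_one_of_one_lt_of_neg one_lt_two (neg_neg_of_pos (corrExp_pos k))

lemma corrConst_nonneg (k : ℕ) : 0 ≤ corrConst k :=
  div_nonneg zero_le_two (sub_nonneg.2 (two_rpow_neg_corrExp_lt k).le)

/-- The terms of the corrector series at the exponent `corrExp k`. -/
def corrTerm (k : ℕ) (h : ℕ → ℂ) (n : ℕ) : ℝ := ‖h n‖ * (n : ℝ) ^ (-corrExp k)

lemma corrTerm_nonneg (k : ℕ) (h : ℕ → ℂ) (n : ℕ) : 0 ≤ corrTerm k h n := by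
  unfold corrTerm
  positivity

namespace PowerSupported

variable {k N : ℕ} {g : ArithmeticFunction ℂ} {G : ℕ →*₀ ℂ}

lemma norm_corrector_le (h : PowerSupported k N g G) {p : ℕ} (hp : p.Prime) (v : ℕ) :
    ‖corrector k g G (p ^ v)‖ ≤ 2 := by
  rw [corrector_prime_pow (by linarith [h.one_le]) h.mult.1 _ hp]
  have hG : ‖G p‖ ≤ 1 := by
    by_cases hd : p ∣ N
    · simp [h.apply_of_dvd p hp hd]
    · rw [h.apply_of_not_dvd p hp hd]
      exact h.norm_le _
  refine (norm_sub_le _ _).trans ((add_le_add (h.norm_le _) ?_).trans_eq one_add_one_eq_two)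
  split_ifs
  · rw [norm_mul]
    exact mul_le_one₀ hG (norm_nonneg _) (h.norm_le _)
  · simp

lemma corrector_eq_zero (h : PowerSupported k N g G) {p : ℕ} (hp : p.Prime) (hd : ¬ p ∣ N) {v : ℕ}
    (hv : 0 < v) (hvk : v < k + 1) : corrector k g G (p ^ v) = 0 := by
  rw [corrector_prime_pow (by linarith [h.one_le]) h.mult.1 _ hp]
  rcases (Nat.lt_succ_iff.1 hvk).lt_or_eq with hlt | rfl
  · rw [h.apply_pow p hp hd v hv hlt, if_neg (by omega), sub_zero]
  · rw [if_pos le_rfl, Nat.sub_self, pow_zero, h.mult.1, mul_one, h.apply_of_not_dvd p hp hd,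
      sub_self]

lemma local_summable (h : PowerSupported k N g G) {p : ℕ} (hp : p.Prime) :
    Summable (fun v => corrTerm k (corrector k g G) (p ^ v)) ∧
    ∑' v, corrTerm k (corrector k g G) (p ^ v) ≤
      1 + corrConst k * ((p : ℝ) ^ (-corrExp k)) ^ (if p ∣ N then 1 else k + 1) := by
  have hp0 : (0 : ℝ) < p := Nat.cast_pos.2 hp.pos
  have hpow (v : ℕ) : ((p ^ v : ℕ) : ℝ) ^ (-corrExp k) = ((p : ℝ) ^ (-corrExp k)) ^ v := by
    rw [Nat.cast_pow, ← rpow_natCast, ← rpow_natCast, ← rpow_mul hp0.le,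
      ← rpow_mul hp0.le, mul_comm]
  refine summable_and_tsum_le_of_geometric (fun v => corrTerm_nonneg _ _ _) ?_ ?_ ?_ ?_
    (by positivity) ?_ (two_rpow_neg_corrExp_lt k)
  · simp [corrTerm, (isMultiplicative_mulExt _).1, corrector]
  · intro v hv hvj
    split_ifs at hvj with hd
    · omega
    · rw [corrTerm, h.corrector_eq_zero hp hd hv hvj, norm_zero, zero_mul]
  · split_ifs <;> omega
  · intro v
    rw [corrTerm, hpow]
    gcongr
    exact h.norm_corrector_le hp v
  · exact rpow_le_rpow_of_nonpos two_pos (mod_cast hp.two_le)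
      (neg_nonpos.2 (corrExp_pos k).le)

lemma summable_rpow_corrExp (k : ℕ) :
    Summable fun n : ℕ => ((n : ℝ) ^ (-corrExp k)) ^ (k + 1) := by
  have e (n : ℕ) : ((n : ℝ) ^ (-corrExp k)) ^ (k + 1) = (n : ℝ) ^ (-corrExp k * (k + 1 : ℕ)) := by
    rw [rpow_mul (Nat.cast_nonneg n), rpow_natCast]
  simp_rw [e]
  rw [summable_nat_rpow, corrExp, neg_mul, neg_lt_neg_iff, one_div, ← div_eq_inv_mul,
    lt_div_iff₀ (by positivity)]
  push_cast
  linarith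

/-- The bound for the corrector series. -/
def corrBound (k N : ℕ) : ℝ :=
  exp (corrConst k * (∑' n : ℕ, ((n : ℝ) ^ (-corrExp k)) ^ (k + 1) +
    ∑ ℓ ∈ N.primeFactors, (ℓ : ℝ) ^ (-corrExp k)))

lemma sum_factoredNumbers_le (h : PowerSupported k N g G) (s : Finset ℕ) :
    Summable (fun n : Nat.factoredNumbers s => corrTerm k (corrector k g G) n) ∧
    ∑' n : Nat.factoredNumbers s, corrTerm k (corrector k g G) n ≤ corrBound k N := by
  have h1 : corrTerm k (corrector k g G) 1 = 1 := by
    simp [corrTerm, (isMultiplicative_mulExt _).1, corrector]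
  have hmul {m n : ℕ} (hmn : m.Coprime n) : corrTerm k (corrector k g G) (m * n) =
      corrTerm k (corrector k g G) m * corrTerm k (corrector k g G) n := by
    rw [corrTerm, corrector, (isMultiplicative_mulExt _).2 hmn, norm_mul, Nat.cast_mul,
      mul_rpow (Nat.cast_nonneg _) (Nat.cast_nonneg _), corrTerm, corrTerm]
    ring
  obtain ⟨hs, hsum⟩ := EulerProduct.summable_and_hasSum_factoredNumbers_prod_filter_prime_tsum
    h1 hmul (fun hp => (h.local_summable hp).1.norm) s
  refine ⟨hs.of_norm, ?_⟩
  rw [hsum.tsum_eq]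
  have hC := corrConst_nonneg k
  calc ∏ p ∈ s with p.Prime, ∑' v, corrTerm k (corrector k g G) (p ^ v)
      ≤ ∏ p ∈ s with p.Prime, exp (corrConst k *
          ((p : ℝ) ^ (-corrExp k)) ^ (if p ∣ N then 1 else k + 1)) := by
        refine prod_le_prod (fun p _ => tsum_nonneg fun v => corrTerm_nonneg _ _ _)
          fun p hp => ?_
        refine (h.local_summable (mem_filter.1 hp).2).2.trans ?_
        rw [add_comm]
        exact add_one_le_exp _
    _ = exp (corrConst k * ∑ p ∈ s with p.Prime,
          ((p : ℝ) ^ (-corrExp k)) ^ (if p ∣ N then 1 else k + 1)) := by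
        rw [← exp_sum, mul_sum]
    _ ≤ corrBound k N := by
        refine exp_le_exp.2 (mul_le_mul_of_nonneg_left ?_ hC)
        rw [← sum_filter_add_sum_filter_not _ (fun p => p ∣ N), add_comm]
        refine add_le_add ?_ ?_
        · refine le_trans (sum_le_sum fun p hp => ?_)
            ((summable_rpow_corrExp k).sum_le_tsum (s.filter Nat.Prime |>.filter (¬ · ∣ N))
              fun n _ => by positivity)
          rw [if_neg (mem_filter.1 hp).2]
        · refine (sum_congr rfl fun p hp => ?_).trans_le
            (sum_le_sum_of_subset_of_nonneg (f := fun ℓ : ℕ => (ℓ : ℝ) ^ (-corrExp k))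
              (fun p hp => ?_) fun p _ _ => by positivity)
          · rw [if_pos (mem_filter.1 hp).2, pow_one]
          · obtain ⟨h1, h2⟩ := mem_filter.1 hp
            exact mem_primeFactors.2 ⟨(mem_filter.1 h1).2, h2, h.ne_zero⟩

lemma sum_corrTerm_le (h : PowerSupported k N g G) (u : Finset ℕ) :
    ∑ n ∈ u, corrTerm k (corrector k g G) n ≤ corrBound k N := by
  obtain ⟨hs, hle⟩ := h.sum_factoredNumbers_le (range (u.sup id + 1))
  have h0 : corrTerm k (corrector k g G) 0 = 0 := by simp [corrTerm]
  rw [← sum_erase u h0]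
  have hmem : ∀ n ∈ u.erase 0, n ∈ Nat.factoredNumbers (range (u.sup id + 1)) := by
    intro n hn
    obtain ⟨hn0, hn⟩ := mem_erase.1 hn
    refine Nat.mem_factoredNumbers.2 ⟨hn0, fun p hp => mem_range.2 (Nat.lt_succ_iff.2 ?_)⟩
    exact (Nat.le_of_mem_primeFactorsList hp).trans (le_sup (f := id) hn)
  refine le_trans ?_ hle
  rw [← sum_attach]
  let φ : {n // n ∈ u.erase 0} ↪ Nat.factoredNumbers (range (u.sup id + 1)) :=
    ⟨fun n => ⟨n.1, hmem n.1 n.2⟩, fun a b hab => Subtype.ext (Subtype.mk.inj hab)⟩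
  refine le_of_eq_of_le ?_ (hs.sum_le_tsum ((u.erase 0).attach.map φ)
    fun n _ => corrTerm_nonneg _ _ _)
  rw [sum_map]
  rfl

lemma summable_corrTerm (h : PowerSupported k N g G) :
    Summable (corrTerm k (corrector k g G)) :=
  summable_of_sum_le (corrTerm_nonneg k _) h.sum_corrTerm_le

lemma tsum_corrTerm_le (h : PowerSupported k N g G) :
    ∑' n, corrTerm k (corrector k g G) n ≤ corrBound k N :=
  tsum_le_of_sum_le (corrTerm_nonneg k _) h.sum_corrTerm_le

end PowerSupported

/-- A sum over the prime divisors of `N` is small on a logarithmic scale. -/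
lemma sum_primeFactors_rpow_le {N : ℕ} (hN : N ≠ 0) {θ w K₁ : ℝ} (hθ : 0 < θ) (hθ1 : θ ≤ 1)
    (hw : 1 ≤ w) (hNw : log N ≤ K₁ * w) :
    ∑ ℓ ∈ N.primeFactors, (ℓ : ℝ) ^ (-θ) ≤ (1 + 2 * K₁) * w ^ (1 - θ / 2) := by
  have hw0 : 0 < w := by linarith
  rw [← sum_filter_add_sum_filter_not _ (fun ℓ : ℕ => (ℓ : ℝ) ≤ √w), add_mul, one_mul]
  refine add_le_add ?_ ?_
  · calc ∑ ℓ ∈ N.primeFactors with ((ℓ : ℕ) : ℝ) ≤ √w, (ℓ : ℝ) ^ (-θ)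
        ≤ ∑ ℓ ∈ N.primeFactors with ((ℓ : ℕ) : ℝ) ≤ √w, (1 : ℝ) := by
          refine sum_le_sum fun ℓ hℓ => ?_
          have hp := prime_of_mem_primeFactors (mem_filter.1 hℓ).1
          exact rpow_le_one_of_one_le_of_nonpos (mod_cast hp.one_le) (by linarith)
      _ = ((N.primeFactors.filter fun ℓ : ℕ => (ℓ : ℝ) ≤ √w).card : ℝ) := by simp
      _ ≤ ((Icc 1 ⌊√w⌋₊).card : ℝ) := by
          refine Nat.cast_le.2 (card_le_card fun ℓ hℓ => ?_)
          obtain ⟨h1, h2⟩ := mem_filter.1 hℓ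
          exact mem_Icc.2 ⟨(prime_of_mem_primeFactors h1).one_le, Nat.le_floor h2⟩
      _ ≤ √w := by
          rw [Nat.card_Icc, Nat.add_sub_cancel]
          exact Nat.floor_le (sqrt_nonneg w)
      _ ≤ w ^ (1 - θ / 2) := by
          rw [sqrt_eq_rpow]
          exact rpow_le_rpow_of_exponent_le hw (by linarith)
  · calc ∑ ℓ ∈ N.primeFactors with ¬ ((ℓ : ℕ) : ℝ) ≤ √w, (ℓ : ℝ) ^ (-θ)
        ≤ ∑ ℓ ∈ N.primeFactors with ¬ ((ℓ : ℕ) : ℝ) ≤ √w, w ^ (-(θ / 2)) := by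
          refine sum_le_sum fun ℓ hℓ => ?_
          have h2 := (not_le.1 (mem_filter.1 hℓ).2).le
          refine (rpow_le_rpow_of_nonpos (sqrt_pos.2 hw0) h2 (by linarith)).trans_eq ?_
          rw [sqrt_eq_rpow, ← rpow_mul hw0.le]
          ring_nf
      _ ≤ (N.primeFactors.card : ℝ) * w ^ (-(θ / 2)) := by
          rw [sum_const, nsmul_eq_mul]
          gcongr
          exact filter_subset _ _
      _ ≤ 2 * (K₁ * w) * w ^ (-(θ / 2)) := by
          gcongr
          exact (card_primeFactors_le_log hN).trans (by linarith)
      _ = 2 * K₁ * w ^ (1 - θ / 2) := by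
          rw [sub_eq_add_neg, rpow_add hw0, rpow_one]
          ring

/-- The weight `m ^ (-1 / k)`. -/
def rootWeight (k m : ℕ) : ℝ := exp (-(log m / k))

lemma rootWeight_pos (k m : ℕ) : 0 < rootWeight k m := exp_pos _

lemma rootWeight_mul (k : ℕ) {m n : ℕ} (hm : m ≠ 0) (hn : n ≠ 0) :
    rootWeight k (m * n) = rootWeight k m * rootWeight k n := by
  rw [rootWeight, Nat.cast_mul, log_mul (Nat.cast_ne_zero.2 hm) (Nat.cast_ne_zero.2 hn),
    add_div, neg_add, exp_add, rootWeight, rootWeight]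

lemma rootWeight_pow (k m v : ℕ) : rootWeight k (m ^ v) = rootWeight k m ^ v := by
  rw [rootWeight, Nat.cast_pow, log_pow, rootWeight, ← exp_nat_mul]
  ring_nf

lemma rpow_neg_div_eq_rootWeight_pow (k : ℕ) {p : ℕ} (hp : 0 < p) (j : ℕ) :
    (p : ℝ) ^ (-(j : ℝ) / (k : ℝ)) = rootWeight k p ^ j := by
  rw [rpow_def_of_pos (Nat.cast_pos.2 hp), rootWeight, ← exp_nat_mul]
  ring_nf

lemma rootWeight_lt_one {k p : ℕ} (hk : 0 < k) (hp : 1 < p) : rootWeight k p < 1 := by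
  rw [rootWeight, exp_lt_one_iff, neg_lt_zero]
  exact div_pos (log_pos (mod_cast hp)) (mod_cast hk)

lemma rootWeight_le {k m : ℕ} (hk : 1 ≤ k) (hm : 1 ≤ m) :
    rootWeight k m ≤ (m : ℝ) ^ (-corrExp k) := by
  have hk' : (1 : ℝ) ≤ k := mod_cast hk
  have hm' : (1 : ℝ) ≤ m := mod_cast hm
  rw [rpow_def_of_pos (by linarith), rootWeight, mul_neg, exp_le_exp, neg_le_neg_iff,
    corrExp, mul_one_div]
  exact div_le_div_of_nonneg_left (log_nonneg hm') (by linarith) (by linarith)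

lemma hasProd_eq_zero {ι : Type*} {f : ι → ℂ} {a : ℂ} (hf : HasProd f a) {i : ι} (hi : f i = 0) :
    a = 0 := by
  refine tendsto_nhds_unique hf (tendsto_const_nhds.congr' ?_)
  filter_upwards [eventually_ge_atTop ({i} : Finset ι)] with s hs
  exact (prod_eq_zero (hs (mem_singleton_self i)) hi).symm

namespace PowerSupported

variable {k N : ℕ} {g : ArithmeticFunction ℂ} {G : ℕ →*₀ ℂ}

lemma norm_corrector_mul_le (h : PowerSupported k N g G) (m : ℕ) :
    ‖corrector k g G m * (rootWeight k m : ℂ)‖ ≤ corrTerm k (corrector k g G) m := by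
  rcases Nat.eq_zero_or_pos m with rfl | hm
  · simp [corrTerm]
  rw [norm_mul, norm_real, norm_of_nonneg (rootWeight_pos k m).le, corrTerm]
  gcongr
  exact rootWeight_le h.one_le hm

lemma summable_corrector_mul (h : PowerSupported k N g G) :
    Summable fun m => ‖corrector k g G m * (rootWeight k m : ℂ)‖ :=
  h.summable_corrTerm.of_nonneg_of_le (fun _ => norm_nonneg _) h.norm_corrector_mul_le

/-- If an Euler factor of `g` vanishes at `1 / k`, so does the Dirichlet series of the corrector. -/
lemma tsum_corrector_eq_zero (h : PowerSupported k N g G) {p : ℕ} (hp : p.Prime)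
    (hv : ∑' j : ℕ, g (p ^ j) * (((p : ℝ) ^ (-(j : ℝ) / (k : ℝ)) : ℝ) : ℂ) = 0) :
    ∑' m, corrector k g G m * (rootWeight k m : ℂ) = 0 := by
  have hk : k ≠ 0 := by linarith [h.one_le]
  set z : ℂ := (rootWeight k p : ℂ) with hz
  have hz1 : ‖z‖ < 1 := by
    rw [hz, norm_real, norm_of_nonneg (rootWeight_pos k p).le]
    exact rootWeight_lt_one (pos_of_ne_zero hk) hp.one_lt
  have hv' : ∑' j : ℕ, g (p ^ j) * z ^ j = 0 := by
    rw [← hv]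
    refine tsum_congr fun j => ?_
    rw [rpow_neg_div_eq_rootWeight_pow k hp.pos, ofReal_pow]
  have hs : Summable fun j : ℕ => g (p ^ j) * z ^ j := by
    refine Summable.of_norm_bounded (summable_geometric_of_lt_one (norm_nonneg z) hz1) fun j => ?_
    rw [norm_mul, norm_pow]
    exact mul_le_of_le_one_left (by positivity) (h.norm_le _)
  set u : ℕ → ℂ := fun j => if k ≤ j then G p * g (p ^ (j - k)) * z ^ j else 0 with hu
  have hshift (j : ℕ) : u (j + k) = G p * z ^ k * (g (p ^ j) * z ^ j) := by
    simp only [hu]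
    rw [if_pos (Nat.le_add_left k j), Nat.add_sub_cancel, pow_add]
    ring
  have hus : Summable u := by
    rw [← summable_nat_add_iff k]
    simp_rw [hshift]
    exact hs.mul_left _
  have hu0 : ∑' j, u j = 0 := by
    rw [← hus.sum_add_tsum_nat_add k, sum_eq_zero fun j hj =>
      if_neg (not_le.2 (mem_range.1 hj)), zero_add]
    simp_rw [hshift]
    rw [tsum_mul_left, hv', mul_zero]
  have hlocal : ∑' e : ℕ, corrector k g G (p ^ e) * (rootWeight k (p ^ e) : ℂ) = 0 := by
    have e1 (e : ℕ) : corrector k g G (p ^ e) * (rootWeight k (p ^ e) : ℂ) =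
        g (p ^ e) * z ^ e - u e := by
      rw [corrector_prime_pow hk h.mult.1 _ hp, rootWeight_pow, ofReal_pow, ← hz]
      simp only [hu]
      split_ifs <;> ring
    simp_rw [e1]
    rw [hs.tsum_sub hus, hv', hu0, sub_zero]
  refine hasProd_eq_zero (EulerProduct.eulerProduct_hasProd
    (f := fun m => corrector k g G m * (rootWeight k m : ℂ)) ?_ ?_ h.summable_corrector_mul ?_)
    (i := ⟨p, hp⟩) hlocal
  · simp [corrector, (isMultiplicative_mulExt _).1, rootWeight]
  · intro m n hmn
    rcases eq_or_ne m 0 with rfl | hm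
    · simp
    rcases eq_or_ne n 0 with rfl | hn
    · simp
    rw [rootWeight_mul k hm hn, corrector, (isMultiplicative_mulExt _).2 hmn, ofReal_mul]
    ring
  · simp

end PowerSupported

/-- Comparison of a weighted sum with its main term. -/
lemma norm_sum_mul_le {c a : ℕ → ℂ} {u : ℕ → ℝ} {μ : ℂ} {D H : ℝ} {S : Finset ℕ}
    (hu : Summable u) (hu0 : ∀ m, 0 ≤ u m) (hH : ∑' m, u m ≤ H) (hD : 0 ≤ D)
    (hin : ∀ m ∈ S, ‖c m‖ * ‖a m - μ‖ ≤ D * u m) (hout : ∀ m ∉ S, ‖c m‖ * ‖μ‖ ≤ D * u m)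
    (hc : ∀ m, ‖c m‖ ≤ u m) (hμ : ∑' m, c m = 0 ∨ ‖μ‖ ≤ D) :
    ‖∑ m ∈ S, c m * a m‖ ≤ 2 * D * H := by
  have hcs : Summable c := Summable.of_norm_bounded hu hc
  set b : ℕ → ℂ := fun m => c m * ((if m ∈ S then a m else 0) - μ) with hb
  have hbn (m : ℕ) : ‖b m‖ ≤ D * u m := by
    simp only [hb]
    rw [norm_mul]
    split_ifs with hm
    · exact hin m hm
    · rw [zero_sub, norm_neg]
      exact hout m hm
  have hbs : Summable b := Summable.of_norm_bounded (hu.mul_left D) hbn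
  have e1 : ∑ m ∈ S, c m * a m = ∑' m, b m + (∑' m, c m) * μ := by
    rw [← tsum_mul_right, ← hbs.tsum_add (hcs.mul_right μ), tsum_eq_sum (s := S)]
    · refine sum_congr rfl fun m hm => ?_
      simp only [hb, if_pos hm]
      ring
    · intro m hm
      simp only [hb, if_neg hm]
      ring
  have hH' : D * ∑' m, u m ≤ D * H := mul_le_mul_of_nonneg_left hH hD
  have h1 : ‖∑' m, b m‖ ≤ D * H :=
    (tsum_of_norm_bounded (hu.mul_left D).hasSum hbn).trans (by rwa [tsum_mul_left])
  have h2 : ‖(∑' m, c m) * μ‖ ≤ D * H := by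
    rcases hμ with h0 | hμ
    · rw [h0, zero_mul, norm_zero]
      exact (mul_nonneg hD (tsum_nonneg hu0)).trans hH'
    · rw [norm_mul, mul_comm]
      exact mul_le_mul hμ ((tsum_of_norm_bounded hu.hasSum hc).trans hH) (norm_nonneg _) hD
  rw [e1]
  exact (norm_add_le _ _).trans (by linarith)

open PowerSupported

lemma norm_meanTo_le_one {G : ℕ → ℂ} (hG : ∀ n, ‖G n‖ ≤ 1) (L : ℝ) : ‖meanTo G L‖ ≤ 1 := by
  have h : ‖∑ n ∈ Icc 1 ⌊exp L⌋₊, G n‖ ≤ exp L := by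
    refine (norm_sum_le_of_le _ fun n _ => hG n).trans ?_
    rw [sum_const, Nat.card_Icc, Nat.add_sub_cancel, nsmul_eq_mul, mul_one]
    exact Nat.floor_le (exp_pos L).le
  rw [meanTo, norm_mul, norm_real, norm_of_nonneg (exp_pos _).le]
  calc _ ≤ exp L * exp (-L) := by gcongr
    _ = 1 := by rw [← exp_add, add_neg_cancel, exp_zero]

lemma rootWeight_mul_one_add_le {k m : ℕ} (hk : 1 ≤ k) (hm : 1 ≤ m) :
    rootWeight k m * (1 + log m / k) ≤ (2 * k + 1) * (m : ℝ) ^ (-corrExp k) := by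
  have hk0 : (0 : ℝ) < k := mod_cast hk
  have hm1 : (1 : ℝ) ≤ m := mod_cast hm
  set t : ℝ := log m / k with ht
  have ht0 : 0 ≤ t := div_nonneg (log_nonneg hm1) hk0.le
  have h1 : 1 + t ≤ (2 * k + 1) * exp (t / (2 * k + 1)) := by
    have := add_one_le_exp (t / (2 * k + 1))
    calc 1 + t ≤ (2 * k + 1) * (t / (2 * k + 1) + 1) := by
          rw [mul_add, mul_div_cancel₀ _ (by positivity)]
          linarith
      _ ≤ _ := by gcongr
  have h2 : (m : ℝ) ^ (-corrExp k) = exp (-t) * exp (t / (2 * k + 1)) := by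
    rw [rpow_def_of_pos (by linarith), ← exp_add, corrExp, ht]
    congr 1
    field_simp
    ring
  calc rootWeight k m * (1 + t) ≤ exp (-t) * ((2 * k + 1) * exp (t / (2 * k + 1))) :=
        mul_le_mul_of_nonneg_left h1 (exp_pos _).le
    _ = _ := by
        rw [h2]
        ring

lemma two_mul_rootWeight_le {k m : ℕ} (hk : 1 ≤ k) (hm : 1 ≤ m) {X : ℝ} (hX : 0 < X)
    (h : X / 2 ≤ log m / k) :
    rootWeight k m * 2 ≤ 4 * (2 * k + 1) * X ^ (-1 : ℝ) * (m : ℝ) ^ (-corrExp k) := by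
  have h1 : rootWeight k m * (X / 2) ≤ (2 * k + 1) * (m : ℝ) ^ (-corrExp k) :=
    (mul_le_mul_of_nonneg_left (by linarith) (rootWeight_pos k m).le).trans
      (rootWeight_mul_one_add_le hk hm)
  rw [rpow_neg_one]
  calc rootWeight k m * 2 = 4 * X⁻¹ * (rootWeight k m * (X / 2)) := by
        field_simp
        ring
    _ ≤ 4 * X⁻¹ * ((2 * k + 1) * (m : ℝ) ^ (-corrExp k)) := by gcongr
    _ = _ := by ring

/-- The summatory function of `g`, given the regularity of the means of `G` near the scale `X`. -/
lemma PowerSupported.norm_sum_le {k N : ℕ} {g : ArithmeticFunction ℂ} {G : ℕ →*₀ ℂ}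
    (h : PowerSupported k N g G) (hG : ∀ n, ‖G n‖ ≤ 1) {X C Y : ℝ} (hX : 1 ≤ X) (hC : 0 ≤ C)
    (hY : X ^ (-1 : ℝ) ≤ Y)
    (hL : ∀ L, X / 2 ≤ L → L ≤ X → ‖meanTo G L - meanTo G X‖ ≤ C * (1 + (X - L)) * Y)
    (hμ : ‖meanTo G X‖ ≤ C * Y ∨ ∃ p : ℕ, p.Prime ∧
      ∑' j : ℕ, g (p ^ j) * (((p : ℝ) ^ (-(j : ℝ) / (k : ℝ)) : ℝ) : ℂ) = 0) :
    ‖∑ n ∈ Icc 1 ⌊exp (k * X)⌋₊, g n‖ ≤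
      exp X * (2 * ((2 * k + 1) * (C + 4) * Y) * corrBound k N) := by
  have hk := h.one_le
  have hk0 : (0 : ℝ) < k := mod_cast hk
  have hX0 : 0 < X := by linarith
  have hY0 : 0 ≤ Y := (rpow_nonneg hX0.le _).trans hY
  rw [sum_eq_exp_mul_sum_corrector (by linarith) h.mult G, norm_mul, norm_real,
    norm_of_nonneg (exp_pos X).le]
  refine mul_le_mul_of_nonneg_left ?_ (exp_pos X).le
  have key (m : ℕ) (hm : 1 ≤ m) (B : ℝ) (hB : rootWeight k m * B ≤
      (2 * k + 1) * (C + 4) * Y * (m : ℝ) ^ (-corrExp k)) :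
      ‖corrector k g G m * (rootWeight k m : ℂ)‖ * B ≤
        (2 * k + 1) * (C + 4) * Y * corrTerm k (corrector k g G) m := by
    rw [norm_mul, norm_real, norm_of_nonneg (rootWeight_pos k m).le, corrTerm,
      mul_assoc, mul_left_comm _ ‖_‖]
    exact mul_le_mul_of_nonneg_left hB (norm_nonneg _)
  have hfar (m : ℕ) (hm : 1 ≤ m) (ht : X / 2 ≤ log m / k) :
      rootWeight k m * 2 ≤ (2 * k + 1) * (C + 4) * Y * (m : ℝ) ^ (-corrExp k) := by
    refine (two_mul_rootWeight_le hk hm hX0 ht).trans ?_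
    rw [show 4 * (2 * (k : ℝ) + 1) = (2 * k + 1) * 4 by ring]
    gcongr
    linarith
  refine norm_sum_mul_le (c := fun m => corrector k g G m * (rootWeight k m : ℂ))
    (a := fun m => meanTo G (X - log m / k)) (μ := meanTo G X) h.summable_corrTerm
    (corrTerm_nonneg k _) h.tsum_corrTerm_le (by positivity) ?_ ?_ h.norm_corrector_mul_le ?_
  · intro m hm
    have hm1 := (mem_Icc.1 hm).1
    have hm1' : (1 : ℝ) ≤ m := mod_cast hm1
    refine key m hm1 _ ?_
    have ht0 : 0 ≤ log m / k := div_nonneg (log_nonneg hm1') hk0.le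
    rcases le_total (log m / k) (X / 2) with ht | ht
    · have hw := (rootWeight_pos k m).le
      calc rootWeight k m * ‖meanTo G (X - log m / k) - meanTo G X‖
          ≤ rootWeight k m * (C * (1 + (X - (X - log m / k))) * Y) := by
            gcongr
            exact hL _ (by linarith) (by linarith)
        _ = C * Y * (rootWeight k m * (1 + log m / k)) := by ring
        _ ≤ (C + 4) * Y * ((2 * k + 1) * (m : ℝ) ^ (-corrExp k)) := by
            refine mul_le_mul ?_ (rootWeight_mul_one_add_le hk hm1) (by positivity) (by positivity)
            gcongr
            linarith
        _ = _ := by ring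
    · refine le_trans ?_ (hfar m hm1 ht)
      gcongr
      · exact (rootWeight_pos k m).le
      · refine (norm_sub_le _ _).trans ?_
        linarith [norm_meanTo_le_one hG (X - log m / k), norm_meanTo_le_one hG X]
  · intro m hm
    rcases Nat.eq_zero_or_pos m with rfl | hm0
    · simp [corrTerm]
    refine key m hm0 _ (le_trans ?_ (hfar m hm0 ?_))
    · gcongr
      · exact (rootWeight_pos k m).le
      · linarith [norm_meanTo_le_one hG X]
    · have h1 : exp (k * X) < m := (Nat.floor_lt (exp_pos _).le).1 (by
        by_contra hle
        exact hm (mem_Icc.2 ⟨hm0, not_lt.1 hle⟩))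
      have h2 := log_le_log (exp_pos _) h1.le
      rw [log_exp] at h2
      rw [le_div_iff₀ hk0]
      nlinarith
  · rcases hμ with hμ | ⟨p, hp, hv⟩
    · refine .inr (hμ.trans ?_)
      gcongr
      have : (1 : ℝ) ≤ k := mod_cast hk
      nlinarith
    · exact .inl (h.tsum_corrector_eq_zero hp hv)

lemma exists_rpow_mul_le (A : ℝ) {B a b : ℝ} (hB : 0 < B) (hab : a < b) :
    ∃ w₀ ≥ 1, ∀ w ≥ w₀, A * w ^ a ≤ B * w ^ b := by
  obtain ⟨w₀, hw₀⟩ := eventually_atTop.1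
    ((tendsto_rpow_atTop (sub_pos.2 hab)).eventually_ge_atTop (A / B))
  refine ⟨max 1 w₀, le_max_left _ _, fun w hw => ?_⟩
  have hw1 : 0 < w := by linarith [le_max_left 1 w₀]
  have h := (div_le_iff₀ hB).1 (hw₀ w ((le_max_right _ _).trans hw))
  calc A * w ^ a ≤ w ^ (b - a) * B * w ^ a := by gcongr
    _ = B * w ^ b := by
        rw [mul_right_comm, ← rpow_add hw1, sub_add_cancel, mul_comm]

/-- The corrector bound is absorbed by a power of `X` whose exponent is the model density. -/
lemma exists_corrBound_le (P : ℤ[X]) {k : ℕ} (hk : 1 ≤ k) {lam K₁ η : ℝ} (hlam : 0 < lam)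
    (hη : 0 < η) :
    ∃ C X₀ : ℝ, 0 ≤ C ∧ 3 ≤ X₀ ∧ ∀ X ≥ X₀, ∀ (m : ℕ) (T : Finset ℕ) (h₀ : ℕ → ℂ) (G : ℕ →*₀ ℂ),
      SieveModel P m T h₀ G → (m : ℝ) ≤ lam → ((m * ∏ ℓ ∈ T, ℓ : ℕ) : ℝ) ≤ X ^ K₁ →
      corrBound k (m * ∏ ℓ ∈ T, ℓ) ≤ C * X ^ (η * modelDensity P m T h₀) := by
  have hθ := corrExp_pos k
  have hθ1 := corrExp_le hk
  obtain ⟨c, hc, hdens⟩ := exists_modelDensity_ge P (K₁ := K₁) hlam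
    (by positivity : 0 < corrExp k / 4)
  obtain ⟨w₀, hw₀, habs⟩ := exists_rpow_mul_le (corrConst k * (1 + 2 * K₁)) (mul_pos hη hc)
    (by linarith : 1 - corrExp k / 2 < 1 - corrExp k / 4)
  refine ⟨exp (corrConst k * ∑' n : ℕ, ((n : ℝ) ^ (-corrExp k)) ^ (k + 1)),
    exp (max 3 w₀), (exp_pos _).le, ?_, ?_⟩
  · linarith [add_one_le_exp (max 3 w₀), le_max_left 3 w₀]
  intro X hX m T h₀ G hG hm hN
  have hX0 : 0 < X := (exp_pos _).trans_le hX
  have hw : max 3 w₀ ≤ log X := (le_log_iff_exp_le hX0).2 hX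
  have hw3 := (le_max_left _ _).trans hw
  have hw1 : 0 < log X := by linarith
  have hN0 := hG.data.modulus_pos
  have hlogN : log (m * ∏ ℓ ∈ T, ℓ : ℕ) ≤ K₁ * log X := by
    rw [← log_rpow hX0]
    exact log_le_log (mod_cast hN0) hN
  have hα := hdens _ hw3 m T h₀ G hG hm hlogN
  have hs := sum_primeFactors_rpow_le hN0.ne' hθ (by linarith) (by linarith) hlogN
  rw [corrBound, rpow_def_of_pos hX0, ← exp_add, exp_le_exp, mul_add]
  refine add_le_add le_rfl ?_
  calc corrConst k * ∑ ℓ ∈ (m * ∏ ℓ ∈ T, ℓ).primeFactors, (ℓ : ℝ) ^ (-corrExp k)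
      ≤ corrConst k * ((1 + 2 * K₁) * log X ^ (1 - corrExp k / 2)) :=
        mul_le_mul_of_nonneg_left hs (corrConst_nonneg k)
    _ = corrConst k * (1 + 2 * K₁) * log X ^ (1 - corrExp k / 2) := by ring
    _ ≤ η * c * log X ^ (1 - corrExp k / 4) := habs _ ((le_max_right _ _).trans hw)
    _ = log X * (η * (c * log X ^ (-(corrExp k / 4)))) := by
        rw [sub_eq_add_neg, rpow_add hw1, rpow_one]
        ring
    _ ≤ log X * (η * modelDensity P m T h₀) := by gcongr

/-- The summatory function of a multiplicative function attached to a sieve model, when either the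
mean of the twist is deficient or an Euler factor vanishes. -/
lemma exists_norm_sum_le (P : ℤ[X]) {k : ℕ} (hk : 1 ≤ k) {lam K₁ δ : ℝ} (hlam : 1 ≤ lam)
    (hK : 0 < K₁) (hδ : 0 < δ) (hδ1 : δ ≤ 1) :
    ∃ C X₀ : ℝ, 0 ≤ C ∧ 3 ≤ X₀ ∧ ∀ X ≥ X₀, ∀ (m : ℕ) (T : Finset ℕ) (h₀ : ℕ → ℂ) (G : ℕ →*₀ ℂ)
      (g : ArithmeticFunction ℂ), SieveModel P m T h₀ G → PowerSupported k (m * ∏ ℓ ∈ T, ℓ) g G →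
      (m : ℝ) ≤ lam → ((m * ∏ ℓ ∈ T, ℓ : ℕ) : ℝ) ≤ X ^ K₁ →
      ((unitAvg m h₀).re ≤ (1 - δ) * unitAvg m (fun n => ‖h₀ n‖) ∨ ∃ p : ℕ, p.Prime ∧
        ∑' j : ℕ, g (p ^ j) * (((p : ℝ) ^ (-(j : ℝ) / (k : ℝ)) : ℝ) : ℂ) = 0) →
      ‖∑ n ∈ Icc 1 ⌊exp (k * X)⌋₊, g n‖ ≤
        C * exp X * X ^ (-1 + (1 - δ / 32) * modelDensity P m T h₀) := by
  obtain ⟨C, X₀, hC, hX₀, H⟩ := exists_meanTo_bounds P hlam hK hδ hδ1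
  obtain ⟨C', X₁, hC', -, H'⟩ := exists_corrBound_le P hk (K₁ := K₁) (by linarith : 0 < lam)
    (by positivity : 0 < δ / 32)
  refine ⟨2 * ((2 * k + 1) * (C + 4)) * C', max X₀ X₁, by positivity,
    hX₀.trans (le_max_left _ _), ?_⟩
  intro X hX m T h₀ G g hG hg hm hN hcase
  have hX1 : 1 ≤ X := by linarith [le_max_left X₀ X₁]
  have hX0 : 0 < X := by linarith
  obtain ⟨h1, h2⟩ := H X ((le_max_left _ _).trans hX) m T h₀ G hG hm hN
  have h3 := H' X ((le_max_right _ _).trans hX) m T h₀ G hG hm hN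
  have hα := hG.modelDensity_pos.le
  set α := modelDensity P m T h₀ with hα_def
  have hY : X ^ (-1 : ℝ) ≤ X ^ (-1 + (1 - δ / 16) * α) :=
    rpow_le_rpow_of_exponent_le hX1 (by nlinarith)
  refine (hg.norm_sum_le hG.norm_le hX1 hC hY h2 (hcase.imp_left h1)).trans ?_
  calc exp X * (2 * ((2 * k + 1) * (C + 4) * X ^ (-1 + (1 - δ / 16) * α)) *
        corrBound k (m * ∏ ℓ ∈ T, ℓ))
      ≤ exp X * (2 * ((2 * k + 1) * (C + 4) * X ^ (-1 + (1 - δ / 16) * α)) *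
        (C' * X ^ (δ / 32 * α))) := by gcongr
    _ = 2 * ((2 * k + 1) * (C + 4)) * C' * exp X *
        (X ^ (-1 + (1 - δ / 16) * α) * X ^ (δ / 32 * α)) := by ring
    _ = _ := by
        rw [← rpow_add hX0]
        ring_nf

lemma isUnit_intCast_iff (n : ℕ) (z : ℤ) :
    IsUnit (z : ZMod n) ↔ ∀ p : ℕ, p.Prime → p ∣ n → ¬ (p : ℤ) ∣ z := by
  rw [ZMod.coe_int_isUnit_iff_isCoprime, Int.isCoprime_iff_gcd_eq_one]
  simp only [Int.gcd_def, Int.natAbs_natCast, Int.natCast_dvd]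
  constructor
  · exact fun h p hp hpn hpz => Nat.not_coprime_of_dvd_of_dvd hp.one_lt hpn hpz h
  · exact fun h => Nat.Coprime.symm (Nat.coprime_of_dvd fun p hp hpz hpn => h p hp hpn hpz)

lemma gcd_eq_one_iff_isUnit (n : ℕ) (z : ℤ) : Int.gcd z n = 1 ↔ IsUnit (z : ZMod n) := by
  rw [ZMod.coe_int_isUnit_iff_isCoprime, Int.isCoprime_iff_gcd_eq_one, Int.gcd_comm]

lemma intCast_eval (n : ℕ) (P : ℤ[X]) (z : ℤ) :
    ((P.eval z : ℤ) : ZMod n) = aeval (z : ZMod n) P := by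
  rw [aeval_def, eval₂_at_intCast]
  rfl

lemma intCast_eval_val {n : ℕ} [NeZero n] (P : ℤ[X]) (u : ZMod n) :
    ((P.eval (u.val : ℤ) : ℤ) : ZMod n) = aeval u P := by
  rw [intCast_eval, Int.cast_natCast, ZMod.natCast_zmod_val]

lemma prod_changeLevel_apply {K n q : ℕ} (h : n ∣ q) (χ : Fin K → DirichletCharacter ℂ n)
    (z : Fin K → ℤ) : ∏ i, (χ i).changeLevel h (z i : ZMod q) =
      if Int.gcd (∏ i, z i) q = 1 then ∏ i, χ i (z i : ZMod n) else 0 := by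
  split_ifs with hu
  all_goals rw [gcd_eq_one_iff_isUnit, Int.cast_prod, IsUnit.prod_iff] at hu
  · refine prod_congr rfl fun i hi => ?_
    exact DirichletCharacter.changeLevel_eq_cast_of_dvd' _ h
      ((ZMod.coe_int_isUnit_iff_isCoprime _ _).1 (hu i hi)).symm
  · push Not at hu
    obtain ⟨i, hi, hui⟩ := hu
    exact prod_eq_zero hi (MulChar.map_nonunit _ hui)

/-- The twist of the values of the polynomials `F i` by the characters `χ i`. -/
def polyTwist {K n : ℕ} (χ : Fin K → DirichletCharacter ℂ n) (F : Fin K → ℤ[X]) (a : ℕ) : ℂ :=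
  ∏ i, χ i (((F i).eval (a : ℤ) : ℤ) : ZMod n)

lemma periodic_polyTwist {K n : ℕ} (χ : Fin K → DirichletCharacter ℂ n) (F : Fin K → ℤ[X]) :
    Periodic (polyTwist χ F) n := by
  intro a
  simp only [polyTwist, intCast_eval]
  simp

lemma norm_polyTwist {K n : ℕ} (χ : Fin K → DirichletCharacter ℂ n) (F : Fin K → ℤ[X]) (a : ℕ) :
    ‖polyTwist χ F a‖ = if IsUnit (((∏ i, F i).eval (a : ℤ) : ℤ) : ZMod n) then 1 else 0 := by
  rw [polyTwist, norm_prod]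
  split_ifs with hu
  all_goals rw [eval_prod, Int.cast_prod, IsUnit.prod_iff] at hu
  · exact prod_eq_one fun i hi => (χ i).unit_norm_eq_one (hu i hi).unit
  · push Not at hu
    obtain ⟨i, hi, hui⟩ := hu
    exact prod_eq_zero hi (by rw [MulChar.map_nonunit _ hui, norm_zero])

lemma norm_polyTwist_le {K n : ℕ} (χ : Fin K → DirichletCharacter ℂ n) (F : Fin K → ℤ[X])
    (a : ℕ) : ‖polyTwist χ F a‖ ≤ 1 := by
  rw [norm_polyTwist]
  split_ifs <;> norm_num

/-- A twist that is not trivial on its support has a deficient mean. -/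
lemma re_unitAvg_lt {n : ℕ} {h : ℕ → ℂ} (hn : 0 < n) {a : ℕ} (han : n.Coprime a)
    (hper : Periodic h n) (ha1 : h a ≠ 1) (ha : ‖h a‖ = 1) :
    (unitAvg n h).re < unitAvg n (fun a => ‖h a‖) := by
  have hφ : (0 : ℝ) < (n.totient : ℝ)⁻¹ := by
    have := totient_pos.2 hn
    positivity
  have e : (unitAvg n h).re = (n.totient : ℝ)⁻¹ *
      ∑ a ∈ range n with n.Coprime a, (h a).re := by
    rw [unitAvg, ← re_sum, ← ofReal_natCast, ← Complex.ofReal_inv,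
      Complex.re_ofReal_mul]
  rw [e, unitAvg]
  refine mul_lt_mul_of_pos_left (sum_lt_sum (fun b _ => re_le_norm _)
    ⟨a % n, ?_, ?_⟩) hφ
  · exact mem_filter.2 ⟨mem_range.2 (Nat.mod_lt a hn), by
      rwa [Nat.coprime_comm, Coprime, ← Nat.gcd_rec]⟩
  · rw [hper.map_mod_nat]
    refine lt_of_le_of_ne (re_le_norm _) fun hre => ha1 ?_
    rw [ha] at hre
    have him := Complex.normSq_eq_norm_sq (h a)
    rw [ha, Complex.normSq_apply, hre] at him
    exact Complex.ext hre (by simpa using him)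

/-- Finitely many tuples of characters have a uniform deficiency. -/
lemma exists_uniform_deficiency {K : ℕ} (F : Fin K → ℤ[X]) (M : ℕ) :
    ∃ δ : ℝ, 0 < δ ∧ δ ≤ 1 ∧ ∀ n : ℕ, 0 < n → n ≤ M → ∀ χ : Fin K → DirichletCharacter ℂ n,
      (∀ a : ℕ, n.Coprime a → ‖polyTwist χ F a‖ = 1 → polyTwist χ F a = 1) ∨
      (unitAvg n (polyTwist χ F)).re ≤ (1 - δ) * unitAvg n (fun a => ‖polyTwist χ F a‖) := by
  have key : ∀ᶠ δ : ℝ in nhdsWithin 0 (Set.Ioi 0),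
      ∀ t : (Σ n : Fin M, (Fin K → DirichletCharacter ℂ (n + 1))),
      (∀ a : ℕ, ((t.1 : ℕ) + 1).Coprime a → ‖polyTwist t.2 F a‖ = 1 → polyTwist t.2 F a = 1) ∨
      (unitAvg (t.1 + 1) (polyTwist t.2 F)).re ≤
        (1 - δ) * unitAvg (t.1 + 1) (fun a => ‖polyTwist t.2 F a‖) := by
    rw [eventually_all]
    rintro ⟨n, χ⟩
    by_cases htriv : ∀ a : ℕ, ((n : ℕ) + 1).Coprime a → ‖polyTwist χ F a‖ = 1 → polyTwist χ F a = 1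
    · exact Eventually.of_forall fun _ => .inl htriv
    push Not at htriv
    obtain ⟨a, han, ha, ha1⟩ := htriv
    have hlt := re_unitAvg_lt n.1.succ_pos han (periodic_polyTwist χ F) ha1 ha
    have hle : unitAvg (n + 1) (fun a => ‖polyTwist χ F a‖) ≤ 1 := by
      rw [← unitAvg_one (R := ℝ) (n + 1) n.1.succ_pos, unitAvg, unitAvg]
      gcongr
      exact norm_polyTwist_le χ F _
    filter_upwards [Ioc_mem_nhdsGT (sub_pos.2 hlt)] with δ hδ
    refine .inr ?_
    have := mul_le_of_le_one_right hδ.1.le hle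
    linarith [hδ.2]
  obtain ⟨δ, hδ, hδ0, hδ1⟩ := (key.and (Ioc_mem_nhdsGT zero_lt_one)).exists
  refine ⟨δ, hδ0, hδ1, fun n hn hnM χ => ?_⟩
  obtain ⟨n, rfl⟩ := Nat.exists_eq_add_of_le' hn
  exact hδ ⟨⟨n, hnM⟩, χ⟩

/-- The arithmetic function `n ↦ ∏ i, χ i (f i n)`. -/
def charTwist {K q : ℕ} (f : Fin K → ℕ → ℤ) (χ : Fin K → DirichletCharacter ℂ q) :
    ArithmeticFunction ℂ :=
  ⟨fun n => if n = 0 then 0 else ∏ i, χ i (f i n : ZMod q), if_pos rfl⟩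

lemma charTwist_apply {K q : ℕ} (f : Fin K → ℕ → ℤ) (χ : Fin K → DirichletCharacter ℂ q) {n : ℕ}
    (hn : n ≠ 0) : charTwist f χ n = ∏ i, χ i (f i n : ZMod q) :=
  if_neg hn

lemma isMultiplicative_charTwist {K q : ℕ} {f : Fin K → ℕ → ℤ} (hf : ∀ i, IsMultFn (f i))
    (χ : Fin K → DirichletCharacter ℂ q) : (charTwist f χ).IsMultiplicative := by
  refine ⟨?_, fun {m n} hmn => ?_⟩
  · rw [charTwist_apply _ _ one_ne_zero]
    exact prod_eq_one fun i _ => by rw [(hf i).1, Int.cast_one, map_one]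
  rcases eq_or_ne m 0 with rfl | hm
  · simp
  rcases eq_or_ne n 0 with rfl | hn
  · simp
  rw [charTwist_apply _ _ hm, charTwist_apply _ _ hn, charTwist_apply _ _ (mul_ne_zero hm hn),
    ← prod_mul_distrib]
  exact prod_congr rfl fun i _ => by rw [(hf i).2 m n hmn, Int.cast_mul, map_mul]

lemma norm_charTwist_le {K q : ℕ} (f : Fin K → ℕ → ℤ) (χ : Fin K → DirichletCharacter ℂ q)
    (n : ℕ) : ‖charTwist f χ n‖ ≤ 1 := by
  rcases eq_or_ne n 0 with rfl | hn
  · simp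
  rw [charTwist_apply _ _ hn, norm_prod]
  exact prod_le_one (fun _ _ => norm_nonneg _) fun i _ => (χ i).norm_le_one _

lemma charTwist_prime_pow_eq_zero {K q v : ℕ} {f : Fin K → ℕ → ℤ} {F : Fin K → ℤ[X]}
    (χ : Fin K → DirichletCharacter ℂ q) {p : ℕ} (hp : p.Prime) (hpq : ¬ p ∣ q)
    (hfF : ∀ i, f i (p ^ v) = (F i).eval (p : ℤ))
    (hF : ¬ ∃ u : (ZMod q)ˣ, IsUnit (aeval (u : ZMod q) (∏ i, F i))) :
    charTwist f χ (p ^ v) = 0 := by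
  rw [charTwist_apply _ _ (pow_ne_zero _ hp.ne_zero)]
  by_contra h
  rw [← ne_eq, prod_ne_zero_iff] at h
  refine hF ⟨ZMod.unitOfCoprime p ((Nat.Prime.coprime_iff_not_dvd hp).2 hpq), ?_⟩
  rw [map_prod, IsUnit.prod_iff]
  intro i hi
  have hu : IsUnit ((f i (p ^ v) : ℤ) : ZMod q) := by
    by_contra hnu
    exact h i hi (MulChar.map_nonunit _ hnu)
  rwa [hfF, intCast_eval, Int.cast_natCast] at hu

/-- The prime divisors of `q` that do not divide `n`. -/
def outerPrimes (q n : ℕ) : Finset ℕ := q.primeFactors.filter fun p => ¬ p ∣ n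

lemma mem_outerPrimes {q n p : ℕ} (hq : q ≠ 0) :
    p ∈ outerPrimes q n ↔ p.Prime ∧ p ∣ q ∧ ¬ p ∣ n := by
  simp [outerPrimes, hq, and_assoc]

lemma coprime_of_mem_outerPrimes {q n p : ℕ} (hp : p ∈ outerPrimes q n) : n.Coprime p := by
  obtain ⟨h1, h2⟩ := mem_filter.1 hp
  exact ((prime_of_mem_primeFactors h1).coprime_iff_not_dvd.2 h2).symm

lemma mul_prod_outerPrimes_dvd {q n : ℕ} (h : n ∣ q) : n * ∏ p ∈ outerPrimes q n, p ∣ q :=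
  (Nat.Coprime.prod_right fun _ => coprime_of_mem_outerPrimes).mul_dvd_of_dvd_of_dvd h
    ((prod_dvd_prod_of_subset _ _ _ (filter_subset _ _)).trans
      (prod_primeFactors_dvd q))

lemma prime_dvd_mul_prod_outerPrimes {q n p : ℕ} (hq : q ≠ 0) (h : n ∣ q) (hp : p.Prime) :
    p ∣ n * ∏ p ∈ outerPrimes q n, p ↔ p ∣ q := by
  refine ⟨fun hd => hd.trans (mul_prod_outerPrimes_dvd h), fun hd => ?_⟩
  by_cases hn : p ∣ n
  · exact hn.mul_right _
  · exact (dvd_prod_of_mem id ((mem_outerPrimes hq).2 ⟨hp, hd, hn⟩)).mul_left _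

lemma isUnit_iff_outerPrimes {q n : ℕ} (hq : q ≠ 0) (h : n ∣ q) (z : ℤ) :
    IsUnit (z : ZMod q) ↔ IsUnit (z : ZMod n) ∧ ∀ p ∈ outerPrimes q n, ¬ (p : ℤ) ∣ z := by
  rw [isUnit_intCast_iff, isUnit_intCast_iff]
  refine ⟨fun H => ⟨fun p hp hpn => H p hp (hpn.trans h), fun p hp => ?_⟩, fun H p hp hpq => ?_⟩
  · obtain ⟨hp, hpq, -⟩ := (mem_outerPrimes hq).1 hp
    exact H p hp hpq
  · by_cases hpn : p ∣ n
    · exact H.1 p hp hpn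
    · exact H.2 p ((mem_outerPrimes hq).2 ⟨hp, hpq, hpn⟩)

lemma prod_one_sub_rootInd (R : Type*) [Field R] (P : ℤ[X]) (T : Finset ℕ) (a : ℕ) :
    ∏ ℓ ∈ T, (1 - rootInd R P ℓ a) = if ∀ ℓ ∈ T, ¬ (ℓ : ℤ) ∣ P.eval (a : ℤ) then 1 else 0 := by
  split_ifs with h
  · exact prod_eq_one fun ℓ hℓ => by rw [rootInd, if_neg (h ℓ hℓ), sub_zero]
  · push Not at h
    obtain ⟨ℓ, hℓ, hd⟩ := h
    exact prod_eq_zero hℓ (by rw [rootInd, if_pos hd, sub_self])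

lemma norm_polyTwist_mul_prod {K q n : ℕ} (hq : q ≠ 0) (h : n ∣ q)
    (χ : Fin K → DirichletCharacter ℂ n) (F : Fin K → ℤ[X]) (a : ℕ) :
    ‖polyTwist χ F a‖ * ∏ ℓ ∈ outerPrimes q n, (1 - rootInd ℝ (∏ i, F i) ℓ a) =
      if IsUnit (((∏ i, F i).eval (a : ℤ) : ℤ) : ZMod q) then 1 else 0 := by
  rw [norm_polyTwist, prod_one_sub_rootInd]
  simp only [isUnit_iff_outerPrimes hq h]
  split_ifs <;> simp_all

lemma prod_changeLevel_eval {K q n : ℕ} (hq : q ≠ 0) (h : n ∣ q)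
    (χ : Fin K → DirichletCharacter ℂ n) (F : Fin K → ℤ[X]) (a : ℕ) :
    ∏ i, (χ i).changeLevel h (((F i).eval (a : ℤ) : ℤ) : ZMod q) =
      polyTwist χ F a * ∏ ℓ ∈ outerPrimes q n, (1 - rootInd ℂ (∏ i, F i) ℓ a) := by
  rw [prod_changeLevel_apply, prod_one_sub_rootInd, ← eval_prod]
  have hn := norm_polyTwist χ F a
  simp only [gcd_eq_one_iff_isUnit, isUnit_iff_outerPrimes hq h]
  by_cases h1 : IsUnit (((∏ i, F i).eval (a : ℤ) : ℤ) : ZMod n)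
  · simp only [h1, true_and, polyTwist]
    split_ifs <;> simp
  · rw [if_neg h1, norm_eq_zero] at hn
    simp [h1, hn]

lemma sieveData_outerPrimes {q n : ℕ} (hq : 0 < q) (h : n ∣ q) {P : ℤ[X]} {u : (ZMod q)ˣ}
    (hu : IsUnit (aeval (u : ZMod q) P)) : SieveData P n (outerPrimes q n) where
  pos := Nat.pos_of_dvd_of_pos h hq
  prime ℓ hℓ := ((mem_outerPrimes hq.ne').1 hℓ).1
  coprime ℓ hℓ := coprime_of_mem_outerPrimes hℓ
  unit ℓ hℓ := by
    have : NeZero q := ⟨hq.ne'⟩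
    obtain ⟨hp, hd, -⟩ := (mem_outerPrimes hq.ne').1 hℓ
    refine ⟨(u : ZMod q).val, ((ZMod.val_coe_unit_coprime u).coprime_dvd_right hd).symm, ?_⟩
    rw [← intCast_eval_val] at hu
    exact (isUnit_intCast_iff q _).1 hu ℓ hp hd

lemma exists_norm_polyTwist_eq_one {K q n : ℕ} (hq : 0 < q) (h : n ∣ q)
    (χ : Fin K → DirichletCharacter ℂ n) {F : Fin K → ℤ[X]} {u : (ZMod q)ˣ}
    (hu : IsUnit (aeval (u : ZMod q) (∏ i, F i))) :
    ∃ a : ℕ, n.Coprime a ∧ ‖polyTwist χ F a‖ = 1 := by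
  have : NeZero q := ⟨hq.ne'⟩
  refine ⟨(u : ZMod q).val, ((ZMod.val_coe_unit_coprime u).coprime_dvd_right h).symm, ?_⟩
  rw [← intCast_eval_val] at hu
  rw [norm_polyTwist, if_pos ((isUnit_iff_outerPrimes hq.ne' h _).1 hu).1]

lemma alphaRatio_eq_unitAvg {q : ℕ} (hq : 0 < q) (P : ℤ[X]) :
    alphaRatio q P =
      unitAvg q fun a => if IsUnit ((P.eval (a : ℤ) : ℤ) : ZMod q) then (1 : ℝ) else 0 := by
  have : NeZero q := ⟨hq.ne'⟩
  rw [unitAvg_eq_sum_units, alphaRatio, div_eq_inv_mul, Nat.card_eq_fintype_card,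
    Fintype.card_subtype]
  simp only [intCast_eval_val]
  rw [sum_boole]

/-- The density of admissible units modulo the radical of `q` is the density of the sieve model. -/
lemma alphaRatio_radical {K q n : ℕ} (hq : 0 < q) (h : n ∣ q)
    (χ : Fin K → DirichletCharacter ℂ n) (F : Fin K → ℤ[X]) :
    alphaRatio (∏ ℓ ∈ q.primeFactors, ℓ) (∏ i, F i) =
      modelDensity (∏ i, F i) n (outerPrimes q n) (polyTwist χ F) := by
  have hn := Nat.pos_of_dvd_of_pos h hq
  have hprime (ℓ : ℕ) (hℓ : ℓ ∈ outerPrimes q n) : ℓ.Prime := ((mem_outerPrimes hq.ne').1 hℓ).1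
  have hR : 0 < ∏ ℓ ∈ q.primeFactors, ℓ := prod_pos fun ℓ hℓ =>
    (prime_of_mem_primeFactors hℓ).pos
  have hdens : sieveDensity (∏ i, F i) (outerPrimes q n) =
      ∏ ℓ ∈ outerPrimes q n, unitAvg ℓ fun a => 1 - rootInd ℝ (∏ i, F i) ℓ a :=
    prod_congr rfl fun ℓ hℓ => one_sub_rootDensity (hprime ℓ hℓ).pos
  have hunit (a : ℕ) : IsUnit (((∏ i, F i).eval (a : ℤ) : ℤ) : ZMod (∏ ℓ ∈ q.primeFactors, ℓ)) ↔
      IsUnit (((∏ i, F i).eval (a : ℤ) : ℤ) : ZMod q) := by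
    rw [isUnit_intCast_iff, isUnit_intCast_iff]
    refine forall₂_congr fun p hp => imp_congr_left ⟨fun hd => ?_, fun hd => ?_⟩
    · exact hd.trans (prod_primeFactors_dvd q)
    · exact dvd_prod_of_mem id (mem_primeFactors.2 ⟨hp, hd, hq.ne'⟩)
  rw [alphaRatio_eq_unitAvg hR, modelDensity, hdens, ← unitAvg_mul_prod hn hprime
    (fun ℓ hℓ => coprime_of_mem_outerPrimes hℓ) (fun a => by rw [periodic_polyTwist χ F])
    fun ℓ _ a => by rw [periodic_rootInd]]
  simp only [norm_polyTwist_mul_prod hq.ne' h, ← hunit]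
  refine (unitAvg_of_dvd ?_ ?_ fun a => ?_).symm
  · exact Nat.pos_of_dvd_of_pos (mul_prod_outerPrimes_dvd h) hq
  · refine prod_primes_dvd _ (fun p hp => (prime_of_mem_primeFactors hp).prime)
      fun p hp => ?_
    exact (prime_dvd_mul_prod_outerPrimes hq.ne' h (prime_of_mem_primeFactors hp)).2
      (Nat.dvd_of_mem_primeFactors hp)
  · have e : (((a + ∏ ℓ ∈ q.primeFactors, ℓ : ℕ) : ℤ) : ZMod (∏ ℓ ∈ q.primeFactors, ℓ)) =
        ((a : ℤ) : ZMod (∏ ℓ ∈ q.primeFactors, ℓ)) := by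
      rw [Int.cast_natCast, Int.cast_natCast, Nat.cast_add, ZMod.natCast_self, add_zero]
    simp only [intCast_eval, e]

/-- The completely multiplicative function given by the values of `charTwist` at the `k`-th powers
of the primes not dividing `q`. -/
def primeTwist {K q : ℕ} (k : ℕ) (f : Fin K → ℕ → ℤ) (χ : Fin K → DirichletCharacter ℂ q) :
    ℕ →*₀ ℂ :=
  cmul fun p => if p ∣ q then 0 else charTwist f χ (p ^ k)

lemma primeTwist_prime {K q : ℕ} (k : ℕ) (f : Fin K → ℕ → ℤ) (χ : Fin K → DirichletCharacter ℂ q)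
    {p : ℕ} (hp : p.Prime) :
    primeTwist k f χ p = if p ∣ q then 0 else charTwist f χ (p ^ k) :=
  cmul_prime _ hp

lemma sieveModel_polyTwist {K q n k : ℕ} (hq : 0 < q) (h : n ∣ q)
    (χ : Fin K → DirichletCharacter ℂ n) {f : Fin K → ℕ → ℤ} {F : Fin K → ℤ[X]}
    (hfF : ∀ i, ∀ p : ℕ, p.Prime → f i (p ^ k) = (F i).eval (p : ℤ))
    {u : (ZMod q)ˣ} (hu : IsUnit (aeval (u : ZMod q) (∏ i, F i))) :
    SieveModel (∏ i, F i) n (outerPrimes q n) (polyTwist χ F)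
      (primeTwist k f fun i => (χ i).changeLevel h) where
  data := sieveData_outerPrimes hq h hu
  periodic := periodic_polyTwist χ F
  norm_twist_le := norm_polyTwist_le χ F
  exists_norm_twist := exists_norm_polyTwist_eq_one hq h χ hu
  norm_le := norm_cmul_le fun p => by
    split_ifs
    · simp
    · exact norm_charTwist_le _ _ _
  apply_of_not_coprime p hp hc := by
    rw [primeTwist_prime _ _ _ hp, if_pos]
    rw [← prime_dvd_mul_prod_outerPrimes hq.ne' h hp]
    by_contra hd
    exact hc (hp.coprime_iff_not_dvd.2 hd).symm
  apply_of_coprime p hp hc := by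
    have hd : ¬ p ∣ q := by
      rw [← prime_dvd_mul_prod_outerPrimes hq.ne' h hp]
      exact hp.coprime_iff_not_dvd.1 hc.symm
    rw [primeTwist_prime _ _ _ hp, if_neg hd, charTwist_apply _ _ (pow_ne_zero _ hp.ne_zero),
      ← prod_changeLevel_eval hq.ne' h]
    simp only [hfF _ p hp]

lemma powerSupported_charTwist {K q n k : ℕ} (hk : 1 ≤ k) (hq : 0 < q) (h : n ∣ q)
    {f : Fin K → ℕ → ℤ} (hf : ∀ i, IsMultFn (f i)) {W : Fin K → ℕ → ℤ[X]}
    (hfW : ∀ i, ∀ v, 1 ≤ v → v < k → ∀ p : ℕ, p.Prime → f i (p ^ v) = (W i v).eval (p : ℤ))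
    (χ : Fin K → DirichletCharacter ℂ q) (hadm : KAdmissible (fun v => ∏ i, W i v) k q) :
    PowerSupported k (n * ∏ ℓ ∈ outerPrimes q n, ℓ) (charTwist f χ) (primeTwist k f χ) where
  one_le := hk
  ne_zero := (Nat.pos_of_dvd_of_pos (mul_prod_outerPrimes_dvd h) hq).ne'
  mult := isMultiplicative_charTwist hf χ
  norm_le := norm_charTwist_le f χ
  apply_of_dvd p hp hd := by
    rw [primeTwist_prime _ _ _ hp, if_pos ((prime_dvd_mul_prod_outerPrimes hq.ne' h hp).1 hd)]
  apply_of_not_dvd p hp hd := by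
    rw [primeTwist_prime _ _ _ hp, if_neg fun hd' =>
      hd ((prime_dvd_mul_prod_outerPrimes hq.ne' h hp).2 hd')]
  apply_pow p hp hd v hv hvk := charTwist_prime_pow_eq_zero χ hp
    (fun hd' => hd ((prime_dvd_mul_prod_outerPrimes hq.ne' h hp).2 hd'))
    (fun i => hfW i v hv hvk p hp) (hadm.2 v hv hvk)

/-- For a modulus in `NarkSet`, a nontrivial tuple of characters whose polynomial twist is trivial
on its support has a vanishing Euler factor. -/
lemma exists_euler_factor_eq_zero {K q n k : ℕ} (hq : 0 < q) (h : n ∣ q)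
    {f : Fin K → ℕ → ℤ} {W : Fin K → ℕ → ℤ[X]} (hqN : q ∈ NarkSet k f W)
    {χ : Fin K → DirichletCharacter ℂ n} (hχ : χ ≠ fun _ => 1)
    (htriv : ∀ a : ℕ, n.Coprime a → ‖polyTwist χ (fun i => W i k) a‖ = 1 →
      polyTwist χ (fun i => W i k) a = 1) :
    ∃ p : ℕ, p.Prime ∧ ∑' j : ℕ, charTwist f (fun i => (χ i).changeLevel h) (p ^ j) *
      (((p : ℝ) ^ (-(j : ℝ) / (k : ℝ)) : ℝ) : ℂ) = 0 := by
  have : NeZero q := ⟨hq.ne'⟩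
  have hne : (fun i => (χ i).changeLevel h) ≠ fun _ => 1 := fun hone => hχ (funext fun i =>
    (DirichletCharacter.changeLevel_eq_one_iff h).1 (congrFun hone i))
  have hone (u : (ZMod q)ˣ) (hu : IsUnit (aeval (u : ZMod q) (∏ i, W i k))) :
      ∏ i, (χ i).changeLevel h (aeval (u : ZMod q) (W i k)) = 1 := by
    rw [← intCast_eval_val] at hu
    have hu' := (isUnit_iff_outerPrimes hq.ne' h _).1 hu
    simp only [← intCast_eval_val]
    rw [prod_changeLevel_eval hq.ne' h χ (fun i => W i k), prod_one_sub_rootInd, if_pos hu'.2,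
      mul_one]
    refine htriv _ ((ZMod.val_coe_unit_coprime u).coprime_dvd_right h).symm ?_
    rw [norm_polyTwist, if_pos hu'.1]
  obtain ⟨p, hp, hsum⟩ := hqN.2 _ hne hone
  refine ⟨p, hp, ?_⟩
  simpa only [charTwist_apply _ _ (pow_ne_zero _ hp.ne_zero)] using hsum

lemma rpow_le_mul_mul_rpow {k X e : ℝ} (hk : 1 ≤ k) (hX : 0 < X) (he : -1 ≤ e) :
    X ^ e ≤ k * (k * X) ^ e := by
  have hk0 : 0 < k := by linarith
  have hone : 1 ≤ k ^ (1 + e) := Real.one_le_rpow hk (by linarith)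
  rw [Real.rpow_add hk0, Real.rpow_one] at hone
  rw [Real.mul_rpow hk0.le hX.le, ← mul_assoc]
  exact le_mul_of_one_le_left (by positivity) hone

end CharSum

open CharSum

theorem character_sum_bound
    (K V : ℕ) (hK : 1 ≤ K) (hV : 1 ≤ V)
    (K₀ B₀ : ℝ) (hK₀ : 0 < K₀) (hB₀ : 0 < B₀)
    (f : Fin K → ℕ → ℤ) (hf : ∀ i, IsMultFn (f i))
    (W : Fin K → ℕ → Polynomial ℤ)
    (hfW : ∀ (i : Fin K) (v : ℕ), 1 ≤ v → v ≤ V → ∀ p : ℕ, p.Prime →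
      f i (p ^ v) = (W i v).eval (p : ℤ))
    (k : ℕ) (hk1 : 1 ≤ k) (hkV : k ≤ V)
    (hWnc : ∀ i, 0 < (W i k).natDegree)
    (hMI : MultIndep (fun i => W i k))
 :
    ∀ lam : ℝ, 0 < lam → ∃ δ₀ : ℝ, 0 < δ₀ ∧ ∃ A Qstar : ℝ, 0 < A ∧ 0 < Qstar ∧
      ∀ x : ℝ, 3 ≤ x →
        ∀ q : ℕ, 0 < q → (q : ℝ) ≤ Real.log x ^ K₀ → q ∈ NarkSet k f W →
          Qstar < ((∏ ℓ ∈ q.primeFactors, ℓ : ℕ) : ℝ) →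
          ∀ Q₀ : ℕ, Q₀ ∣ q → (Q₀ : ℝ) ≤ lam →
            ∀ χ : Fin K → DirichletCharacter ℂ Q₀, χ ≠ (fun _ => 1) →
              ‖∑ n ∈ Finset.Icc 1 ⌊x⌋₊,
                  (if Int.gcd (∏ i, f i n) (q : ℤ) = 1 then
                    ∏ i, (χ i) ((f i n : ZMod Q₀)) else 0)‖ ≤
                A * x ^ ((1 : ℝ) / (k : ℝ)) /
                  Real.log x ^
                    (1 - (1 - δ₀) * alphaRatio (∏ ℓ ∈ q.primeFactors, ℓ) (∏ i, W i k)) := by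
  intro lam hlam
  have hk1' : (1 : ℝ) ≤ k := by exact_mod_cast hk1
  have hk0 : (0 : ℝ) < k := by linarith
  obtain ⟨δ, hδ, hδ1, hdef⟩ := exists_uniform_deficiency (fun i => W i k) ⌊lam⌋₊
  obtain ⟨C, X₀, hC, hX₀, hbound⟩ := exists_norm_sum_le (∏ i, W i k) hk1 (le_max_right lam 1)
    (mul_pos two_pos hK₀) hδ hδ1
  set X₁ : ℝ := max X₀ k with hX₁
  have hX₁0 : 0 < X₁ := hk0.trans_le (le_max_right _ _)
  refine ⟨δ / 32, by positivity, C * k + Real.exp (k * X₁) * (k * X₁), 1, by positivity, one_pos,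
    fun x hx q hq hqx hqN _ Q₀ hQ₀ hQlam χ hχ => ?_⟩
  have hQpos := Nat.pos_of_dvd_of_pos hQ₀ hq
  obtain ⟨u, hu⟩ := hqN.1.1
  have hmodel := sieveModel_polyTwist hq hQ₀ χ (fun i p hp => hfW i k hk1 hkV p hp) hu
  have hsupp := powerSupported_charTwist hk1 hq hQ₀ hf
    (fun i v hv hvk p hp => hfW i v hv (hvk.le.trans hkV) p hp)
    (fun i => (χ i).changeLevel hQ₀) hqN.1
  have hsum : ∑ n ∈ Finset.Icc 1 ⌊x⌋₊, (if Int.gcd (∏ i, f i n) (q : ℤ) = 1 then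
      ∏ i, (χ i) ((f i n : ZMod Q₀)) else 0) =
      ∑ n ∈ Finset.Icc 1 ⌊x⌋₊, charTwist f (fun i => (χ i).changeLevel hQ₀) n :=
    Finset.sum_congr rfl fun n hn => by
      rw [charTwist_apply _ _ (Nat.one_le_iff_ne_zero.1 (Finset.mem_Icc.1 hn).1),
        prod_changeLevel_apply hQ₀ χ fun i => f i n]
  rw [hsum, alphaRatio_radical hq hQ₀ χ]
  have hα0 := hmodel.modelDensity_pos
  have hα1 := hmodel.modelDensity_le_one
  set α := modelDensity (∏ i, W i k) Q₀ (outerPrimes q Q₀) (polyTwist χ fun i => W i k)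
  have hθ0 : 0 ≤ (1 - δ / 32) * α := mul_nonneg (by linarith) hα0.le
  have hθ1 : (1 - δ / 32) * α ≤ 1 := mul_le_one₀ (by linarith) hα0.le hα1
  set θ := (1 - δ / 32) * α
  have hx0 : 0 < x := by linarith
  have hlog1 : 1 ≤ Real.log x := by
    rw [Real.le_log_iff_exp_le hx0]
    linarith [Real.exp_one_lt_d9]
  have hlog0 : 0 < Real.log x := by linarith
  have hxk : 1 ≤ x ^ ((1 : ℝ) / k) := Real.one_le_rpow (by linarith) (by positivity)
  rcases lt_or_ge (Real.log x / k) X₁ with hX | hX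
  · rw [div_lt_iff₀' hk0] at hX
    rw [le_div_iff₀ (by positivity)]
    have hxX : x ≤ Real.exp (k * X₁) := (Real.log_le_iff_le_exp hx0).1 hX.le
    have htriv : ‖∑ n ∈ Finset.Icc 1 ⌊x⌋₊, charTwist f (fun i => (χ i).changeLevel hQ₀) n‖ ≤ x := by
      refine (norm_sum_le_of_le _ fun n _ => norm_charTwist_le f _ n).trans ?_
      simpa using Nat.floor_le hx0.le
    have hpow : Real.log x ^ (1 - θ) ≤ k * X₁ :=
      (Real.rpow_le_rpow_of_exponent_le hlog1 (by linarith)).trans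
        ((Real.rpow_one _).trans_le hX.le)
    calc _ ≤ Real.exp (k * X₁) * (k * X₁) := by gcongr; exact htriv.trans hxX
      _ ≤ C * k + Real.exp (k * X₁) * (k * X₁) := le_add_of_nonneg_left (by positivity)
      _ ≤ _ := le_mul_of_one_le_right (by positivity) hxk
  · have hXk : k ≤ Real.log x / k := (le_max_right _ _).trans hX
    have hX0 : 0 < Real.log x / k := by positivity
    set X := Real.log x / k with hXdef
    have hkX : k * X = Real.log x := mul_div_cancel₀ _ hk0.ne'
    have hmodulus : ((Q₀ * ∏ ℓ ∈ outerPrimes q Q₀, ℓ : ℕ) : ℝ) ≤ X ^ (2 * K₀) := by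
      calc ((Q₀ * ∏ ℓ ∈ outerPrimes q Q₀, ℓ : ℕ) : ℝ) ≤ q := by
            exact_mod_cast Nat.le_of_dvd hq (mul_prod_outerPrimes_dvd hQ₀)
        _ ≤ (X ^ (2 : ℝ)) ^ K₀ := by
            refine hqx.trans (Real.rpow_le_rpow hlog0.le ?_ hK₀.le)
            rw [Real.rpow_two, sq, ← hkX]
            gcongr
        _ = X ^ (2 * K₀) := (Real.rpow_mul hX0.le _ _).symm
    have halt : (unitAvg Q₀ (polyTwist χ fun i => W i k)).re ≤
        (1 - δ) * unitAvg Q₀ (fun a => ‖polyTwist χ (fun i => W i k) a‖) ∨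
        ∃ p : ℕ, p.Prime ∧ ∑' j : ℕ, charTwist f (fun i => (χ i).changeLevel hQ₀) (p ^ j) *
          (((p : ℝ) ^ (-(j : ℝ) / (k : ℝ)) : ℝ) : ℂ) = 0 := by
      rcases hdef Q₀ hQpos (Nat.le_floor hQlam) χ with htriv | hlt
      · exact Or.inr (exists_euler_factor_eq_zero hq hQ₀ hqN hχ htriv)
      · exact Or.inl hlt
    have hmain := hbound X ((le_max_left _ _).trans hX) Q₀ (outerPrimes q Q₀) _ _ _ hmodel hsupp
      (hQlam.trans (le_max_left _ _)) hmodulus halt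
    rw [hkX, Real.exp_log hx0] at hmain
    have hexp : Real.exp X = x ^ ((1 : ℝ) / k) := by
      rw [Real.rpow_def_of_pos hx0, hXdef, mul_one_div]
    calc _ ≤ C * Real.exp X * X ^ (-1 + θ) := hmain
      _ ≤ C * Real.exp X * (k * (k * X) ^ (-1 + θ)) := by
          gcongr
          exact rpow_le_mul_mul_rpow hk1' hX0 (by linarith)
      _ = C * k * x ^ ((1 : ℝ) / k) / Real.log x ^ (1 - θ) := by
          rw [hexp, hkX, show -1 + θ = -(1 - θ) by ring, Real.rpow_neg hlog0.le]
          ring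
      _ ≤ _ := by
          gcongr
          exact le_add_of_nonneg_right (by positivity)
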